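/- Let p be an odd prime and let G be a finite p-solvable group. Let φ ∈ IBr(G) and suppose M is a normal subgroup of G. If χ ∈ Irr(G) is a lift of φ with vertex pair (Q, δ), then some irreducible constituent of the restriction χ_M has vertex pair (Q ∩ M, δ_{Q ∩ M}). -/

import Mathlib

open scoped Classical

noncomputable section

/-- All prime divisors of `n` belong to the set of primes `σ`. -/
def IsPiNumber (σ : Set ℕ) (n : ℕ) : Prop :=
  ∀ q : ℕ, q.Prime → q ∣ n → q ∈ σ

/-- `g` is a `σ`-element: its order is a `σ`-number. -/
def IsPiElt (σ : Set ℕ) {G : Type} [Group G] (g : G) : Prop :=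
  IsPiNumber σ (orderOf g)

/-- The `p`-part of a natural number. -/
def pPart (p n : ℕ) : ℕ := p ^ (n.factorization p)

/-- `χ` is the character of a finite-dimensional complex representation of `G`. -/
def IsCharacter (G : Type) [Group G] (χ : G → ℂ) : Prop :=
  ∃ V : FDRep ℂ G, ∀ g, χ g = V.character g

/-- `χ` is an irreducible (ordinary, complex) character of `G`: a nonzero character
which is not the sum of two nonzero characters. -/
def IsIrrChar (G : Type) [Group G] (χ : G → ℂ) : Prop :=
  IsCharacter G χ ∧ χ ≠ 0 ∧
    ¬ ∃ χ₁ χ₂ : G → ℂ, IsCharacter G χ₁ ∧ χ₁ ≠ 0 ∧ IsCharacter G χ₂ ∧ χ₂ ≠ 0 ∧ χ = χ₁ + χ₂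

/-- Restriction of a class function on `G` to a subgroup `H`. -/
def resChar {G : Type} [Group G] (H : Subgroup G) (χ : G → ℂ) : ↥H → ℂ :=
  fun h => χ (h : G)

/-- Restriction of a class function between nested subgroups. -/
def resCharLe {G : Type} [Group G] {K H : Subgroup G} (hKH : K ≤ H) (χ : ↥H → ℂ) : ↥K → ℂ :=
  fun k => χ ⟨(k : G), hKH k.2⟩

/-- The induced class function from a subgroup `H` of `G`, given by the usual
induction formula. -/
def indChar {G : Type} [Group G] [Fintype G] (H : Subgroup G) (ψ : ↥H → ℂ) : G → ℂ :=
  fun g => (Nat.card ↥H : ℂ)⁻¹ *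
    ∑ x : G, if h : x * g * x⁻¹ ∈ H then ψ ⟨x * g * x⁻¹, h⟩ else 0

/-- Induction of a class function between nested subgroups. -/
def indCharLe {G : Type} [Group G] [Fintype G] {K H : Subgroup G} (_ : K ≤ H)
    (ψ : ↥K → ℂ) : ↥H → ℂ :=
  fun x => (Nat.card ↥K : ℂ)⁻¹ *
    ∑ y : ↥H, if h : (y : G) * (x : G) * (y : G)⁻¹ ∈ K then ψ ⟨(y : G) * (x : G) * (y : G)⁻¹, h⟩ else 0

/-- `θ` is an irreducible constituent of the class function `χ`. -/
def IsConstituent {G : Type} [Group G] (θ χ : G → ℂ) : Prop :=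
  IsIrrChar G θ ∧ ∃ ξ : G → ℂ, (ξ = 0 ∨ IsCharacter G ξ) ∧ χ = θ + ξ

/-- The restriction `χ^o` of a class function to the `σ`-elements of `G`
(extended by zero elsewhere). -/
def piRestrict (σ : Set ℕ) {G : Type} [Group G] (χ : G → ℂ) : G → ℂ :=
  fun g => if IsPiElt σ g then χ g else 0

/-- `φ` is a `σ`-partial character of `G`: the restriction to the `σ`-elements of an
ordinary character. -/
def IsPartialChar (σ : Set ℕ) (G : Type) [Group G] (φ : G → ℂ) : Prop :=
  ∃ χ : G → ℂ, IsCharacter G χ ∧ χ ≠ 0 ∧ φ = piRestrict σ χ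

/-- `φ ∈ I_σ(G)`: an irreducible `σ`-partial character, i.e. one which is not the
sum of two `σ`-partial characters. -/
def IsIPiChar (σ : Set ℕ) (G : Type) [Group G] (φ : G → ℂ) : Prop :=
  IsPartialChar σ G φ ∧
    ¬ ∃ φ₁ φ₂ : G → ℂ, IsPartialChar σ G φ₁ ∧ IsPartialChar σ G φ₂ ∧ φ = φ₁ + φ₂

/-- `φ ∈ IBr(G)` (at the prime `p`): irreducible Brauer characters are the irreducible
`p'`-partial characters, where the `p`-regular elements are the `{p}ᶜ`-elements. -/
def IsIBrChar (p : ℕ) (G : Type) [Group G] (φ : G → ℂ) : Prop :=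
  IsIPiChar ({p}ᶜ) G φ

/-- The restriction `χ^o` of `χ` to the `p`-regular elements of `G`. -/
def brRestrict (p : ℕ) {G : Type} [Group G] (χ : G → ℂ) : G → ℂ :=
  piRestrict ({p}ᶜ) χ

/-- `χ` is a lift of the `σ`-partial character `φ`. -/
def IsLiftOfPi (σ : Set ℕ) (G : Type) [Group G] (χ φ : G → ℂ) : Prop :=
  IsIrrChar G χ ∧ piRestrict σ χ = φ

/-- `χ` is a lift: `χ` is irreducible and `χ^o` is an irreducible `σ`-partial character. -/
def IsLiftPi (σ : Set ℕ) (G : Type) [Group G] (χ : G → ℂ) : Prop :=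
  IsIrrChar G χ ∧ IsIPiChar σ G (piRestrict σ χ)

/-- `H` is a subnormal subgroup of `G`. -/
def IsSubnormalSubgroup {G : Type} [Group G] (H : Subgroup G) : Prop :=
  ∃ (n : ℕ) (c : Fin (n + 1) → Subgroup G),
    c 0 = H ∧ c (Fin.last n) = ⊤ ∧
    ∀ i : Fin n, c i.castSucc ≤ c i.succ ∧ ((c i.castSucc).subgroupOf (c i.succ)).Normal

/-- The determinantal order `o(det θ)` of `θ` is a `σ`-number. -/
def HasPiDetOrder (σ : Set ℕ) (G : Type) [Group G] (θ : G → ℂ) : Prop :=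
  ∃ V : FDRep ℂ G, (∀ g, θ g = V.character g) ∧
    IsPiNumber σ (orderOf (fun g : G => LinearMap.det (V.ρ g)))

/-- `χ` is a `σ`-special character of `G`: `χ` is irreducible, `χ(1)` is a `σ`-number,
and for every subnormal subgroup `M` of `G`, every irreducible constituent of `χ_M`
has determinantal order a `σ`-number. -/
def IsPiSpecial (σ : Set ℕ) (G : Type) [Group G] (χ : G → ℂ) : Prop :=
  IsIrrChar G χ ∧ (∃ n : ℕ, χ 1 = (n : ℂ) ∧ IsPiNumber σ n) ∧
    ∀ M : Subgroup G, IsSubnormalSubgroup M →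
      ∀ θ : ↥M → ℂ, IsConstituent θ (resChar M χ) → HasPiDetOrder σ ↥M θ

/-- `χ` is `σ`-factored: `χ = αβ` with `α` `σ`-special and `β` `σ'`-special. -/
def IsPiFactored (σ : Set ℕ) (G : Type) [Group G] (χ : G → ℂ) : Prop :=
  ∃ α β : G → ℂ, IsPiSpecial σ G α ∧ IsPiSpecial σᶜ G β ∧ χ = α * β

/-- `G` is `σ`-separable: it has a subnormal series each of whose factors is a
`σ`-group or a `σ'`-group (equivalently, every composition factor is a `σ`-group or a
`σ'`-group). -/
def IsPiSeparable (σ : Set ℕ) (G : Type) [Group G] : Prop :=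
  ∃ (n : ℕ) (c : Fin (n + 1) → Subgroup G),
    c 0 = ⊥ ∧ c (Fin.last n) = ⊤ ∧
    ∀ i : Fin n, c i.castSucc ≤ c i.succ ∧ ((c i.castSucc).subgroupOf (c i.succ)).Normal ∧
      (IsPiNumber σ (Nat.card (↥(c i.succ) ⧸ (c i.castSucc).subgroupOf (c i.succ))) ∨
        IsPiNumber σᶜ (Nat.card (↥(c i.succ) ⧸ (c i.castSucc).subgroupOf (c i.succ))))

/-- `G` is `p`-solvable: every composition factor is a `p`-group or a `p'`-group. -/
def IsPSolvable (p : ℕ) (G : Type) [Group G] : Prop :=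
  IsPiSeparable {p} G

/-- The character `δ` of the subgroup `Q` is invariant under (conjugation by the
elements of) the subgroup `S`. -/
def InvariantUnder {G : Type} [Group G] (Q : Subgroup G) (δ : ↥Q → ℂ) (S : Subgroup G) : Prop :=
  ∀ g ∈ S, ∀ x : ↥Q, ∀ h : g * (x : G) * g⁻¹ ∈ Q, δ ⟨g * (x : G) * g⁻¹, h⟩ = δ x

/-- `(Q, δ)` is a vertex pair for `χ ∈ Irr(G)` (at the prime `p`): `Q` is a `p`-subgroup
of `G`, `δ ∈ Irr(Q)`, and there are a subgroup `U ≤ G` and an irreducible character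
`ψ = αβ` of `U` with `α` `p'`-special and `β` `p`-special, such that `ψ^G = χ`, `Q` is a
Sylow `p`-subgroup of `U`, and `β_Q = δ`. -/
def IsVertexPair (p : ℕ) {G : Type} [Group G] [Fintype G] (χ : G → ℂ)
    (Q : Subgroup G) (δ : ↥Q → ℂ) : Prop :=
  IsPGroup p ↥Q ∧ IsIrrChar ↥Q δ ∧
    ∃ (U : Subgroup G) (hQU : Q ≤ U) (α β : ↥U → ℂ),
      IsPiSpecial ({p}ᶜ) ↥U α ∧ IsPiSpecial {p} ↥U β ∧
      IsIrrChar ↥U (α * β) ∧ indChar U (α * β) = χ ∧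
      ¬ p ∣ (Q.subgroupOf U).index ∧
      ∀ x : ↥Q, δ x = β ⟨(x : G), hQU x.2⟩

/-- `(Q, δ)` is a generalized `σ`-vertex for `χ ∈ Irr(G)`: there are `U ≤ G` and an
irreducible `ψ = αβ ∈ Irr(U)` with `α` `σ`-special and `β` `σ'`-special such that
`ψ^G = χ`, `Q` is a Hall `σ'`-subgroup of `U` and `δ = β_Q`. -/
def IsGenPiVertex (σ : Set ℕ) {G : Type} [Group G] [Fintype G] (χ : G → ℂ)
    (Q : Subgroup G) (δ : ↥Q → ℂ) : Prop :=
  ∃ (U : Subgroup G) (hQU : Q ≤ U) (α β : ↥U → ℂ),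
    IsPiSpecial σ ↥U α ∧ IsPiSpecial σᶜ ↥U β ∧
    IsIrrChar ↥U (α * β) ∧ indChar U (α * β) = χ ∧
    IsPiNumber σᶜ (Nat.card ↥Q) ∧ IsPiNumber σ ((Q.subgroupOf U).index) ∧
    ∀ x : ↥Q, δ x = β ⟨(x : G), hQU x.2⟩

/-- The pair `(Q₂, δ₂)` is the conjugate of the pair `(Q₁, δ₁)` by the element `g`. -/
def IsConjPair {G : Type} [Group G] (g : G)
    (Q₁ : Subgroup G) (δ₁ : ↥Q₁ → ℂ) (Q₂ : Subgroup G) (δ₂ : ↥Q₂ → ℂ) : Prop :=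
  Q₂ = Subgroup.map (MulAut.conj g).toMonoidHom Q₁ ∧
    ∀ x : ↥Q₁, ∀ h : g * (x : G) * g⁻¹ ∈ Q₂, δ₂ ⟨g * (x : G) * g⁻¹, h⟩ = δ₁ x

/-- `Q` is a vertex (subgroup) of the irreducible `σ`-partial character `φ` of `G`:
`Q` is a Hall `σ'`-subgroup of a subgroup `U ≤ G` possessing an irreducible `σ`-partial
character `κ` of `σ`-degree with `κ^G = φ`. -/
def IsVertexSubgroup (σ : Set ℕ) {G : Type} [Group G] [Fintype G] (φ : G → ℂ)
    (Q : Subgroup G) : Prop :=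
  ∃ (U : Subgroup G) (κ : ↥U → ℂ), Q ≤ U ∧
    IsPiNumber σᶜ (Nat.card ↥Q) ∧ IsPiNumber σ ((Q.subgroupOf U).index) ∧
    IsIPiChar σ ↥U κ ∧ (∃ n : ℕ, κ 1 = (n : ℂ) ∧ IsPiNumber σ n) ∧
    indChar U κ = φ

/-- `θ ∈ I_σ(M)` is an irreducible constituent of the restriction `φ_M`. -/
def IsIPiConstituent (σ : Set ℕ) {G : Type} [Group G] (M : Subgroup G)
    (θ : ↥M → ℂ) (φ : G → ℂ) : Prop :=
  IsIPiChar σ ↥M θ ∧ ∃ ξ : ↥M → ℂ, (ξ = 0 ∨ IsPartialChar σ ↥M ξ) ∧ resChar M φ = θ + ξ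

set_option linter.unusedSectionVars false

namespace SubChar

section

variable {X : Type} [Group X] [Fintype X]

/-- `f` is afforded by an irreducible representation. -/
def IsSimpleChar (X : Type) [Group X] (f : X → ℂ) : Prop :=
  ∃ (V : Type) (_ : AddCommGroup V) (_ : Module ℂ V) (_ : FiniteDimensional ℂ V)
    (ρ : Representation ℂ X V), ρ.IsIrreducible ∧ f = ρ.character

theorem exists_multiset_simpleChar (n : ℕ) : ∀ (V : Type) [AddCommGroup V] [Module ℂ V]
    [FiniteDimensional ℂ V] (ρ : Representation ℂ X V), Module.finrank ℂ V = n →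
    ∃ s : Multiset (X → ℂ), (∀ θ ∈ s, IsSimpleChar X θ) ∧ ρ.character = s.sum := by
  induction n using Nat.strong_induction_on with
  | _ n ih =>
  intro V _ _ _ ρ hn
  rcases Nat.eq_zero_or_pos n with h0 | hpos
  · refine ⟨0, by simp, ?_⟩
    subst h0
    have : Subsingleton V := Module.finrank_zero_iff.mp hn
    ext g
    have : ρ g = 0 := LinearMap.ext fun v => Subsingleton.elim _ _
    simp [Representation.character, this]
  · have : Nontrivial V := Module.nontrivial_of_finrank_pos (R := ℂ) (hn ▸ hpos)
    by_cases hirr : ρ.IsIrreducible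
    · exact ⟨{ρ.character}, by simpa using ⟨V, _, _, inferInstance, ρ, hirr, rfl⟩, by simp⟩
    · have hnt : Nontrivial (Subrepresentation ρ) := by
        refine ⟨⊥, ⊤, fun h => ?_⟩
        have := congrArg Subrepresentation.toSubmodule h
        exact bot_ne_top (α := Submodule ℂ V) this
      have : ∃ W : Subrepresentation ρ, W ≠ ⊥ ∧ W ≠ ⊤ := by
        by_contra hcon
        push Not at hcon
        exact hirr ⟨fun W => or_iff_not_imp_left.mpr (hcon W)⟩
      obtain ⟨W, hW0, hW1⟩ := this
      have : NeZero (Nat.card X : ℂ) := ⟨by simp⟩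
      obtain ⟨W', hW'⟩ := exists_isCompl W
      have hc : IsCompl W.toSubmodule W'.toSubmodule := by
        constructor
        · rw [disjoint_iff]
          exact congrArg Subrepresentation.toSubmodule hW'.inf_eq_bot
        · rw [codisjoint_iff]
          exact congrArg Subrepresentation.toSubmodule hW'.sup_eq_top
      have hadd := Submodule.finrank_add_eq_of_isCompl hc
      have h1 : Module.finrank ℂ W.toSubmodule ≠ 0 := fun h => hW0 <| by
        apply Subrepresentation.toSubmodule_injective
        exact Submodule.finrank_eq_zero.mp h
      have h2 : Module.finrank ℂ W'.toSubmodule ≠ 0 := fun h => hW1 <| by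
        have h' : W' = ⊥ := by
          apply Subrepresentation.toSubmodule_injective
          exact Submodule.finrank_eq_zero.mp h
        simpa [h'] using hW'.sup_eq_top
      obtain ⟨s, hs, hs'⟩ := ih _ (by omega) _ W.toRepresentation rfl
      obtain ⟨t, ht, ht'⟩ := ih _ (by omega) _ W'.toRepresentation rfl
      refine ⟨s + t, fun θ hθ => ?_, ?_⟩
      · rcases Multiset.mem_add.mp hθ with h | h
        exacts [hs _ h, ht _ h]
      · rw [Multiset.sum_add, ← hs', ← ht']
        ext g
        have hint : DirectSum.IsInternal (fun b : Bool => cond b W.toSubmodule W'.toSubmodule) :=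
          (DirectSum.isInternal_submodule_iff_isCompl _ (i := true) (j := false) (by simp)
            (by ext b; cases b <;> simp)).mpr hc
        have := LinearMap.trace_eq_sum_trace_restrict hint (f := ρ g)
          (fun b => by
            cases b
            · exact fun v hv => W'.apply_mem_toSubmodule g hv
            · exact fun v hv => W.apply_mem_toSubmodule g hv)
        simp only [Fintype.sum_bool] at this
        exact this

theorem simpleChar_ip {f k : X → ℂ} (hf : IsSimpleChar X f) (hk : IsSimpleChar X k) :
    (Nat.card X : ℂ)⁻¹ * ∑ g, f g * k g⁻¹ = if f = k then 1 else 0 := by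
  obtain ⟨V, _, _, _, ρ, hρ, rfl⟩ := hf
  obtain ⟨W, _, _, _, σ, hσ, rfl⟩ := hk
  have : Invertible (Nat.card X : ℂ) := invertibleOfNonzero (by simp)
  by_cases h : Nonempty (Representation.Equiv σ ρ)
  · rw [Representation.char_orthonormal ρ σ, if_pos h,
      if_pos (Representation.char_iso h.some).symm]
  · rw [Representation.char_orthonormal ρ σ, if_neg h, if_neg]
    intro he
    have h1 := Representation.char_orthonormal ρ σ
    have h2 := Representation.char_orthonormal ρ ρ
    rw [if_pos ⟨Representation.Equiv.refl ρ⟩] at h2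
    rw [if_neg h, ← he, h2] at h1
    exact one_ne_zero h1

end

section

variable {G : Type} [Group G] [Fintype G]

/-- Extension by zero of a function on a subgroup. -/
def ext0 (H : Subgroup G) (φ : H → ℂ) (g : G) : ℂ := if h : g ∈ H then φ ⟨g, h⟩ else 0

/-- `f` is supported on `H` and its restriction to `H` is a (possibly zero) character. -/
def Chr (H : Subgroup G) (f : G → ℂ) : Prop :=
  ∃ (V : Type) (_ : AddCommGroup V) (_ : Module ℂ V) (_ : FiniteDimensional ℂ V)
    (ρ : Representation ℂ H V), f = ext0 H ρ.character

/-- The (bilinear) inner product of the restrictions of two functions to `H`. -/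
def ip (H : Subgroup G) (f k : G → ℂ) : ℂ :=
  (Nat.card H : ℂ)⁻¹ * ∑ g : G, if g ∈ H then f g * k g⁻¹ else 0

/-- `f` is supported on `H` and its restriction to `H` is an irreducible character. -/
def Irr (H : Subgroup G) (f : G → ℂ) : Prop := Chr H f ∧ ip H f f = 1

/-- Restriction of a function to a subgroup, extended by zero. -/
def res (H : Subgroup G) (f : G → ℂ) (g : G) : ℂ := if g ∈ H then f g else 0

/-- Induction of functions from `K` to `H`. -/
def ind (K H : Subgroup G) (f : G → ℂ) (g : G) : ℂ :=
  (Nat.card K : ℂ)⁻¹ * ∑ x : G, if x ∈ H then f (x * g * x⁻¹) else 0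

variable {H K : Subgroup G} {f k : G → ℂ}

theorem card_ne_zero' (H : Subgroup G) : (Nat.card H : ℂ) ≠ 0 := by simp

theorem ext0_coe (φ : H → ℂ) (x : H) : ext0 H φ x = φ x := by simp [ext0]

theorem Chr.supp (hf : Chr H f) {g : G} (hg : g ∉ H) : f g = 0 := by
  obtain ⟨V, _, _, _, ρ, rfl⟩ := hf
  simp [ext0, hg]

theorem Irr.supp (hf : Irr H f) {g : G} (hg : g ∉ H) : f g = 0 := hf.1.supp hg

theorem sum_ite_mem (H : Subgroup G) (F : G → ℂ) :
    (∑ g : G, if g ∈ H then F g else 0) = ∑ x : H, F x := by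
  rw [← Finset.sum_filter, Finset.sum_subtype _ (p := (· ∈ H)) (by simp)]

theorem ip_eq (H : Subgroup G) (f k : G → ℂ) :
    ip H f k = (Nat.card H : ℂ)⁻¹ * ∑ x : H, f x * k (x⁻¹ : H) := by
  rw [ip, sum_ite_mem H (fun g => f g * k g⁻¹)]; simp

theorem ip_comm (H : Subgroup G) (f k : G → ℂ) : ip H f k = ip H k f := by
  rw [ip_eq, ip_eq]
  congr 1
  exact Fintype.sum_equiv (Equiv.inv H) _ _ fun x => by simp [mul_comm]

theorem ip_add_left (H : Subgroup G) (f f' k : G → ℂ) : ip H (f + f') k = ip H f k + ip H f' k := by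
  simp [ip_eq, add_mul, Finset.sum_add_distrib, mul_add]

theorem ip_add_right (H : Subgroup G) (f k k' : G → ℂ) : ip H f (k + k') = ip H f k + ip H f k' := by
  simp only [ip_comm H f, ip_add_left]

theorem ip_smul_left (H : Subgroup G) (c : ℂ) (f k : G → ℂ) : ip H (c • f) k = c * ip H f k := by
  simp only [ip_eq, Pi.smul_apply, smul_eq_mul, mul_assoc, ← Finset.mul_sum]
  ring

theorem ip_smul_right (H : Subgroup G) (c : ℂ) (f k : G → ℂ) : ip H f (c • k) = c * ip H f k := by
  simp only [ip_comm H f, ip_smul_left]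

@[simp] theorem ip_zero_left (H : Subgroup G) (k : G → ℂ) : ip H 0 k = 0 := by simp [ip_eq]

@[simp] theorem ip_zero_right (H : Subgroup G) (k : G → ℂ) : ip H k 0 = 0 := by simp [ip_eq]

theorem ip_sum_left {ι : Type*} (H : Subgroup G) (s : Finset ι) (f : ι → G → ℂ) (k : G → ℂ) :
    ip H (∑ i ∈ s, f i) k = ∑ i ∈ s, ip H (f i) k := by
  induction s using Finset.induction_on with
  | empty => simp
  | insert a s ha ih => rw [Finset.sum_insert ha, Finset.sum_insert ha, ip_add_left, ih]

theorem ip_sum_right {ι : Type*} (H : Subgroup G) (s : Finset ι) (f : ι → G → ℂ) (k : G → ℂ) :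
    ip H k (∑ i ∈ s, f i) = ∑ i ∈ s, ip H k (f i) := by
  simp only [ip_comm H k, ip_sum_left]

theorem ip_congr_left {f f' : G → ℂ} (h : ∀ g ∈ H, f g = f' g) (k : G → ℂ) : ip H f k = ip H f' k := by
  rw [ip_eq, ip_eq]
  simp [h _ (SetLike.coe_mem _)]

theorem ip_congr_right {k k' : G → ℂ} (h : ∀ g ∈ H, k g = k' g) (f : G → ℂ) : ip H f k = ip H f k' := by
  rw [ip_comm, ip_congr_left h, ip_comm]

@[simp] theorem ip_res_left (f k : G → ℂ) : ip H (res H f) k = ip H f k :=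
  ip_congr_left (fun g hg => by simp [res, hg]) k

@[simp] theorem ip_res_right (f k : G → ℂ) : ip H f (res H k) = ip H f k :=
  ip_congr_right (fun g hg => by simp [res, hg]) f

theorem res_of_supp {f : G → ℂ} (h : ∀ g, g ∉ H → f g = 0) : res H f = f := by
  ext g
  by_cases hg : g ∈ H <;> simp [res, hg, h]

theorem res_of_mem {f : G → ℂ} {g : G} (h : g ∈ H) : res H f g = f g := by simp [res, h]

theorem res_of_notMem {f : G → ℂ} {g : G} (h : g ∉ H) : res H f g = 0 := by simp [res, h]

theorem res_res (h : K ≤ H) (f : G → ℂ) : res K (res H f) = res K f := by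
  ext g
  by_cases hg : g ∈ K
  · simp [res, hg, h hg]
  · simp [res, hg]

theorem ext0_ip (φ ψ : H → ℂ) :
    ip H (ext0 H φ) (ext0 H ψ) = (Nat.card H : ℂ)⁻¹ * ∑ x, φ x * ψ x⁻¹ := by
  rw [ip_eq]
  simp only [ext0_coe]

theorem ext0_injective (H : Subgroup G) : Function.Injective (ext0 H) := fun φ ψ h => by
  ext x
  rw [← ext0_coe φ, ← ext0_coe ψ, h]

theorem ext0_add (φ ψ : H → ℂ) : ext0 H (φ + ψ) = ext0 H φ + ext0 H ψ := by
  ext g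
  by_cases hg : g ∈ H <;> simp [ext0, hg]

/-- Extension by zero as an additive map. -/
def ext0Hom (H : Subgroup G) : (H → ℂ) →+ (G → ℂ) where
  toFun := ext0 H
  map_zero' := by ext; simp [ext0]
  map_add' := ext0_add

/-- A multiplicative (not necessarily unital) matrix-valued map affords a character. -/
theorem Chr.of_matrix {ι : Type} [Fintype ι] (M : G → Matrix ι ι ℂ)
    (hmul : ∀ g ∈ H, ∀ h ∈ H, M (g * h) = M g * M h) (hf : ∀ g ∈ H, f g = (M g).trace)
    (h0 : ∀ g ∉ H, f g = 0) : Chr H f := by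
  let W : Submodule ℂ (ι → ℂ) := LinearMap.range (Matrix.toLin' (M 1))
  have hmem : ∀ g : H, ∀ v, Matrix.toLin' (M g) v ∈ W := fun g v => by
    refine ⟨Matrix.toLin' (M g) v, ?_⟩
    rw [← LinearMap.comp_apply, ← Matrix.toLin'_mul, ← hmul 1 H.one_mem g g.2, one_mul]
  let ρ : Representation ℂ H W :=
    { toFun := fun g => (Matrix.toLin' (M g)).restrict (p := W) (q := W) fun v _ => hmem g v
      map_one' := by
        ext1 ⟨v, w, hw⟩
        apply Subtype.ext
        simp only [LinearMap.restrict_apply, Module.End.one_apply]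
        subst hw
        rw [← LinearMap.comp_apply, ← Matrix.toLin'_mul, OneMemClass.coe_one,
          ← hmul 1 H.one_mem 1 H.one_mem, one_mul]
      map_mul' := fun g h => by
        ext1 v
        apply Subtype.ext
        simp [LinearMap.restrict_apply, hmul g g.2 h h.2] }
  refine ⟨W, _, _, inferInstance, ρ, ?_⟩
  ext g
  by_cases hg : g ∈ H
  · simp only [ext0, hg, dif_pos]
    have := LinearMap.trace_restrict_eq_of_forall_mem W (Matrix.toLin' (M g)) (hmem ⟨g, hg⟩)
    rw [hf g hg, ← Matrix.trace_toLin'_eq]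
    exact this.symm
  · simp [ext0, hg, h0]

theorem Chr.exists_matrix (hf : Chr H f) : ∃ (n : ℕ) (M : G → Matrix (Fin n) (Fin n) ℂ),
    (∀ g ∉ H, M g = 0) ∧ (∀ g ∈ H, ∀ h ∈ H, M (g * h) = M g * M h) ∧ M 1 = 1 ∧
    ∀ g, f g = (M g).trace := by
  obtain ⟨V, _, _, _, ρ, rfl⟩ := hf
  let b := Module.finBasis ℂ V
  refine ⟨_, fun g => if h : g ∈ H then LinearMap.toMatrix b b (ρ ⟨g, h⟩) else 0,
    fun g hg => by simp [hg], fun g hg h hh => ?_, ?_, fun g => ?_⟩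
  · simp only [hg, hh, H.mul_mem hg hh, dif_pos]
    rw [← LinearMap.toMatrix_mul, ← map_mul]; rfl
  · beta_reduce
    rw [dif_pos H.one_mem, ← LinearMap.toMatrix_one b, ← map_one ρ]; rfl
  · by_cases hg : g ∈ H
    · simp only [ext0, hg, dif_pos, Representation.character]
      exact LinearMap.trace_eq_matrix_trace ℂ b _
    · simp [ext0, hg]

theorem Chr.zero (H : Subgroup G) : Chr H (0 : G → ℂ) :=
  Chr.of_matrix (ι := Empty) (fun _ => 0) (by simp) (by simp) (by simp)

theorem Chr.add (hf : Chr H f) (hk : Chr H k) : Chr H (f + k) := by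
  obtain ⟨n, M, hM0, hM, -, hMf⟩ := hf.exists_matrix
  obtain ⟨m, N, hN0, hN, -, hNf⟩ := hk.exists_matrix
  refine Chr.of_matrix (fun g => Matrix.fromBlocks (M g) 0 0 (N g)) (fun g hg h hh => ?_)
    (fun g hg => ?_) (fun g hg => ?_)
  · simp [Matrix.fromBlocks_multiply, hM g hg h hh, hN g hg h hh]
  · simp [hMf, hNf, Matrix.trace, Matrix.fromBlocks, Fintype.sum_sum_type]
  · simp [hf.supp hg, hk.supp hg]

theorem Chr.sum {ι : Type*} {s : Finset ι} {f : ι → G → ℂ} (h : ∀ i ∈ s, Chr H (f i)) :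
    Chr H (∑ i ∈ s, f i) := by
  induction s using Finset.induction_on with
  | empty => simpa using Chr.zero H
  | insert a s ha ih =>
    rw [Finset.sum_insert ha]
    exact (h a (by simp)).add (ih fun i hi => h i (by simp [hi]))

theorem Chr.nsmul (hf : Chr H f) (n : ℕ) : Chr H ((n : ℂ) • f) := by
  have := Chr.sum (H := H) (s := Finset.range n) (f := fun _ => f) fun _ _ => hf
  simpa [← Nat.cast_smul_eq_nsmul ℂ] using this

theorem Chr.mul (hf : Chr H f) (hk : Chr H k) : Chr H (f * k) := by
  obtain ⟨n, M, hM0, hM, -, hMf⟩ := hf.exists_matrix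
  obtain ⟨m, N, hN0, hN, -, hNf⟩ := hk.exists_matrix
  refine Chr.of_matrix (fun g => Matrix.kroneckerMap (· * ·) (M g) (N g)) (fun g hg h hh => ?_)
    (fun g hg => ?_) (fun g hg => ?_)
  · rw [hM g hg h hh, hN g hg h hh]
    exact Matrix.mul_kronecker_mul _ _ _ _
  · rw [Pi.mul_apply, hMf, hNf]
    exact (Matrix.trace_kronecker _ _).symm
  · simp [hf.supp hg]

theorem Chr.res (hf : Chr H f) (h : K ≤ H) : Chr K (res K f) := by
  obtain ⟨n, M, hM0, hM, -, hMf⟩ := hf.exists_matrix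
  exact Chr.of_matrix M (fun g hg k hk => hM g (h hg) k (h hk))
    (fun g hg => by rw [res_of_mem hg, hMf]) (fun g hg => res_of_notMem hg)

/-- A class function of `x⁻¹ H x` obtained from one of `H`. -/
def cj (x : G) (f : G → ℂ) (g : G) : ℂ := f (x * g * x⁻¹)

theorem Chr.cj {x : G} (hf : Chr H f) (hK : ∀ g, g ∈ K ↔ x * g * x⁻¹ ∈ H) : Chr K (cj x f) := by
  obtain ⟨n, M, hM0, hM, -, hMf⟩ := hf.exists_matrix
  refine Chr.of_matrix (fun g => M (x * g * x⁻¹)) (fun g hg k hk => ?_)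
    (fun g hg => by rw [SubChar.cj, hMf]) (fun g hg => hf.supp (by rwa [← hK]))
  rw [← hM _ ((hK g).1 hg) _ ((hK k).1 hk)]
  group

theorem Chr.galois (hf : Chr H f) (σ : ℂ →+* ℂ) : Chr H (σ ∘ f) := by
  obtain ⟨n, M, hM0, hM, -, hMf⟩ := hf.exists_matrix
  refine Chr.of_matrix (fun g => σ.mapMatrix (M g)) (fun g hg k hk => ?_)
    (fun g hg => ?_) (fun g hg => by simp [hf.supp hg])
  · rw [hM g hg k hk, map_mul]
  · simp [hMf, Matrix.trace]

theorem Chr.ind (hf : Chr K f) (h : K ≤ H) : Chr H (ind K H f) := by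
  obtain ⟨n, M, hM0, hM, -, hMf⟩ := hf.exists_matrix
  have hK := card_ne_zero' K
  refine Chr.of_matrix (ι := H × Fin n)
    (fun g => Matrix.of fun xa yb => (Nat.card K : ℂ)⁻¹ * M (xa.1 * g * (yb.1 : G)⁻¹) xa.2 yb.2)
    (fun g hg k hk => ?_) (fun g hg => ?_) (fun g hg => ?_)
  · ext ⟨x, a⟩ ⟨y, b⟩
    simp only [Matrix.of_apply, Matrix.mul_apply, Fintype.sum_prod_type]
    have key : ∀ z : H, ∑ c, (Nat.card K : ℂ)⁻¹ * M (x * g * (z : G)⁻¹) a c *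
        ((Nat.card K : ℂ)⁻¹ * M (z * k * (y : G)⁻¹) c b) =
        if (x * g * (z : G)⁻¹) ∈ K then
        (Nat.card K : ℂ)⁻¹ * (Nat.card K : ℂ)⁻¹ * M (x * (g * k) * (y : G)⁻¹) a b else 0 := by
      intro z
      have e : (x : G) * (g * k) * (y : G)⁻¹ = (x * g * (z : G)⁻¹) * (z * k * (y : G)⁻¹) := by group
      split_ifs with hz
      · by_cases hy : (z * k * (y : G)⁻¹) ∈ K
        · rw [e, hM _ hz _ hy, Matrix.mul_apply, Finset.mul_sum]
          exact Finset.sum_congr rfl fun c _ => by ring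
        · have : (x : G) * (g * k) * (y : G)⁻¹ ∉ K := by
            rw [e, K.mul_mem_cancel_left hz]; exact hy
          simp [hM0 _ hy, hM0 _ this]
      · simp [hM0 _ hz]
    rw [Finset.sum_congr rfl fun z _ => key z, ← Finset.sum_filter, Finset.sum_const]
    have hcard : (Finset.univ.filter fun z : H => (x * g * (z : G)⁻¹) ∈ K).card = Nat.card K := by
      rw [← Fintype.card_eq_nat_card, ← Finset.card_univ]
      refine Finset.card_bij' (fun z _ => if h : x * g * (z : G)⁻¹ ∈ K then ⟨_, h⟩ else 1)
        (fun (w : K) _ => (⟨(w : G)⁻¹ * (x * g), H.mul_mem (H.inv_mem (h w.2))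
          (H.mul_mem x.2 hg)⟩ : H)) (by simp) (fun w _ => ?_) (fun z hz => ?_) (fun w _ => ?_)
      · simp [mul_assoc]
      · simp only [Finset.mem_filter, Finset.mem_univ, true_and] at hz
        simp only [hz, dif_pos]
        apply Subtype.ext
        simp [mul_assoc]
      · simp [mul_assoc]
    rw [hcard, nsmul_eq_mul]
    field_simp
  · simp only [SubChar.ind, Matrix.trace, Matrix.diag, Matrix.of_apply, Fintype.sum_prod_type]
    rw [sum_ite_mem H fun x => f (x * g * x⁻¹), Finset.mul_sum]
    refine Finset.sum_congr rfl fun x _ => ?_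
    rw [hMf, Matrix.trace, Finset.mul_sum]
    rfl
  · simp only [SubChar.ind]
    rw [Finset.sum_eq_zero, mul_zero]
    intro x _
    split_ifs with hx
    · refine hf.supp fun hc => hg ?_
      have := H.mul_mem (H.mul_mem (H.inv_mem hx) (h hc)) hx
      simpa [mul_assoc] using this
    · rfl

end

section

variable {G : Type} [Group G] [Fintype G] {H K : Subgroup G} {f k θ : G → ℂ}

/-! ### Orthogonality and decomposition into irreducibles -/

theorem Chr.decomp_aux (hf : Chr H f) : ∃ (T : Finset (H → ℂ)) (m : (H → ℂ) → ℕ),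
    (∀ θ ∈ T, IsSimpleChar H θ ∧ 0 < m θ) ∧ f = ∑ θ ∈ T, (m θ : ℂ) • ext0 H θ := by
  obtain ⟨V, _, _, _, ρ, rfl⟩ := hf
  obtain ⟨s, hs, h⟩ := exists_multiset_simpleChar _ V ρ rfl
  refine ⟨s.toFinset, fun θ => s.count θ, fun θ hθ => ?_, ?_⟩
  · rw [Multiset.mem_toFinset] at hθ
    exact ⟨hs θ hθ, Multiset.count_pos.mpr hθ⟩
  · rw [h, Finset.sum_multiset_count]
    change ext0Hom H _ = ∑ θ ∈ _, _ • ext0Hom H θ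
    rw [map_sum]
    exact Finset.sum_congr rfl fun θ _ => by rw [map_nsmul, Nat.cast_smul_eq_nsmul]

theorem IsSimpleChar.chr {θ : H → ℂ} (h : IsSimpleChar H θ) : Chr H (ext0 H θ) := by
  obtain ⟨V, _, _, _, ρ, -, rfl⟩ := h
  exact ⟨V, _, _, inferInstance, ρ, rfl⟩

theorem IsSimpleChar.ip {θ η : H → ℂ} (h : IsSimpleChar H θ) (h' : IsSimpleChar H η) :
    ip H (ext0 H θ) (ext0 H η) = if θ = η then 1 else 0 := by
  rw [ext0_ip, simpleChar_ip h h']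

theorem IsSimpleChar.irr {θ : H → ℂ} (h : IsSimpleChar H θ) : Irr H (ext0 H θ) :=
  ⟨h.chr, by rw [h.ip h, if_pos rfl]⟩

theorem Irr.exists_simple (hf : Irr H f) : ∃ θ : H → ℂ, IsSimpleChar H θ ∧ f = ext0 H θ := by
  obtain ⟨T, m, hT, h⟩ := hf.1.decomp_aux
  have h1 := hf.2
  rw [h, ip_sum_left] at h1
  have h2 : ∀ θ ∈ T, SubChar.ip H ((m θ : ℂ) • ext0 H θ) (∑ η ∈ T, (m η : ℂ) • ext0 H η)
      = ((m θ ^ 2 : ℕ) : ℂ) := by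
    intro θ hθ
    rw [ip_smul_left, ip_sum_right, Finset.sum_eq_single θ]
    · rw [ip_smul_right, (hT θ hθ).1.ip (hT θ hθ).1, if_pos rfl]
      push_cast; ring
    · intro η hη hne
      rw [ip_smul_right, (hT θ hθ).1.ip (hT η hη).1, if_neg hne.symm, mul_zero]
    · exact fun h => absurd hθ h
  rw [Finset.sum_congr rfl h2, ← Nat.cast_sum, Nat.cast_eq_one] at h1
  have hne : T.Nonempty := by
    rw [Finset.nonempty_iff_ne_empty]; rintro rfl; simp at h1
  obtain ⟨θ, hθ⟩ := hne
  have hpos : ∀ η ∈ T, 0 < m η ^ 2 := fun η hη => pow_pos (hT η hη).2 2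
  rw [← Finset.add_sum_erase _ _ hθ] at h1
  have hθ1 := hpos θ hθ
  have he : T.erase θ = ∅ := by
    by_contra hcon
    obtain ⟨η, hη⟩ := Finset.nonempty_iff_ne_empty.mpr hcon
    have := Finset.single_le_sum (f := fun η => m η ^ 2) (fun _ _ => Nat.zero_le _) hη
    have := hpos η (Finset.mem_of_mem_erase hη)
    omega
  have hm : m θ = 1 := by
    rw [he] at h1
    simpa using h1
  refine ⟨θ, (hT θ hθ).1, ?_⟩
  rw [h, ← Finset.add_sum_erase _ _ hθ, he, hm]
  simp

theorem irr_ip (hf : Irr H f) (hk : Irr H k) : ip H f k = if f = k then 1 else 0 := by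
  obtain ⟨θ, hθ, rfl⟩ := hf.exists_simple
  obtain ⟨η, hη, rfl⟩ := hk.exists_simple
  rw [hθ.ip hη]
  simp [(ext0_injective H).eq_iff]

theorem Irr.ip_self (hf : Irr H f) : ip H f f = 1 := hf.2

theorem Irr.ip_of_ne (hf : Irr H f) (hk : Irr H k) (h : f ≠ k) : ip H f k = 0 := by
  rw [irr_ip hf hk, if_neg h]

theorem setOf_irr_finite (H : Subgroup G) : {θ : G → ℂ | Irr H θ}.Finite := by
  apply LinearIndependent.setFinite (R := ℂ)
  rw [linearIndependent_iff']
  intro s g hg i hi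
  have := congrArg (fun k => ip H k (i : G → ℂ)) hg
  simp only [ip_sum_left, ip_smul_left, ip_zero_left] at this
  rw [Finset.sum_eq_single i] at this
  · simpa [Irr.ip_self i.2] using this
  · intro b hb hne
    rw [Irr.ip_of_ne b.2 i.2 (fun h => hne (Subtype.ext h)), mul_zero]
  · exact fun h => absurd hi h

/-- The finite set of irreducible characters. -/
def irr (H : Subgroup G) : Finset (G → ℂ) := (setOf_irr_finite H).toFinset

@[simp] theorem mem_irr : θ ∈ irr H ↔ Irr H θ := by simp [irr]

theorem Chr.decomp_nat (hf : Chr H f) :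
    ∃ m : (G → ℂ) → ℕ, f = ∑ θ ∈ irr H, (m θ : ℂ) • θ := by
  obtain ⟨T, m, hT, h⟩ := hf.decomp_aux
  have hTi : T.image (ext0 H) ⊆ irr H := by
    intro θ hθ
    obtain ⟨η, hη, rfl⟩ := Finset.mem_image.mp hθ
    exact mem_irr.mpr (hT η hη).1.irr
  refine ⟨fun θ => if θ ∈ T.image (ext0 H) then m (fun x => θ x) else 0, ?_⟩
  rw [h, ← Finset.sum_subset hTi]
  · rw [Finset.sum_image fun _ _ _ _ h => ext0_injective H h]
    refine Finset.sum_congr rfl fun θ hθ => ?_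
    beta_reduce
    rw [if_pos (Finset.mem_image_of_mem _ hθ)]
    simp only [ext0_coe]
  · intro θ _ hθ
    simp [hθ]

theorem ip_sum_irr (c : (G → ℂ) → ℂ) (hθ : Irr H θ) :
    ip H (∑ η ∈ irr H, c η • η) θ = c θ := by
  rw [ip_sum_left, Finset.sum_eq_single θ]
  · rw [ip_smul_left, hθ.ip_self, mul_one]
  · intro b hb hne
    rw [ip_smul_left, (mem_irr.mp hb).ip_of_ne hθ hne, mul_zero]
  · exact fun h => absurd (mem_irr.mpr hθ) h

/-- The multiplicity of `θ` in `f`. -/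
def mult (H : Subgroup G) (f θ : G → ℂ) : ℕ :=
  if h : ∃ n : ℕ, ip H f θ = n then h.choose else 0

theorem Chr.ip_nat (hf : Chr H f) (hk : Chr H k) : ∃ n : ℕ, ip H f k = n := by
  obtain ⟨m, h⟩ := hf.decomp_nat
  obtain ⟨m', h'⟩ := hk.decomp_nat
  refine ⟨∑ θ ∈ irr H, m' θ * m θ, ?_⟩
  conv_lhs => rw [h', ip_sum_right]
  push_cast
  refine Finset.sum_congr rfl fun θ hθ => ?_
  rw [ip_smul_right, h, ip_sum_irr (fun θ => (m θ : ℂ)) (mem_irr.mp hθ)]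

theorem Chr.cast_mult (hf : Chr H f) (hk : Chr H k) : (mult H f k : ℂ) = ip H f k := by
  have h := hf.ip_nat hk
  rw [mult, dif_pos h]
  exact h.choose_spec.symm

theorem Chr.decomp (hf : Chr H f) : f = ∑ θ ∈ irr H, ip H f θ • θ := by
  obtain ⟨m, h⟩ := hf.decomp_nat
  conv_lhs => rw [h]
  refine Finset.sum_congr rfl fun θ hθ => ?_
  rw [h, ip_sum_irr (fun θ => (m θ : ℂ)) (mem_irr.mp hθ)]

theorem Chr.decomp_mult (hf : Chr H f) : f = ∑ θ ∈ irr H, (mult H f θ : ℂ) • θ := by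
  conv_lhs => rw [hf.decomp]
  exact Finset.sum_congr rfl fun θ hθ => by rw [hf.cast_mult (mem_irr.mp hθ).1]

theorem Chr.ip_eq_sum (hf : Chr H f) (k : G → ℂ) :
    ip H f k = ∑ θ ∈ irr H, ip H f θ * ip H k θ := by
  conv_lhs => rw [hf.decomp, ip_sum_left]
  exact Finset.sum_congr rfl fun θ _ => by rw [ip_smul_left, ip_comm H θ]

theorem Chr.eq_of_ip (hf : Chr H f) (hk : Chr H k) (h : ∀ θ, Irr H θ → ip H f θ = ip H k θ) :
    f = k := by
  rw [hf.decomp, hk.decomp]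
  exact Finset.sum_congr rfl fun θ hθ => by rw [h θ (mem_irr.mp hθ)]

theorem Chr.exists_constituent (hf : Chr H f) (h0 : f ≠ 0) : ∃ θ, Irr H θ ∧ ip H f θ ≠ 0 := by
  by_contra hcon
  push Not at hcon
  exact h0 (hf.eq_of_ip (Chr.zero H) fun θ hθ => by rw [hcon θ hθ, ip_zero_left])

theorem Chr.exists_add (hf : Chr H f) (hθ : Irr H θ) (h : ip H f θ ≠ 0) :
    ∃ f', Chr H f' ∧ f = θ + f' := by
  have hm : mult H f θ ≠ 0 := by
    rwa [← hf.cast_mult hθ.1, Nat.cast_ne_zero] at h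
  refine ⟨((mult H f θ - 1 : ℕ) : ℂ) • θ + ∑ η ∈ (irr H).erase θ, (mult H f η : ℂ) • η,
    (hθ.1.nsmul _).add (Chr.sum fun η hη =>
      (mem_irr.mp (Finset.mem_of_mem_erase hη)).1.nsmul _), ?_⟩
  conv_lhs => rw [hf.decomp_mult, ← Finset.add_sum_erase _ _ (mem_irr.mpr hθ)]
  rw [← add_assoc]
  congr 1
  rw [Nat.cast_sub (Nat.one_le_iff_ne_zero.mpr hm), sub_smul]
  simp

theorem Chr.deg (hf : Chr H f) : ∃ n : ℕ, f 1 = n ∧ (n = 0 → f = 0) := by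
  obtain ⟨n, M, hM0, hM, h1, hMf⟩ := hf.exists_matrix
  refine ⟨n, by rw [hMf, h1]; simp, ?_⟩
  rintro rfl
  ext g
  simp [hMf, Matrix.trace]

/-- The degree as a natural number. -/
def dg (f : G → ℂ) : ℕ := if h : ∃ n : ℕ, f 1 = n then h.choose else 0

theorem Chr.cast_dg (hf : Chr H f) : (dg f : ℂ) = f 1 := by
  have h : ∃ n : ℕ, f 1 = n := let ⟨n, h, _⟩ := hf.deg; ⟨n, h⟩
  rw [dg, dif_pos h]
  exact h.choose_spec.symm

theorem dg_eq {n : ℕ} (h : f 1 = n) : dg f = n := by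
  have h' : ∃ n : ℕ, f 1 = n := ⟨n, h⟩
  rw [dg, dif_pos h']
  exact_mod_cast h'.choose_spec.symm.trans h

theorem Chr.dg_eq_zero (hf : Chr H f) : dg f = 0 ↔ f = 0 := by
  constructor
  · intro h
    obtain ⟨n, hn, h0⟩ := hf.deg
    exact h0 ((dg_eq hn).symm.trans h)
  · rintro rfl
    exact dg_eq (by simp)

theorem Chr.apply_one_ne_zero (hf : Chr H f) (h : f ≠ 0) : f 1 ≠ 0 := by
  rw [← hf.cast_dg, Nat.cast_ne_zero, Ne, hf.dg_eq_zero]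
  exact h

theorem Irr.ne_zero (hf : Irr H f) : f ≠ 0 := by
  rintro rfl
  simpa using hf.2

theorem Irr.apply_one_ne_zero (hf : Irr H f) : f 1 ≠ 0 := hf.1.apply_one_ne_zero hf.ne_zero

theorem dg_add (hf : Chr H f) (hk : Chr H k) : dg (f + k) = dg f + dg k :=
  dg_eq (by simp [hf.cast_dg, hk.cast_dg])

theorem dg_mul (hf : Chr H f) (hk : Chr K k) : dg (f * k) = dg f * dg k :=
  dg_eq (by simp [hf.cast_dg, hk.cast_dg])

theorem Irr.dg_pos (hf : Irr H f) : 0 < dg f :=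
  Nat.pos_of_ne_zero fun h => hf.ne_zero (hf.1.dg_eq_zero.mp h)

theorem Chr.add_ne_zero (hf : Chr H f) (hk : Chr H k) (h : f ≠ 0) : f + k ≠ 0 := fun h0 => by
  have := dg_add hf hk
  rw [h0, (Chr.zero H).dg_eq_zero.mpr rfl] at this
  exact h (hf.dg_eq_zero.mp (by omega))

theorem Chr.cls (hf : Chr H f) {x : G} (hx : x ∈ H) (g : G) : f (x * g * x⁻¹) = f g := by
  by_cases hg : g ∈ H
  · obtain ⟨n, M, hM0, hM, h1, hMf⟩ := hf.exists_matrix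
    rw [hMf, hMf, hM _ (H.mul_mem hx hg) _ (H.inv_mem hx), Matrix.trace_mul_comm,
      ← hM _ (H.inv_mem hx) _ (H.mul_mem hx hg), inv_mul_cancel_left]
  · rw [hf.supp hg, hf.supp]
    rwa [H.mul_mem_cancel_right (H.inv_mem hx), H.mul_mem_cancel_left hx]

theorem Chr.ip_self_ge (hf : Chr H f) (h0 : f ≠ 0) : ∃ n : ℕ, ip H f f = n ∧ 1 ≤ n := by
  obtain ⟨θ, hθ, h⟩ := hf.exists_constituent h0
  refine ⟨∑ θ ∈ irr H, mult H f θ * mult H f θ, ?_, ?_⟩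
  · rw [hf.ip_eq_sum f]
    push_cast
    exact Finset.sum_congr rfl fun θ hθ => by rw [hf.cast_mult (mem_irr.mp hθ).1]
  · have h1 := Finset.single_le_sum (f := fun θ => mult H f θ * mult H f θ)
      (fun _ _ => Nat.zero_le _) (mem_irr.mpr hθ)
    have h2 : mult H f θ ≠ 0 := by rwa [← hf.cast_mult hθ.1, Nat.cast_ne_zero] at h
    have := Nat.mul_pos (Nat.pos_of_ne_zero h2) (Nat.pos_of_ne_zero h2)
    omega

theorem Irr.indecomposable (hθ : Irr H θ) (hf : Chr H f) (hk : Chr H k) (h : θ = f + k) :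
    f = 0 ∨ k = 0 := by
  by_contra! hcon
  obtain ⟨a, ha, ha'⟩ := hf.ip_self_ge hcon.1
  obtain ⟨b, hb, hb'⟩ := hk.ip_self_ge hcon.2
  obtain ⟨c, hc⟩ := hf.ip_nat hk
  have := hθ.2
  rw [h, ip_add_left, ip_add_right, ip_add_right, ip_comm H k f, ha, hb, hc] at this
  norm_cast at this
  omega

theorem Chr.irr_of_indecomposable (hf : Chr H f) (h0 : f ≠ 0)
    (h : ∀ f₁ f₂, Chr H f₁ → Chr H f₂ → f = f₁ + f₂ → f₁ = 0 ∨ f₂ = 0) : Irr H f := by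
  obtain ⟨θ, hθ, hne⟩ := hf.exists_constituent h0
  obtain ⟨f', hf', rfl⟩ := hf.exists_add hθ hne
  rcases h _ _ hθ.1 hf' rfl with h | h
  · exact absurd h hθ.ne_zero
  · rwa [h, add_zero]

/-! ### Linear characters -/

/-- `l` is a linear character of `H`, extended by zero. -/
structure Lin (H : Subgroup G) (l : G → ℂ) : Prop where
  supp : ∀ g ∉ H, l g = 0
  mul : ∀ g ∈ H, ∀ h ∈ H, l (g * h) = l g * l h
  one : l 1 = 1

theorem Lin.chr {l : G → ℂ} (hl : Lin H l) : Chr H l :=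
  Chr.of_matrix (ι := Unit) (fun g => Matrix.of fun _ _ => l g)
    (fun g hg h hh => by ext; simp [Matrix.mul_apply, hl.mul g hg h hh])
    (fun g _ => by simp [Matrix.trace]) hl.supp

theorem Chr.lin (hf : Chr H f) (h1 : f 1 = 1) : Lin H f := by
  obtain ⟨n, M, hM0, hM, hM1, hMf⟩ := hf.exists_matrix
  have hn : n = 1 := by
    have := hMf 1
    rw [hM1, h1] at this
    simp only [Matrix.trace_one, Fintype.card_fin] at this
    exact_mod_cast this.symm
  subst hn
  exact ⟨fun g hg => hf.supp hg, fun g hg h hh => by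
    simp [hMf, hM g hg h hh, Matrix.trace, Matrix.mul_apply], h1⟩

theorem Chr.irr_of_one (hf : Chr H f) (h1 : f 1 = 1) : Irr H f := by
  refine hf.irr_of_indecomposable (fun h => by simp [h] at h1) fun f₁ f₂ h h' he => ?_
  have h2 := dg_add h h'
  rw [← he, dg_eq (n := 1) (by simpa using h1)] at h2
  rw [← h.dg_eq_zero, ← h'.dg_eq_zero]
  omega

theorem Lin.irr {l : G → ℂ} (hl : Lin H l) : Irr H l := hl.chr.irr_of_one hl.one

/-- The trivial character. -/
def tr (H : Subgroup G) : G → ℂ := res H 1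

theorem tr_lin (H : Subgroup G) : Lin H (tr H) :=
  ⟨fun _ hg => res_of_notMem hg, fun g hg h hh => by
    simp [tr, res_of_mem, hg, hh, H.mul_mem hg hh], by simp [tr, res_of_mem, H.one_mem]⟩

theorem tr_of_mem {g : G} (h : g ∈ H) : tr H g = 1 := by simp [tr, res, h]

theorem tr_mul_of_supp (h : ∀ g ∉ H, f g = 0) : tr H * f = f := by
  ext g
  by_cases hg : g ∈ H
  · simp [tr_of_mem hg]
  · simp [h g hg]

theorem Lin.ne_zero' {l : G → ℂ} (hl : Lin H l) {g : G} (hg : g ∈ H) : l g ≠ 0 := by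
  intro h
  have := hl.mul g hg g⁻¹ (H.inv_mem hg)
  rw [mul_inv_cancel, hl.one, h, zero_mul] at this
  exact one_ne_zero this

theorem Lin.inv_apply {l : G → ℂ} (hl : Lin H l) {g : G} (hg : g ∈ H) : l g⁻¹ = (l g)⁻¹ := by
  have := hl.mul g hg g⁻¹ (H.inv_mem hg)
  rw [mul_inv_cancel, hl.one] at this
  exact (DivisionMonoid.inv_eq_of_mul _ _ this.symm).symm

theorem Lin.inv' {l : G → ℂ} (hl : Lin H l) : Lin H l⁻¹ :=
  ⟨fun g hg => by simp [hl.supp g hg], fun g hg h hh => by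
    simp [hl.mul g hg h hh]; ring, by simp [hl.one]⟩

theorem Lin.mul_inv {l : G → ℂ} (hl : Lin H l) : l * l⁻¹ = tr H := by
  ext g
  by_cases hg : g ∈ H
  · simp [tr_of_mem hg, hl.ne_zero' hg]
  · simp [tr, res_of_notMem hg, hl.supp g hg]

theorem Lin.res' {l : G → ℂ} (hl : Lin H l) (h : K ≤ H) : Lin K (res K l) :=
  ⟨fun _ hg => res_of_notMem hg, fun g hg k hk => by
    simp [res_of_mem, hg, hk, K.mul_mem hg hk, hl.mul g (h hg) k (h hk)],
    by simp [res_of_mem, K.one_mem, hl.one]⟩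

theorem Lin.pow_apply {l : G → ℂ} (hl : Lin H l) {g : G} (hg : g ∈ H) (n : ℕ) :
    l (g ^ n) = l g ^ n := by
  induction n with
  | zero => simp [hl.one]
  | succ n ih => rw [pow_succ, hl.mul _ (H.pow_mem hg n) _ hg, ih, pow_succ]

theorem Irr.mul_lin {l : G → ℂ} (hf : Irr H f) (hl : Lin H l) : Irr H (f * l) := by
  refine ⟨hf.1.mul hl.chr, ?_⟩
  rw [← hf.2, ip_eq, ip_eq]
  congr 1
  refine Finset.sum_congr rfl fun x _ => ?_
  have : l x * l (x⁻¹ : H) = 1 := by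
    rw [← hl.mul _ x.2 _ (x⁻¹ : H).2]
    simp [hl.one]
  simp only [Pi.mul_apply]
  linear_combination (f x * f (x⁻¹ : H)) * this

/-! ### Frobenius reciprocity -/

theorem sum_conj (x : G) (F : G → ℂ) : ∑ g, F (x * g * x⁻¹) = ∑ g, F g :=
  Fintype.sum_equiv (MulAut.conj x).toEquiv _ _ fun _ => rfl

theorem frobenius (h : K ≤ H) (hf : ∀ g ∉ K, f g = 0)
    (hk : ∀ x ∈ H, ∀ g, k (x * g * x⁻¹) = k g) : ip H (ind K H f) k = ip K f k := by
  have hH := card_ne_zero' H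
  have hK := card_ne_zero' K
  have key : ∀ x ∈ H, (∑ g : G, if g ∈ H then f (x * g * x⁻¹) * k g⁻¹ else 0) =
      ∑ g : G, if g ∈ K then f g * k g⁻¹ else 0 := by
    intro x hx
    rw [← sum_conj x fun g => if g ∈ K then f g * k g⁻¹ else 0]
    refine Finset.sum_congr rfl fun g _ => ?_
    have hkk : k (x * g * x⁻¹)⁻¹ = k g⁻¹ := by
      rw [← hk x hx g⁻¹]; simp [mul_assoc]
    have e : g ∈ H ↔ x * g * x⁻¹ ∈ H := by
      rw [H.mul_mem_cancel_right (H.inv_mem hx), H.mul_mem_cancel_left hx]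
    by_cases hg : x * g * x⁻¹ ∈ K
    · rw [if_pos hg, if_pos (e.mpr (h hg)), hkk]
    · simp [hg, hf _ hg]
  have h2 : (∑ g : G, if g ∈ H then ind K H f g * k g⁻¹ else 0) = (Nat.card K : ℂ)⁻¹ *
      ∑ x : G, if x ∈ H then (∑ g : G, if g ∈ H then f (x * g * x⁻¹) * k g⁻¹ else 0) else 0 := by
    have : ∀ g : G, (if g ∈ H then ind K H f g * k g⁻¹ else 0) = (Nat.card K : ℂ)⁻¹ *
        ∑ x : G, if x ∈ H then (if g ∈ H then f (x * g * x⁻¹) * k g⁻¹ else 0) else 0 := by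
      intro g
      split_ifs with hg
      · simp only [ind, mul_assoc, Finset.sum_mul, ite_mul, zero_mul]
      · simp
    rw [Finset.sum_congr rfl fun g _ => this g, ← Finset.mul_sum, Finset.sum_comm]
    congr 1
    refine Finset.sum_congr rfl fun x _ => ?_
    split_ifs <;> simp
  rw [ip, ip, h2]
  have h3 : (∑ x : G, if x ∈ H then (∑ g : G, if g ∈ H then f (x * g * x⁻¹) * k g⁻¹ else 0) else 0)
      = (Nat.card H : ℂ) * ∑ g : G, if g ∈ K then f g * k g⁻¹ else 0 := by
    rw [Finset.sum_congr rfl fun x _ => show _ = (if x ∈ H then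
      (∑ g : G, if g ∈ K then f g * k g⁻¹ else 0) else 0) by
        split_ifs with hx
        · exact key x hx
        · rfl]
    rw [sum_ite_mem H fun _ => ∑ g : G, if g ∈ K then f g * k g⁻¹ else 0]
    simp
  rw [h3]
  field_simp

theorem Chr.frob (hf : Chr K f) (h : K ≤ H) (hk : Chr H k) : ip H (SubChar.ind K H f) k = ip K f k :=
  frobenius h (fun _ hg => hf.supp hg) fun _ hx g => hk.cls hx g

end

section

variable {G : Type} [Group G] [Fintype G] {H K N L T U : Subgroup G} {f k θ χ ψ : G → ℂ}

/-! ### Constituents of restrictions -/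

theorem ip_add_ne_zero (hf : Chr H f) (hk : Chr H k) (hθ : Chr H θ) (h : ip H f θ ≠ 0) :
    ip H (f + k) θ ≠ 0 := by
  obtain ⟨a, ha⟩ := hf.ip_nat hθ
  obtain ⟨b, hb⟩ := hk.ip_nat hθ
  rw [ip_add_left, ha, hb]
  rw [ha] at h
  norm_cast at h ⊢
  omega

theorem Chr.ip_nat_res (hf : Chr H f) (h : K ≤ H) (hk : Chr K k) : ∃ n : ℕ, ip K f k = n := by
  obtain ⟨n, hn⟩ := (hf.res h).ip_nat hk
  exact ⟨n, by rw [← hn, ip_res_left]⟩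

theorem Chr.exists_over (hf : Chr H f) (h : ip K f θ ≠ 0) :
    ∃ ψ, Irr H ψ ∧ ip H f ψ ≠ 0 ∧ ip K ψ θ ≠ 0 := by
  rw [hf.decomp, ip_sum_left] at h
  obtain ⟨ψ, hψ, hne⟩ := Finset.exists_ne_zero_of_sum_ne_zero h
  rw [ip_smul_left] at hne
  exact ⟨ψ, mem_irr.mp hψ, left_ne_zero_of_mul hne, right_ne_zero_of_mul hne⟩

theorem Chr.over_trans (hf : Chr H f) (h : K ≤ H) (hψ : Irr H ψ) (hθ : Chr K θ)
    (h1 : ip H f ψ ≠ 0) (h2 : ip K ψ θ ≠ 0) : ip K f θ ≠ 0 := by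
  obtain ⟨f', hf', rfl⟩ := hf.exists_add hψ h1
  rw [← ip_res_left] at h2 ⊢
  have : SubChar.res K (ψ + f') = SubChar.res K ψ + SubChar.res K f' := by
    ext g; by_cases hg : g ∈ K <;> simp [SubChar.res, hg]
  rw [this]
  exact ip_add_ne_zero (hψ.1.res h) (hf'.res h) hθ h2

theorem res_add (f k : G → ℂ) : res H (f + k) = res H f + res H k := by
  ext g; by_cases hg : g ∈ H <;> simp [SubChar.res, hg]

theorem res_smul (c : ℂ) (f : G → ℂ) : res H (c • f) = c • res H f := by
  ext g; by_cases hg : g ∈ H <;> simp [SubChar.res, hg]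

theorem res_mul (f k : G → ℂ) : res H (f * k) = res H f * res H k := by
  ext g; by_cases hg : g ∈ H <;> simp [SubChar.res, hg]

theorem res_sum {ι : Type*} (s : Finset ι) (f : ι → G → ℂ) :
    res H (∑ i ∈ s, f i) = ∑ i ∈ s, res H (f i) := by
  ext g; by_cases hg : g ∈ H <;> simp [SubChar.res, hg]

theorem Chr.res_ne_zero (hf : Chr H f) (h0 : f ≠ 0) : SubChar.res K f ≠ 0 := fun h =>
  hf.apply_one_ne_zero h0 (by rw [← res_of_mem (f := f) K.one_mem, h]; rfl)

theorem Irr.exists_constituent (hf : Irr H f) (h : K ≤ H) : ∃ θ, Irr K θ ∧ ip K f θ ≠ 0 := by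
  obtain ⟨θ, hθ, hne⟩ := (hf.1.res h).exists_constituent (hf.1.res_ne_zero hf.ne_zero)
  exact ⟨θ, hθ, by rwa [ip_res_left] at hne⟩

/-- If the nonzero characters `ψ i` satisfy `[∑ mᵢψᵢ, ∑ mᵢψᵢ] = ∑ mᵢ²`, then they are irreducible
and pairwise distinct. -/
theorem irr_of_norm {ι : Type*} (S : Finset ι) (m : ι → ℕ) (ψ : ι → G → ℂ)
    (hm : ∀ i ∈ S, 0 < m i) (hψ : ∀ i ∈ S, Chr H (ψ i)) (h0 : ∀ i ∈ S, ψ i ≠ 0)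
    (h : ip H (∑ i ∈ S, (m i : ℂ) • ψ i) (∑ i ∈ S, (m i : ℂ) • ψ i) = ∑ i ∈ S, (m i : ℂ) ^ 2) :
    (∀ i ∈ S, Irr H (ψ i)) ∧ Set.InjOn ψ S := by
  have e : ip H (∑ i ∈ S, (m i : ℂ) • ψ i) (∑ i ∈ S, (m i : ℂ) • ψ i) =
      ((∑ i ∈ S, ∑ j ∈ S, m i * (m j * mult H (ψ i) (ψ j)) : ℕ) : ℂ) := by
    rw [ip_sum_left]
    push_cast
    refine Finset.sum_congr rfl fun i hi => ?_
    rw [ip_sum_right]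
    refine Finset.sum_congr rfl fun j hj => ?_
    rw [ip_smul_left, ip_smul_right, (hψ i hi).cast_mult (hψ j hj)]
  rw [e] at h
  norm_cast at h
  have hge : ∀ i ∈ S, 1 ≤ mult H (ψ i) (ψ i) := fun i hi => by
    obtain ⟨n, hn, hn'⟩ := (hψ i hi).ip_self_ge (h0 i hi)
    rw [← (hψ i hi).cast_mult (hψ i hi)] at hn
    norm_cast at hn
    omega
  have hle : ∀ i ∈ S, m i ^ 2 ≤ ∑ j ∈ S, m i * (m j * mult H (ψ i) (ψ j)) := fun i hi => by
    refine le_trans ?_ (Finset.single_le_sum (fun _ _ => Nat.zero_le _) hi)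
    have := hge i hi
    nlinarith [sq_nonneg (m i)]
  have heq := (Finset.sum_eq_sum_iff_of_le hle).mp h.symm
  refine ⟨fun i hi => ⟨hψ i hi, ?_⟩, fun i hi j hj hij => ?_⟩
  swap
  · by_contra hne
    have h1 := heq i hi
    have h2 : ∑ k ∈ {i, j}, m i * (m k * mult H (ψ i) (ψ k)) ≤
        ∑ k ∈ S, m i * (m k * mult H (ψ i) (ψ k)) :=
      Finset.sum_le_sum_of_subset (Finset.insert_subset hi (Finset.singleton_subset_iff.2 hj))
    rw [← h1, Finset.sum_pair hne, ← hij] at h2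
    have h3 := hge i hi
    have h4 := Nat.mul_pos (hm i hi) (hm j hj)
    nlinarith
  have h1 : m i * (m i * mult H (ψ i) (ψ i)) ≤ m i ^ 2 := by
    rw [heq i hi]
    exact Finset.single_le_sum (f := fun j => m i * (m j * mult H (ψ i) (ψ j)))
      (fun _ _ => Nat.zero_le _) hi
  have h2 : mult H (ψ i) (ψ i) = 1 := by
    have := hge i hi
    have hmi := hm i hi
    have : m i * m i * mult H (ψ i) (ψ i) ≤ m i * m i * 1 := by nlinarith
    have := Nat.le_of_mul_le_mul_left this (Nat.mul_pos hmi hmi)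
    omega
  rw [← (hψ i hi).cast_mult (hψ i hi), h2, Nat.cast_one]

/-! ### Conjugation and field automorphisms -/

/-- `N` is a normal subgroup of `H`. -/
def Nrm (N H : Subgroup G) : Prop := N ≤ H ∧ ∀ x ∈ H, ∀ n ∈ N, x * n * x⁻¹ ∈ N

theorem Nrm.le (h : Nrm N H) : N ≤ H := h.1

theorem Nrm.mem_iff (h : Nrm N H) {x : G} (hx : x ∈ H) (n : G) : n ∈ N ↔ x * n * x⁻¹ ∈ N := by
  refine ⟨h.2 x hx n, fun hn => ?_⟩
  have := h.2 x⁻¹ (H.inv_mem hx) _ hn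
  simpa [mul_assoc] using this

theorem Nrm.mem_iff' (h : Nrm N H) {x : G} (hx : x ∈ H) (n : G) : n ∈ N ↔ x⁻¹ * n * x ∈ N := by
  simpa using h.mem_iff (H.inv_mem hx) n

theorem Nrm.mono (h : Nrm N H) (hK : K ≤ H) (hN : N ≤ K) : Nrm N K :=
  ⟨hN, fun x hx n hn => h.2 x (hK hx) n hn⟩

theorem Nrm.inf (h : Nrm N H) (hK : K ≤ H) : Nrm (K ⊓ N) K :=
  ⟨inf_le_left, fun x hx n hn => ⟨K.mul_mem (K.mul_mem hx hn.1) (K.inv_mem hx),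
    h.2 x (hK hx) n hn.2⟩⟩

theorem Nrm.refl (H : Subgroup G) : Nrm H H :=
  ⟨le_rfl, fun _ hx _ hn => H.mul_mem (H.mul_mem hx hn) (H.inv_mem hx)⟩

theorem Nrm.bot (H : Subgroup G) : Nrm ⊥ H :=
  ⟨bot_le, fun x _ n hn => by rw [Subgroup.mem_bot] at hn ⊢; simp [hn]⟩

theorem cj_cj (x y : G) (f : G → ℂ) : cj x (cj y f) = cj (y * x) f := by
  ext g; simp [cj, mul_assoc]

@[simp] theorem cj_one (f : G → ℂ) : cj 1 f = f := by ext g; simp [cj]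

theorem cj_mul (x : G) (f k : G → ℂ) : cj x (f * k) = cj x f * cj x k := rfl

theorem ip_cj {x : G} (hK : ∀ g, g ∈ K ↔ x * g * x⁻¹ ∈ H) (f k : G → ℂ) :
    ip K (cj x f) (cj x k) = ip H f k := by
  have hc : Nat.card K = Nat.card H :=
    Nat.card_congr ((MulAut.conj x).toEquiv.subtypeEquiv fun g => hK g)
  rw [ip, ip, hc, ← sum_conj x fun g => if g ∈ H then f g * k g⁻¹ else 0]
  congr 1
  refine Finset.sum_congr rfl fun g _ => ?_
  simp only [cj, hK g]
  simp [mul_assoc]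

theorem Irr.cj {x : G} (hf : Irr H f) (hK : ∀ g, g ∈ K ↔ x * g * x⁻¹ ∈ H) : Irr K (cj x f) :=
  ⟨hf.1.cj hK, by rw [ip_cj hK, hf.2]⟩

theorem Irr.cj_nrm {x : G} (hf : Irr N f) (hN : Nrm N H) (hx : x ∈ H) : Irr N (SubChar.cj x f) :=
  hf.cj (hN.mem_iff hx)

theorem Chr.cj_eq {x : G} (hf : Chr H f) (hx : x ∈ H) : SubChar.cj x f = f := by
  ext g; exact hf.cls hx g

theorem ip_galois (σ : ℂ →+* ℂ) (f k : G → ℂ) : ip H (σ ∘ f) (σ ∘ k) = σ (ip H f k) := by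
  simp only [ip, map_mul, map_sum, map_inv₀, map_natCast, Function.comp]
  congr 1
  refine Finset.sum_congr rfl fun g _ => ?_
  split_ifs <;> simp

theorem Irr.galois (hf : Irr H f) (σ : ℂ →+* ℂ) : Irr H (σ ∘ f) :=
  ⟨hf.1.galois σ, by rw [ip_galois, hf.2, map_one]⟩

theorem ip_cj_eq_of_cls (hN : Nrm N H) {x : G} (hx : x ∈ H) (hχ : Chr H χ) (θ : G → ℂ) :
    ip N χ (cj x θ) = ip N χ θ := by
  conv_lhs => rw [← hχ.cj_eq hx]
  exact ip_cj (hN.mem_iff hx) _ _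

/-! ### Induction -/

theorem ind_one (f : G → ℂ) : ind K H f 1 = (Nat.card H : ℂ) / Nat.card K * f 1 := by
  simp only [ind, mul_one, mul_inv_cancel]
  rw [sum_ite_mem H fun _ => f 1]
  simp
  ring

theorem ind_add (f k : G → ℂ) : ind K H (f + k) = ind K H f + ind K H k := by
  ext g
  simp only [ind, Pi.add_apply, ← mul_add, ← Finset.sum_add_distrib]
  congr 1
  exact Finset.sum_congr rfl fun x _ => by split_ifs <;> simp

theorem ind_congr_support (hK : K ≤ H) (hf : ∀ g ∉ K, f g = 0) (g : G) (hg : g ∉ H) :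
    ind K H f g = 0 := by
  rw [ind, Finset.sum_eq_zero, mul_zero]
  intro x _
  split_ifs with hx
  · refine hf _ fun hc => hg ?_
    have := H.mul_mem (H.mul_mem (H.inv_mem hx) (hK hc)) hx
    simpa [mul_assoc] using this
  · rfl

theorem ind_trans (h2 : L ≤ H) (f : G → ℂ) : ind L H (ind K L f) = ind K H f := by
  have hL := card_ne_zero' L
  have hK := card_ne_zero' K
  ext g
  have key : ∀ y ∈ L, (∑ x : G, if x ∈ H then f (y * (x * g * x⁻¹) * y⁻¹) else 0) =
      ∑ x : G, if x ∈ H then f (x * g * x⁻¹) else 0 := by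
    intro y hy
    refine Fintype.sum_equiv (Equiv.mulLeft y) _ _ fun x => ?_
    simp only [Equiv.coe_mulLeft, mul_inv_rev, mul_assoc, H.mul_mem_cancel_left (h2 hy)]
  simp only [ind]
  have h3 : ∀ x : G, (if x ∈ H then (Nat.card K : ℂ)⁻¹ *
      ∑ y : G, (if y ∈ L then f (y * (x * g * x⁻¹) * y⁻¹) else 0) else 0) = (Nat.card K : ℂ)⁻¹ *
      ∑ y : G, (if y ∈ L then (if x ∈ H then f (y * (x * g * x⁻¹) * y⁻¹) else 0) else 0) := by
    intro x
    split_ifs with hx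
    · rfl
    · simp
  rw [Finset.sum_congr rfl fun x _ => h3 x, ← Finset.mul_sum, Finset.sum_comm]
  have h4 : ∀ y : G, (∑ x : G, if y ∈ L then
      (if x ∈ H then f (y * (x * g * x⁻¹) * y⁻¹) else 0) else 0) =
      if y ∈ L then ∑ x : G, (if x ∈ H then f (x * g * x⁻¹) else 0) else 0 := by
    intro y
    split_ifs with hy
    · exact key y hy
    · simp
  rw [Finset.sum_congr rfl fun y _ => h4 y,
    sum_ite_mem L fun _ => ∑ x : G, (if x ∈ H then f (x * g * x⁻¹) else 0)]
  simp
  field_simp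

theorem ind_mul (hk : ∀ x ∈ H, ∀ g, k (x * g * x⁻¹) = k g) (f : G → ℂ) :
    ind K H (f * k) = ind K H f * k := by
  ext g
  simp only [ind, Pi.mul_apply]
  rw [mul_assoc, Finset.sum_mul]
  congr 1
  refine Finset.sum_congr rfl fun x _ => ?_
  split_ifs with hx
  · rw [hk x hx]
  · simp

theorem ind_mul_res (hf : ∀ g ∉ K, f g = 0)
    (hk : ∀ x ∈ H, ∀ g, k (x * g * x⁻¹) = k g) :
    ind K H (f * res K k) = ind K H f * k := by
  rw [← ind_mul hk]
  congr 1
  ext g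
  by_cases hg : g ∈ K
  · simp [res, hg]
  · simp [hf g hg]

/-- Induction from a normal subgroup, restricted to the normal subgroup. -/
theorem ind_nrm_apply (f : G → ℂ) (g : G) :
    ind N H f g = (Nat.card N : ℂ)⁻¹ * (∑ x : G, if x ∈ H then cj x f else 0) g := by
  simp only [ind, Finset.sum_apply]
  congr 1
  refine Finset.sum_congr rfl fun x _ => ?_
  split_ifs <;> rfl

/-! ### Clifford theory -/

theorem exists_cj_of_ip_ne_zero (hN : Nrm N H) (hχ : Irr H χ) {η : G → ℂ} (hθ : Irr N θ)
    (hη : Irr N η) (h1 : ip N χ θ ≠ 0) (h2 : ip N χ η ≠ 0) : ∃ x ∈ H, η = cj x θ := by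
  have h3 : ip H (ind N H θ) χ ≠ 0 := by
    rw [hθ.1.frob hN.le hχ.1, ip_comm]; exact h1
  have h4 := (hθ.1.ind hN.le).over_trans hN.le hχ hη.1 h3 h2
  by_contra hcon
  push Not at hcon
  apply h4
  have : ind N H θ = (Nat.card N : ℂ)⁻¹ • ∑ x : G, if x ∈ H then cj x θ else 0 := by
    ext g; exact ind_nrm_apply θ g
  rw [this, ip_smul_left, ip_sum_left, Finset.sum_eq_zero, mul_zero]
  intro x _
  split_ifs with hx
  · exact (hθ.cj_nrm hN hx).ip_of_ne hη (hcon x hx).symm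
  · simp

/-- The stabilizer of a function in `H`. -/
def stab (H : Subgroup G) (θ : G → ℂ) : Subgroup G where
  carrier := {x | x ∈ H ∧ cj x θ = θ}
  mul_mem' := fun {a b} ha hb => ⟨H.mul_mem ha.1 hb.1, by rw [← cj_cj, ha.2, hb.2]⟩
  one_mem' := ⟨H.one_mem, cj_one θ⟩
  inv_mem' := fun {a} ha => ⟨H.inv_mem ha.1, by
    conv_lhs => rw [← ha.2, cj_cj, mul_inv_cancel, cj_one]⟩

theorem mem_stab {x : G} : x ∈ stab H θ ↔ x ∈ H ∧ cj x θ = θ := Iff.rfl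

theorem stab_le : stab H θ ≤ H := fun _ h => h.1

theorem le_stab (hN : Nrm N H) (hθ : Chr N θ) : N ≤ stab H θ := fun _ hx =>
  ⟨hN.le hx, hθ.cj_eq hx⟩

theorem clifford_res (hN : Nrm N H) (hχ : Irr H χ) (hθ : Irr N θ) (h1 : ip N χ θ ≠ 0) :
    (Nat.card (stab H θ) : ℂ) • res N χ = ip N χ θ • ∑ x : G, if x ∈ H then cj x θ else 0 := by
  obtain ⟨e, he⟩ := hχ.1.ip_nat_res hN.le hθ.1
  have hS : Chr N (∑ x : G, if x ∈ H then cj x θ else 0) := Chr.sum fun x _ => by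
    split_ifs with hx
    · exact (hθ.cj_nrm hN hx).1
    · exact Chr.zero N
  refine ((hχ.1.res hN.le).nsmul _).eq_of_ip (by rw [he]; exact hS.nsmul e) fun η hη => ?_
  rw [ip_smul_left, ip_smul_left, ip_res_left, ip_sum_left]
  by_cases h : ∃ y ∈ H, η = cj y θ
  · obtain ⟨y, hy, rfl⟩ := h
    rw [ip_cj_eq_of_cls hN hy hχ.1]
    have : ∀ x : G, ip N (if x ∈ H then cj x θ else 0) (cj y θ) =
        if x * y⁻¹ ∈ stab H θ then 1 else 0 := by
      intro x
      by_cases hx : x ∈ H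
      · rw [if_pos hx, irr_ip (hθ.cj_nrm hN hx) hη]
        congr 1
        rw [mem_stab, ← cj_cj]
        refine propext ⟨fun h => ⟨H.mul_mem hx (H.inv_mem hy), ?_⟩, fun h => ?_⟩
        · rw [h, cj_cj, mul_inv_cancel, cj_one]
        · have := congrArg (cj y) h.2
          rwa [cj_cj, inv_mul_cancel, cj_one] at this
      · rw [if_neg hx, ip_zero_left, if_neg]
        intro h
        exact hx (by simpa using H.mul_mem h.1 hy)
    rw [Finset.sum_congr rfl fun x _ => this x,
      Fintype.sum_equiv (Equiv.mulRight y⁻¹) (fun x => if x * y⁻¹ ∈ stab H θ then (1 : ℂ) else 0)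
        (fun x => if x ∈ stab H θ then 1 else 0) (fun x => rfl), sum_ite_mem (stab H θ) fun _ => 1]
    simp
    ring
  · push Not at h
    have h0 : ip N χ η = 0 := by
      by_contra hne
      obtain ⟨y, hy, hy'⟩ := exists_cj_of_ip_ne_zero hN hχ hθ hη h1 hne
      exact h y hy hy'
    rw [h0, mul_zero, Finset.sum_eq_zero, mul_zero]
    intro x _
    split_ifs with hx
    · exact (hθ.cj_nrm hN hx).ip_of_ne hη (h x hx).symm
    · simp

theorem res_of_invariant (hN : Nrm N H) (hχ : Irr H χ) (hθ : Irr N θ) (h1 : ip N χ θ ≠ 0)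
    (hinv : ∀ x ∈ H, cj x θ = θ) : res N χ = ip N χ θ • θ := by
  have h := clifford_res hN hχ hθ h1
  have hst : stab H θ = H := le_antisymm stab_le fun x hx => ⟨hx, hinv x hx⟩
  have hS : (∑ x : G, if x ∈ H then cj x θ else 0) = (Nat.card H : ℂ) • θ := by
    rw [Finset.sum_congr rfl fun x _ => show _ = (if x ∈ H then θ else 0) by
      split_ifs with hx
      · exact hinv x hx
      · rfl]
    ext g
    simp only [Finset.sum_apply, ite_apply, Pi.zero_apply, Pi.smul_apply, smul_eq_mul]
    rw [sum_ite_mem H fun _ => θ g]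
    simp
  rw [hst, hS, smul_comm] at h
  exact smul_right_injective _ (card_ne_zero' H) h

theorem clifford_corr (hN : Nrm N H) (hχ : Irr H χ) (hθ : Irr N θ) (hψ : Irr (stab H θ) ψ)
    (h1 : ip N ψ θ ≠ 0) (h2 : ip (stab H θ) χ ψ ≠ 0) :
    ind (stab H θ) H ψ = χ ∧ ip N ψ θ = ip N χ θ := by
  set T := stab H θ with hT
  have hTH : T ≤ H := stab_le
  have hNT : N ≤ T := le_stab hN hθ.1
  have hNT' : Nrm N T := hN.mono hTH hNT
  have h3 : ip N χ θ ≠ 0 := by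
    have := (hχ.1.res hTH).over_trans hNT hψ hθ.1 (by rwa [ip_res_left]) h1
    rw [← ip_res_left, res_res hNT, ip_res_left] at this
    exact this
  have hind : ip H (ind T H ψ) χ ≠ 0 := by
    rw [hψ.1.frob hTH hχ.1, ip_comm]; exact h2
  obtain ⟨f, hf, hfe⟩ := (hψ.1.ind hTH).exists_add hχ hind
  obtain ⟨e, he⟩ := hψ.1.ip_nat_res hNT hθ.1
  obtain ⟨e', he'⟩ := hχ.1.ip_nat_res hN.le hθ.1
  have hee : e ≤ e' := by
    obtain ⟨r, hr, hre⟩ := (hχ.1.res hTH).exists_add hψ (by rwa [ip_res_left])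
    obtain ⟨c, hc⟩ := hr.ip_nat_res hNT hθ.1
    have : ip N χ θ = ip N ψ θ + ip N r θ := by
      rw [← ip_add_left, ← hre]
      exact ip_congr_left (fun g hg => (res_of_mem (hNT hg)).symm) θ
    rw [he, he', hc] at this
    norm_cast at this
    omega
  have hd1 := congrFun (clifford_res hN hχ hθ h3) 1
  have hd2 := congrFun (res_of_invariant hNT' hψ hθ h1 fun x hx => hx.2) 1
  have hd3 := congrFun hfe 1
  have hsum : (∑ x : G, if x ∈ H then cj x θ else 0) 1 = (Nat.card H : ℂ) * θ 1 := by
    simp only [Finset.sum_apply, ite_apply, Pi.zero_apply]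
    rw [Finset.sum_congr rfl fun x _ => show _ = (if x ∈ H then θ 1 else 0) by simp [cj],
      sum_ite_mem H fun _ => θ 1]
    simp
  simp only [Pi.smul_apply, smul_eq_mul, hsum, res_of_mem N.one_mem, he', he] at hd1 hd2
  rw [ind_one, hd2] at hd3
  have hTc := card_ne_zero' T
  obtain ⟨d, hd, hd0⟩ := hf.deg
  rw [Pi.add_apply, hd] at hd3
  have hkey : (Nat.card H : ℂ) * e * dg θ = Nat.card H * e' * dg θ + Nat.card T * d := by
    rw [hθ.1.cast_dg, show (Nat.card H : ℂ) * e' * θ 1 = e' * (Nat.card H * θ 1) by ring, ← hd1,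
      ← mul_add, ← hd3, ← hT]
    field_simp
  norm_cast at hkey
  have hHpos : 0 < Nat.card H := Nat.card_pos
  have hTpos : 0 < Nat.card T := Nat.card_pos
  have hθpos := hθ.dg_pos
  have hmul : Nat.card H * e * dg θ ≤ Nat.card H * e' * dg θ := by gcongr
  have hd00 : d = 0 := by
    by_contra hne
    have := Nat.mul_pos hTpos (Nat.pos_of_ne_zero hne)
    omega
  have hee' : e = e' := by
    rw [hd00, mul_zero, add_zero] at hkey
    exact Nat.eq_of_mul_eq_mul_left hHpos (Nat.eq_of_mul_eq_mul_right hθpos hkey)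
  exact ⟨by rw [hfe, hd0 hd00, add_zero], by rw [he, he', hee']⟩

theorem clifford_exists (hN : Nrm N H) (hχ : Irr H χ) (hθ : Irr N θ) (h1 : ip N χ θ ≠ 0) :
    ∃ ψ, Irr (stab H θ) ψ ∧ ip N ψ θ ≠ 0 ∧ ip (stab H θ) χ ψ ≠ 0 ∧ ind (stab H θ) H ψ = χ ∧
      ip N ψ θ = ip N χ θ := by
  have hTH : stab H θ ≤ H := stab_le
  have hNT := le_stab hN hθ.1
  have h2 : ip N (res (stab H θ) χ) θ ≠ 0 := by
    rw [ip_congr_left (fun g hg => res_of_mem (hNT hg)) θ]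
    exact h1
  obtain ⟨ψ, hψ, h3, h4⟩ := (hχ.1.res hTH).exists_over h2
  rw [ip_res_left] at h3
  exact ⟨ψ, hψ, h4, h3, clifford_corr hN hχ hθ hψ h4 h3⟩

theorem clifford_unique (hN : Nrm N H) (hχ : Irr H χ) (hθ : Irr N θ) {ψ' : G → ℂ}
    (hψ : Irr (stab H θ) ψ) (hψ' : Irr (stab H θ) ψ')
    (h1 : ip N ψ θ ≠ 0) (h2 : ip (stab H θ) χ ψ ≠ 0)
    (h1' : ip N ψ' θ ≠ 0) (h2' : ip (stab H θ) χ ψ' ≠ 0) : ψ = ψ' := by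
  have hTH : stab H θ ≤ H := stab_le
  have hNT := le_stab hN hθ.1
  by_contra hne
  obtain ⟨r, hr, hre⟩ := (hχ.1.res hTH).exists_add hψ (by rwa [ip_res_left])
  have h3 : ip (stab H θ) r ψ' ≠ 0 := by
    rw [← ip_res_left, hre, ip_add_left, hψ.ip_of_ne hψ' hne, zero_add] at h2'
    exact h2'
  have h4 := hr.over_trans hNT hψ' hθ.1 h3 h1'
  have h5 : ip N χ θ = ip N ψ θ + ip N r θ := by
    rw [← ip_add_left, ← hre]
    exact ip_congr_left (fun g hg => (res_of_mem (hNT hg)).symm) θ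
  rw [← (clifford_corr hN hχ hθ hψ h1 h2).2] at h5
  exact h4 (by linear_combination -h5)

theorem clifford_ind_irr (hN : Nrm N H) (hθ : Irr N θ) (hψ : Irr (stab H θ) ψ)
    (h1 : ip N ψ θ ≠ 0) : Irr H (ind (stab H θ) H ψ) := by
  have hTH : stab H θ ≤ H := stab_le
  have h0 : ind (stab H θ) H ψ ≠ 0 := fun h => by
    have := congrFun h 1
    rw [ind_one] at this
    simp [hψ.apply_one_ne_zero] at this
  obtain ⟨χ, hχ, h2⟩ := (hψ.1.ind hTH).exists_constituent h0
  rw [hψ.1.frob hTH hχ.1, ip_comm] at h2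
  rw [(clifford_corr hN hχ hθ hψ h1 h2).1]
  exact hχ

theorem ind_ne_zero (hψ : Irr K ψ) : ind K H ψ ≠ 0 := fun h => by
  have := congrFun h 1
  rw [ind_one] at this
  simp [hψ.apply_one_ne_zero] at this

end

section

variable {G : Type} [Group G] [Fintype G] {H K N L T U : Subgroup G} {f k θ χ ψ : G → ℂ}

/-! ### Averaging over a normal subgroup -/

/-- The average of `f` over the cosets of `N`. -/
def avg (N : Subgroup G) (f : G → ℂ) (g : G) : ℂ :=
  (Nat.card N : ℂ)⁻¹ * ∑ n : N, f (g * n)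

/-- `f` is invariant under translation by `N`. -/
def Trv (N : Subgroup G) (f : G → ℂ) : Prop := ∀ n ∈ N, ∀ g, f (g * n) = f g

theorem Trv.apply_mem (h : Trv N f) {n : G} (hn : n ∈ N) : f n = f 1 := by
  simpa using h n hn 1

theorem avg_trv (N : Subgroup G) (f : G → ℂ) : Trv N (avg N f) := fun n hn g => by
  simp only [avg]
  congr 1
  exact Fintype.sum_equiv (Equiv.mulLeft ⟨n, hn⟩) _ _ fun m => by simp [mul_assoc]

theorem avg_of_trv (h : Trv N f) : avg N f = f := by
  ext g
  have := card_ne_zero' N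
  rw [avg, Finset.sum_congr rfl fun (n : N) _ => h n n.2 g]
  simp

theorem avg_one (N : Subgroup G) (f : G → ℂ) : avg N f 1 = ip N f (tr N) := by
  rw [avg, ip_eq]
  congr 1
  refine Finset.sum_congr rfl fun x _ => ?_
  rw [tr_of_mem (SetLike.coe_mem _), one_mul, mul_one]

theorem Chr.avg (hf : Chr H f) (hN : Nrm N H) : Chr H (avg N f) ∧ Chr H (f - SubChar.avg N f) := by
  obtain ⟨n, M, hM0, hM, hM1, hMf⟩ := hf.exists_matrix
  have hNc := card_ne_zero' N
  set P : Matrix (Fin n) (Fin n) ℂ := (Nat.card N : ℂ)⁻¹ • ∑ x : N, M x with hP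
  have hPx : ∀ x ∈ N, P * M x = P := fun x hx => by
    rw [hP, Matrix.smul_mul, Finset.sum_mul]
    congr 1
    refine Fintype.sum_equiv (Equiv.mulRight ⟨x, hx⟩) _ _ fun m => ?_
    rw [← hM _ (hN.le m.2) _ (hN.le hx)]
    rfl
  have hPP : P * P = P := by
    conv_lhs => rw [hP, Matrix.mul_smul, Finset.mul_sum,
      Finset.sum_congr rfl fun x _ => hPx x.1 x.2]
    simp [← Nat.cast_smul_eq_nsmul ℂ, smul_smul]
  have hPM : ∀ g ∈ H, P * M g = M g * P := fun g hg => by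
    rw [hP, Matrix.smul_mul, Matrix.mul_smul, Finset.sum_mul, Finset.mul_sum]
    congr 1
    symm
    refine Fintype.sum_equiv
      ((MulAut.conj g).toEquiv.subtypeEquiv fun n => hN.mem_iff hg n) _ _ fun m => ?_
    rw [← hM _ hg _ (hN.le m.2)]
    simp only [Equiv.subtypeEquiv_apply, MulEquiv.toEquiv_eq_coe, EquivLike.coe_coe,
      MulAut.conj_apply]
    rw [← hM _ (H.mul_mem (H.mul_mem hg (hN.le m.2)) (H.inv_mem hg)) _ hg]
    simp
  have htr : ∀ g ∈ H, SubChar.avg N f g = (M g * P).trace := fun g hg => by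
    rw [SubChar.avg, hP, Matrix.mul_smul, Matrix.trace_smul, smul_eq_mul]
    congr 1
    rw [Finset.mul_sum, Matrix.trace_sum]
    refine Finset.sum_congr rfl fun x _ => ?_
    rw [← hM _ hg _ (hN.le x.2), hMf]
  have h0 : ∀ g ∉ H, SubChar.avg N f g = 0 := fun g hg => by
    rw [SubChar.avg, Finset.sum_eq_zero, mul_zero]
    intro x _
    exact hf.supp (by rwa [H.mul_mem_cancel_right (hN.le x.2)])
  constructor
  · refine Chr.of_matrix (fun g => M g * P) (fun g hg h hh => ?_) htr h0
    rw [hM g hg h hh, ← mul_assoc, mul_assoc (M g) P, hPM h hh, mul_assoc (M g) (M h * P) P,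
      mul_assoc (M h) P P, hPP, mul_assoc]
  · refine Chr.of_matrix (fun g => M g * (1 - P)) (fun g hg h hh => ?_) (fun g hg => ?_)
      fun g hg => by simp [hf.supp hg, h0 g hg]
    · have e : (1 - P) * M h = M h * (1 - P) := by
        rw [sub_mul, mul_sub, hPM h hh, one_mul, mul_one]
      have e2 : (1 - P) * (1 - P) = 1 - P := by
        rw [mul_sub, sub_mul, sub_mul, hPP]; simp
      rw [hM g hg h hh, ← mul_assoc, mul_assoc (M g) (1 - P), e, mul_assoc (M g) (M h * (1 - P)),
        mul_assoc (M h) (1 - P) (1 - P), e2, mul_assoc]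
    · rw [Pi.sub_apply, htr g hg, mul_sub, mul_one, Matrix.trace_sub, hMf]

theorem Irr.trv_of_ip (hf : Irr H f) (hN : Nrm N H) (h : ip N f (tr N) ≠ 0) : Trv N f := by
  obtain ⟨h1, h2⟩ := hf.1.avg hN
  rcases hf.indecomposable h1 h2 (by simp) with h0 | h0
  · rw [← avg_one, h0] at h
    exact absurd rfl h
  · rw [sub_eq_zero.mp h0]
    exact avg_trv N f

theorem Trv.res_eq (h : Trv N f) : res N f = f 1 • tr N := by
  ext g
  by_cases hg : g ∈ N
  · simp [tr_of_mem hg, res_of_mem hg, h.apply_mem hg]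
  · simp [tr, res_of_notMem hg]

theorem Trv.ip_tr (h : Trv N f) : ip N f (tr N) = f 1 := by
  rw [← ip_res_left, h.res_eq, ip_smul_left, (tr_lin N).irr.2, mul_one]

theorem Chr.trv_of_res (hf : Chr H f) (hN : Nrm N H) (h : ∀ n ∈ N, f n = f 1) : Trv N f := by
  have h1 : ip N f (tr N) = f 1 := by
    rw [ip_congr_left (f' := f 1 • tr N) (fun g hg => by simp [tr_of_mem hg, h g hg]),
      ip_smul_left, (tr_lin N).irr.2, mul_one]
  have h2 := (hf.avg hN).2
  have : f - SubChar.avg N f = 0 := by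
    rw [← h2.dg_eq_zero]
    exact dg_eq (by simp [avg_one, h1])
  rw [sub_eq_zero.mp this]
  exact avg_trv N f

theorem Chr.trv_conj (hf : Chr H f) (h : Trv N f) (hN : Nrm N H) {n g : G} (hn : n ∈ N) :
    f (n * g) = f g := by
  by_cases hg : g ∈ H
  · have : n * g = g * (g⁻¹ * n * g) := by group
    rw [this, h _ ((hN.mem_iff' hg n).mp hn)]
  · rw [hf.supp hg, hf.supp]
    rwa [H.mul_mem_cancel_left (hN.le hn)]

/-! ### Gallagher's theorem -/

theorem ind_tr_apply (hN : Nrm N H) (g : G) :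
    ind N H (tr N) g = if g ∈ N then (Nat.card H : ℂ) / Nat.card N else 0 := by
  rw [ind]
  have : ∀ x : G, (if x ∈ H then tr N (x * g * x⁻¹) else 0) =
      if x ∈ H then (if g ∈ N then 1 else 0) else 0 := fun x => by
    by_cases hx : x ∈ H
    · by_cases hg : g ∈ N
      · simp only [if_pos hx, if_pos hg]
        exact tr_of_mem ((hN.mem_iff hx g).mp hg)
      · simp only [if_pos hx, if_neg hg]
        exact res_of_notMem fun h => hg ((hN.mem_iff hx g).mpr h)
    · simp only [if_neg hx]
  rw [Finset.sum_congr rfl fun x _ => this x, sum_ite_mem H fun _ => if g ∈ N then 1 else 0]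
  by_cases hg : g ∈ N
  · simp [hg]; ring
  · simp [hg]

theorem ip_ind_tr (hN : Nrm N H) (hk : Chr H k) : ip H (ind N H (tr N)) k = ip N (tr N) k :=
  (tr_lin N).chr.frob hN.le hk

theorem trv_of_mem_ind_tr (hN : Nrm N H) (hf : Irr H f) (h : ip H (ind N H (tr N)) f ≠ 0) :
    Trv N f := by
  rw [ip_ind_tr hN hf.1, ip_comm] at h
  exact hf.trv_of_ip hN h

theorem gallagher_aux (hN : Nrm N H) {b : G → ℂ} (hb : Irr H b) (hbN : Irr N (res N b)) :
    ∀ ρ, Irr H ρ → Trv N ρ → Irr H (b * ρ) := by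
  set R := ind N H (tr N) with hR
  have hRc : Chr H R := (tr_lin N).chr.ind hN.le
  set S := (irr H).filter fun ρ => mult H R ρ ≠ 0 with hS
  have hRe : R = ∑ ρ ∈ S, (mult H R ρ : ℂ) • ρ := by
    conv_lhs => rw [hRc.decomp_mult]
    rw [hS, Finset.sum_filter]
    refine Finset.sum_congr rfl fun ρ _ => ?_
    split_ifs with h
    · rfl
    · push Not at h
      simp [h]
  have hbR : b * R = ind N H (res N b) := by
    rw [hR, mul_comm, ← ind_mul_res (fun g hg => (tr_lin N).supp g hg)
      fun x hx g => hb.1.cls hx g, tr_mul_of_supp fun g hg => res_of_notMem hg]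
  have hsum : b * R = ∑ ρ ∈ S, (mult H R ρ : ℂ) • (b * ρ) := by
    conv_lhs => rw [hRe, Finset.mul_sum]
    simp only [mul_smul_comm]
  have hnorm : ip H (b * R) (b * R) = ∑ ρ ∈ S, (mult H R ρ : ℂ) ^ 2 := by
    have e1 : ip H (b * R) (b * R) = (Nat.card H : ℂ) / Nat.card N := by
      conv_lhs => rw [hbR]
      rw [hbN.1.frob hN.le (hbN.1.ind hN.le), ← hbR]
      have : ip N (res N b) (b * R) =
          ip N (res N b) (((Nat.card H : ℂ) / Nat.card N) • res N b) :=
        ip_congr_right (fun g hg => by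
          simp only [Pi.mul_apply, hR, ind_tr_apply hN, if_pos hg, Pi.smul_apply, smul_eq_mul,
            res_of_mem hg]
          ring) _
      rw [this, ip_smul_right, hbN.2, mul_one]
    have e2 : ip H R R = (Nat.card H : ℂ) / Nat.card N := by
      have e3 : ip H R R = ip N (tr N) R := ip_ind_tr hN hRc
      rw [e3, ip_comm, ← avg_one, avg, Finset.sum_congr rfl fun (n : N) _ => show
        R (1 * n) = (Nat.card H : ℂ) / Nat.card N by
          rw [one_mul, hR, ind_tr_apply hN, if_pos n.2]]
      have := card_ne_zero' N
      simp
    rw [e1, ← e2, hRc.ip_eq_sum R, hS, Finset.sum_filter]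
    refine Finset.sum_congr rfl fun ρ hρ => ?_
    rw [← hRc.cast_mult (mem_irr.mp hρ).1]
    split_ifs with h
    · ring
    · push Not at h
      simp [h]
  rw [hsum] at hnorm
  have key := irr_of_norm S (fun ρ => mult H R ρ) (fun ρ => b * ρ)
    (fun ρ hρ => Nat.pos_of_ne_zero (Finset.mem_filter.mp hρ).2)
    (fun ρ hρ => hb.1.mul (mem_irr.mp (Finset.mem_filter.mp hρ).1).1)
    (fun ρ hρ h0 => by
      have := congrFun h0 1
      simp [hb.apply_one_ne_zero,
        (mem_irr.mp (Finset.mem_filter.mp hρ).1).apply_one_ne_zero] at this) hnorm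
  intro ρ hρ hρN
  refine key.1 ρ (Finset.mem_filter.mpr ⟨mem_irr.mpr hρ, fun h => ?_⟩)
  have h1 := hRc.cast_mult hρ.1
  rw [h, ip_ind_tr hN hρ.1, ip_comm, hρN.ip_tr] at h1
  exact hρ.apply_one_ne_zero (by rw [← h1, Nat.cast_zero])

theorem gallagher (hN : Nrm N H) {b : G → ℂ} (hb : Irr H b) (hbN : Irr N (res N b)) {ξ : G → ℂ}
    (hξ : Irr H ξ) (h : ip N ξ (res N b) ≠ 0) : ∃ ρ, Irr H ρ ∧ Trv N ρ ∧ ξ = b * ρ := by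
  set R := ind N H (tr N) with hR
  have hRc : Chr H R := (tr_lin N).chr.ind hN.le
  have hbR : b * R = ind N H (res N b) := by
    rw [hR, mul_comm, ← ind_mul_res (fun g hg => (tr_lin N).supp g hg)
      fun x hx g => hb.1.cls hx g, tr_mul_of_supp fun g hg => res_of_notMem hg]
  have h1 : ip H (b * R) ξ ≠ 0 := by
    rw [hbR, hbN.1.frob hN.le hξ.1, ip_comm]; exact h
  rw [hRc.decomp, Finset.mul_sum, ip_sum_left] at h1
  obtain ⟨ρ, hρ, hne⟩ := Finset.exists_ne_zero_of_sum_ne_zero h1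
  rw [mul_smul_comm, ip_smul_left] at hne
  have hρ' := mem_irr.mp hρ
  have htr := trv_of_mem_ind_tr hN hρ' (left_ne_zero_of_mul hne)
  have hirr := gallagher_aux hN hb hbN ρ hρ' htr
  refine ⟨ρ, hρ', htr, ?_⟩
  by_contra hcon
  exact right_ne_zero_of_mul hne (hirr.ip_of_ne hξ (Ne.symm hcon))

theorem gallagher_chr (hN : Nrm N H) {b Ψ : G → ℂ} (hb : Irr H b) (hbN : Irr N (res N b))
    (hΨ : Chr H Ψ) (h : ∀ ξ, Irr H ξ → ip H Ψ ξ ≠ 0 → ip N ξ (res N b) ≠ 0) :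
    ∃ ρ, Chr H ρ ∧ Trv N ρ ∧ Ψ = b * ρ := by
  have h1 : ∀ ξ : G → ℂ, ∃ ρ, Chr H ρ ∧ Trv N ρ ∧
      (Irr H ξ → ip H Ψ ξ ≠ 0 → ξ = b * ρ) := fun ξ => by
    by_cases hξ : Irr H ξ ∧ ip H Ψ ξ ≠ 0
    · obtain ⟨ρ, hρ, h2, h3⟩ := gallagher hN hb hbN hξ.1 (h ξ hξ.1 hξ.2)
      exact ⟨ρ, hρ.1, h2, fun _ _ => h3⟩
    · exact ⟨0, Chr.zero H, fun _ _ _ => rfl, fun a b => absurd ⟨a, b⟩ hξ⟩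
  choose ρ h2 h3 h4 using h1
  refine ⟨∑ ξ ∈ irr H, (mult H Ψ ξ : ℂ) • ρ ξ, Chr.sum fun ξ _ => (h2 ξ).nsmul _,
    fun n hn g => ?_, ?_⟩
  · simp only [Finset.sum_apply, Pi.smul_apply, h3 _ n hn g]
  · conv_lhs => rw [hΨ.decomp_mult]
    rw [Finset.mul_sum]
    refine Finset.sum_congr rfl fun ξ hξ => ?_
    by_cases h5 : ip H Ψ ξ = 0
    · have := hΨ.cast_mult (mem_irr.mp hξ).1
      rw [h5] at this
      simp [this]
    · rw [mul_smul_comm, ← h4 ξ (mem_irr.mp hξ) h5]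

/-! ### Restriction of induced characters to a supplement -/

theorem sum_supplement (hL : L ≤ H) (hU : U ≤ H) (hLU : ∀ x ∈ H, ∃ l ∈ L, ∃ u ∈ U, x = l * u)
    (F : G → ℂ) (hF : ∀ l ∈ L, ∀ x, F (l * x) = F x) :
    (Nat.card L : ℂ)⁻¹ * ∑ x : H, F x = (Nat.card (U ⊓ L : Subgroup G) : ℂ)⁻¹ * ∑ u : U, F u := by
  have hLc := card_ne_zero' L
  have hDc := card_ne_zero' (U ⊓ L)
  have h1 : ∑ x : H, ∑ u : U, (if (x * (u : G)⁻¹ : G) ∈ L then F x else 0) =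
      (Nat.card L : ℂ) * ∑ u : U, F u := by
    rw [Finset.sum_comm, Finset.mul_sum]
    refine Finset.sum_congr rfl fun u _ => ?_
    rw [← sum_ite_mem H fun x => if (x * (u : G)⁻¹ : G) ∈ L then F x else 0,
      Fintype.sum_equiv (Equiv.mulRight (u : G)⁻¹) _ (fun x => if x ∈ L then F u else 0)]
    · rw [sum_ite_mem L fun _ => F u]; simp
    · intro x
      by_cases h : (x * (u : G)⁻¹ : G) ∈ L
      · have hx : x ∈ H := by simpa using H.mul_mem (hL h) (hU u.2)
        have : F x = F u := by rw [← hF _ h u]; simp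
        simp [h, hx, this]
      · simp [h]
  have h2 : ∑ x : H, ∑ u : U, (if (x * (u : G)⁻¹ : G) ∈ L then F x else 0) =
      (Nat.card (U ⊓ L : Subgroup G) : ℂ) * ∑ x : H, F x := by
    rw [Finset.mul_sum]
    refine Finset.sum_congr rfl fun x _ => ?_
    obtain ⟨l, hl, u₀, hu₀, hx⟩ := hLU x x.2
    rw [← sum_ite_mem U fun u => if (x * (u : G)⁻¹ : G) ∈ L then F x else 0,
      Fintype.sum_equiv (Equiv.mulRight u₀⁻¹) _ (fun d => if d ∈ U ⊓ L then F x else 0)]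
    · rw [sum_ite_mem (U ⊓ L) fun _ => F x]; simp
    · intro u
      have e : ((x * (u : G)⁻¹ : G) ∈ L) ↔ u * u₀⁻¹ ∈ L := by
        rw [hx, mul_assoc, L.mul_mem_cancel_left hl, ← L.inv_mem_iff]; simp
      have e' : u * u₀⁻¹ ∈ U ↔ u ∈ U := U.mul_mem_cancel_right (U.inv_mem hu₀)
      simp only [Equiv.coe_mulRight, Subgroup.mem_inf, e, e']
      by_cases h : u ∈ U <;> by_cases h' : u * u₀⁻¹ ∈ L <;> simp [h, h']
  rw [h1] at h2
  field_simp
  linear_combination -h2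

theorem res_ind_supplement (hL : L ≤ H) (hU : U ≤ H)
    (hLU : ∀ x ∈ H, ∃ l ∈ L, ∃ u ∈ U, x = l * u) {ω : G → ℂ} (hω : Chr L ω) :
    res U (ind L H ω) = ind (U ⊓ L) U (res (U ⊓ L) ω) := by
  ext g
  by_cases hg : g ∈ U
  · rw [res_of_mem hg, ind, ind, sum_ite_mem H fun x => ω (x * g * x⁻¹),
      sum_ite_mem U fun x => res (U ⊓ L) ω (x * g * x⁻¹),
      sum_supplement hL hU hLU (fun x => ω (x * g * x⁻¹)) fun l hl x => ?_]
    · congr 1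
      refine Finset.sum_congr rfl fun u _ => ?_
      have hu : (u : G) * g * (u : G)⁻¹ ∈ U := U.mul_mem (U.mul_mem u.2 hg) (U.inv_mem u.2)
      by_cases h : (u : G) * g * (u : G)⁻¹ ∈ L
      · rw [res_of_mem (show _ ∈ U ⊓ L from ⟨hu, h⟩)]
      · rw [res_of_notMem fun h' : _ ∈ U ⊓ L => h h'.2, hω.supp h]
    · have e : l * x * g * (l * x)⁻¹ = l * (x * g * x⁻¹) * l⁻¹ := by group
      rw [e, hω.cls hl]
  · rw [res_of_notMem hg, ind_congr_support inf_le_left (fun g hg => res_of_notMem hg) g hg]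

theorem card_supplement (hL : L ≤ H) (hU : U ≤ H)
    (hLU : ∀ x ∈ H, ∃ l ∈ L, ∃ u ∈ U, x = l * u) :
    Nat.card H * Nat.card (U ⊓ L : Subgroup G) = Nat.card U * Nat.card L := by
  have h := sum_supplement hL hU hLU 1 fun _ _ _ => rfl
  have hLc := card_ne_zero' L
  have hDc := card_ne_zero' (U ⊓ L)
  simp only [Pi.one_apply, Finset.sum_const, Finset.card_univ, Fintype.card_eq_nat_card,
    nsmul_eq_mul, mul_one] at h
  field_simp at h
  have : ((Nat.card H * Nat.card (U ⊓ L : Subgroup G) : ℕ) : ℂ) =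
    (Nat.card U * Nat.card L : ℕ) := by
    push_cast; linear_combination h
  exact_mod_cast this

theorem ip_ind_invariant (hL : Nrm L H) {ω : G → ℂ} (hω : Irr L ω) (hinv : ∀ x ∈ H, cj x ω = ω) :
    ip H (ind L H ω) (ind L H ω) = (Nat.card H : ℂ) / Nat.card L := by
  rw [hω.1.frob hL.le (hω.1.ind hL.le)]
  have : ∀ g, ind L H ω g = (((Nat.card H : ℂ) / Nat.card L) • ω) g := fun g => by
    rw [ind_nrm_apply, Finset.sum_congr rfl fun x _ => show _ = (if x ∈ H then ω else 0) by
      split_ifs with hx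
      · exact hinv x hx
      · rfl]
    simp only [Finset.sum_apply, ite_apply, Pi.zero_apply, Pi.smul_apply, smul_eq_mul]
    rw [sum_ite_mem H fun _ => ω g]
    simp
    ring
  rw [ip_congr_right (fun g _ => this g), ip_smul_right, hω.2, mul_one]

/-- If restriction to `U` preserves the norm of `Ψ`, then it is irreducible and injective on the
constituents of `Ψ`. -/
theorem res_constituents_of_norm {Ψ : G → ℂ} (hΨ : Chr H Ψ) (hU : U ≤ H)
    (hn : ip U (res U Ψ) (res U Ψ) = ip H Ψ Ψ) :
    (∀ ρ, Irr H ρ → ip H Ψ ρ ≠ 0 → Irr U (res U ρ)) ∧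
      ∀ ρ ρ', Irr H ρ → Irr H ρ' → ip H Ψ ρ ≠ 0 → ip H Ψ ρ' ≠ 0 → res U ρ = res U ρ' → ρ = ρ' := by
  set S := (irr H).filter fun ρ => mult H Ψ ρ ≠ 0 with hS
  have hRe : Ψ = ∑ ρ ∈ S, (mult H Ψ ρ : ℂ) • ρ := by
    conv_lhs => rw [hΨ.decomp_mult]
    rw [hS, Finset.sum_filter]
    refine Finset.sum_congr rfl fun ρ _ => ?_
    split_ifs with h
    · rfl
    · push Not at h
      simp [h]
  have hsum : res U Ψ = ∑ ρ ∈ S, (mult H Ψ ρ : ℂ) • res U ρ := by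
    conv_lhs => rw [hRe, res_sum]
    simp only [res_smul]
  have hnorm : ip U (res U Ψ) (res U Ψ) = ∑ ρ ∈ S, (mult H Ψ ρ : ℂ) ^ 2 := by
    rw [hn, hΨ.ip_eq_sum Ψ, hS, Finset.sum_filter]
    refine Finset.sum_congr rfl fun ρ hρ => ?_
    rw [← hΨ.cast_mult (mem_irr.mp hρ).1]
    split_ifs with h
    · ring
    · push Not at h
      simp [h]
  rw [hsum] at hnorm
  have hSi : ∀ ρ ∈ S, Irr H ρ := fun ρ hρ => mem_irr.mp (Finset.mem_filter.mp hρ).1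
  have hmem : ∀ ρ, Irr H ρ → ip H Ψ ρ ≠ 0 → ρ ∈ S := fun ρ hρ hne =>
    Finset.mem_filter.2 ⟨mem_irr.2 hρ, by rw [← hΨ.cast_mult hρ.1] at hne; exact_mod_cast hne⟩
  have key := irr_of_norm S (fun ρ => mult H Ψ ρ) (fun ρ => res U ρ)
    (fun ρ hρ => Nat.pos_of_ne_zero (Finset.mem_filter.mp hρ).2)
    (fun ρ hρ => (hSi ρ hρ).1.res hU)
    (fun ρ hρ => (hSi ρ hρ).1.res_ne_zero (hSi ρ hρ).ne_zero) hnorm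
  exact ⟨fun ρ hρ hne => key.1 ρ (hmem ρ hρ hne),
    fun ρ ρ' hρ hρ' hne hne' he => key.2 (hmem ρ hρ hne) (hmem ρ' hρ' hne') he⟩

/-- Restriction is a bijection over an invariant character which remains irreducible on the
intersection with a supplement. -/
theorem exists_extension_supplement (hL : Nrm L H) (hU : U ≤ H)
    (hLU : ∀ x ∈ H, ∃ l ∈ L, ∃ u ∈ U, x = l * u) {ω α : G → ℂ} (hω : Irr L ω)
    (hinv : ∀ x ∈ H, cj x ω = ω) (hD : Irr (U ⊓ L) (res (U ⊓ L) ω)) (hα : Irr U α)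
    (hαω : ip (U ⊓ L) α (res (U ⊓ L) ω) ≠ 0) :
    ∃ ξ, Irr H ξ ∧ ip L ξ ω ≠ 0 ∧ res U ξ = α := by
  set D := U ⊓ L with hDdef
  have hDU : Nrm D U := hL.inf hU
  set Ψ := ind L H ω with hΨ
  have hΨc : Chr H Ψ := hω.1.ind hL.le
  have hmack : res U Ψ = ind D U (res D ω) := res_ind_supplement hL.le hU hLU hω.1
  have hinvD : ∀ x ∈ U, cj x (res D ω) = res D ω := fun x hx => by
    ext g
    by_cases hg : g ∈ D
    · rw [cj, res_of_mem hg, res_of_mem ((hDU.mem_iff hx g).mp hg)]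
      exact congrFun (hinv x (hU hx)) g
    · rw [cj, res_of_notMem hg, res_of_notMem fun h => hg ((hDU.mem_iff hx g).mpr h)]
  have e1 : ip U (res U Ψ) (res U Ψ) = ip H Ψ Ψ := by
    rw [hmack, ip_ind_invariant hDU hD hinvD, hΨ, ip_ind_invariant hL hω hinv]
    have := card_supplement hL.le hU hLU
    have hLc := card_ne_zero' L
    have hDc := card_ne_zero' D
    field_simp
    rw [mul_comm (Nat.card D : ℂ)]
    exact_mod_cast this.symm
  have key := (res_constituents_of_norm hΨc hU e1).1
  have h1 : ip U (res U Ψ) α ≠ 0 := by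
    rw [hmack, hD.1.frob hDU.le hα.1, ip_comm]; exact hαω
  obtain ⟨ξ, hξ, hne, hne'⟩ := hΨc.exists_over (K := U) (θ := α) (by rwa [← ip_res_left])
  refine ⟨ξ, hξ, ?_, ?_⟩
  · rwa [hΨ, hω.1.frob hL.le hξ.1, ip_comm] at hne
  · by_contra hcon
    exact hne' (by rw [← ip_res_left]; exact (key ξ hξ hne).ip_of_ne hα hcon)

end

section

open Module in
/-- Power traces and determinant of an endomorphism of finite order. -/
theorem exists_eigenvalues {V : Type} [AddCommGroup V] [Module ℂ V] [FiniteDimensional ℂ V]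
    (A : End ℂ V) {N : ℕ} (hN : N ≠ 0) (hA : A ^ N = 1) :
    ∃ s : Multiset ℂ, (∀ x ∈ s, x ^ N = 1) ∧ LinearMap.det A = s.prod ∧
      ∀ k : ℕ, LinearMap.trace ℂ V (A ^ k) = (s.map (· ^ k)).sum := by
  have hss : A.IsSemisimple := by
    refine End.isSemisimple_of_squarefree_aeval_eq_zero (p := Polynomial.X ^ N - 1) ?_ (by simp [hA])
    have := (Polynomial.separable_X_pow_sub_C (1 : ℂ) (by exact_mod_cast hN) one_ne_zero)
    rw [map_one] at this
    exact this.squarefree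
  have htop : (⊤ : Submodule ℂ V) ≤ Submodule.span ℂ {v | ∃ μ : ℂ, A v = μ • v} := by
    rw [← End.iSup_maxGenEigenspace_eq_top A, iSup_le_iff]
    intro μ v hv
    rw [hss.isFinitelySemisimple.maxGenEigenspace_eq_eigenspace, End.mem_eigenspace_iff] at hv
    exact Submodule.subset_span ⟨μ, hv⟩
  let b := Basis.ofSpan htop
  have : Fintype ((linearIndepOn_empty ℂ id).extend (Set.empty_subset {v | ∃ μ : ℂ, A v = μ • v})) :=
    FiniteDimensional.fintypeBasisIndex b
  have hb : ∀ i, ∃ μ : ℂ, A (b i) = μ • b i := fun i => Basis.ofSpan_subset htop ⟨i, rfl⟩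
  choose μ hμ using hb
  have hk : ∀ k i, (A ^ k) (b i) = μ i ^ k • b i := fun k i => by
    induction k with
    | zero => simp
    | succ k ih => rw [pow_succ, End.mul_apply, hμ, map_smul, ih, smul_smul, pow_succ, mul_comm]
  have hM : ∀ k, LinearMap.toMatrix b b (A ^ k) = Matrix.diagonal fun i => μ i ^ k := fun k => by
    ext i j
    rw [LinearMap.toMatrix_apply, hk, Matrix.diagonal_apply, map_smul]
    by_cases h : i = j
    · subst h; simp
    · simp [h]
  refine ⟨Finset.univ.val.map μ, fun x hx => ?_, ?_, fun k => ?_⟩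
  · obtain ⟨i, -, rfl⟩ := Multiset.mem_map.mp hx
    have := hk N i
    rw [hA, End.one_apply] at this
    have h2 : (μ i ^ N - 1) • b i = 0 := by rw [sub_smul, ← this, one_smul, sub_self]
    exact sub_eq_zero.mp ((smul_eq_zero.mp h2).resolve_right (b.ne_zero i))
  · rw [← LinearMap.det_toMatrix b]
    have := hM 1
    rw [pow_one] at this
    rw [this, Matrix.det_diagonal]
    simp
  · rw [LinearMap.trace_eq_matrix_trace ℂ b, hM, Matrix.trace_diagonal, Multiset.map_map]
    rfl

theorem multiset_eq_of_pow_sum {s t : Multiset ℂ}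
    (h : ∀ k : ℕ, (s.map (· ^ k)).sum = (t.map (· ^ k)).sum) : s = t := by
  have hP : ∀ P : Polynomial ℂ, (s.map P.eval).sum = (t.map P.eval).sum := fun P => by
    induction P using Polynomial.induction_on' with
    | add p q hp hq => simp only [Polynomial.eval_add, Multiset.sum_map_add, hp, hq]
    | monomial n a => simp only [Polynomial.eval_monomial, Multiset.sum_map_mul_left, h n]
  have key : ∀ (a : ℂ) (F : Finset ℂ), ∀ u : Multiset ℂ, u.toFinset ⊆ F →
      (u.map (∏ y ∈ F.erase a, (Polynomial.X - Polynomial.C y)).eval).sum =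
        u.count a * ∏ y ∈ F.erase a, (a - y) := fun a F u hu => by
    rw [Finset.sum_multiset_map_count, Finset.sum_eq_single a]
    · simp [Polynomial.eval_prod]
    · intro b hb hba
      have : (∏ y ∈ F.erase a, (Polynomial.X - Polynomial.C y)).eval b = 0 := by
        rw [Polynomial.eval_prod]
        exact Finset.prod_eq_zero (Finset.mem_erase.mpr ⟨hba, hu hb⟩) (by simp)
      rw [this, smul_zero]
    · intro ha
      rw [Multiset.count_eq_zero.mpr fun h => ha (Multiset.mem_toFinset.mpr h), zero_smul]
  ext a
  have h1 := key a (s + t).toFinset s (by simp)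
  have h2 := key a (s + t).toFinset t (by simp)
  rw [hP, h2] at h1
  have h3 : ∏ y ∈ (s + t).toFinset.erase a, (a - y) ≠ 0 :=
    Finset.prod_ne_zero_iff.mpr fun y hy => sub_ne_zero.mpr (Ne.symm (Finset.mem_erase.mp hy).1)
  exact_mod_cast (mul_right_cancel₀ h3 h1).symm

variable {G : Type} [Group G] [Fintype G] {H K N L T U : Subgroup G} {f k θ χ ψ l : G → ℂ} {g : G}

/-! ### Eigenvalues and determinants -/

/-- The multiset of eigenvalues of `g` on a representation affording `f`. -/
def eig (f : G → ℂ) (g : G) : Multiset ℂ :=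
  if h : ∃ s : Multiset ℂ, ∀ k : ℕ, f (g ^ k) = (s.map (· ^ k)).sum then h.choose else 0

/-- The determinant of `g` on a representation affording `f`. -/
def dt (f : G → ℂ) (g : G) : ℂ := (eig f g).prod

theorem eig_eq {s : Multiset ℂ} (h : ∀ k : ℕ, f (g ^ k) = (s.map (· ^ k)).sum) : eig f g = s := by
  have h' : ∃ s : Multiset ℂ, ∀ k : ℕ, f (g ^ k) = (s.map (· ^ k)).sum := ⟨s, h⟩
  rw [eig, dif_pos h']
  exact multiset_eq_of_pow_sum fun k => by rw [← h, h'.choose_spec]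

theorem eig_congr {G' : Type} [Group G'] [Fintype G'] {f' : G' → ℂ} {g' : G'}
    (h : ∀ k : ℕ, f (g ^ k) = f' (g' ^ k)) : eig f g = eig f' g' := by
  simp only [eig, h]

theorem Chr.exists_eig (hf : Chr H f) : ∃ d : G → ℂ, (∀ g ∈ H, ∀ h ∈ H, d (g * h) = d g * d h) ∧
    ∀ g ∈ H, (∀ k : ℕ, f (g ^ k) = ((eig f g).map (· ^ k)).sum) ∧ d g = (eig f g).prod ∧
      ∀ N : ℕ, N ≠ 0 → g ^ N = 1 → ∀ x ∈ eig f g, x ^ N = 1 := by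
  obtain ⟨V, _, _, _, ρ, rfl⟩ := hf
  refine ⟨fun g => if h : g ∈ H then LinearMap.det (ρ ⟨g, h⟩) else 0, fun g hg h hh => ?_,
    fun g hg => ?_⟩
  · simp only [hg, hh, H.mul_mem hg hh, dif_pos]
    rw [← map_mul, ← map_mul]; rfl
  · have hk : ∀ k : ℕ, ext0 H ρ.character (g ^ k) = LinearMap.trace ℂ V (ρ ⟨g, hg⟩ ^ k) := fun k => by
      rw [ext0, dif_pos (H.pow_mem hg k), ← map_pow]; rfl
    have key : ∀ N : ℕ, N ≠ 0 → g ^ N = 1 →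
        ∃ s : Multiset ℂ, (∀ x ∈ s, x ^ N = 1) ∧ LinearMap.det (ρ ⟨g, hg⟩) = s.prod ∧
          eig (ext0 H ρ.character) g = s ∧
          ∀ k : ℕ, ext0 H ρ.character (g ^ k) = (s.map (· ^ k)).sum := fun N hN hgN => by
      obtain ⟨s, h1, h2, h3⟩ := exists_eigenvalues (ρ ⟨g, hg⟩) hN (by
        rw [← map_pow, ← map_one ρ]; congr 1; exact Subtype.ext hgN)
      have h4 : ∀ k : ℕ, ext0 H ρ.character (g ^ k) = (s.map (· ^ k)).sum := fun k => by rw [hk, h3]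
      exact ⟨s, h1, h2, eig_eq h4, h4⟩
    obtain ⟨s, h1, h2, h3, h4⟩ := key (Nat.card G) Nat.card_pos.ne' pow_card_eq_one'
    refine ⟨by rwa [h3], by rw [h3, ← h2]; simp [hg], fun N hN hgN => ?_⟩
    obtain ⟨t, h5, -, h6, -⟩ := key N hN hgN
    rwa [h6]

theorem Chr.apply_pow (hf : Chr H f) (hg : g ∈ H) (k : ℕ) :
    f (g ^ k) = ((eig f g).map (· ^ k)).sum := by
  obtain ⟨d, -, h⟩ := hf.exists_eig
  exact (h g hg).1 k

theorem Chr.apply_eq_sum (hf : Chr H f) (hg : g ∈ H) : f g = (eig f g).sum := by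
  simpa using hf.apply_pow hg 1

theorem Chr.eig_pow (hf : Chr H f) (hg : g ∈ H) {N : ℕ} (hN : N ≠ 0) (hgN : g ^ N = 1) :
    ∀ x ∈ eig f g, x ^ N = 1 := by
  obtain ⟨d, -, h⟩ := hf.exists_eig
  exact (h g hg).2.2 N hN hgN

theorem Chr.card_eig (hf : Chr H f) (hg : g ∈ H) : (eig f g).card = dg f := by
  have := hf.apply_pow hg 0
  rw [pow_zero, ← hf.cast_dg] at this
  simp at this
  exact this.symm

theorem Chr.dt_mul (hf : Chr H f) {g h : G} (hg : g ∈ H) (hh : h ∈ H) :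
    dt f (g * h) = dt f g * dt f h := by
  obtain ⟨d, h1, h2⟩ := hf.exists_eig
  rw [dt, dt, dt, ← (h2 _ hg).2.1, ← (h2 _ hh).2.1, ← (h2 _ (H.mul_mem hg hh)).2.1, h1 g hg h hh]

theorem Chr.dt_pow_eq_one (hf : Chr H f) (hg : g ∈ H) {N : ℕ} (hN : N ≠ 0) (hgN : g ^ N = 1) :
    dt f g ^ N = 1 := by
  have : ((eig f g).map (· ^ N)).prod = (eig f g).prod ^ N := by
    rw [Multiset.prod_map_pow, Multiset.map_id']
  rw [dt, ← this, Multiset.prod_eq_one]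
  intro x hx
  obtain ⟨y, hy, rfl⟩ := Multiset.mem_map.mp hx
  exact hf.eig_pow hg hN hgN y hy

theorem Chr.eig_add (hf : Chr H f) (hk : Chr H k) (hg : g ∈ H) :
    eig (f + k) g = eig f g + eig k g :=
  eig_eq fun n => by
    rw [Multiset.map_add, Multiset.sum_add, Pi.add_apply, hf.apply_pow hg, hk.apply_pow hg]

theorem Chr.dt_add (hf : Chr H f) (hk : Chr H k) (hg : g ∈ H) :
    dt (f + k) g = dt f g * dt k g := by
  rw [dt, hf.eig_add hk hg, Multiset.prod_add]; rfl

theorem dt_zero (g : G) : dt 0 g = 1 := by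
  rw [dt, eig_eq (s := 0) (by simp), Multiset.prod_zero]

theorem Chr.dt_nsmul (hf : Chr H f) (hg : g ∈ H) (n : ℕ) : dt ((n : ℂ) • f) g = dt f g ^ n := by
  induction n with
  | zero => rw [Nat.cast_zero, zero_smul, dt_zero, pow_zero]
  | succ n ih =>
    rw [Nat.cast_succ, add_smul, one_smul, (hf.nsmul n).dt_add hf hg, ih, pow_succ]

theorem dt_sum {ι : Type*} {s : Finset ι} {f : ι → G → ℂ} (h : ∀ i ∈ s, Chr H (f i)) (hg : g ∈ H) :
    dt (∑ i ∈ s, f i) g = ∏ i ∈ s, dt (f i) g := by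
  induction s using Finset.induction_on with
  | empty => simp [dt_zero]
  | insert a s ha ih =>
    rw [Finset.sum_insert ha, Finset.prod_insert ha, (h a (by simp)).dt_add
      (Chr.sum fun i hi => h i (by simp [hi])) hg, ih fun i hi => h i (by simp [hi])]

theorem Chr.dt_mul_lin (hf : Chr H f) (hl : Lin H l) (hg : g ∈ H) :
    dt (f * l) g = dt f g * l g ^ dg f := by
  have : eig (f * l) g = (eig f g).map (· * l g) := eig_eq fun n => by
    rw [Pi.mul_apply, hl.pow_apply hg, hf.apply_pow hg, Multiset.map_map,
      ← Multiset.sum_map_mul_right]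
    simp [mul_pow]
  rw [dt, this, Multiset.prod_map_mul, Multiset.map_id', Multiset.map_const', Multiset.prod_replicate,
    hf.card_eig hg]
  rfl

theorem Lin.dt_eq (hl : Lin H l) (hg : g ∈ H) : dt l g = l g := by
  rw [dt, eig_eq (s := {l g}) fun n => by simp [hl.pow_apply hg], Multiset.prod_singleton]

theorem Chr.dt_galois (hf : Chr H f) (hg : g ∈ H) (σ : ℂ →+* ℂ) :
    dt (σ ∘ f) g = σ (dt f g) := by
  have : eig (σ ∘ f) g = (eig f g).map σ := eig_eq fun n => by
    rw [Function.comp_apply, hf.apply_pow hg, map_multiset_sum, Multiset.map_map, Multiset.map_map]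
    simp
  rw [dt, this, ← map_multiset_prod]
  rfl

theorem dt_cj (x : G) (f : G → ℂ) (g : G) : dt (cj x f) g = dt f (x * g * x⁻¹) := by
  rw [dt, dt, eig_congr (f' := f) (g' := x * g * x⁻¹)]
  intro k
  rw [cj, conj_pow]

theorem dt_res {K : Subgroup G} (hg : g ∈ K) (f : G → ℂ) : dt (res K f) g = dt f g := by
  rw [dt, dt, eig_congr (f' := f) (g' := g)]
  intro k
  rw [res_of_mem (K.pow_mem hg k)]

/-- The determinant of `f` as a linear character of `H`. -/
theorem Chr.lin_dt (hf : Chr H f) : Lin H (SubChar.res H (dt f)) where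
  supp g hg := res_of_notMem hg
  mul g hg h hh := by
    rw [res_of_mem hg, res_of_mem hh, res_of_mem (H.mul_mem hg hh), hf.dt_mul hg hh]
  one := by
    rw [res_of_mem H.one_mem]
    simpa using hf.dt_pow_eq_one H.one_mem one_ne_zero (one_pow 1)

theorem Chr.galois_apply_eq (hf : Chr H f) (hg : g ∈ H) {N : ℕ} (hN : N ≠ 0) (hgN : g ^ N = 1)
    {σ : ℂ →+* ℂ} (hσ : ∀ x : ℂ, x ^ N = 1 → σ x = x) : σ (f g) = f g := by
  rw [hf.apply_eq_sum hg, map_multiset_sum, Multiset.map_congr rfl fun x hx =>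
    hσ x (hf.eig_pow hg hN hgN x hx), Multiset.map_id']

theorem Chr.isIntegral (hf : Chr H f) (g : G) : IsIntegral ℤ (f g) := by
  by_cases hg : g ∈ H
  · rw [hf.apply_eq_sum hg]
    refine IsIntegral.multiset_sum fun x hx => IsIntegral.of_pow (n := Nat.card G) Nat.card_pos ?_
    rw [hf.eig_pow hg Nat.card_pos.ne' pow_card_eq_one' x hx]
    exact isIntegral_one
  · rw [hf.supp hg]; exact isIntegral_zero

end

section

variable {G : Type} [Group G] [Fintype G] {E H K N L T U : Subgroup G} {f k θ χ ψ l β : G → ℂ} {g : G}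

/-! ### Schur's lemma -/

theorem schur {n : ℕ} {M : G → Matrix (Fin n) (Fin n) ℂ}
    (hM : ∀ g ∈ H, ∀ h ∈ H, M (g * h) = M g * M h) (hM1 : M 1 = 1)
    (hirr : ip H (fun g => (M g).trace) (fun g => (M g).trace) = 1)
    {A : Matrix (Fin n) (Fin n) ℂ} (hA : ∀ g ∈ H, M g * A = A * M g) : ∃ c : ℂ, A = c • 1 := by
  let ρ : Representation ℂ H (Fin n → ℂ) :=
    { toFun := fun g => Matrix.toLin' (M g)
      map_one' := by simp [hM1, Module.End.one_eq_id]
      map_mul' := fun g h => by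
        rw [Subgroup.coe_mul, hM g g.2 h h.2, Matrix.toLin'_mul]; rfl }
  have hρ : ρ.character = fun g : H => (M g).trace := by
    ext g
    exact Matrix.trace_toLin'_eq _
  have : Invertible (Nat.card H : ℂ) := invertibleOfNonzero (card_ne_zero' H)
  have h1 := Representation.card_inv_mul_sum_char_eq_finrank (Representation.linHom ρ ρ)
  simp only [Representation.char_linHom, hρ] at h1
  rw [ip_eq] at hirr
  rw [show (Nat.card H : ℂ)⁻¹ * ∑ g : H, (M ((g⁻¹ : H) : G)).trace * (M g).trace = 1 by
    rw [← hirr]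
    congr 1
    exact Finset.sum_congr rfl fun g _ => mul_comm _ _] at h1
  have h2 : Module.finrank ℂ (Representation.invariants (Representation.linHom ρ ρ)) = 1 := by
    exact_mod_cast h1.symm
  have hone : LinearMap.id ∈ Representation.invariants (Representation.linHom ρ ρ) := fun g => by
    rw [Representation.linHom_apply, LinearMap.id_comp]
    change ρ g * ρ g⁻¹ = 1
    rw [← map_mul, mul_inv_cancel, map_one]
  have hAm : Matrix.toLin' A ∈ Representation.invariants (Representation.linHom ρ ρ) := fun g => by
    rw [Representation.linHom_apply]
    have h3 : Matrix.toLin' A ∘ₗ ρ g⁻¹ = ρ g⁻¹ ∘ₗ Matrix.toLin' A := by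
      change Matrix.toLin' A ∘ₗ Matrix.toLin' (M _) = Matrix.toLin' (M _) ∘ₗ Matrix.toLin' A
      rw [← Matrix.toLin'_mul, ← Matrix.toLin'_mul, hA _ (g⁻¹).2]
    rw [h3, ← LinearMap.comp_assoc]
    change (ρ g * ρ g⁻¹) ∘ₗ _ = _
    rw [← map_mul, mul_inv_cancel, map_one]
    rfl
  have hne : (⟨LinearMap.id, hone⟩ : ↥(Representation.invariants (Representation.linHom ρ ρ))) ≠ 0 := by
    intro h0
    have h4 : (LinearMap.id : (Fin n → ℂ) →ₗ[ℂ] (Fin n → ℂ)) = 0 := congrArg Subtype.val h0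
    have h5 : (1 : Matrix (Fin n) (Fin n) ℂ) = 0 := by
      rw [← LinearMap.toMatrix'_id, h4, map_zero]
    rw [Finset.sum_eq_zero, mul_zero] at hirr
    · exact zero_ne_one hirr
    · intro g _
      rw [← mul_one (M g), h5]
      simp
  obtain ⟨c, hc⟩ := exists_smul_eq_of_finrank_eq_one
    (V := ↥(Representation.invariants (Representation.linHom ρ ρ))) h2 (x := ⟨LinearMap.id, hone⟩)
    (by simpa using hne) ⟨_, hAm⟩
  refine ⟨c, ?_⟩
  have h6 : c • LinearMap.id = Matrix.toLin' A := congrArg Subtype.val hc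
  rw [← LinearMap.toMatrix'_toLin' A, ← h6, map_smul, LinearMap.toMatrix'_id]

theorem Chr.schur_average (hβ : Chr H β) (hE : E ≤ H) (hirr : Irr E (SubChar.res E β)) {g g' : G}
    (hg : g ∈ H) (hg' : g' ∈ H) :
    (Nat.card E : ℂ)⁻¹ * ∑ x : E, β (x * g * (x : G)⁻¹ * g') = β g * β g' / β 1 := by
  obtain ⟨n, M, hM0, hM, hM1, hMf⟩ := hβ.exists_matrix
  have hEc := card_ne_zero' E
  set A := (Nat.card E : ℂ)⁻¹ • ∑ x : E, M (x * g * (x : G)⁻¹) with hAdef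
  have hmul : ∀ x ∈ E, ∀ y : G, y ∈ H → M (x * y) = M x * M y := fun x hx y hy => hM _ (hE hx) _ hy
  have hc : ∀ x ∈ E, x * g * x⁻¹ ∈ H := fun x hx =>
    H.mul_mem (H.mul_mem (hE hx) hg) (H.inv_mem (hE hx))
  have hA : ∀ y ∈ E, M y * A = A * M y := fun y hy => by
    rw [hAdef, Matrix.mul_smul, Matrix.smul_mul, Finset.mul_sum, Finset.sum_mul]
    congr 1
    refine Fintype.sum_equiv (Equiv.mulLeft (⟨y, hy⟩ : E)) _ _ fun x => ?_
    rw [← hM _ (hE hy) _ (hc _ x.2), ← hM _ (hc _ ((Equiv.mulLeft (⟨y, hy⟩ : E)) x).2) _ (hE hy)]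
    congr 1
    simp only [Equiv.coe_mulLeft, Subgroup.coe_mul]
    group
  have hirr' : ip E (fun g => (M g).trace) (fun g => (M g).trace) = 1 := by
    rw [← hirr.2, ip_res_left, ip_res_right]
    simp only [← hMf]
  obtain ⟨c, hcA⟩ := schur (fun g hg h hh => hM g (hE hg) h (hE hh)) hM1 hirr' hA
  have h1 : β 1 ≠ 0 := by
    have := hirr.apply_one_ne_zero
    rwa [res_of_mem E.one_mem] at this
  have key : ∀ z ∈ H, (Nat.card E : ℂ)⁻¹ * ∑ x : E, β (x * g * (x : G)⁻¹ * z) = c * β z :=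
    fun z hz => by
    have : (A * M z).trace = c * β z := by
      rw [hcA, Matrix.smul_mul, one_mul, Matrix.trace_smul, ← hMf, smul_eq_mul]
    rw [← this, hAdef, Matrix.smul_mul, Matrix.trace_smul, smul_eq_mul, Finset.sum_mul,
      Matrix.trace_sum]
    congr 1
    refine Finset.sum_congr rfl fun x _ => ?_
    rw [hMf, hM _ (hc _ x.2) _ hz]
  have h2 := key 1 H.one_mem
  rw [Finset.sum_congr rfl fun (x : E) _ => show β (x * g * (x : G)⁻¹ * 1) = β g by
    rw [mul_one, hβ.cls (hE x.2)]] at h2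
  simp only [Finset.sum_const, Finset.card_univ, Fintype.card_eq_nat_card, nsmul_eq_mul,
    inv_mul_cancel_left₀ hEc] at h2
  rw [key g' hg', h2]
  field_simp

theorem Irr.schur_average (hβ : Irr H β) {g g' : G} (hg : g ∈ H) (hg' : g' ∈ H) :
    (Nat.card H : ℂ)⁻¹ * ∑ x : H, β (x * g * (x : G)⁻¹ * g') = β g * β g' / β 1 :=
  hβ.1.schur_average le_rfl (by rwa [res_of_supp fun g hg => hβ.supp hg]) hg hg'

theorem Irr.apply_central (hβ : Irr H β) {z g : G} (hz : z ∈ H) (hc : ∀ h ∈ H, z * h = h * z)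
    (hg : g ∈ H) : β (z * g) * β 1 = β z * β g := by
  have h := hβ.schur_average hz hg
  have hHc := card_ne_zero' H
  rw [Finset.sum_congr rfl fun (x : H) _ => show β (x * z * (x : G)⁻¹ * g) = β (z * g) by
    rw [← hc x x.2, mul_inv_cancel_right]] at h
  simp only [Finset.sum_const, Finset.card_univ, Fintype.card_eq_nat_card, nsmul_eq_mul,
    inv_mul_cancel_left₀ hHc] at h
  rw [h]
  field_simp [hβ.apply_one_ne_zero]

/-- Irreducible characters of abelian quotients are linear. -/
theorem Irr.lin_of_trv (hβ : Irr H β) (hN : Trv N β)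
    (hab : ∀ x ∈ H, ∀ y ∈ H, x * y * x⁻¹ * y⁻¹ ∈ N) : Lin H β := by
  have hHc := card_ne_zero' H
  have h1 := hβ.apply_one_ne_zero
  have key : ∀ g ∈ H, β g * β g⁻¹ = β 1 ^ 2 := fun g hg => by
    have h := hβ.schur_average hg (H.inv_mem hg)
    rw [Finset.sum_congr rfl fun (x : H) _ => show β (x * g * (x : G)⁻¹ * g⁻¹) = β 1 from
      hN.apply_mem (hab x x.2 g hg)] at h
    simp only [Finset.sum_const, Finset.card_univ, Fintype.card_eq_nat_card, nsmul_eq_mul,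
      inv_mul_cancel_left₀ hHc] at h
    field_simp at h
    exact h.symm
  have h2 := hβ.2
  rw [ip_eq, Finset.sum_congr rfl fun (x : H) _ => show β x * β (x⁻¹ : H) = β 1 ^ 2 from key x x.2] at h2
  simp only [Finset.sum_const, Finset.card_univ, Fintype.card_eq_nat_card, nsmul_eq_mul,
    inv_mul_cancel_left₀ hHc] at h2
  refine hβ.1.lin ?_
  rw [← hβ.1.cast_dg] at h2 ⊢
  have h3 : dg β ^ 2 = 1 := by exact_mod_cast h2
  simp at h3
  simp [h3]

end

section

variable {G : Type} [Group G] [Fintype G] {E H K N L T U : Subgroup G} {f k θ χ ψ l β : G → ℂ} {g : G}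
  {a b : ℕ}

/-! ### The part of the determinant of order prime to `b` -/

/-- `a` and `b` are coprime and `a * b` is an exponent of `G`. -/
structure ExpFac (a b : ℕ) (G : Type) [Group G] : Prop where
  cop : a.Coprime b
  ha : a ≠ 0
  hb : b ≠ 0
  ex : ∀ g : G, g ^ (a * b) = 1

theorem ExpFac.symm (h : ExpFac a b G) : ExpFac b a G :=
  ⟨h.cop.symm, h.hb, h.ha, fun g => by rw [mul_comm]; exact h.ex g⟩

theorem pow_eq_of_modEq {M : Type*} [Monoid M] {x : M} {n i j : ℕ} (hx : x ^ n = 1)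
    (h : i ≡ j [MOD n]) : x ^ i = x ^ j := by
  rw [← Nat.mod_add_div i n, ← Nat.mod_add_div j n, pow_add, pow_add, pow_mul, pow_mul, hx,
    one_pow, one_pow, h]

theorem eq_one_of_pow_of_coprime {M : Type*} [Monoid M] {x : M} {m n : ℕ} (h : m.Coprime n) (hm : x ^ m = 1)
    (hn : x ^ n = 1) : x = 1 := by
  have := pow_gcd_eq_one.2 ⟨hm, hn⟩
  rwa [h, pow_one] at this

theorem exists_ndx (hab : a.Coprime b) (n : ℕ) (hn : n.Coprime a) :
    ∃ j, b ∣ j ∧ j * n ≡ 1 [MOD a] := by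
  rcases Nat.lt_or_ge 1 a with ha | ha
  · obtain ⟨t, ht⟩ := Nat.exists_mul_mod_eq_one_of_coprime (Nat.Coprime.mul_left hn hab.symm) ha
    exact ⟨t * b, dvd_mul_left _ _, by
      rw [Nat.ModEq, Nat.mod_eq_of_lt ha, ← ht.2]; congr 1; ring⟩
  · interval_cases a
    · have : b = 1 := by simpa using hab
      have : n = 1 := by simpa using hn
      exact ⟨1, by simp_all, by subst this; exact rfl⟩
    · exact ⟨0, dvd_zero _, Nat.modEq_one⟩

def ndx (a b n : ℕ) : ℕ := if h : ∃ j, b ∣ j ∧ j * n ≡ 1 [MOD a] then h.choose else 0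

theorem ndx_spec (hab : a.Coprime b) {n : ℕ} (hn : n.Coprime a) :
    b ∣ ndx a b n ∧ ndx a b n * n ≡ 1 [MOD a] := by
  rw [ndx, dif_pos (exists_ndx hab n hn)]
  exact (exists_ndx hab n hn).choose_spec

/-- A linear character of `H` of order dividing `a` whose power of exponent `f 1` is the `a`-part of
the determinant of `f`. -/
def nd (a b : ℕ) (H : Subgroup G) (f : G → ℂ) (g : G) : ℂ :=
  if g ∈ H then dt f g ^ ndx a b (dg f) else 0

theorem nd_of_mem (hg : g ∈ H) : nd a b H f g = dt f g ^ ndx a b (dg f) := if_pos hg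

theorem nd_of_notMem (hg : g ∉ H) : nd a b H f g = 0 := if_neg hg

theorem Chr.nd_lin (hf : Chr H f) (a b : ℕ) : Lin H (nd a b H f) where
  supp g hg := nd_of_notMem hg
  mul g hg h hh := by
    rw [nd_of_mem hg, nd_of_mem hh, nd_of_mem (H.mul_mem hg hh), hf.dt_mul hg hh, mul_pow]
  one := by
    rw [nd_of_mem H.one_mem]
    have := hf.dt_pow_eq_one H.one_mem one_ne_zero (one_pow 1)
    rw [pow_one] at this
    rw [this, one_pow]

theorem Chr.dt_ab (hf : Chr H f) (hab : ExpFac a b G) (hg : g ∈ H) : dt f g ^ (a * b) = 1 :=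
  hf.dt_pow_eq_one hg (mul_ne_zero hab.ha hab.hb) (hab.ex g)

theorem Chr.nd_pow (hf : Chr H f) (hab : ExpFac a b G) (hc : (dg f).Coprime a) (hg : g ∈ H) :
    nd a b H f g ^ a = 1 := by
  obtain ⟨c, hc⟩ := (ndx_spec hab.cop hc).1
  rw [nd_of_mem hg, ← pow_mul, hc, show b * c * a = a * b * c by ring, pow_mul,
    hf.dt_ab hab hg, one_pow]

theorem nd_res (h : K ≤ H) (f : G → ℂ) : nd a b K (res K f) = res K (nd a b H f) := by
  ext g
  by_cases hg : g ∈ K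
  · rw [nd_of_mem hg, res_of_mem hg, nd_of_mem (h hg), dt_res hg]
    congr 2
    simp [dg, res_of_mem K.one_mem]
  · rw [nd_of_notMem hg, res_of_notMem hg]

theorem nd_cj {x : G} (hK : ∀ g, g ∈ K ↔ x * g * x⁻¹ ∈ H) (f : G → ℂ) :
    nd a b K (cj x f) = cj x (nd a b H f) := by
  ext g
  by_cases hg : g ∈ K
  · rw [nd_of_mem hg, cj, nd_of_mem ((hK g).1 hg), dt_cj]
    congr 2
    simp [dg, cj]
  · rw [nd_of_notMem hg, cj, nd_of_notMem (fun h => hg ((hK g).2 h))]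

theorem dg_galois (hf : Chr H f) (σ : ℂ →+* ℂ) : dg (σ ∘ f) = dg f := by
  apply dg_eq
  rw [Function.comp_apply, ← hf.cast_dg, map_natCast]

theorem Chr.nd_galois (hf : Chr H f) (σ : ℂ →+* ℂ) : nd a b H (σ ∘ f) = σ ∘ nd a b H f := by
  ext g
  by_cases hg : g ∈ H
  · rw [nd_of_mem hg, Function.comp_apply, nd_of_mem hg, map_pow, hf.dt_galois hg, dg_galois hf]
  · rw [nd_of_notMem hg, Function.comp_apply, nd_of_notMem hg, map_zero]

theorem dg_mul_lin (hl : Lin H l) : dg (f * l) = dg f := by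
  simp [dg, hl.one]

theorem Chr.nd_mul_lin (hf : Chr H f) (hab : ExpFac a b G) (hc : (dg f).Coprime a) (hl : Lin H l)
    (hla : ∀ g ∈ H, l g ^ a = 1) : nd a b H (f * l) = nd a b H f * l := by
  ext g
  by_cases hg : g ∈ H
  · rw [nd_of_mem hg, Pi.mul_apply, nd_of_mem hg, hf.dt_mul_lin hl hg, dg_mul_lin hl, mul_pow,
      ← pow_mul, mul_comm (dg f), pow_eq_of_modEq (hla g hg) (ndx_spec hab.cop hc).2, pow_one]
  · rw [nd_of_notMem hg, Pi.mul_apply, nd_of_notMem hg, zero_mul]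

theorem dg_nsmul (n : ℕ) {f : G → ℂ} (hf : Chr H f) : dg ((n : ℂ) • f) = n * dg f := by
  apply dg_eq
  rw [Pi.smul_apply, smul_eq_mul, ← hf.cast_dg]
  push_cast
  rfl

theorem Chr.nd_nsmul (hf : Chr H f) (hab : ExpFac a b G) (n : ℕ) (hc : (n * dg f).Coprime a) :
    nd a b H ((n : ℂ) • f) = nd a b H f := by
  ext g
  by_cases hg : g ∈ H
  · rw [nd_of_mem hg, nd_of_mem hg, hf.dt_nsmul hg, dg_nsmul n hf, ← pow_mul]
    apply pow_eq_of_modEq (hf.dt_ab hab hg)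
    have h1 := ndx_spec hab.cop hc
    have h2 := ndx_spec hab.cop (Nat.Coprime.coprime_mul_left hc)
    refine (Nat.modEq_and_modEq_iff_modEq_mul hab.cop).1 ⟨?_, ?_⟩
    · have hd : a.gcd (dg f) = 1 := (Nat.Coprime.coprime_mul_left hc).symm
      refine Nat.ModEq.cancel_right_of_coprime hd ?_
      refine Nat.ModEq.trans ?_ h2.2.symm
      rw [show n * ndx a b (n * dg f) * dg f = ndx a b (n * dg f) * (n * dg f) by ring]
      exact h1.2
    · exact ((Nat.modEq_zero_iff_dvd).2 (dvd_mul_of_dvd_right h1.1 _)).trans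
        ((Nat.modEq_zero_iff_dvd).2 h2.1).symm
  · rw [nd_of_notMem hg, nd_of_notMem hg]

theorem Chr.dt_mul_nd_inv (hf : Chr H f) (hab : ExpFac a b G) (hc : (dg f).Coprime a) (hg : g ∈ H) :
    dt (f * (nd a b H f)⁻¹) g ^ b = 1 := by
  rw [hf.dt_mul_lin (hf.nd_lin a b).inv' hg, Pi.inv_apply, nd_of_mem hg, inv_pow, ← pow_mul, mul_pow,
    inv_pow, ← pow_mul]
  have h1 := ndx_spec hab.cop hc
  rw [pow_eq_of_modEq (hf.dt_ab hab hg) (i := ndx a b (dg f) * dg f * b) (j := b), mul_inv_cancel₀]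
  · exact pow_ne_zero _ fun h => by
      have := hf.dt_ab hab hg
      rw [h, zero_pow (mul_ne_zero hab.ha hab.hb)] at this
      exact zero_ne_one this
  · simpa using h1.2.mul_right' b

theorem nd_eq_tr (hab : ExpFac a b G) (hc : (dg f).Coprime a)
    (h : ∀ g ∈ H, dt f g ^ b = 1) : nd a b H f = tr H := by
  ext g
  by_cases hg : g ∈ H
  · obtain ⟨c, hc⟩ := (ndx_spec hab.cop hc).1
    rw [nd_of_mem hg, tr_of_mem hg, hc, pow_mul, h g hg, one_pow]
  · rw [nd_of_notMem hg, tr, res_of_notMem hg]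

end

section

variable {G : Type} [Group G] [Fintype G] {E H J J₀ K N L T U X Y : Subgroup G} {f k θ χ ψ l β α ξ ζ : G → ℂ} {g : G}
  {a b : ℕ}

/-! ### Special characters -/

/-- `J` is subnormal in `H`. -/
def Subn (J H : Subgroup G) : Prop := Relation.ReflTransGen Nrm J H

theorem Subn.le (h : Subn J H) : J ≤ H := by
  induction h with
  | refl => exact le_rfl
  | tail _ h ih => exact ih.trans h.le

theorem Subn.inf (h : Subn J H) (K : Subgroup G) : Subn (J ⊓ K) (H ⊓ K) := by
  induction h with
  | refl => exact Relation.ReflTransGen.refl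
  | @tail J₁ J₂ _ h ih =>
    refine ih.tail ⟨inf_le_inf_right _ h.le, fun x hx n hn => ⟨h.2 x hx.1 n hn.1, ?_⟩⟩
    exact K.mul_mem (K.mul_mem hx.2 hn.2) (K.inv_mem hx.2)

theorem Chr.dt_pow_of_constituents (hf : Chr H f) (hg : g ∈ H) {ν : ℂ}
    (h : ∀ θ, Irr H θ → ip H f θ ≠ 0 → dt θ g ^ b = ν) :
    dt f g ^ b = ν ^ ∑ θ ∈ irr H, mult H f θ := by
  conv_lhs => rw [hf.decomp_mult]
  rw [dt_sum (fun θ hθ => (mem_irr.mp hθ).1.nsmul _) hg, ← Finset.prod_pow,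
    ← Finset.prod_pow_eq_pow_sum]
  refine Finset.prod_congr rfl fun θ hθ => ?_
  have hθ := mem_irr.mp hθ
  rw [hθ.1.dt_nsmul hg, ← pow_mul, mul_comm, pow_mul]
  by_cases h0 : mult H f θ = 0
  · rw [h0, pow_zero, pow_zero]
  · rw [h θ hθ]
    rw [← hf.cast_mult hθ.1]
    exact_mod_cast h0

theorem Chr.dg_of_constituents (hf : Chr H f) {n : ℕ}
    (h : ∀ θ, Irr H θ → ip H f θ ≠ 0 → dg θ = n) :
    dg f = (∑ θ ∈ irr H, mult H f θ) * n := by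
  apply dg_eq
  conv_lhs => rw [hf.decomp_mult]
  rw [Finset.sum_apply]
  push_cast
  rw [Finset.sum_mul]
  refine Finset.sum_congr rfl fun θ hθ => ?_
  have hθ := mem_irr.mp hθ
  rw [Pi.smul_apply, smul_eq_mul]
  by_cases h0 : mult H f θ = 0
  · rw [h0]; simp
  · rw [← hθ.1.cast_dg, h θ hθ]
    rw [← hf.cast_mult hθ.1]
    exact_mod_cast h0

theorem dg_res (K : Subgroup G) (f : G → ℂ) : dg (res K f) = dg f := by
  simp [dg, res_of_mem K.one_mem]

theorem dg_cj (x : G) (f : G → ℂ) : dg (cj x f) = dg f := by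
  simp [dg, cj]

theorem dg_constituent (hY : Nrm Y X) (hξ : Irr X ξ) (hζ : Irr Y ζ) (h : ip Y ξ ζ ≠ 0) :
    dg ξ = (∑ θ ∈ irr Y, mult Y (res Y ξ) θ) * dg ζ := by
  rw [← dg_res Y ξ]
  refine (hξ.1.res hY.le).dg_of_constituents fun θ hθ hne => ?_
  rw [ip_res_left] at hne
  obtain ⟨x, -, rfl⟩ := exists_cj_of_ip_ne_zero hY hξ hζ hθ h hne
  exact dg_cj _ _

theorem dg_constituent_dvd (hY : Nrm Y X) (hξ : Irr X ξ) (hζ : Irr Y ζ) (h : ip Y ξ ζ ≠ 0) :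
    dg ζ ∣ dg ξ := Dvd.intro_left _ (dg_constituent hY hξ hζ h).symm

/-- `f` is an irreducible character of `H` of degree prime to `a` whose constituents on subnormal
subgroups have determinants of order dividing `b`. -/
structure Spec (a b : ℕ) (H : Subgroup G) (f : G → ℂ) : Prop where
  irr : Irr H f
  cop : (dg f).Coprime a
  det : ∀ J, Subn J H → ∀ θ, Irr J θ → ip J f θ ≠ 0 → ∀ g ∈ J, dt θ g ^ b = 1

theorem Spec.dt_pow (h : Spec a b H f) (hg : g ∈ H) : dt f g ^ b = 1 :=
  h.det H .refl f h.irr (by rw [h.irr.2]; exact one_ne_zero) g hg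

theorem ip_chain (hf : Chr H f) (hN : N ≤ H) (hJ : J ≤ N) (hθ : Irr N θ) (hη : Irr J ζ)
    (h1 : ip N f θ ≠ 0) (h2 : ip J θ ζ ≠ 0) : ip J f ζ ≠ 0 := by
  have := (hf.res hN).over_trans hJ hθ hη.1 (by rwa [ip_res_left]) h2
  rwa [← ip_res_left, res_res hJ, ip_res_left] at this

theorem Spec.constituent (h : Spec a b H f) (hN : Nrm N H) (hθ : Irr N θ) (hne : ip N f θ ≠ 0) :
    Spec a b N θ :=
  ⟨hθ, h.cop.coprime_dvd_left (dg_constituent_dvd hN h.irr hθ hne), fun J hJ η hη hne' g hg =>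
    h.det J (hJ.tail hN) η hη (ip_chain h.irr.1 hN.le hJ.le hθ hη hne hne') g hg⟩

theorem exists_between (hf : Chr H f) (hN : N ≤ H) (hJ : J ≤ N) (h : ip J f ζ ≠ 0) :
    ∃ θ, Irr N θ ∧ ip N f θ ≠ 0 ∧ ip J θ ζ ≠ 0 := by
  obtain ⟨θ, h1, h2, h3⟩ := (hf.res hN).exists_over (K := J) (θ := ζ)
    (by rwa [← ip_res_left, res_res hJ, ip_res_left])
  exact ⟨θ, h1, by rwa [ip_res_left] at h2, h3⟩

theorem mem_sup_of_nrm (hK : Nrm K T) (hJ : J ≤ T) {x : G} (hx : x ∈ K ⊔ J) :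
    ∃ k ∈ K, ∃ j ∈ J, x = k * j := by
  let S : Subgroup G :=
    { carrier := {x | ∃ k ∈ K, ∃ j ∈ J, x = k * j}
      one_mem' := ⟨1, K.one_mem, 1, J.one_mem, by simp⟩
      mul_mem' := by
        rintro _ _ ⟨k, hk, j, hj, rfl⟩ ⟨k', hk', j', hj', rfl⟩
        exact ⟨k * (j * k' * j⁻¹), K.mul_mem hk (hK.2 j (hJ hj) _ hk'), j * j', J.mul_mem hj hj',
          by group⟩
      inv_mem' := by
        rintro _ ⟨k, hk, j, hj, rfl⟩
        exact ⟨j⁻¹ * k⁻¹ * j⁻¹⁻¹, hK.2 _ (hJ (J.inv_mem hj)) _ (K.inv_mem hk), j⁻¹, J.inv_mem hj,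
          by group⟩ }
  have : K ⊔ J ≤ S := sup_le (fun k hk => ⟨k, hk, 1, J.one_mem, by simp⟩)
    fun j hj => ⟨1, K.one_mem, j, hj, by simp⟩
  exact this hx

theorem Chr.irr_of_res (hf : Chr H f) (hK : K ≤ H) (h : Irr K (SubChar.res K f)) : Irr H f := by
  refine hf.irr_of_indecomposable (fun h0 => h.ne_zero (by rw [h0]; ext; simp [SubChar.res])) ?_
  intro f₁ f₂ h₁ h₂ he
  rw [he, res_add] at h
  by_contra! h0
  rcases h.indecomposable (h₁.res hK) (h₂.res hK) rfl with h' | h'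
  · exact h₁.res_ne_zero h0.1 h'
  · exact h₂.res_ne_zero h0.2 h'

theorem Irr.res_of_le (hf : Chr T f) (h : Irr K (res K f)) (hK : K ≤ H) (hH : H ≤ T) :
    Irr H (res H f) :=
  (hf.res hH).irr_of_res hK (by rwa [res_res hK])

theorem Irr.eq_of_ip_ne_zero (hf : Irr H f) (hk : Irr H k) (h : ip H f k ≠ 0) : f = k := by
  by_contra hne
  exact h (hf.ip_of_ne hk hne)

/-- A character of degree prime to `a` is special if its restriction to a normal subgroup is special
and its determinant has the right order. -/
theorem Spec.of_res (hab : ExpFac a b G) (hK : Nrm K T) (hχ : Irr T χ) (hs : Spec a b K (res K χ))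
    (hdt : ∀ g ∈ T, dt χ g ^ b = 1) : Spec a b T χ := by
  refine ⟨hχ, by rw [← dg_res K]; exact hs.cop, fun J₀ hJ₀ => ?_⟩
  have key : ∀ J, Subn J T → J₀ ≤ J → ∀ θ, Irr (J ⊓ (K ⊔ J₀)) θ → ip (J ⊓ (K ⊔ J₀)) χ θ ≠ 0 →
      dg θ ∣ dg χ ∧ ∀ g ∈ J ⊓ (K ⊔ J₀), dt θ g ^ b = 1 := by
    intro J hJ
    induction hJ using Relation.ReflTransGen.head_induction_on with
    | refl =>
      intro hJ₀T θ hθ hne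
      rw [inf_eq_right.2 (sup_le hK.le hJ₀T)] at hθ hne ⊢
      have hST : K ⊔ J₀ ≤ T := sup_le hK.le hJ₀T
      have hirr : Irr (K ⊔ J₀) (res (K ⊔ J₀) χ) := Irr.res_of_le hχ.1 hs.irr le_sup_left hST
      rw [← ip_res_left] at hne
      rw [← hirr.eq_of_ip_ne_zero hθ hne, dg_res]
      exact ⟨dvd_rfl, fun g hg => by rw [dt_res hg]; exact hdt g (hST hg)⟩
    | @head J J₁ hJ hJ₁ ih =>
      intro hJ₀J ζ hζ hne
      set Y := J ⊓ (K ⊔ J₀) with hYdef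
      set X := J₁ ⊓ (K ⊔ J₀) with hXdef
      have hJT : J ≤ T := hJ.le.trans (Subn.le hJ₁)
      have hJ₁T : J₁ ≤ T := Subn.le hJ₁
      have hYX : Nrm Y X := ⟨inf_le_inf_right _ hJ.le, fun x hx n hn =>
        ⟨hJ.2 x hx.1 n hn.1, (K ⊔ J₀).mul_mem ((K ⊔ J₀).mul_mem hx.2 hn.2) ((K ⊔ J₀).inv_mem hx.2)⟩⟩
      have hXT : X ≤ T := inf_le_left.trans hJ₁T
      obtain ⟨ξ, hξ, h1, h2⟩ := exists_between hχ.1 hXT hYX.le hne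
      obtain ⟨hd, hdet⟩ := ih (hJ₀J.trans hJ.le) ξ hξ h1
      have hdζ := dg_constituent hYX hξ hζ h2
      refine ⟨(dg_constituent_dvd hYX hξ hζ h2).trans hd, fun g hg => ?_⟩
      have hYT : Y ≤ T := hYX.le.trans hXT
      have hsub : Subn (Y ⊓ K) K := by
        have h3 : Y ⊓ K = J ⊓ K := by
          rw [hYdef, inf_assoc, inf_eq_right.2 (le_sup_left : K ≤ K ⊔ J₀)]
        rw [h3]
        have := Subn.inf (Relation.ReflTransGen.head hJ hJ₁) K
        rwa [inf_eq_right.2 hK.le] at this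
      have hν : ∀ n ∈ Y ⊓ K, dt ζ n ^ b = 1 := fun n hn => by
        rw [← dt_res hn ζ, (hζ.1.res inf_le_left).dt_pow_of_constituents (ν := 1) hn, one_pow]
        intro η hη hne'
        rw [ip_res_left] at hne'
        have h3 := ip_chain hχ.1 hYT inf_le_left hζ hη hne hne'
        refine hs.det _ hsub η hη ?_ n hn
        rwa [← ip_res_left, res_res hsub.le, ip_res_left]
      have hconst : ∀ θ, Irr Y θ → ip Y (res Y ξ) θ ≠ 0 → dt θ g ^ b = dt ζ g ^ b := by
        intro θ hθ hne'
        rw [ip_res_left] at hne'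
        obtain ⟨x, hx, rfl⟩ := exists_cj_of_ip_ne_zero hYX hξ hζ hθ h2 hne'
        obtain ⟨k, hk, j, hj, rfl⟩ := mem_sup_of_nrm hK (hJ₀J.trans hJT) hx.2
        have hjY : j ∈ Y := ⟨hJ₀J hj, (le_sup_right : J₀ ≤ K ⊔ J₀) hj⟩
        have hkX : k ∈ X := by
          have := X.mul_mem hx (X.inv_mem (hYX.le hjY))
          rwa [mul_inv_cancel_right] at this
        have hmul : ∀ c ∈ Y ⊓ K, ∀ g ∈ Y, dt ζ (g * c) ^ b = dt ζ g ^ b := fun c hc g hg => by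
          rw [hζ.1.dt_mul hg hc.1, mul_pow, hν c hc, mul_one]
        have h4 : ∀ h ∈ Y, dt ζ (k * h * k⁻¹) ^ b = dt ζ h ^ b := fun h hh => by
          have := hmul (h⁻¹ * (k * h * k⁻¹)) ⟨Y.mul_mem (Y.inv_mem hh) (hYX.2 k hkX h hh), ?_⟩ h hh
          · rwa [mul_inv_cancel_left] at this
          · have : h⁻¹ * (k * h * k⁻¹) = (h⁻¹ * k * h⁻¹⁻¹) * k⁻¹ := by group
            rw [this]
            exact K.mul_mem (hK.2 _ (T.inv_mem (hYT hh)) k hk) (K.inv_mem hk)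
        rw [dt_cj]
        have h5 : k * j * g * (k * j)⁻¹ = k * (j * g * j⁻¹) * k⁻¹ := by group
        rw [h5, h4 _ (Y.mul_mem (Y.mul_mem hjY hg) (Y.inv_mem hjY)), ← dt_cj, hζ.1.cj_eq hjY]
      have h6 := (hξ.1.res hYX.le).dt_pow_of_constituents hg hconst
      rw [dt_res hg, hdet g (hYX.le hg)] at h6
      refine eq_one_of_pow_of_coprime (m := ∑ θ ∈ SubChar.irr Y, mult Y (res Y ξ) θ) (n := a) ?_ h6.symm ?_
      · have h7 : (dg χ).Coprime a := by rw [← dg_res K]; exact hs.cop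
        exact h7.coprime_dvd_left ((Dvd.intro _ hdζ.symm).trans hd)
      · rw [← pow_mul, mul_comm]
        exact hζ.1.dt_ab hab hg
  intro θ hθ hne g hg
  have e : J₀ ⊓ (K ⊔ J₀) = J₀ := inf_eq_left.2 le_sup_right
  have := key J₀ hJ₀ le_rfl
  rw [e] at this
  exact (this θ hθ hne).2 g hg

/-- A character of degree prime to `a` is special if it lies over a special character of a normal
subgroup whose index is prime to `a`. -/
theorem Spec.of_coprime (hab : ExpFac a b G) (hN : Nrm N T) (hα : Irr T α)
    (hs : ∀ θ, Irr N θ → ip N α θ ≠ 0 → Spec a b N θ) (hc : (dg α).Coprime a) {r : ℕ}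
    (hr : r.Coprime a) (hT : ∀ g ∈ T, g ^ r ∈ N) : Spec a b T α := by
  refine ⟨hα, hc, fun J hJ θ hθ hne g hg => ?_⟩
  have hJN : J ⊓ N ≤ N := inf_le_right
  have h1 : ∀ n ∈ J ⊓ N, dt θ n ^ b = 1 := fun n hn => by
    rw [← dt_res hn θ, (hθ.1.res inf_le_left).dt_pow_of_constituents (ν := 1) hn, one_pow]
    intro η hη hne'
    rw [ip_res_left] at hne'
    have h2 := ip_chain hα.1 hJ.le inf_le_left hθ hη hne hne'
    obtain ⟨ω, hω, h3, h4⟩ := exists_between hα.1 hN.le hJN h2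
    refine (hs ω hω h3).det _ ?_ η hη h4 n hn
    have := hJ.inf N
    rwa [inf_eq_right.2 hN.le] at this
  have h2 : dt θ (g ^ r) ^ b = 1 := h1 _ ⟨J.pow_mem hg _, hT g (hJ.le hg)⟩
  have h3 := hθ.1.lin_dt.pow_apply hg r
  rw [res_of_mem hg, res_of_mem (J.pow_mem hg r)] at h3
  rw [h3, ← pow_mul, mul_comm, pow_mul] at h2
  have h4 := hθ.1.dt_ab hab hg
  rw [mul_comm, pow_mul] at h4
  exact eq_one_of_pow_of_coprime hr h2 h4

end

section

variable {G : Type} [Group G] [Fintype G] {E H J J₀ K N L S T U X Y : Subgroup G} {f k θ χ ψ l β α ξ ζ c c' τ ρ : G → ℂ} {g : G}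
  {a b p : ℕ}

/-! ### Extending special characters -/

theorem Lin.ext' (hl : Lin H l) {l' : G → ℂ} (hl' : Lin H l') (h : ∀ g ∈ H, l g = l' g) : l = l' := by
  ext g
  by_cases hg : g ∈ H
  · exact h g hg
  · rw [hl.supp g hg, hl'.supp g hg]

theorem Lin.eq_tr (hl : Lin H l) (h : ∀ g ∈ H, l g = 1) : l = tr H :=
  hl.ext' (tr_lin H) fun g hg => by rw [h g hg, tr_of_mem hg]

theorem Lin.eq_tr_of_coprime (hl : Lin H l) {m n : ℕ} (hmn : m.Coprime n) (h : ∀ g ∈ H, l g ^ m = 1)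
    (h' : ∀ g ∈ H, l g ^ n = 1) : l = tr H :=
  hl.eq_tr fun g hg => eq_one_of_pow_of_coprime hmn (h g hg) (h' g hg)

theorem Lin.pow_of_trv (hl : Lin H l) (hN : Trv N l) {n : ℕ} (h : ∀ x ∈ H, x ^ n ∈ N) :
    ∀ g ∈ H, l g ^ n = 1 := fun g hg => by
  rw [← hl.pow_apply hg, hN.apply_mem (h g hg), hl.one]

theorem Irr.mul_lin_eq (hτ : Irr H τ) (hl : Lin H l) (h : τ * l = τ) : ∀ g ∈ H, l g ^ dg τ = 1 := by
  intro g hg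
  have h1 := hτ.1.dt_mul_lin hl hg
  rw [h] at h1
  have h2 : dt τ g ≠ 0 := by
    have := hτ.1.lin_dt.ne_zero' hg
    rwa [res_of_mem hg] at this
  exact mul_left_cancel₀ h2 (by rw [← h1, mul_one])

theorem ip_self_of_stab (hN : Nrm N H) (hab : ∀ x ∈ H, ∀ y ∈ H, x * y * x⁻¹ * y⁻¹ ∈ N)
    (hχ : Irr H χ) (h : ∀ ρ, Lin H ρ → Trv N ρ → χ * ρ = χ → ρ = tr H) : ip N χ χ = 1 := by
  set R := ind N H (tr N) with hR
  have hRc : Chr H R := (tr_lin N).chr.ind hN.le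
  have h1 : ip N χ χ = ip H (R * χ) χ := by
    rw [hR, ← ind_mul_res (tr_lin N).supp fun x hx g => hχ.1.cls hx g, Chr.frob _ hN.le hχ.1,
      tr_mul_of_supp fun g hg => res_of_notMem hg, ip_res_left]
    exact (tr_lin N).chr.mul (hχ.1.res hN.le)
  rw [h1, hRc.decomp, Finset.sum_mul, ip_sum_left, Finset.sum_eq_single (tr H)]
  · rw [smul_mul_assoc, ip_smul_left, tr_mul_of_supp fun g hg => hχ.1.supp hg, hχ.2, mul_one, hR,
      ip_ind_tr hN (tr_lin H).chr, ip_comm]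
    exact (Trv.ip_tr fun n hn g => by
      simp only [tr, SubChar.res, Subgroup.mul_mem_cancel_right _ (hN.le hn), Pi.one_apply]).trans (tr_lin H).one
  · intro ρ hρ hne
    rw [smul_mul_assoc, ip_smul_left]
    by_cases h0 : ip H R ρ = 0
    · rw [h0, zero_mul]
    · have hρi := mem_irr.mp hρ
      have ht := trv_of_mem_ind_tr hN hρi h0
      have hl := hρi.lin_of_trv ht hab
      rw [mul_comm ρ, (hχ.mul_lin hl).ip_of_ne hχ (fun h' => hne (h ρ hl ht h')), mul_zero]
  · intro h
    exact absurd (mem_irr.mpr (tr_lin H).irr) h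

/-- A character of degree prime to `a` restricts irreducibly to a normal subgroup with abelian quotient
of exponent dividing `a`. -/
theorem Irr.res_of_abelian (hN : Nrm N H) (hab : ∀ x ∈ H, ∀ y ∈ H, x * y * x⁻¹ * y⁻¹ ∈ N)
    (ha : ∀ x ∈ H, x ^ a ∈ N) (hτ : Irr H τ) (hc : (dg τ).Coprime a) : Irr N (SubChar.res N τ) := by
  refine ⟨hτ.1.res hN.le, ?_⟩
  rw [ip_res_left, ip_res_right]
  exact ip_self_of_stab hN hab hτ fun ρ hl ht h =>
    hl.eq_tr_of_coprime hc (hτ.mul_lin_eq hl h) (hl.pow_of_trv ht ha)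

theorem extension_unique (hN : Nrm N H) (hc : Irr H c) (hc' : Irr H c') (hr : Irr N (res N c))
    (he : res N c' = res N c) (ha : ∀ x ∈ H, x ^ a ∈ N) (hd : (dg c).Coprime a) (hab : a.Coprime b)
    (h : ∀ g ∈ H, dt c g ^ b = 1) (h' : ∀ g ∈ H, dt c' g ^ b = 1) : c' = c := by
  obtain ⟨ρ, hρ, ht, hcρ⟩ := gallagher hN hc hr hc' (by
    rw [← ip_res_left, he, hr.2]; exact one_ne_zero)
  have h1 : ρ 1 = 1 := by
    have h2 : c' 1 = c 1 := by
      rw [← res_of_mem (f := c') N.one_mem, he, res_of_mem N.one_mem]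
    rw [hcρ, Pi.mul_apply] at h2
    exact mul_left_cancel₀ hc.apply_one_ne_zero (by rw [h2, mul_one])
  have hl := hρ.1.lin h1
  have : ρ = tr H := by
    refine hl.eq_tr_of_coprime (m := dg c * b) (Nat.Coprime.mul_left hd hab.symm) (fun g hg => ?_)
      (hl.pow_of_trv ht ha)
    have h2 := h' g hg
    rwa [hcρ, hc.1.dt_mul_lin hl hg, mul_pow, h g hg, one_mul, ← pow_mul] at h2
  rw [hcρ, this, mul_comm, tr_mul_of_supp fun g hg => hc.1.supp hg]

theorem res_mul_nd_inv (hab : ExpFac a b G) (hN : N ≤ H) (hd : (dg χ).Coprime a)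
    (h : ∀ g ∈ N, dt χ g ^ b = 1) : res N (χ * (nd a b H χ)⁻¹) = res N χ := by
  have h1 : res N (nd a b H χ) = tr N := by
    rw [← nd_res hN, nd_eq_tr hab (by rwa [dg_res]) fun g hg => by rw [dt_res hg]; exact h g hg]
  ext g
  by_cases hg : g ∈ N
  · have := congrFun h1 g
    rw [res_of_mem hg, tr_of_mem hg] at this
    rw [res_of_mem hg, res_of_mem hg, Pi.mul_apply, Pi.inv_apply, this, inv_one, mul_one]
  · rw [res_of_notMem hg, res_of_notMem hg]

theorem exists_prime_step {n : ℕ} {y : G} (hy : y ∉ X) (hn : y ^ p ^ n ∈ X) :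
    ∃ i : ℕ, y ^ i ∉ X ∧ (y ^ i) ^ p ∈ X := by
  induction n generalizing y with
  | zero => simp_all
  | succ n ih =>
    by_cases h : y ^ p ∈ X
    · exact ⟨1, by simpa using hy, by simpa using h⟩
    · obtain ⟨i, h1, h2⟩ := ih h (by rwa [← pow_mul, ← pow_succ'])
      exact ⟨p * i, by rwa [pow_mul], by rwa [pow_mul]⟩

theorem card_sup_zpowers (hp : p.Prime) (hX : Nrm X L) {x : G} (hx : x ∈ L) (hxX : x ∉ X)
    (hxp : x ^ p ∈ X) : Nat.card ↥(X ⊔ Subgroup.zpowers x) = p * Nat.card X := by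
  set X' := X ⊔ Subgroup.zpowers x with hX'
  have hzL : Subgroup.zpowers x ≤ L := (Subgroup.zpowers_le).2 hx
  have hXX' : X ≤ X' := le_sup_left
  have hX'L : X' ≤ L := sup_le hX.le hzL
  have hxX' : x ∈ X' := (le_sup_right : _ ≤ X') (Subgroup.mem_zpowers x)
  have hn : (X.subgroupOf X').Normal := ⟨fun n hn y => hX.2 y (hX'L y.2) n hn⟩
  let q : X' ⧸ X.subgroupOf X' := QuotientGroup.mk ⟨x, hxX'⟩
  have hq : orderOf q = p := by
    have := Fact.mk hp
    refine orderOf_eq_prime ?_ ?_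
    · exact (QuotientGroup.eq_one_iff _).2 hxp
    · exact fun h => hxX ((QuotientGroup.eq_one_iff (N := X.subgroupOf X') ⟨x, hxX'⟩).1 h)
  have hgen : ∀ y, y ∈ Subgroup.zpowers q := by
    intro y
    induction y using QuotientGroup.induction_on with
    | H y =>
      obtain ⟨y, hy⟩ := y
      obtain ⟨k, hk, _, hz, rfl⟩ := mem_sup_of_nrm hX hzL hy
      obtain ⟨i, rfl⟩ := Subgroup.mem_zpowers_iff.1 hz
      refine Subgroup.mem_zpowers_iff.2 ⟨i, ?_⟩
      change ((((⟨x, hxX'⟩ : X') ^ i : X')) : X' ⧸ X.subgroupOf X') = _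
      refine QuotientGroup.eq.2 ?_
      have h1 : (x ^ i)⁻¹ * (k * x ^ i) = (x ^ i)⁻¹ * k * (x ^ i)⁻¹⁻¹ := by group
      show (x ^ i)⁻¹ * (k * x ^ i) ∈ X
      rw [h1]
      exact hX.2 _ (L.inv_mem (L.zpow_mem hx i)) k hk
  have h1 := orderOf_eq_card_of_forall_mem_zpowers hgen
  have h2 := Subgroup.card_mul_index (X.subgroupOf X')
  rw [Subgroup.index, ← h1, hq, Nat.card_congr (Subgroup.subgroupOfEquivOfLe hXX').toEquiv] at h2
  rw [← h2, mul_comm]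

/-- An invariant special character of a normal subgroup with abelian `p`-quotient extends. -/
theorem exists_special_extension (hp : p.Prime) {n : ℕ} (hab : ExpFac (p ^ n) b G) (hS : Nrm S L)
    (hcom : ∀ x ∈ L, ∀ y ∈ L, x * y * x⁻¹ * y⁻¹ ∈ S) (ha : ∀ x ∈ L, x ^ p ^ n ∈ S)
    (hα : Irr S α) (hinv : ∀ x ∈ L, cj x α = α) (hd : (dg α).Coprime p)
    (hdt : ∀ g ∈ S, dt α g ^ b = 1) :
    ∃ c, Irr L c ∧ res S c = α ∧ ∀ g ∈ L, dt c g ^ b = 1 := by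
  have hnrm : ∀ X, S ≤ X → X ≤ L → Nrm X L := fun X h1 h2 => ⟨h2, fun x hx y hy => by
    have := X.mul_mem (h1 (hcom x hx y (h2 hy))) hy
    rwa [inv_mul_cancel_right] at this⟩
  let P : Set (Subgroup G) :=
    {X | S ≤ X ∧ X ≤ L ∧ ∃ c, Irr X c ∧ res S c = α ∧ ∀ g ∈ X, dt c g ^ b = 1}
  have hP : P.Nonempty := ⟨S, le_rfl, hS.le, α, hα, res_of_supp fun g hg => hα.supp hg, hdt⟩
  obtain ⟨X, hXmax⟩ := P.toFinite.exists_maximal hP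
  obtain ⟨hSX, hXL, c, hc, hcα, hcdt⟩ := hXmax.1
  by_cases hXe : X = L
  · subst hXe
    exact ⟨c, hc, hcα, hcdt⟩
  exfalso
  obtain ⟨y, hy, hyX⟩ := SetLike.exists_of_lt (lt_of_le_of_ne hXL hXe)
  obtain ⟨i, hxX, hxp⟩ := exists_prime_step hyX (hSX (ha y hy))
  have hx : y ^ i ∈ L := L.pow_mem hy i
  set x := y ^ i
  have hXn := hnrm X hSX hXL
  set X' := X ⊔ Subgroup.zpowers x with hX'
  have hzL : Subgroup.zpowers x ≤ L := (Subgroup.zpowers_le).2 hx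
  have hXX' : X ≤ X' := le_sup_left
  have hX'L : X' ≤ L := sup_le hXL hzL
  have hxX' : x ∈ X' := (le_sup_right : _ ≤ X') (Subgroup.mem_zpowers x)
  have hSnX := hS.mono hXL hSX
  have hXnX' := hXn.mono hX'L hXX'
  have hdc : (dg c).Coprime p := by rwa [← dg_res S, hcα]
  have hcinv : ∀ z ∈ X', cj z c = c := fun z hz => by
    have hzc := hc.cj_nrm hXnX' hz
    refine extension_unique hSnX hc hzc (by rwa [hcα]) ?_ (fun x hx => ha x (hXL hx))
      (hdc.pow_right n) hab.cop hcdt fun g hg => ?_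
    · rw [hcα]
      conv_rhs => rw [← hinv z (hX'L hz), ← hcα]
      ext g
      by_cases hg : g ∈ S
      · rw [res_of_mem hg, cj, cj, res_of_mem (hS.2 z (hX'L hz) g hg)]
      · rw [res_of_notMem hg, cj, res_of_notMem fun h => hg ((hS.mem_iff (hX'L hz) g).2 h)]
    · rw [dt_cj]
      exact hcdt _ (hXnX'.2 z hz g hg)
  obtain ⟨χ, hχ, hχne⟩ := (hc.1.ind hXX').exists_constituent (ind_ne_zero hc)
  rw [hc.1.frob hXX' hχ.1, ip_comm] at hχne
  have hres := res_of_invariant hXnX' hχ hc hχne hcinv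
  have hcom' : ∀ x ∈ X', ∀ y ∈ X', x * y * x⁻¹ * y⁻¹ ∈ X := fun x hx y hy =>
    hSX (hcom x (hX'L hx) y (hX'L hy))
  obtain ⟨e, he⟩ := hχ.1.ip_nat_res hXX' hc.1
  have hXc := card_ne_zero' X
  have hss : ip X χ χ = (e : ℂ) ^ 2 := by
    rw [← ip_res_left, ← ip_res_right, hres, ip_smul_left, ip_smul_right, hc.2, he]; ring
  have hstab : ∀ ρ, Lin X' ρ → Trv X ρ → χ * ρ = χ → ρ = tr X' := by
    intro ρ hρ hρX hfix
    by_contra hne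
    have hρx : ∀ g ∈ X', g ∉ X → ρ g ≠ 1 := fun g hg hgX h1 => by
      obtain ⟨j, hj, hjp⟩ := exists_prime_step hgX (hSX (ha g (hX'L hg)))
      have hgj : g ^ j ∈ X' := X'.pow_mem hg j
      have h2 : X ⊔ Subgroup.zpowers (g ^ j) = X' := by
        refine Subgroup.eq_of_le_of_card_ge (sup_le hXX' ((Subgroup.zpowers_le).2 hgj)) ?_
        rw [card_sup_zpowers hp hXn (hX'L hgj) hj hjp, card_sup_zpowers hp hXn hx hxX hxp]
      let Kρ : Subgroup G :=
        { carrier := {h | h ∈ X' ∧ ρ h = 1}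
          one_mem' := ⟨X'.one_mem, hρ.one⟩
          mul_mem' := fun {u v} hu hv => ⟨X'.mul_mem hu.1 hv.1, by
            rw [hρ.mul u hu.1 v hv.1, hu.2, hv.2, one_mul]⟩
          inv_mem' := fun {u} hu => ⟨X'.inv_mem hu.1, by rw [hρ.inv_apply hu.1, hu.2, inv_one]⟩ }
      have h3 : X' ≤ Kρ := by
        rw [← h2]
        refine sup_le (fun u hu => ⟨hXX' hu, ?_⟩) ((Subgroup.zpowers_le).2 ⟨hgj, ?_⟩)
        · rw [hρX.apply_mem hu, hρ.one]
        · rw [hρ.pow_apply hg, h1, one_pow]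
      exact hne (hρ.eq_tr fun u hu => (h3 hu).2)
    have hvan : ∀ g ∉ X, χ g = 0 := fun g hg => by
      by_cases hg' : g ∈ X'
      · have h1 := congrFun hfix g
        rw [Pi.mul_apply] at h1
        by_contra h0
        exact hρx g hg' hg (mul_left_cancel₀ h0 (by rw [h1, mul_one]))
      · exact hχ.supp hg'
    have h1 : (Nat.card X' : ℂ) * ip X' χ χ = Nat.card X * ip X χ χ := by
      rw [ip, ip, mul_inv_cancel_left₀ (card_ne_zero' X'), mul_inv_cancel_left₀ hXc]
      refine Finset.sum_congr rfl fun g _ => ?_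
      by_cases hg : g ∈ X
      · rw [if_pos hg, if_pos (hXX' hg)]
      · rw [if_neg hg, hvan g hg, zero_mul, ite_self]
    rw [hχ.2, hss, card_sup_zpowers hp hXn hx hxX hxp] at h1
    have h2 : p = e ^ 2 := by
      have : (p : ℂ) = (e : ℂ) ^ 2 := by
        push_cast at h1
        exact mul_left_cancel₀ hXc (by linear_combination h1)
      exact_mod_cast this
    exact hp.prime.not_isSquare ⟨e, by rw [h2, sq]⟩
  have he1 : e = 1 := by
    have h1 := ip_self_of_stab hXnX' hcom' hχ hstab
    rw [hss] at h1
    have : e ^ 2 = 1 := by exact_mod_cast h1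
    simpa using this
  have hres' : res X χ = c := by rw [hres, he, he1]; simp
  have hd' : (dg χ).Coprime (p ^ n) := by
    rw [← dg_res X, hres']
    exact hdc.pow_right n
  have h3 : X' ∈ P := by
    refine ⟨hSX.trans hXX', hX'L, χ * (nd (p ^ n) b X' χ)⁻¹, hχ.mul_lin (hχ.1.nd_lin _ _).inv', ?_,
      fun g hg => hχ.1.dt_mul_nd_inv hab hd' hg⟩
    rw [← res_res hSX, res_mul_nd_inv hab hXX' hd', hres', hcα]
    intro g hg
    rw [← dt_res hg, hres']
    exact hcdt g hg
  exact hxX (hXmax.2 h3 hXX' hxX')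

end

section

variable {G : Type} [Group G] [Fintype G] {E H J J₀ K N L M S T U X Y D : Subgroup G} {g : G}
  {a b p n m : ℕ}

/-! ### Chief factors of `p`-solvable groups -/

theorem mem_of_pow_coprime (hab : a.Coprime b) (h1 : g ^ a ∈ H) (h2 : g ^ b ∈ H) : g ∈ H := by
  have h : ((1 : ℕ) : ℤ) = a * a.gcdA b + b * a.gcdB b := by
    rw [← Nat.gcd_eq_gcd_ab, hab]
  have h3 : g = (g ^ a) ^ a.gcdA b * (g ^ b) ^ a.gcdB b := by
    rw [← zpow_natCast, ← zpow_natCast, ← zpow_mul, ← zpow_mul, ← zpow_add, ← h]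
    simp
  rw [h3]
  exact H.mul_mem (H.zpow_mem h1 _) (H.zpow_mem h2 _)

/-- `X` is normal in `Y` with quotient of exponent dividing `a` or `b`. -/
def Step (a b : ℕ) (X Y : Subgroup G) : Prop :=
  Nrm X Y ∧ ((∀ g ∈ Y, g ^ a ∈ X) ∨ ∀ g ∈ Y, g ^ b ∈ X)

theorem Nrm.mul_pow_mem (hS : Nrm S L) {s y : G} (hs : s ∈ S) (hy : y ∈ L) (k : ℕ) :
    (s * y) ^ k * (y ^ k)⁻¹ ∈ S := by
  induction k with
  | zero => simp
  | succ k ih =>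
    have : (s * y) ^ (k + 1) * (y ^ (k + 1))⁻¹ =
        s * (y * ((s * y) ^ k * (y ^ k)⁻¹) * y⁻¹) := by
      rw [pow_succ', pow_succ']; group
    rw [this]
    exact S.mul_mem hs (hS.2 y hy _ ih)

theorem Step.sup (h : Step a b X Y) (hS : Nrm S L) (hYL : Y ⊓ L ⊔ S = L) :
    Step a b (X ⊓ L ⊔ S) L := by
  set d := X ⊓ L ⊔ S with hd
  have hdL : d ≤ L := sup_le inf_le_right hS.le
  have hSd : S ≤ d := le_sup_right
  have hXd : X ⊓ L ≤ d := le_sup_left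
  have hmem : ∀ g ∈ L, ∃ s ∈ S, ∃ y ∈ Y ⊓ L, g = s * y := fun g hg => by
    rw [← hYL, sup_comm] at hg
    exact mem_sup_of_nrm hS inf_le_right hg
  have hconj : ∀ s ∈ S, ∀ x ∈ L, ∃ t ∈ S, s * x * s⁻¹ = t * x := fun s hs x hx =>
    ⟨s * (x * s⁻¹ * x⁻¹), S.mul_mem hs (hS.2 x hx _ (S.inv_mem hs)), by group⟩
  refine ⟨⟨hdL, fun g hg x hx => ?_⟩, ?_⟩
  · obtain ⟨s, hs, y, hy, rfl⟩ := hmem g hg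
    rw [hd, sup_comm] at hx
    obtain ⟨t, ht, x, hxX, rfl⟩ := mem_sup_of_nrm (J := X ⊓ L) hS inf_le_right hx
    have h1 : y * (t * x) * y⁻¹ ∈ d := by
      have : y * (t * x) * y⁻¹ = (y * t * y⁻¹) * (y * x * y⁻¹) := by group
      rw [this]
      exact d.mul_mem (hSd (hS.2 y hy.2 t ht)) (hXd ⟨h.1.2 y hy.1 x hxX.1,
        L.mul_mem (L.mul_mem hy.2 hxX.2) (L.inv_mem hy.2)⟩)
    obtain ⟨u, hu, he⟩ := hconj s hs _ (hdL h1)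
    have : s * y * (t * x) * (s * y)⁻¹ = s * (y * (t * x) * y⁻¹) * s⁻¹ := by group
    rw [this, he]
    exact d.mul_mem (hSd hu) h1
  · have key : ∀ k, (∀ g ∈ Y, g ^ k ∈ X) → ∀ g ∈ L, g ^ k ∈ d := fun k hk g hg => by
      obtain ⟨s, hs, y, hy, rfl⟩ := hmem g hg
      have := d.mul_mem (hSd (hS.mul_pow_mem hs hy.2 k)) (hXd ⟨hk y hy.1, L.pow_mem hy.2 k⟩)
      rwa [inv_mul_cancel_right] at this
    exact h.2.imp (key a) (key b)

/-- The data of a finite `p`-solvable group of exponent dividing `p ^ n * m` with `m` prime to `p`. -/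
structure PSol (p n m : ℕ) (G : Type) [Group G] : Prop where
  hp : p.Prime
  hn : n ≠ 0
  ef : ExpFac (p ^ n) m G
  ser : Relation.ReflTransGen (Step (G := G) (p ^ n) m) ⊥ ⊤

theorem PSol.cop (h : PSol p n m G) : p.Coprime m :=
  (Nat.coprime_pow_left_iff (Nat.pos_of_ne_zero h.hn) _ _).1 h.ef.cop

/-- The subgroup generated by `S` and the elements of `L` of exponent `k` modulo `S`. -/
theorem Nrm.closure_pow (hS : Nrm S H) (hL : Nrm L H) (hSL : S ≤ L) (k : ℕ) :
    ∃ D, Nrm D H ∧ S ≤ D ∧ D ≤ L ∧ (∀ g ∈ L, g ^ k ∈ S → g ∈ D) ∧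
      ∀ E, S ≤ E → (∀ g ∈ L, g ^ k ∈ S → g ∈ E) → D ≤ E := by
  refine ⟨Subgroup.closure {g | g ∈ L ∧ g ^ k ∈ S}, ⟨?_, ?_⟩, ?_, ?_, ?_, ?_⟩
  · exact (Subgroup.closure_le _).2 fun g hg => hL.le hg.1
  · intro x hx y hy
    induction hy using Subgroup.closure_induction with
    | mem y hy =>
      exact Subgroup.subset_closure ⟨hL.2 x hx y hy.1, by rw [conj_pow]; exact hS.2 x hx _ hy.2⟩
    | one => simp
    | mul y z _ _ h1 h2 =>
      have : x * (y * z) * x⁻¹ = (x * y * x⁻¹) * (x * z * x⁻¹) := by group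
      rw [this]
      exact Subgroup.mul_mem _ h1 h2
    | inv y _ h =>
      have : x * y⁻¹ * x⁻¹ = (x * y * x⁻¹)⁻¹ := by group
      rw [this]
      exact Subgroup.inv_mem _ h
  · exact fun s hs => Subgroup.subset_closure ⟨hSL hs, S.pow_mem hs k⟩
  · exact (Subgroup.closure_le _).2 fun g hg => hg.1
  · exact fun g hg h => Subgroup.subset_closure ⟨hg, h⟩
  · exact fun E _ hE => (Subgroup.closure_le _).2 fun g hg => hE g hg.1 hg.2

/-- `L / S` is a `p'`-group, or an abelian `p`-group. -/
def Chief (p n m : ℕ) (S L : Subgroup G) : Prop :=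
  (∀ g ∈ L, g ^ m ∈ S) ∨ ((∀ x ∈ L, ∀ y ∈ L, x * y * x⁻¹ * y⁻¹ ∈ S) ∧ ∀ g ∈ L, g ^ p ^ n ∈ S)

theorem PSol.exists_chief (h : PSol p n m G) (hS : Nrm S H) (hM : Nrm M H) (hSM : S < M) :
    ∃ L, Nrm L H ∧ S < L ∧ L ≤ M ∧ Chief p n m S L := by
  obtain ⟨L, hLmin⟩ := Set.Finite.exists_minimal (s := {L : Subgroup G | Nrm L H ∧ S < L ∧ L ≤ M})
    (Set.toFinite _) ⟨M, hM, hSM, le_rfl⟩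
  obtain ⟨hL, hSL, hLM⟩ := hLmin.1
  refine ⟨L, hL, hSL, hLM, ?_⟩
  have hmin : ∀ D, Nrm D H → S ≤ D → D ≤ L → D = S ∨ D = L := fun D hD h1 h2 => by
    rcases h1.eq_or_lt with h1 | h1
    · exact Or.inl h1.symm
    · exact Or.inr (le_antisymm h2 (hLmin.2 ⟨hD, h1, h2.trans hLM⟩ h2))
  have hSnL := hS.mono hL.le hSL.le
  have hpow : ∀ g : G, (g ^ p ^ n) ^ m = 1 := fun g => by rw [← pow_mul, h.ef.ex]
  have hpow' : ∀ g : G, (g ^ m) ^ p ^ n = 1 := fun g => by rw [← pow_mul, mul_comm, h.ef.ex]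
  obtain ⟨D, hD, hSD, hDL, hD1, hD2⟩ := hS.closure_pow hL hSL.le m
  obtain ⟨D', hD', hSD', hDL', hD1', hD2'⟩ := hS.closure_pow hL hSL.le (p ^ n)
  rcases hmin D' hD' hSD' hDL' with h1 | h1
  · left
    intro g hg
    rw [← h1]
    exact hD1' _ (L.pow_mem hg _) (by rw [hpow']; exact S.one_mem)
  rcases hmin D hD hSD hDL with h2 | h2
  · right
    have hexp : ∀ g ∈ L, g ^ p ^ n ∈ S := fun g hg => by
      rw [← h2]
      exact hD1 _ (L.pow_mem hg _) (by rw [hpow]; exact S.one_mem)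
    refine ⟨?_, hexp⟩
    let Z : Subgroup G :=
      { carrier := {x | x ∈ L ∧ ∀ y ∈ L, x * y * x⁻¹ * y⁻¹ ∈ S}
        one_mem' := ⟨L.one_mem, fun y _ => by simp⟩
        mul_mem' := fun {u v} hu hv => ⟨L.mul_mem hu.1 hv.1, fun y hy => by
          have : u * v * y * (u * v)⁻¹ * y⁻¹ =
            (u * (v * y * v⁻¹ * y⁻¹) * u⁻¹) * (u * y * u⁻¹ * y⁻¹) := by group
          rw [this]
          exact S.mul_mem (hSnL.2 u hu.1 _ (hv.2 y hy)) (hu.2 y hy)⟩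
        inv_mem' := fun {u} hu => ⟨L.inv_mem hu.1, fun y hy => by
          have : u⁻¹ * y * u⁻¹⁻¹ * y⁻¹ = u⁻¹ * (u * y * u⁻¹ * y⁻¹)⁻¹ * u⁻¹⁻¹ := by group
          rw [this]
          exact hSnL.2 _ (L.inv_mem hu.1) _ (S.inv_mem (hu.2 y hy))⟩ }
    have hZ : Nrm Z H := ⟨fun x hx => hL.le hx.1, fun x hx z hz => ⟨hL.2 x hx z hz.1, fun y hy => by
      have h3 := hS.2 x hx _ (hz.2 (x⁻¹ * y * x)
        (by simpa using hL.2 _ (H.inv_mem hx) y hy))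
      have : x * z * x⁻¹ * y * (x * z * x⁻¹)⁻¹ * y⁻¹ =
        x * (z * (x⁻¹ * y * x) * z⁻¹ * (x⁻¹ * y * x)⁻¹) * x⁻¹ := by group
      rwa [this]⟩⟩
    have hSZ : S ≤ Z := fun s hs => ⟨hSL.le hs, fun y hy => by
      have : s * y * s⁻¹ * y⁻¹ = s * (y * s⁻¹ * y⁻¹) := by group
      rw [this]
      exact S.mul_mem hs (hSnL.2 y hy _ (S.inv_mem hs))⟩
    rcases hmin Z hZ hSZ (fun x hx => hx.1) with h3 | h3
    · exfalso
      have hnorm : (S.subgroupOf L).Normal := ⟨fun x hx y => hSnL.2 y y.2 x hx⟩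
      have := Fact.mk h.hp
      have hpg : IsPGroup p (L ⧸ S.subgroupOf L) := fun q => by
        induction q using QuotientGroup.induction_on with
        | H x => exact ⟨n, (QuotientGroup.eq_one_iff (N := S.subgroupOf L) (x ^ p ^ n)).2 (hexp x x.2)⟩
      have hnt : Nontrivial (L ⧸ S.subgroupOf L) := by
        rw [QuotientGroup.nontrivial_iff]
        intro h4
        exact hSL.not_ge (Subgroup.subgroupOf_eq_top.1 h4)
      have := hpg.center_nontrivial
      obtain ⟨⟨q, hq⟩, hq1⟩ := exists_ne (1 : Subgroup.center (L ⧸ S.subgroupOf L))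
      induction q using QuotientGroup.induction_on with
      | H x =>
        have hxZ : (x : G) ∈ Z := ⟨x.2, fun y hy => by
          have h4 := Subgroup.mem_center_iff.1 hq (QuotientGroup.mk ⟨y, hy⟩)
          have h4' : ((⟨y, hy⟩ * x : L) : L ⧸ S.subgroupOf L) = ((x * ⟨y, hy⟩ : L) : _) := h4
          have h5 := QuotientGroup.eq.1 h4'
          have h6 : (y * x : G)⁻¹ * (x * y) ∈ S := h5
          have : (x : G) * y * (x : G)⁻¹ * y⁻¹ = (y * x) * ((y * x : G)⁻¹ * (x * y)) * (y * x)⁻¹ := by group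
          rw [this]
          exact hSnL.2 _ (L.mul_mem hy x.2) _ h6⟩
        rw [h3] at hxZ
        refine hq1 (Subtype.ext ?_)
        exact (QuotientGroup.eq_one_iff (N := S.subgroupOf L) x).2 hxZ
    · exact fun x hx y hy => (h3.symm ▸ hx : x ∈ Z).2 y hy
  · exfalso
    have key : ∀ X, Relation.ReflTransGen (Step (G := G) (p ^ n) m) ⊥ X → X ⊓ L ⊔ S ≠ L := by
      intro X hX
      induction hX with
      | refl =>
        rw [bot_inf_eq, bot_sup_eq]
        exact hSL.ne
      | @tail X Y _ hXY ih =>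
        intro hYL
        have hst := hXY.sup hSnL hYL
        refine ih (le_antisymm hst.1.le ?_)
        have hSd : S ≤ X ⊓ L ⊔ S := le_sup_right
        rcases hst.2 with h3 | h3
        · rw [← h2] at h3 ⊢
          refine hD2 _ (by rwa [h2]) fun g hg hgm => ?_
          refine mem_of_pow_coprime h.ef.cop ?_ (by rw [h2]; exact hSd hgm)
          exact h3 g (by rwa [h2])
        · refine h1.symm.le.trans (hD2' _ hSd fun g hg hgm => ?_)
          exact mem_of_pow_coprime h.ef.cop (hSd hgm) (h3 g hg)
    exact key ⊤ h.ser (by rw [top_inf_eq, sup_eq_left.2 hSL.le])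

end

section

/-! ### A field automorphism acting on roots of unity -/

theorem exists_ringEquiv_of_countable {K C D : Type} [Field K] [Field C] [Field D] [Algebra K C]
    [Algebra K D] [IsAlgClosed C] [IsAlgClosed D] (hK : Cardinal.mk K ≤ Cardinal.aleph0)
    (hC : Cardinal.aleph0 < Cardinal.mk C) (hCD : Cardinal.mk C = Cardinal.mk D) :
    ∃ σ : C ≃+* D, ∀ x, σ (algebraMap K C x) = algebraMap K D x := by
  obtain ⟨s, hs⟩ := exists_isTranscendenceBasis K C
  obtain ⟨t, ht⟩ := exists_isTranscendenceBasis K D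
  have hst : Cardinal.mk s = Cardinal.mk t := by
    rw [← IsAlgClosed.cardinal_eq_cardinal_transcendence_basis_of_aleph0_lt' _ hs hK hC,
      ← IsAlgClosed.cardinal_eq_cardinal_transcendence_basis_of_aleph0_lt' _ ht hK (hCD ▸ hC), hCD]
  obtain ⟨e⟩ := Cardinal.eq.1 hst
  let := IsAlgClosed.isAlgClosure_of_transcendence_basis _ hs
  let := IsAlgClosed.isAlgClosure_of_transcendence_basis _ ht
  let f := (hs.1.aevalEquiv.symm.trans (MvPolynomial.renameEquiv K e)).trans ht.1.aevalEquiv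
  refine ⟨IsAlgClosure.equivOfEquiv C D f.toRingEquiv, fun x => ?_⟩
  have h := IsAlgClosure.equivOfEquiv_algebraMap C D f.toRingEquiv (algebraMap K _ x)
  have h2 : f.toRingEquiv (algebraMap K _ x) = algebraMap K _ x := f.commutes x
  rw [h2] at h
  exact h

theorem exists_galois {N k : ℕ} (hN : N ≠ 0) (hk : k.Coprime N) :
    ∃ σ : ℂ →+* ℂ, ∀ x : ℂ, x ^ N = 1 → σ x = x ^ k := by
  have : NeZero N := ⟨hN⟩
  have : NeZero ((N : ℕ) : ℚ) := ⟨Nat.cast_ne_zero.2 hN⟩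
  let K := CyclotomicField N ℚ
  have : IsCyclotomicExtension {N} ℚ K := CyclotomicField.isCyclotomicExtension N ℚ
  have hirr := Polynomial.cyclotomic.irreducible_rat (Nat.pos_of_ne_zero hN)
  have hζ := IsCyclotomicExtension.zeta_spec N ℚ K
  let τ : K ≃ₐ[ℚ] K := IsCyclotomicExtension.fromZetaAut (hζ.pow_of_coprime k hk) hirr
  have hτ : τ (IsCyclotomicExtension.zeta N ℚ K) = IsCyclotomicExtension.zeta N ℚ K ^ k :=
    IsCyclotomicExtension.fromZetaAut_spec _ hirr
  let i : K →ₐ[ℚ] ℂ := IsAlgClosed.lift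
  have hK : Cardinal.mk K ≤ Cardinal.aleph0 := by
    have := Algebra.IsAlgebraic.cardinalMk_le_max ℚ K
    simpa using this
  have hC : Cardinal.aleph0 < Cardinal.mk ℂ := by
    rw [Cardinal.mk_complex]; exact Cardinal.aleph0_lt_continuum
  obtain ⟨σ, hσ⟩ := @exists_ringEquiv_of_countable K ℂ ℂ _ _ _ (i : K →+* ℂ).toAlgebra
    ((i : K →+* ℂ).comp (τ : K →+* K)).toAlgebra _ _ hK hC rfl
  refine ⟨σ, fun x hx => ?_⟩
  have hiζ : IsPrimitiveRoot (i (IsCyclotomicExtension.zeta N ℚ K)) N :=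
    hζ.map_of_injective i.injective
  obtain ⟨j, -, rfl⟩ := hiζ.eq_pow_of_pow_eq_one hx
  have h1 : σ (i (IsCyclotomicExtension.zeta N ℚ K)) =
      i (τ (IsCyclotomicExtension.zeta N ℚ K)) := hσ _
  rw [hτ, map_pow] at h1
  change σ _ = _
  rw [map_pow, h1, ← pow_mul, ← pow_mul, mul_comm]

variable {G : Type} [Group G] [Fintype G] {E H J J₀ K N L M S T U X Y D : Subgroup G} {g : G}
  {a b p n m : ℕ}

theorem PSol.hm (h : PSol p n m G) : m ≠ 0 := h.ef.hb

theorem PSol.exists_galois (h : PSol p n m G) (hodd : Odd p) :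
    ∃ σ : ℂ →+* ℂ, (∀ x, x ^ m = 1 → σ x = x) ∧ ∀ x, x ^ p ^ n = 1 → σ x = x ^ 2 := by
  have hc := h.ef.cop
  have h2 : (2 : ℕ).Coprime (p ^ n) := (Nat.coprime_two_left.2 hodd).pow_right n
  obtain ⟨k, hk1, hk2⟩ := Nat.chineseRemainder hc 2 1
  have hkc : k.Coprime (p ^ n * m) := by
    refine Nat.Coprime.mul_right ?_ ?_
    · rw [Nat.Coprime, hk1.gcd_eq]; exact h2
    · rw [Nat.Coprime, hk2.gcd_eq]; exact Nat.gcd_one_left _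
  obtain ⟨σ, hσ⟩ := SubChar.exists_galois (mul_ne_zero h.ef.ha h.ef.hb) hkc
  refine ⟨σ, fun x hx => ?_, fun x hx => ?_⟩
  · rw [hσ x (by rw [mul_comm, pow_mul, hx, one_pow]), pow_eq_of_modEq hx hk2, pow_one]
  · rw [hσ x (by rw [pow_mul, hx, one_pow]), pow_eq_of_modEq hx hk1]

/-! ### Relating the series of subgroups -/

theorem mem_of_pow_gcd {c d e : ℕ} (h1 : g ^ c ∈ H) (h2 : g ^ d ∈ H) (he : c.gcd d ∣ e) : g ^ e ∈ H := by
  have h : ((c.gcd d : ℕ) : ℤ) = c * c.gcdA d + d * c.gcdB d := Nat.gcd_eq_gcd_ab c d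
  have h3 : g ^ c.gcd d = (g ^ c) ^ c.gcdA d * (g ^ d) ^ c.gcdB d := by
    rw [← zpow_natCast, ← zpow_natCast, ← zpow_natCast, ← zpow_mul, ← zpow_mul, ← zpow_add, ← h]
  obtain ⟨f, rfl⟩ := he
  rw [pow_mul, h3]
  exact H.pow_mem (H.mul_mem (H.zpow_mem h1 _) (H.zpow_mem h2 _)) f

theorem exists_exponent (hp : p.Prime) (G : Type) [Group G] [Fintype G] :
    ∃ n m, n ≠ 0 ∧ ExpFac (p ^ n) m G := by
  have hc : Nat.card G ≠ 0 := Nat.card_pos.ne'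
  refine ⟨(Nat.card G).factorization p + 1, ordCompl[p] (Nat.card G), by simp, ?_, ?_, ?_, ?_⟩
  · exact (Nat.coprime_ordCompl hp hc).pow_left _
  · exact pow_ne_zero _ hp.ne_zero
  · exact (Nat.ordCompl_pos p hc).ne'
  · intro g
    rw [pow_succ, mul_right_comm, Nat.ordProj_mul_ordCompl_eq_self, pow_mul, pow_card_eq_one',
      one_pow]

theorem dvd_of_isPiNumber_singleton (hp : p.Prime) {c : ℕ} (hpm : p.Coprime m)
    (hc : IsPiNumber {p} c) (hd : c ∣ p ^ n * m) : c ∣ p ^ n := by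
  refine Nat.Coprime.dvd_of_dvd_mul_right ?_ hd
  refine Nat.coprime_of_dvd fun q hq h1 h2 => ?_
  have : q = p := hc q hq h1
  subst this
  exact (hq.coprime_iff_not_dvd.1 hpm) h2

theorem dvd_of_isPiNumber_compl (hp : p.Prime) {c : ℕ}
    (hc : IsPiNumber {p}ᶜ c) (hd : c ∣ p ^ n * m) : c ∣ m := by
  refine Nat.Coprime.dvd_of_dvd_mul_left ?_ hd
  refine (Nat.Coprime.pow_left n ?_).symm
  exact (hp.coprime_iff_not_dvd.2 fun h => hc p hp h rfl)

theorem IsPSolvable.pSol (hp : p.Prime) (h : IsPSolvable p G) : ∃ n m, PSol p n m G := by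
  obtain ⟨n, m, hn, hef⟩ := exists_exponent hp G
  refine ⟨n, m, hp, hn, hef, ?_⟩
  have hpm : p.Coprime m := (Nat.coprime_pow_left_iff (Nat.pos_of_ne_zero hn) _ _).1 hef.cop
  obtain ⟨l, c, h0, hl, hc⟩ := h
  have key : ∀ i : Fin (l + 1), Relation.ReflTransGen (Step (G := G) (p ^ n) m) ⊥ (c i) := by
    intro i
    induction i using Fin.induction with
    | zero => rw [h0]
    | succ i ih =>
      refine ih.tail ?_
      obtain ⟨h1, h2, h3⟩ := hc i
      refine ⟨⟨h1, fun x hx y hy => h2.conj_mem ⟨y, h1 hy⟩ hy ⟨x, hx⟩⟩, ?_⟩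
      have hcard : ∀ g ∈ c i.succ, g ^ Nat.card (↥(c i.succ) ⧸ (c i.castSucc).subgroupOf (c i.succ)) ∈
          c i.castSucc := fun g hg => by
        have := (QuotientGroup.eq_one_iff (N := (c i.castSucc).subgroupOf (c i.succ))
          ((⟨g, hg⟩ : ↥(c i.succ)) ^ Nat.card (↥(c i.succ) ⧸ (c i.castSucc).subgroupOf (c i.succ)))).1
          (by rw [QuotientGroup.mk_pow, pow_card_eq_one'])
        exact this
      have hall : ∀ g : G, g ^ (p ^ n * m) ∈ c i.castSucc := fun g => by
        rw [hef.ex]; exact one_mem _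
      rcases h3 with h3 | h3
      · refine Or.inl fun g hg => mem_of_pow_gcd (hcard g hg) (hall g) ?_
        exact dvd_of_isPiNumber_singleton hp hpm (fun q hq hd => h3 q hq (hd.trans (Nat.gcd_dvd_left _ _)))
          (Nat.gcd_dvd_right _ _)
      · refine Or.inr fun g hg => mem_of_pow_gcd (hcard g hg) (hall g) ?_
        exact dvd_of_isPiNumber_compl hp (fun q hq hd => h3 q hq (hd.trans (Nat.gcd_dvd_left _ _)))
          (Nat.gcd_dvd_right _ _)
  rw [← hl]
  exact key _

/-! ### Hall subgroups -/

theorem not_dvd_card_of_pow (hp : p.Prime) (hpm : p.Coprime m) {Q : Type*} [Group Q] [Finite Q]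
    (h : ∀ q : Q, q ^ m = 1) : ¬ p ∣ Nat.card Q := fun hd => by
  have := Fact.mk hp
  obtain ⟨q, hq⟩ := exists_prime_orderOf_dvd_card' p hd
  have := orderOf_dvd_of_pow_eq_one (h q)
  rw [hq] at this
  exact hp.coprime_iff_not_dvd.1 hpm this

/-- `H` is a Hall `p'`-subgroup of `U` modulo `S`. -/
structure Hall (p m : ℕ) (S U H : Subgroup G) : Prop where
  ge : S ≤ H
  le : H ≤ U
  pow : ∀ g ∈ H, g ^ m ∈ S
  card : ∃ k, Nat.card U ∣ Nat.card H * p ^ k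

theorem exists_complement_of_pow (hp : p.Prime) (hpm : p.Coprime m) (hS : Nrm S X) (hL : Nrm L X)
    (hSL : S ≤ L) (hLp : ∀ g ∈ L, g ^ p ^ n ∈ S) (hXm : ∀ g ∈ X, g ^ m ∈ L) :
    ∃ H, S ≤ H ∧ H ≤ X ∧ H ⊓ L = S ∧ ∃ k, Nat.card X = Nat.card H * p ^ k := by
  have := Fact.mk hp
  have hSn : (S.subgroupOf X).Normal := ⟨fun x hx y => hS.2 y y.2 x hx⟩
  have hLn : (L.subgroupOf X).Normal := ⟨fun x hx y => hL.2 y y.2 x hx⟩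
  let q : X →* X ⧸ S.subgroupOf X := QuotientGroup.mk' _
  have hq : Function.Surjective q := QuotientGroup.mk'_surjective _
  have hq1 : ∀ x : X, q x = 1 ↔ (x : G) ∈ S := fun x => QuotientGroup.eq_one_iff x
  let L' := (L.subgroupOf X).map q
  have hL'n : L'.Normal := hLn.map q hq
  have hL'p : IsPGroup p L' := by
    rintro ⟨_, y, hy, rfl⟩
    refine ⟨n, Subtype.ext ?_⟩
    change q y ^ p ^ n = 1
    rw [← map_pow, hq1]
    exact hLp y hy
  obtain ⟨k, hk⟩ := IsPGroup.iff_card.1 hL'p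
  have hind : ¬ p ∣ L'.index := by
    refine not_dvd_card_of_pow hp hpm fun x => ?_
    induction x using QuotientGroup.induction_on with
    | H x =>
      obtain ⟨y, rfl⟩ := hq x
      rw [← QuotientGroup.mk_pow, QuotientGroup.eq_one_iff, ← map_pow]
      exact ⟨y ^ m, hXm y y.2, rfl⟩
  obtain ⟨C, hC⟩ := Subgroup.exists_right_complement'_of_coprime (N := L') (by
    rw [hk]; exact ((hp.coprime_iff_not_dvd.2 hind).pow_left k))
  refine ⟨(C.comap q).map X.subtype, fun s hs => ?_, ?_, ?_, k, ?_⟩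
  · refine ⟨⟨s, hS.le hs⟩, ?_, rfl⟩
    change q _ ∈ C
    rw [(hq1 _).2 hs]
    exact C.one_mem
  · rintro _ ⟨x, -, rfl⟩
    exact x.2
  · refine le_antisymm ?_ (le_inf (fun s hs => ⟨⟨s, hS.le hs⟩, ?_, rfl⟩) hSL)
    · rintro _ ⟨⟨x, hx, rfl⟩, hxL⟩
      have h1 := hC.disjoint.le_bot (x := q x) ⟨⟨x, hxL, rfl⟩, hx⟩
      exact (hq1 x).1 h1
    · change q _ ∈ C
      rw [(hq1 _).2 hs]
      exact C.one_mem
  · rw [Subgroup.card_map_of_injective X.subtype_injective, ← hk, ← hC.index_eq_card,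
      ← Subgroup.index_comap_of_surjective C hq, Subgroup.card_mul_index]

theorem PSol.exists_hall (h : PSol p n m G) {S U : Subgroup G} (hS : Nrm S U) :
    ∃ H, Hall p m S U H := by
  by_cases hSU : S = U
  · exact ⟨U, hSU.le, le_rfl, fun g hg => hSU ▸ U.pow_mem hg m, 0, by simp⟩
  obtain ⟨L, hL, hSL, -, hch⟩ := h.exists_chief hS (Nrm.refl U) (lt_of_le_of_ne hS.le hSU)
  have hlt : Nat.card U - Nat.card L < Nat.card U - Nat.card S := by
    have h1 : Nat.card S < Nat.card L := Set.ncard_lt_ncard (s := (S : Set G)) (t := L) hSL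
    have h2 : Nat.card L ≤ Nat.card U := Nat.card_mono (Set.toFinite _) hL.le
    omega
  obtain ⟨X, hX⟩ := h.exists_hall hL
  rcases hch with hch | ⟨-, hch⟩
  · refine ⟨X, hSL.le.trans hX.ge, hX.le, fun g hg => ?_, hX.card⟩
    have h1 := hch _ (hX.pow g hg)
    refine mem_of_pow_coprime h.ef.cop ?_ h1
    rw [← pow_mul, mul_comm, h.ef.ex]
    exact S.one_mem
  · obtain ⟨H, h1, h2, h3, k, hk⟩ := exists_complement_of_pow h.hp h.cop
      (hS.mono hX.le (hSL.le.trans hX.ge)) (hL.mono hX.le hX.ge) hSL.le hch hX.pow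
    obtain ⟨j, hj⟩ := hX.card
    refine ⟨H, h1, h2.trans hX.le, fun g hg => ?_, k + j, ?_⟩
    · rw [← h3]
      exact ⟨H.pow_mem hg m, hX.pow g (h2 hg)⟩
    · rwa [pow_add, ← mul_assoc, ← hk]
termination_by Nat.card U - Nat.card S

theorem Hall.pow_bot (h : Hall p m ⊥ U H) (hg : g ∈ H) : g ^ m = 1 := h.pow g hg

theorem Hall.dvd_card_inf (h : Hall p m ⊥ U H) (hN : Nrm N U) :
    ∃ k, Nat.card N ∣ Nat.card (H ⊓ N : Subgroup G) * p ^ k := by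
  obtain ⟨k, hk⟩ := h.card
  refine ⟨k, ?_⟩
  have h1 : N ⊔ H ≤ U := sup_le hN.le h.le
  have h2 := card_supplement (H := N ⊔ H) (L := N) (U := H) le_sup_left le_sup_right
    (fun x hx => mem_sup_of_nrm hN h.le hx)
  have h3 := (Subgroup.card_dvd_of_le h1).trans hk
  have hH : 0 < Nat.card H := Nat.card_pos
  refine Nat.dvd_of_mul_dvd_mul_left hH ?_
  rw [← h2, ← mul_assoc, mul_right_comm, mul_comm (Nat.card H * p ^ k)]
  rw [mul_comm (Nat.card (N ⊔ H : Subgroup G))]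
  exact Nat.mul_dvd_mul_left _ h3

/-- A Hall subgroup covers the `p'`-factors. -/
theorem Hall.covers (hp : p.Prime) (hpm : p.Coprime m) (h : Hall p m ⊥ U H) (hN : Nrm N U) (hK : Nrm K N)
    (hKN : ∀ g ∈ N, g ^ m ∈ K) : ∀ g ∈ N, ∃ k ∈ K, ∃ x ∈ H ⊓ N, g = k * x := by
  have hKn : (K.subgroupOf N).Normal := ⟨fun x hx y => hK.2 y y.2 x hx⟩
  have hle : K ⊔ H ⊓ N ≤ N := sup_le hK.le inf_le_right
  have heq : K ⊔ H ⊓ N = N := by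
    refine Subgroup.eq_of_le_of_card_ge hle ?_
    obtain ⟨k, hk⟩ := h.dvd_card_inf hN
    have hc := Subgroup.card_mul_index (K.subgroupOf N)
    have hp' : ¬ p ∣ (K.subgroupOf N).index := not_dvd_card_of_pow hp hpm fun q => by
      induction q using QuotientGroup.induction_on with
      | H x => exact (QuotientGroup.eq_one_iff (N := K.subgroupOf N) (x ^ m)).2 (hKN x x.2)
    have e1 : Nat.card (K.subgroupOf N) = Nat.card K :=
      Nat.card_congr (Subgroup.subgroupOfEquivOfLe hK.le).toEquiv
    rw [e1] at hc
    obtain ⟨d, hd⟩ := Subgroup.card_dvd_of_le (le_sup_left : K ≤ K ⊔ H ⊓ N)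
    have h4 : Nat.card N ∣ Nat.card (K ⊔ H ⊓ N : Subgroup G) * p ^ k :=
      hk.trans (Nat.mul_dvd_mul_right (Subgroup.card_dvd_of_le le_sup_right) _)
    rw [← hc, hd, mul_assoc] at h4
    have h5 := Nat.dvd_of_mul_dvd_mul_left Nat.card_pos h4
    have h6 : (K.subgroupOf N).index ∣ d :=
      Nat.Coprime.dvd_of_dvd_mul_right ((hp.coprime_iff_not_dvd.2 hp').symm.pow_right k) h5
    rw [← hc, hd]
    refine Nat.mul_le_mul_left _ (Nat.le_of_dvd ?_ h6)
    refine Nat.pos_of_ne_zero fun h0 => ?_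
    rw [h0, mul_zero] at hd
    exact Nat.card_pos.ne' hd
  intro g hg
  rw [← heq] at hg
  exact mem_sup_of_nrm hK inf_le_right hg

theorem Hall.inf_eq (hab : (p ^ n).Coprime m) (h : Hall p m ⊥ U H) (hKN : K ≤ N) (hN : ∀ g ∈ N, g ^ p ^ n ∈ K) :
    H ⊓ N = H ⊓ K := by
  refine le_antisymm (fun g hg => ⟨hg.1, ?_⟩) (inf_le_inf_left _ hKN)
  refine mem_of_pow_coprime hab (hN g hg.2) ?_
  rw [h.pow_bot hg.1]
  exact K.one_mem

end

section

variable {G : Type} [Group G] [Fintype G] {E H J K M N L S T U X Y : Subgroup G} {f k θ χ ψ l β α ξ ζ ω η : G → ℂ} {g : G}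
  {a b p m n : ℕ}

/-! ### Restriction of special characters to a Hall subgroup -/

theorem Spec.cj (h : Spec a b H f) {x : G} (hK : ∀ g, g ∈ K ↔ x * g * x⁻¹ ∈ H) :
    Spec a b K (cj x f) := by
  refine ⟨h.irr.cj hK, by rw [dg_cj]; exact h.cop, fun J hJ θ hθ hne g hg => ?_⟩
  let c : Subgroup G → Subgroup G := fun Y => Y.comap (MulAut.conj x⁻¹).toMonoidHom
  have hc : ∀ Y : Subgroup G, ∀ g, g ∈ c Y ↔ x⁻¹ * g * x⁻¹⁻¹ ∈ Y := fun _ _ => Iff.rfl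
  have hcH : c K = H := by
    ext g
    rw [hc, hK]
    group
  have hsub : Subn (c J) H := by
    rw [← hcH]
    unfold Subn at hJ ⊢
    refine hJ.lift c (fun A B hAB => ?_)
    refine ⟨fun g hg => hAB.1 hg, fun g hg k hk => ?_⟩
    rw [hc] at hg hk ⊢
    have := hAB.2 _ hg _ hk
    group at this ⊢
    exact this
  have h1 := h.det (c J) hsub (SubChar.cj x⁻¹ θ) (hθ.cj (hc J)) (by
    have := ip_cj (hc J) (SubChar.cj x f) θ
    rw [cj_cj, mul_inv_cancel, cj_one] at this
    rwa [this]) (x * g * x⁻¹) (by rw [hc]; group; exact hg)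
  rw [dt_cj] at h1
  group at h1
  exact h1

theorem Spec.galois (h : Spec a b H f) (σ : ℂ →+* ℂ) : Spec a b H (σ ∘ f) := by
  refine ⟨h.irr.galois σ, by rw [dg_galois h.irr.1]; exact h.cop, fun J hJ θ hθ hne g hg => ?_⟩
  have h1 : ∃ θ', Irr J θ' ∧ ip J f θ' ≠ 0 ∧ θ = σ ∘ θ' := by
    have hd := (h.irr.1.res hJ.le).decomp
    have he : res J (σ ∘ f) = σ ∘ res J f := by
      ext g
      by_cases hg : g ∈ J
      · simp [res_of_mem hg]
      · simp [res_of_notMem hg]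
    have h2 : σ ∘ res J f = ∑ θ' ∈ SubChar.irr J, σ (ip J f θ') • (σ ∘ θ') := by
      conv_lhs => rw [hd]
      ext g
      simp [ip_res_left]
    rw [← ip_res_left, he, h2, ip_sum_left] at hne
    obtain ⟨θ', hθ', h3⟩ := Finset.exists_ne_zero_of_sum_ne_zero hne
    rw [ip_smul_left] at h3
    refine ⟨θ', mem_irr.1 hθ', fun h0 => h3 (by rw [h0]; simp), ?_⟩
    exact (((mem_irr.1 hθ').galois σ).eq_of_ip_ne_zero hθ (right_ne_zero_of_mul h3)).symm
  obtain ⟨θ', hθ', hne', rfl⟩ := h1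
  rw [hθ'.1.dt_galois hg, ← map_pow, h.det J hJ θ' hθ' hne' g hg, map_one]

theorem ip_ind_self (hS : Nrm S L) (hω : Irr S ω) :
    ip L (ind S L ω) (ind S L ω) = (Nat.card (stab L ω) : ℂ) / Nat.card S := by
  rw [hω.1.frob hS.le (hω.1.ind hS.le), ip_comm]
  have : ip S (ind S L ω) ω = (Nat.card S : ℂ)⁻¹ * ∑ x : G, if x ∈ stab L ω then 1 else 0 := by
    rw [funext (ind_nrm_apply ω), show (fun g => (Nat.card S : ℂ)⁻¹ *
      (∑ x : G, if x ∈ L then SubChar.cj x ω else 0) g) =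
      (Nat.card S : ℂ)⁻¹ • (∑ x : G, if x ∈ L then SubChar.cj x ω else 0) from rfl, ip_smul_left, ip_sum_left]
    congr 1
    refine Finset.sum_congr rfl fun x _ => ?_
    by_cases hx : x ∈ L
    · rw [if_pos hx]
      by_cases hs : cj x ω = ω
      · rw [if_pos (mem_stab.2 ⟨hx, hs⟩), hs, hω.2]
      · rw [if_neg fun h => hs (mem_stab.1 h).2, (hω.cj_nrm hS hx).ip_of_ne hω hs]
    · rw [if_neg hx, if_neg fun h => hx (mem_stab.1 h).1, ip_zero_left]
  rw [this, sum_ite_mem, Finset.sum_const, Finset.card_univ, ← Nat.card_eq_fintype_card]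
  simp [div_eq_inv_mul]

theorem cj_res {x : G} (hK : ∀ g, g ∈ K ↔ x * g * x⁻¹ ∈ K) (f : G → ℂ) :
    cj x (res K f) = res K (cj x f) := by
  ext g
  by_cases hg : g ∈ K
  · rw [res_of_mem hg, cj, res_of_mem ((hK g).1 hg), cj]
  · rw [res_of_notMem hg, cj, res_of_notMem fun h => hg ((hK g).2 h)]

theorem PSol.chief_induction (h : PSol p n m G) (hM : Nrm M H) {P : Subgroup G → Prop} (h0 : P ⊥)
    (hstep : ∀ S L, Nrm S H → Nrm L H → S < L → L ≤ M → Chief p n m S L → P S → P L) : P M := by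
  obtain ⟨S, hS⟩ := Set.Finite.exists_maximal (s := {S : Subgroup G | Nrm S H ∧ S ≤ M ∧ P S})
    (Set.toFinite _) ⟨⊥, Nrm.bot H, bot_le, h0⟩
  rcases hS.1.2.1.eq_or_lt with rfl | hlt
  · exact hS.1.2.2
  · obtain ⟨L, hL, hSL, hLM, hch⟩ := h.exists_chief hS.1.1 hM hlt
    exact absurd (hS.2 ⟨hL, hLM, hstep S L hS.1.1 hL hSL hLM hch hS.1.2.2⟩ hSL.le) (not_le_of_gt hSL)

/-- Restriction to a Hall `p'`-subgroup is irreducible and injective on `p'`-special characters. -/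
theorem PSol.spec_hall (h : PSol p n m G) (hH : Hall p m ⊥ U H) :
    ∀ ω, Spec (p ^ n) m U ω → Irr H (res H ω) ∧ ∀ ω', Spec (p ^ n) m U ω' → res H ω = res H ω' → ω = ω' := by
  have key : ∀ ω, Spec (p ^ n) m U ω → Irr (H ⊓ U) (res (H ⊓ U) ω) ∧
      ∀ ω', Spec (p ^ n) m U ω' → res (H ⊓ U) ω = res (H ⊓ U) ω' → ω = ω' := by
    refine h.chief_induction (Nrm.refl U) (P := fun N => ∀ ω, Spec (p ^ n) m N ω →
      Irr (H ⊓ N) (res (H ⊓ N) ω) ∧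
      ∀ ω', Spec (p ^ n) m N ω' → res (H ⊓ N) ω = res (H ⊓ N) ω' → ω = ω') ?_ ?_
    · intro ω hω
      have : ∀ ω, Spec (p ^ n) m ⊥ ω → res (H ⊓ ⊥) ω = ω := fun ω hω => by
        rw [inf_bot_eq, res_of_supp fun g hg => hω.irr.supp hg]
      refine ⟨by rw [this ω hω, inf_bot_eq]; exact hω.irr, fun ω' hω' he => ?_⟩
      rwa [this ω hω, this ω' hω'] at he
    · intro S L hS hL hSL _ hch ih ω hω
      have hSL' : Nrm S L := hS.mono hL.le hSL.le
      have hYS : H ⊓ S ≤ H ⊓ L := inf_le_inf_left _ hSL.le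
      rcases hch with hch | ⟨hcom, hpow⟩
      · have hcov : ∀ x ∈ L, ∃ k ∈ S, ∃ y ∈ H ⊓ L, x = k * y := hH.covers h.hp h.cop hL hSL' hch
        have hYS' : Nrm (H ⊓ S) (H ⊓ L) :=
          ⟨hYS, fun x hx y hy => ⟨H.mul_mem (H.mul_mem hx.1 hy.1) (H.inv_mem hx.1),
            hSL'.2 x hx.2 y hy.2⟩⟩
        have hmeet : H ⊓ L ⊓ S = H ⊓ S := by rw [inf_assoc, inf_eq_right.2 hSL.le]
        have hover : ∀ ω, Spec (p ^ n) m L ω → ∃ θ, Spec (p ^ n) m S θ ∧ ip S ω θ ≠ 0 := fun ω hω => by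
          obtain ⟨θ, hθ, hne⟩ := hω.irr.exists_constituent hSL.le
          exact ⟨θ, hω.constituent hSL' hθ hne, hne⟩
        have main : ∀ θ, Spec (p ^ n) m S θ →
            (∀ ω, Irr L ω → ip S ω θ ≠ 0 → Irr (H ⊓ L) (res (H ⊓ L) ω)) ∧
            ∀ ω ω', Irr L ω → Irr L ω' → ip S ω θ ≠ 0 → ip S ω' θ ≠ 0 →
              res (H ⊓ L) ω = res (H ⊓ L) ω' → ω = ω' := by
          intro θ hθ
          have hΨ := hθ.irr.1.ind hSL.le
          have hnorm : ip (H ⊓ L) (res (H ⊓ L) (ind S L θ)) (res (H ⊓ L) (ind S L θ)) =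
              ip L (ind S L θ) (ind S L θ) := by
            rw [res_ind_supplement hSL.le inf_le_right hcov hθ.irr.1, hmeet,
              ip_ind_self hYS' (ih θ hθ).1, ip_ind_self hSL' hθ.irr]
            have hst : stab (H ⊓ L) (res (H ⊓ S) θ) = stab L θ ⊓ (H ⊓ L) := by
              ext x
              rw [Subgroup.mem_inf, mem_stab, mem_stab]
              constructor
              · rintro ⟨hx, he⟩
                refine ⟨⟨hx.2, ?_⟩, hx⟩
                refine ((ih θ hθ).2 _ (hθ.cj (hSL'.mem_iff hx.2)) ?_).symm
                rw [← cj_res (hYS'.mem_iff hx), he]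
              · rintro ⟨⟨-, he⟩, hx⟩
                exact ⟨hx, by rw [cj_res (hYS'.mem_iff hx), he]⟩
            have hST := le_stab hSL' hθ.irr.1
            have hc := card_supplement (H := stab L θ) (L := S) (U := stab L θ ⊓ (H ⊓ L)) hST inf_le_left
              fun x hx => by
                obtain ⟨k, hk, y, hy, rfl⟩ := hcov x hx.1
                refine ⟨k, hk, y, ⟨?_, hy⟩, rfl⟩
                have := (stab L θ).mul_mem ((stab L θ).inv_mem (hST hk)) hx
                rwa [inv_mul_cancel_left] at this
            have hm' : stab L θ ⊓ (H ⊓ L) ⊓ S = H ⊓ S := by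
              rw [inf_assoc, hmeet, inf_eq_right]
              exact inf_le_right.trans hST
            rw [hst]
            rw [hm'] at hc
            have h1 := card_ne_zero' S
            have h2 := card_ne_zero' (H ⊓ S)
            field_simp
            rw [mul_comm (Nat.card (H ⊓ S : Subgroup G) : ℂ)]
            exact_mod_cast hc.symm
          have hne : ∀ ω, Irr L ω → ip S ω θ ≠ 0 → ip L (ind S L θ) ω ≠ 0 := fun ω hω hne => by
            rwa [hθ.irr.1.frob hSL.le hω.1, ip_comm]
          obtain ⟨r1, r2⟩ := res_constituents_of_norm hΨ (inf_le_right : H ⊓ L ≤ L) hnorm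
          exact ⟨fun ω hω h0 => r1 ω hω (hne ω hω h0), fun ω ω' hω hω' h0 h0' =>
            r2 ω ω' hω hω' (hne ω hω h0) (hne ω' hω' h0')⟩
        obtain ⟨θ, hθ, hne⟩ := hover ω hω
        refine ⟨(main θ hθ).1 ω hω.irr hne, fun ω' hω' he => ?_⟩
        refine (main θ hθ).2 ω ω' hω.irr hω'.irr hne ?_ he
        have h1 : ip (H ⊓ S) ω' (res (H ⊓ S) θ) ≠ 0 := by
          have h2 : ip (H ⊓ S) ω (res (H ⊓ S) θ) ≠ 0 := by
            refine ip_chain hω.irr.1 hSL.le inf_le_right hθ.irr (ih θ hθ).1 hne ?_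
            rw [← ip_res_left, (ih θ hθ).1.2]
            exact one_ne_zero
          rwa [← ip_res_left, ← res_res hYS, ← he, res_res hYS, ip_res_left]
        obtain ⟨θ', hθ', h2, h3⟩ := exists_between hω'.irr.1 hSL.le inf_le_right h1
        have hθ's := hω'.constituent hSL' hθ' h2
        rw [← ip_res_left] at h3
        rwa [(ih θ hθ).2 θ' hθ's ((ih θ' hθ's).1.eq_of_ip_ne_zero (ih θ hθ).1 h3).symm]
      · have hY : H ⊓ L = H ⊓ S := hH.inf_eq h.ef.cop hSL.le hpow
        have hirr : ∀ ω, Spec (p ^ n) m L ω → Irr S (res S ω) ∧ Spec (p ^ n) m S (res S ω) :=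
          fun ω hω => by
            have h1 := hω.irr.res_of_abelian hSL' hcom hpow hω.cop
            refine ⟨h1, hω.constituent hSL' h1 ?_⟩
            rw [← ip_res_left, h1.2]
            exact one_ne_zero
        have hr : ∀ ω : G → ℂ, res (H ⊓ L) ω = res (H ⊓ S) (res S ω) := fun ω => by
          rw [hY, res_res inf_le_right]
        refine ⟨?_, fun ω' hω' he => ?_⟩
        · rw [hr, hY]
          exact (ih _ (hirr ω hω).2).1
        · rw [hr, hr] at he
          have h1 := (ih _ (hirr ω hω).2).2 _ (hirr ω' hω').2 he
          exact (extension_unique hSL' hω.irr hω'.irr (hirr ω hω).1 h1.symm hpow hω.cop h.ef.cop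
            (fun g hg => hω.dt_pow hg) fun g hg => hω'.dt_pow hg).symm
  rwa [inf_eq_left.2 hH.le] at key

/-- A `p'`-special character is determined by its values on the `p'`-elements. -/
theorem PSol.spec_ext (h : PSol p n m G) (hω : Spec (p ^ n) m U ω) (hη : Spec (p ^ n) m U η)
    (he : ∀ g ∈ U, g ^ m = 1 → ω g = η g) : ω = η := by
  obtain ⟨H, hH⟩ := h.exists_hall (Nrm.bot U)
  refine (h.spec_hall hH ω hω).2 η hη ?_
  ext g
  by_cases hg : g ∈ H
  · rw [res_of_mem hg, res_of_mem hg, he g (hH.le hg) (hH.pow_bot hg)]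
  · rw [res_of_notMem hg, res_of_notMem hg]

theorem PSol.spec_galois (h : PSol p n m G) (hω : Spec (p ^ n) m U ω) {σ : ℂ →+* ℂ}
    (hσ : ∀ x : ℂ, x ^ m = 1 → σ x = x) : σ ∘ ω = ω :=
  h.spec_ext (hω.galois σ) hω fun _ hg hgm => hω.irr.1.galois_apply_eq hg h.hm hgm hσ

end

section

variable {G : Type} [Group G] [Fintype G] {E H J K M N L S T U X Y : Subgroup G} {f k θ χ ψ l β α ξ ζ ω η κ : G → ℂ} {g : G}
  {a b p m n : ℕ}

/-! ### Lifts -/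

/-- The restriction of `χ` to the elements `g` of `H` with `g ^ m = 1` is not the sum of the
restrictions of two nonzero characters. -/
def Lft (m : ℕ) (H : Subgroup G) (χ : G → ℂ) : Prop :=
  ∀ χ₁ χ₂, Chr H χ₁ → Chr H χ₂ → (∀ g ∈ H, g ^ m = 1 → χ g = χ₁ g + χ₂ g) → χ₁ = 0 ∨ χ₂ = 0

theorem Lft.congr (h : Lft m H χ) (he : ∀ g ∈ H, g ^ m = 1 → χ g = ψ g) : Lft m H ψ :=
  fun χ₁ χ₂ h₁ h₂ h' => h χ₁ χ₂ h₁ h₂ fun g hg hgm => (he g hg hgm).trans (h' g hg hgm)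

theorem Lft.irr (h : Lft m H χ) (hχ : Chr H χ) (h0 : χ ≠ 0) : Irr H χ :=
  hχ.irr_of_indecomposable h0 fun χ₁ χ₂ h₁ h₂ he => h χ₁ χ₂ h₁ h₂ fun g _ _ => congrFun he g

theorem Chr.ind_eq_zero (hψ : Chr K ψ) (h : SubChar.ind K H ψ = 0) : ψ = 0 := by
  by_contra hne
  have := congrFun h 1
  rw [ind_one] at this
  simp [hψ.apply_one_ne_zero hne] at this

theorem ind_congr_reg (h : ∀ g ∈ K, g ^ m = 1 → f g = k g) (hf : ∀ g ∉ K, f g = k g) (hg : g ^ m = 1) :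
    ind K H f g = ind K H k g := by
  simp only [ind]
  congr 1
  refine Finset.sum_congr rfl fun x _ => ?_
  split_ifs
  · by_cases hx : x * g * x⁻¹ ∈ K
    · exact h _ hx (by rw [conj_pow, hg]; group)
    · exact hf _ hx
  · rfl

theorem Lft.of_ind (hK : K ≤ H) (hψ : Chr K ψ) (h : Lft m H (ind K H ψ)) : Lft m K ψ := by
  intro χ₁ χ₂ h₁ h₂ he
  have := h _ _ (h₁.ind hK) (h₂.ind hK) fun g hg hgm => by
    rw [← Pi.add_apply, ← ind_add]
    exact ind_congr_reg he (fun g hg => by rw [hψ.supp hg, Pi.add_apply, h₁.supp hg, h₂.supp hg, add_zero]) hgm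
  exact this.imp h₁.ind_eq_zero h₂.ind_eq_zero

theorem Lft.of_mul (hα : Chr H α) (h0 : α ≠ 0) (h : Lft m H (α * β)) : Lft m H β := by
  have key : ∀ χ, Chr H χ → α * χ = 0 → χ = 0 := fun χ hχ he => by
    by_contra hne
    have := congrFun he 1
    rw [Pi.mul_apply] at this
    exact mul_ne_zero (hα.apply_one_ne_zero h0) (hχ.apply_one_ne_zero hne) this
  intro χ₁ χ₂ h₁ h₂ he
  have := h _ _ (hα.mul h₁) (hα.mul h₂) fun g hg hgm => by
    simp only [Pi.mul_apply]
    rw [he g hg hgm, mul_add]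
  exact this.imp (key _ h₁) (key _ h₂)

theorem Lin.eq_one_of_pow (hl : Lin H l) (hab : a.Coprime m) (hla : ∀ g ∈ H, l g ^ a = 1) (hg : g ∈ H)
    (hgm : g ^ m = 1) : l g = 1 :=
  eq_one_of_pow_of_coprime hab (hla g hg) (by rw [← hl.pow_apply hg, hgm, hl.one])

theorem Irr.spec_bot (hθ : Irr ⊥ θ) (hc : (dg θ).Coprime a) : Spec a b (⊥ : Subgroup G) θ := by
  refine ⟨hθ, hc, fun J hJ θ hθ _ g hg => ?_⟩
  rw [Subgroup.mem_bot.1 (hJ.le hg)]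
  have := hθ.1.dt_pow_eq_one J.one_mem one_ne_zero (one_pow 1)
  rw [pow_one] at this
  rw [this, one_pow]

theorem dg_ind_dvd (hK : K ≤ H) (hψ : Chr K ψ) : dg ψ ∣ dg (ind K H ψ) := by
  obtain ⟨c, hc⟩ := Subgroup.card_dvd_of_le hK
  refine ⟨c, dg_eq ?_⟩
  have := card_ne_zero' K
  rw [ind_one, hc, ← hψ.cast_dg]
  push_cast
  field_simp

/-- A lift of degree prime to `p` agrees on `p'`-elements with a `p'`-special character. -/
theorem PSol.exists_spec_of_lft (h : PSol p n m G) {B : Subgroup G} (hκ : Irr B κ) (hl : Lft m B κ)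
    (hd : (dg κ).Coprime (p ^ n)) :
    ∃ γ, Spec (p ^ n) m B γ ∧ ∀ g ∈ B, g ^ m = 1 → κ g = γ g := by
  suffices h' : ∃ κ', Irr B κ' ∧ (dg κ').Coprime (p ^ n) ∧ (∀ g ∈ B, g ^ m = 1 → κ g = κ' g) ∧
      ∀ θ, Irr B θ → ip B κ' θ ≠ 0 → Spec (p ^ n) m B θ by
    obtain ⟨γ, hγ, -, he, hs⟩ := h'
    exact ⟨γ, hs γ hγ (by rw [hγ.2]; exact one_ne_zero), he⟩
  refine h.chief_induction (M := B) (Nrm.refl B) (P := fun N => ∃ κ', Irr B κ' ∧ (dg κ').Coprime (p ^ n) ∧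
    (∀ g ∈ B, g ^ m = 1 → κ g = κ' g) ∧ ∀ θ, Irr N θ → ip N κ' θ ≠ 0 → Spec (p ^ n) m N θ) ?_ ?_
  · refine ⟨κ, hκ, hd, fun _ _ _ => rfl, fun θ hθ hne => hθ.spec_bot ?_⟩
    exact hd.coprime_dvd_left (dg_constituent_dvd (Nrm.bot B) hκ hθ hne)
  · rintro S L hS hL hSL - hch ⟨κ', hκ', hd', he, hs⟩
    have hSL' : Nrm S L := hS.mono hL.le hSL.le
    have hdd : ∀ θ, Irr L θ → ip L κ' θ ≠ 0 → (dg θ).Coprime (p ^ n) := fun θ hθ hne =>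
      hd'.coprime_dvd_left (dg_constituent_dvd hL hκ' hθ hne)
    rcases hch with hch | ⟨hcom, hpow⟩
    · refine ⟨κ', hκ', hd', he, fun θ hθ hne => ?_⟩
      exact Spec.of_coprime h.ef hSL' hθ (fun ω hω hne' => hs ω hω
        (ip_chain hκ'.1 hL.le hSL.le hθ hω hne hne')) (hdd θ hθ hne) (h.cop.symm.pow_right n) hch
    · obtain ⟨τ, hτ, hne⟩ := hκ'.exists_constituent hL.le
      have hτd := hdd τ hτ hne
      have hω := hτ.res_of_abelian hSL' hcom hpow hτd
      have hωs : Spec (p ^ n) m S (res S τ) := hs _ hω (ip_chain hκ'.1 hL.le hSL.le hτ hω hne (by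
        rw [← ip_res_left, hω.2]; exact one_ne_zero))
      obtain ⟨ψ, hψ, h1, h2, h3, -⟩ := clifford_exists hL hκ' hτ hne
      set E := stab B τ with hE
      have hEB : E ≤ B := stab_le
      have hLE : Nrm L E := hL.mono hEB (le_stab hL hτ.1)
      have hψd : (dg ψ).Coprime (p ^ n) := by
        refine hd'.coprime_dvd_left ?_
        rw [← h3]
        exact dg_ind_dvd hEB hψ.1
      have hres := res_of_invariant hLE hψ hτ h1 fun x hx => hx.2
      obtain ⟨e, hee⟩ := hψ.1.ip_nat_res hLE.le hτ.1
      rw [hee] at hres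
      set μ := nd (p ^ n) m E ψ with hμ
      have hμl : Lin E μ := hψ.1.nd_lin _ _
      have hμp : ∀ g ∈ E, μ g ^ p ^ n = 1 := fun g hg => hψ.1.nd_pow h.ef hψd hg
      have hμL : res L μ = nd (p ^ n) m L τ := by
        rw [hμ, ← nd_res hLE.le, hres, hτ.1.nd_nsmul h.ef]
        rwa [← dg_nsmul e hτ.1, ← hres, dg_res]
      have hτ' : Spec (p ^ n) m L (τ * (nd (p ^ n) m L τ)⁻¹) := by
        refine Spec.of_res h.ef hSL' (hτ.mul_lin (hτ.1.nd_lin _ _).inv') ?_ fun g hg =>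
          hτ.1.dt_mul_nd_inv h.ef hτd hg
        rwa [res_mul_nd_inv h.ef hSL.le hτd fun g hg => by rw [← dt_res hg]; exact hωs.dt_pow hg]
      have hψμ : Irr E (ψ * μ⁻¹) := hψ.mul_lin hμl.inv'
      have hval : ∀ g ∈ B, g ^ m = 1 → κ g = ind E B (ψ * μ⁻¹) g := fun g hg hgm => by
        rw [he g hg hgm, ← h3]
        refine ind_congr_reg (fun g hg hgm => ?_) (fun g hg => ?_) hgm
        · rw [Pi.mul_apply, Pi.inv_apply, hμl.eq_one_of_pow h.ef.cop hμp hg hgm, inv_one, mul_one]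
        · rw [Pi.mul_apply, hψ.1.supp hg, zero_mul]
      have hirr : Irr B (ind E B (ψ * μ⁻¹)) := (hl.congr hval).irr (hψμ.1.ind hEB) (ind_ne_zero hψμ)
      have hover : ip L (ind E B (ψ * μ⁻¹)) (τ * (nd (p ^ n) m L τ)⁻¹) ≠ 0 := by
        refine ip_chain hirr.1 hEB hLE.le hψμ hτ'.irr ?_ ?_
        · rw [ip_comm, ← hψμ.1.frob hEB hirr.1, hirr.2]
          exact one_ne_zero
        · rw [← ip_res_left]
          have : res L (ψ * μ⁻¹) = (e : ℂ) • (τ * (nd (p ^ n) m L τ)⁻¹) := by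
            rw [← smul_mul_assoc, ← hres, ← hμL, res_mul]
            ext g
            by_cases hg : g ∈ L <;> simp [res_of_mem, res_of_notMem, hg]
          rw [this, ip_smul_left, hτ'.irr.2, mul_one, ← hee]
          exact h1
      refine ⟨_, hirr, ?_, hval, fun θ hθ hne' => ?_⟩
      · have : dg κ = dg (ind E B (ψ * μ⁻¹)) := by rw [dg, dg, hval 1 B.one_mem (one_pow m)]
        rwa [← this]
      · obtain ⟨x, hx, rfl⟩ := exists_cj_of_ip_ne_zero hL hirr hτ'.irr hθ hover hne'
        exact hτ'.cj (hL.mem_iff hx)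

end

section

variable {G : Type} [Group G] [Fintype G] {G' : Type} [Group G'] [Fintype G']
  {E H J K M N L S T U X : Subgroup G} {f k θ χ ψ l β α ξ ζ ω η κ : G → ℂ} {g : G}
  {φ : G' →* G} {Y Y' Z : Subgroup G'} {a b p m n : ℕ}

/-! ### Pulling back along homomorphisms -/

/-- The pullback of `f` along `φ`, restricted to `Y`. -/
def pb (φ : G' →* G) (Y : Subgroup G') (f : G → ℂ) : G' → ℂ := res Y (f ∘ φ)

theorem pb_of_mem {y : G'} (hy : y ∈ Y) : pb φ Y f y = f (φ y) := res_of_mem hy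

theorem sum_comp_surjective {A B : Type} [Group A] [Fintype A] [Group B] [Fintype B] (ν : A →* B)
    (hν : Function.Surjective ν) (F : B → ℂ) :
    (Nat.card A : ℂ)⁻¹ * ∑ x, F (ν x) = (Nat.card B : ℂ)⁻¹ * ∑ y, F y := by
  have hA : (Nat.card A : ℂ) ≠ 0 := by exact_mod_cast Nat.card_pos.ne'
  have hB : (Nat.card B : ℂ) ≠ 0 := by exact_mod_cast Nat.card_pos.ne'
  have h : ∑ y : B, ∑ x, F (ν x * y) = ∑ x, ∑ y : B, F (ν x * y) := Finset.sum_comm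
  rw [Finset.sum_congr rfl fun y _ => show ∑ x, F (ν x * y) = ∑ x, F (ν x) by
      obtain ⟨x₀, rfl⟩ := hν y
      simpa using Equiv.sum_comp (Equiv.mulRight x₀) fun x => F (ν x),
    Finset.sum_congr rfl fun x _ => show ∑ y, F (ν x * y) = ∑ y, F y from
      Equiv.sum_comp (Equiv.mulLeft (ν x)) F] at h
  simp only [Finset.sum_const, Finset.card_univ, nsmul_eq_mul] at h
  rw [Nat.card_eq_fintype_card] at hA hB ⊢
  rw [Nat.card_eq_fintype_card]
  field_simp
  linear_combination h

theorem ip_pb (φ : G' →* G) (Y : Subgroup G') (f k : G → ℂ) :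
    ip Y (pb φ Y f) (pb φ Y k) = ip (Y.map φ) f k := by
  rw [ip_eq, ip_eq, ← sum_comp_surjective (φ.subgroupMap Y) (φ.subgroupMap_surjective Y)]
  congr 1
  refine Finset.sum_congr rfl fun y _ => ?_
  rw [pb_of_mem y.2, pb_of_mem (y⁻¹).2, Subgroup.coe_inv, map_inv]
  rfl

theorem Chr.pb (hf : Chr (Y.map φ) f) : Chr Y (pb φ Y f) := by
  obtain ⟨n, M, -, hM, -, hMf⟩ := hf.exists_matrix
  refine Chr.of_matrix (fun y => M (φ y)) (fun y hy z hz => ?_) (fun y hy => ?_)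
    fun y hy => res_of_notMem hy
  · rw [map_mul, hM _ (Subgroup.mem_map_of_mem φ hy) _ (Subgroup.mem_map_of_mem φ hz)]
  · rw [pb_of_mem hy, hMf]

theorem Irr.pb (hf : Irr (Y.map φ) f) : Irr Y (pb φ Y f) := ⟨hf.1.pb, by rw [ip_pb, hf.2]⟩

theorem res_pb (h : Y' ≤ Y) : res Y' (pb φ Y f) = pb φ Y' (res (Y'.map φ) f) := by
  ext y
  by_cases hy : y ∈ Y'
  · rw [res_of_mem hy, pb_of_mem (φ := φ) (h hy), pb_of_mem (φ := φ) hy, res_of_mem (Subgroup.mem_map_of_mem φ hy)]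
  · rw [res_of_notMem hy, SubChar.pb, res_of_notMem hy]

theorem dt_pb {y : G'} (hy : y ∈ Y) : dt (pb φ Y f) y = dt f (φ y) := by
  have h : eig (pb φ Y f) y = eig f (φ y) := eig_congr fun j => by
    rw [pb_of_mem (φ := φ) (Y.pow_mem hy j), map_pow]
  rw [dt, dt, h]

theorem dg_pb (φ : G' →* G) (Y : Subgroup G') (f : G → ℂ) : dg (pb φ Y f) = dg f := by
  rw [dg, dg, pb_of_mem Y.one_mem, map_one]

theorem Nrm.map (h : Nrm Y' Y) (φ : G' →* G) : Nrm (Y'.map φ) (Y.map φ) := by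
  refine ⟨Subgroup.map_mono h.le, ?_⟩
  rintro _ ⟨x, hx, rfl⟩ _ ⟨y, hy, rfl⟩
  exact ⟨x * y * x⁻¹, h.2 x hx y hy, by simp⟩

theorem Nrm.comap (h : Nrm N H) (φ : G' →* G) : Nrm (N.comap φ) (H.comap φ) :=
  ⟨Subgroup.comap_mono h.le, fun x hx y hy => by
    rw [Subgroup.mem_comap] at hx hy ⊢
    simpa using h.2 _ hx _ hy⟩

theorem Subn.map (h : Subn Y' Y) (φ : G' →* G) : Subn (Y'.map φ) (Y.map φ) :=
  Relation.ReflTransGen.lift (Subgroup.map φ) (fun _ _ h' => Nrm.map h' φ) _ _ h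

theorem Subn.comap (h : Subn N H) (φ : G' →* G) : Subn (N.comap φ) (H.comap φ) :=
  Relation.ReflTransGen.lift (Subgroup.comap φ) (fun _ _ h' => Nrm.comap h' φ) _ _ h

theorem pb_sum {ι : Type*} (s : Finset ι) (F : ι → G → ℂ) :
    pb φ Y (∑ i ∈ s, F i) = ∑ i ∈ s, pb φ Y (F i) := by
  ext y
  by_cases hy : y ∈ Y
  · simp [pb_of_mem hy]
  · simp [pb, res_of_notMem hy]

theorem pb_smul (c : ℂ) : pb φ Y (c • f) = c • pb φ Y f := by
  ext y
  by_cases hy : y ∈ Y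
  · simp [pb_of_mem hy]
  · simp [pb, res_of_notMem hy]

theorem Chr.exists_eq_pb (hf : Chr (Y.map φ) f) {θ : G' → ℂ} (hθ : Irr Y θ)
    (h : ip Y (SubChar.pb φ Y f) θ ≠ 0) :
    ∃ ζ, Irr (Y.map φ) ζ ∧ ip (Y.map φ) f ζ ≠ 0 ∧ θ = SubChar.pb φ Y ζ := by
  rw [hf.decomp, pb_sum, ip_sum_left] at h
  obtain ⟨ζ, hζ, hne⟩ := Finset.exists_ne_zero_of_sum_ne_zero h
  rw [pb_smul, ip_smul_left] at hne
  have hζ := mem_irr.mp hζ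
  exact ⟨ζ, hζ, left_ne_zero_of_mul hne,
    (hζ.pb.eq_of_ip_ne_zero hθ (right_ne_zero_of_mul hne)).symm⟩

theorem Spec.pb (h : Spec a b (Y.map φ) f) : Spec a b Y (pb φ Y f) := by
  refine ⟨h.irr.pb, by rw [dg_pb]; exact h.cop, fun J hJ θ hθ hne y hy => ?_⟩
  rw [← ip_res_left, res_pb hJ.le] at hne
  obtain ⟨ζ, hζ, hne', rfl⟩ := (h.irr.1.res (hJ.map φ).le).exists_eq_pb hθ hne
  rw [ip_res_left] at hne'
  rw [dt_pb hy]
  exact h.det _ (hJ.map φ) ζ hζ hne' _ (Subgroup.mem_map_of_mem φ hy)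

theorem Spec.of_pb (hf : Irr (Y.map φ) f) (h : Spec a b Y (SubChar.pb φ Y f)) :
    Spec a b (Y.map φ) f := by
  refine ⟨hf, by rw [← dg_pb φ Y]; exact h.cop, fun J hJ ζ hζ hne => ?_⟩
  have hJY : Subn (J.comap φ ⊓ Y) Y := by
    have := (hJ.comap φ).inf Y
    rwa [inf_eq_right.mpr (Subgroup.le_comap_map φ Y)] at this
  have hJ' : (J.comap φ ⊓ Y).map φ = J := by
    refine le_antisymm ((Subgroup.map_mono inf_le_left).trans (Subgroup.map_comap_le φ J)) ?_
    intro x hx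
    obtain ⟨y, hy, rfl⟩ := hJ.le hx
    exact ⟨y, ⟨hx, hy⟩, rfl⟩
  intro x hx
  rw [← hJ'] at hζ hne hx
  obtain ⟨y, hy, rfl⟩ := hx
  rw [← dt_pb (f := ζ) hy]
  refine h.det _ hJY _ hζ.pb ?_ _ hy
  rwa [← ip_res_left, res_pb hJY.le, ip_pb, ip_res_left]

/-- Characters trivial on the kernel descend. -/
theorem Chr.exists_pb {ρ : G' → ℂ} (hρ : Chr Y ρ) (ht : Trv φ.ker ρ) (hk : φ.ker ≤ Y) :
    ∃ ρ', Chr (Y.map φ) ρ' ∧ ρ = SubChar.pb φ Y ρ' := by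
  obtain ⟨d, M, hM0, hM, hM1, hMf⟩ := hρ.exists_matrix
  have hc := card_ne_zero' φ.ker
  set e := (Nat.card φ.ker : ℂ)⁻¹ • ∑ z : φ.ker, M z with he
  have hz (z : φ.ker) : (z : G') ∈ Y := hk z.2
  have hez {z : G'} (hz : z ∈ φ.ker) : M z * e = e := by
    rw [he, Matrix.mul_smul, Finset.mul_sum,
      ← Equiv.sum_comp (Equiv.mulLeft (⟨z, hz⟩ : φ.ker)) fun x : φ.ker => M x]
    congr 1
    exact Finset.sum_congr rfl fun x _ => (hM _ (hk hz) _ (hk x.2)).symm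
  have hee : e * e = e := by
    conv_lhs => rw [he, Matrix.smul_mul, Finset.sum_mul]
    rw [Finset.sum_congr rfl fun z _ => hez z.2, Finset.sum_const, Finset.card_univ,
      ← Nat.card_eq_fintype_card, ← Nat.cast_smul_eq_nsmul ℂ, smul_smul, inv_mul_cancel₀ hc, one_smul]
  have hcomm {y : G'} (hy : y ∈ Y) : M y * e = e * M y := by
    rw [he, Matrix.mul_smul, Matrix.smul_mul, Finset.mul_sum, Finset.sum_mul,
      ← Equiv.sum_comp (MulAut.conjNormal (H := φ.ker) y).toEquiv fun z : φ.ker => M z * M y]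
    congr 1
    refine Finset.sum_congr rfl fun z _ => ?_
    rw [← hM _ hy _ (hz z), ← hM _ (hz _) _ hy]
    congr 1
    simp
  let sec : G → G' := fun x => if h : x ∈ Y.map φ then h.choose else 1
  have hsec {x : G} (h : x ∈ Y.map φ) : sec x ∈ Y ∧ φ (sec x) = x := by
    simp only [sec, dif_pos h]
    exact h.choose_spec
  have hwd {x y : G'} (hx : x ∈ Y) (hy : y ∈ Y) (h : φ x = φ y) : M x * e = M y * e := by
    have : M x = M y * M (y⁻¹ * x) := by
      rw [← hM _ hy _ (Y.mul_mem (Y.inv_mem hy) hx), mul_inv_cancel_left]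
    rw [this, mul_assoc, hez]
    rw [MonoidHom.mem_ker, map_mul, map_inv, h, inv_mul_cancel]
  refine ⟨SubChar.res (Y.map φ) fun x => (M (sec x) * e).trace, Chr.of_matrix (fun x => M (sec x) * e)
    (fun x hx y hy => ?_) (fun x hx => res_of_mem hx) fun x hx => res_of_notMem hx, ?_⟩
  · have h1 := hsec hx
    have h2 := hsec hy
    have h3 := hsec ((Y.map φ).mul_mem hx hy)
    rw [hwd h3.1 (Y.mul_mem h1.1 h2.1) (by rw [h3.2, map_mul, h1.2, h2.2]), hM _ h1.1 _ h2.1,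
      mul_assoc, mul_assoc, hcomm h2.1, ← mul_assoc e e, hee]
  · ext y
    by_cases hy : y ∈ Y
    · have h1 := hsec (Subgroup.mem_map_of_mem φ hy)
      rw [pb_of_mem hy, res_of_mem (Subgroup.mem_map_of_mem φ hy), hwd h1.1 hy h1.2, he,
        Matrix.mul_smul, Finset.mul_sum, Matrix.trace_smul, Matrix.trace_sum,
        Finset.sum_congr rfl fun (z : φ.ker) _ => show (M y * M (z : G')).trace = ρ y by
          rw [← hM _ hy _ (hz z), ← hMf, ht _ z.2], Finset.sum_const, Finset.card_univ,
        ← Nat.card_eq_fintype_card, nsmul_eq_mul, smul_eq_mul, inv_mul_cancel_left₀ hc]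
    · rw [hρ.supp hy, SubChar.pb, res_of_notMem hy]

/-! ### Products, degrees and tensor squares -/

theorem Chr.dt_mul' (hf : Chr H f) (hk : Chr H k) (hg : g ∈ H) :
    dt (f * k) g = dt f g ^ dg k * dt k g ^ dg f := by
  have h : eig (f * k) g = (eig f g).bind fun x => (eig k g).map (x * ·) := by
    refine eig_eq fun j => ?_
    rw [Pi.mul_apply, hf.apply_pow hg, hk.apply_pow hg, Multiset.map_bind, Multiset.sum_bind]
    simp only [Multiset.map_map, Function.comp_def, mul_pow, Multiset.sum_map_mul_left,
      Multiset.sum_map_mul_right]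
  have h1 (s : Multiset ℂ) (x : ℂ) : (s.map (x * ·)).prod = x ^ s.card * s.prod := by
    induction s using Multiset.induction with
    | empty => simp
    | cons y s ih => simp only [Multiset.map_cons, Multiset.prod_cons, Multiset.card_cons, ih]; ring
  have h2 (s : Multiset ℂ) (q : ℕ) (c : ℂ) : (s.map fun x => x ^ q * c).prod =
      s.prod ^ q * c ^ s.card := by
    induction s using Multiset.induction with
    | empty => simp
    | cons y s ih => simp only [Multiset.map_cons, Multiset.prod_cons, Multiset.card_cons, ih]; ring
  rw [dt, h, Multiset.prod_bind]
  simp only [h1, h2]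
  rw [hk.card_eig hg, hf.card_eig hg]
  rfl

theorem sum_eq_smul_sum_quotient {V : Type*} [AddCommMonoid V] (F : G → V) (N : Subgroup G)
    (hF : ∀ g, ∀ z ∈ N, F (g * z) = F g) : ∑ g, F g = Nat.card N • ∑ q : G ⧸ N, F q.out := by
  have h (q : G ⧸ N) : ∑ g with (QuotientGroup.mk g : G ⧸ N) = q, F g = Nat.card N • F q.out := by
    have h1 : ∀ g ∈ Finset.univ.filter fun g : G => (QuotientGroup.mk g : G ⧸ N) = q,
        F g = F q.out := fun g hg => by
      rw [Finset.mem_filter] at hg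
      have := QuotientGroup.eq.mp (hg.2.trans q.out_eq'.symm)
      rw [← hF g _ this, mul_inv_cancel_left]
    rw [Finset.sum_congr rfl h1, Finset.sum_const]
    congr 1
    rw [Nat.card_eq_fintype_card, ← Finset.card_univ]
    symm
    refine Finset.card_bij (fun z _ => q.out * (z : G)) (fun z _ => ?_) (fun z _ w _ hzw => ?_)
      fun g hg => ?_
    · rw [Finset.mem_filter]
      exact ⟨Finset.mem_univ _, by
        rw [QuotientGroup.mk_mul_of_mem _ z.2, QuotientGroup.out_eq']⟩
    · exact Subtype.ext (mul_left_cancel hzw)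
    · rw [Finset.mem_filter] at hg
      exact ⟨⟨q.out⁻¹ * g, QuotientGroup.eq.mp (q.out_eq'.trans hg.2.symm)⟩, Finset.mem_univ _,
        mul_inv_cancel_left _ _⟩
  rw [Finset.smul_sum, ← Finset.sum_fiberwise Finset.univ (fun g : G => (QuotientGroup.mk g : G ⧸ N)) F]
  exact Finset.sum_congr rfl fun q _ => h q

/-- If `χ` is a multiple of the linear character `l` on `N`, then its degree divides the index. -/
theorem Irr.dg_dvd_index (hχ : Irr X χ) (hN : N ≤ X) (h : ∀ z ∈ N, ∀ g, χ (g * z) = χ g * l z) :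
    ∃ j : ℕ, dg χ * j * Nat.card N = Nat.card X := by
  obtain ⟨d, M, hM0, hM, hM1, hMf⟩ := hχ.1.exists_matrix
  have h1 := hχ.apply_one_ne_zero
  have hl {z : G} (hz : z ∈ N) {w : G} (hw : w ∈ N) : l (z * w) = l z * l w := by
    have := h _ (N.mul_mem hz hw) 1
    rw [← mul_assoc, h w hw, h z hz, mul_assoc] at this
    exact (mul_left_cancel₀ h1 this).symm
  have hl1 : l 1 = 1 := by
    have := h 1 N.one_mem 1
    rw [mul_one] at this
    exact (mul_left_cancel₀ h1 (by rw [mul_one]; exact this)).symm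
  have hli {z : G} (hz : z ∈ N) : l z⁻¹ * l z = 1 := by
    rw [← hl (N.inv_mem hz) hz, inv_mul_cancel, hl1]
  have hNc := card_ne_zero' N
  set A := ∑ z : N, l (z : G)⁻¹ • M z with hA
  have hMA {g : G} (hg : g ∈ X) {z : G} (hz : z ∈ N) : M (g * z) * A = l z • (M g * A) := by
    have : M z * A = l z • A := by
      rw [hA, Finset.mul_sum, Finset.smul_sum, ← Equiv.sum_comp (Equiv.mulLeft (⟨z, hz⟩ : N))
        fun w : N => l z • l (w : G)⁻¹ • M w]
      refine Finset.sum_congr rfl fun w _ => ?_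
      rw [Matrix.mul_smul, ← hM _ (hN hz) _ (hN w.2), smul_smul]
      congr 1
      simp only [Equiv.coe_mulLeft, Subgroup.coe_mul, mul_inv_rev]
      rw [hl (N.inv_mem w.2) (N.inv_mem hz), mul_left_comm, mul_comm (l z), hli hz, mul_one]
    rw [hM _ hg _ (hN hz), mul_assoc, this, Matrix.mul_smul]
  have hA0 : A ≠ 0 := by
    intro h0
    have h2 : A.trace = Nat.card N * χ 1 := by
      rw [hA, Matrix.trace_sum, Finset.sum_congr rfl fun (z : N) _ =>
        show (l (z : G)⁻¹ • M z).trace = χ 1 by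
          rw [Matrix.trace_smul, ← hMf, ← one_mul (z : G), h z z.2, one_mul, smul_eq_mul,
            mul_left_comm, hli z.2, mul_one]]
      simp
    rw [h0, Matrix.trace_zero] at h2
    exact mul_ne_zero hNc h1 h2.symm
  have hirr : ip X (fun g => (M g).trace) (fun g => (M g).trace) = 1 := by
    simp only [← hMf]; exact hχ.2
  obtain ⟨c, hc⟩ := schur hM hM1 hirr (A := ∑ g : G, χ g⁻¹ • M g) fun x hx => by
    rw [Finset.mul_sum, Finset.sum_mul, ← Equiv.sum_comp (MulAut.conj x).toEquiv
      fun g => χ g⁻¹ • M g * M x]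
    refine Finset.sum_congr rfl fun g _ => ?_
    have hconj : χ (MulAut.conj x g)⁻¹ = χ g⁻¹ := by
      rw [← map_inv]
      exact hχ.1.cls hx _
    change _ = χ (MulAut.conj x g)⁻¹ • M (MulAut.conj x g) * M x
    rw [hconj, Matrix.mul_smul, Matrix.smul_mul, MulAut.conj_apply]
    congr 1
    by_cases hg : g ∈ X
    · rw [← hM _ hx _ hg, ← hM _ (X.mul_mem (X.mul_mem hx hg) (X.inv_mem hx)) _ hx,
        inv_mul_cancel_right]
    · rw [hM0 _ hg, hM0 (x * g * x⁻¹), mul_zero, zero_mul]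
      intro hg'
      have := X.mul_mem (X.mul_mem (X.inv_mem hx) hg') hx
      exact hg (by simpa [mul_assoc] using this)
  have hcX : c * χ 1 = Nat.card X := by
    have := congrArg Matrix.trace hc
    rw [Matrix.trace_sum, Matrix.trace_smul, ← hM1, ← hMf, smul_eq_mul] at this
    rw [← this]
    have h3 := hχ.2
    rw [ip, inv_mul_eq_one₀ (card_ne_zero' X)] at h3
    rw [h3]
    refine Finset.sum_congr rfl fun g _ => ?_
    rw [Matrix.trace_smul, ← hMf, smul_eq_mul]
    split_ifs with hg
    · exact mul_comm _ _
    · rw [hχ.1.supp hg, mul_zero]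
  have hq : c • A = Nat.card N • ∑ q : G ⧸ N, χ q.out⁻¹ • (M q.out * A) := by
    rw [← sum_eq_smul_sum_quotient (fun g => χ g⁻¹ • (M g * A)) N, ← one_mul A, ← Matrix.smul_mul,
      ← hc, Finset.sum_mul]
    · simp only [Matrix.smul_mul, one_mul]
    · intro g z hz
      by_cases hg : g ∈ X
      · have h4 := hχ.1.cls (hN hz) (z⁻¹ * g⁻¹)
        rw [mul_inv_cancel_left, h _ (N.inv_mem hz)] at h4
        rw [hMA hg hz, smul_smul, mul_inv_rev, ← h4, mul_assoc, hli hz, mul_one]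
      · have h4 : g * z ∉ X := fun hg' => hg (by simpa using X.mul_mem hg' (X.inv_mem (hN hz)))
        rw [hM0 _ hg, hM0 _ h4, zero_mul, smul_zero, smul_zero]
  have hint : IsIntegral ℤ (c / Nat.card N) := by
    let R := integralClosure ℤ ℂ
    let V : Submodule R (Matrix (Fin d) (Fin d) ℂ) :=
      Submodule.span R (Set.range fun g : X => M g * A)
    have hV : A ∈ V := Submodule.subset_span ⟨1, by simp only [Subgroup.coe_one, hM1, one_mul]⟩
    refine isIntegral_trans (A := R) _ (isIntegral_of_smul_mem_submodule (M := Matrix (Fin d) (Fin d) ℂ) (N := V)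
      (fun h0 => hA0 (by rw [h0] at hV; exact hV)) (Submodule.fg_span (Set.finite_range _)) _ ?_)
    have hcA : (c / Nat.card N) • A = ∑ q : G ⧸ N, χ q.out⁻¹ • (M q.out * A) := by
      rw [div_eq_inv_mul, mul_smul, hq, ← Nat.cast_smul_eq_nsmul ℂ, inv_smul_smul₀ hNc]
    intro B hB
    induction hB using Submodule.span_induction with
    | mem B hB =>
      obtain ⟨g, rfl⟩ := hB
      simp only
      rw [← Matrix.mul_smul, hcA, Finset.mul_sum]
      refine Submodule.sum_mem _ fun q _ => ?_
      rw [Matrix.mul_smul, ← mul_assoc]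
      by_cases hqX : q.out ∈ X
      · rw [← hM _ g.2 _ hqX]
        exact V.smul_mem (⟨χ q.out⁻¹, hχ.1.isIntegral _⟩ : R)
          (Submodule.subset_span ⟨g * ⟨q.out, hqX⟩, rfl⟩)
      · rw [hM0 _ hqX, mul_zero, zero_mul, smul_zero]
        exact V.zero_mem
    | zero => rw [smul_zero]; exact V.zero_mem
    | add B C _ _ hB hC => rw [smul_add]; exact V.add_mem hB hC
    | smul r B _ hB =>
      rw [smul_comm]
      exact V.smul_mem r hB
  have hcN : ((Nat.card X / (dg χ * Nat.card N) : ℚ) : ℂ) = c / Nat.card N := by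
    push_cast
    rw [hχ.1.cast_dg, ← hcX]
    field_simp
  rw [← hcN] at hint
  have hint' : IsIntegral ℤ (Nat.card X / (dg χ * Nat.card N) : ℚ) :=
    (isIntegral_algebraMap_iff (algebraMap ℚ ℂ).injective).mp hint
  obtain ⟨j, hj⟩ := IsIntegrallyClosed.isIntegral_iff.mp hint'
  have hd := hχ.dg_pos
  have hN0 : 0 < Nat.card N := Nat.card_pos
  have hX0 : 0 < Nat.card X := Nat.card_pos
  rw [eq_div_iff (by positivity), eq_intCast] at hj
  have hj' : j * (dg χ * Nat.card N : ℤ) = Nat.card X := by exact_mod_cast hj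
  lift j to ℕ using by
    by_contra hneg
    have : j * (dg χ * Nat.card N : ℤ) < 0 := mul_neg_of_neg_of_pos (not_le.mp hneg) (by positivity)
    omega
  refine ⟨j, ?_⟩
  have : j * (dg χ * Nat.card N) = Nat.card X := by exact_mod_cast hj'
  rw [← this]
  ring

end

section

variable {G : Type} [Group G] [Fintype G] {G' : Type} [Group G'] [Fintype G']
  {E H J K M N L S T U X : Subgroup G} {f k θ χ ψ l β α ξ ζ ω η κ : G → ℂ} {g : G}
  {φ : G' →* G} {Y Y' Z : Subgroup G'} {a b p m n : ℕ}

/-! ### Characters of `p`-power degree decompose on `p'`-elements -/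

/-- On `p'`-elements `β` is the sum of two characters, whose kernels contain the central
`p`-elements; both are nonzero if `β` is not linear. -/
def Split (p n m : ℕ) (H : Subgroup G) (β : G → ℂ) : Prop :=
  ∃ ρ₁ ρ₂, Chr H ρ₁ ∧ Chr H ρ₂ ∧ ρ₁ ≠ 0 ∧ (β 1 ≠ 1 → ρ₂ ≠ 0) ∧
    (∀ g ∈ H, g ^ m = 1 → β g = ρ₁ g + ρ₂ g) ∧
    ∀ z ∈ H, z ^ p ^ n = 1 → (∀ h ∈ H, z * h = h * z) →
      ∀ g, ρ₁ (g * z) = ρ₁ g ∧ ρ₂ (g * z) = ρ₂ g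

theorem tr_mul_right {z : G} (hz : z ∈ H) (g : G) : tr H (g * z) = tr H g := by
  by_cases hg : g ∈ H
  · rw [tr_of_mem hg, tr_of_mem (H.mul_mem hg hz)]
  · have : g * z ∉ H := fun h => hg (by simpa using H.mul_mem h (H.inv_mem hz))
    rw [tr, res_of_notMem hg, res_of_notMem this]

theorem Spec.eq_one_of_lin (h : PSol p n m G) (hβ : Spec m (p ^ n) H β) (h1 : β 1 = 1)
    (hg : g ∈ H) (hgm : g ^ m = 1) : β g = 1 := by
  have hl := hβ.irr.1.lin h1
  refine hl.eq_one_of_pow (h.cop.pow_left n) (fun x hx => ?_) hg hgm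
  rw [← hl.dt_eq hx]
  exact hβ.dt_pow hx

theorem Spec.split_of_lin (h : PSol p n m G) (hβ : Spec m (p ^ n) H β) (h1 : β 1 = 1) :
    Split p n m H β :=
  ⟨tr H, 0, (tr_lin H).chr, Chr.zero H, (tr_lin H).irr.ne_zero, fun h' => absurd h1 h', fun g hg hgm => by
    rw [hβ.eq_one_of_lin h h1 hg hgm, tr_of_mem hg]; simp, fun z hz _ _ g => ⟨tr_mul_right hz g, rfl⟩⟩

theorem Nrm.dvd_of_dvd_relIndex {r q : ℕ} (hN : Nrm N E) (hr : ∀ g ∈ E, g ^ r ∈ N) (hq : q.Prime)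
    (hqN : q ∣ N.relIndex E) : q ∣ r := by
  have : (N.subgroupOf E).Normal := ⟨fun x hx y => by
    rw [Subgroup.mem_subgroupOf] at hx ⊢
    exact hN.2 _ y.2 _ hx⟩
  by_contra hqr
  refine not_dvd_card_of_pow hq ((Nat.Prime.coprime_iff_not_dvd hq).mpr hqr)
    (Q := E ⧸ N.subgroupOf E) (fun x => ?_) hqN
  induction x using QuotientGroup.induction_on with
  | H g =>
    rw [← QuotientGroup.mk_pow, QuotientGroup.eq_one_iff, Subgroup.mem_subgroupOf]
    exact hr _ g.2

theorem relIndex_mul_card' (hT : T ≤ E) : T.relIndex E * Nat.card T = Nat.card E := by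
  rw [mul_comm, ← T.relIndex_bot_left, ← E.relIndex_bot_left]
  exact Subgroup.relIndex_mul_relIndex ⊥ T E bot_le hT

/-- If the index of `T` in `E` is prime to the exponent of `E / N` then `T = E`. -/
theorem eq_of_index_coprime {r j : ℕ} (hN : Nrm N E) (hNT : N ≤ T) (hT : T ≤ E)
    (hr : ∀ g ∈ E, g ^ r ∈ N) (hc : j.Coprime r) (hj : j * Nat.card T = Nat.card E) : T = E := by
  by_cases hj1 : j = 1
  · rw [hj1, one_mul] at hj
    exact Subgroup.eq_of_le_of_card_ge hT hj.ge
  obtain ⟨q, hq, hqj⟩ := Nat.exists_prime_and_dvd hj1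
  have hidx : j = T.relIndex E :=
    Nat.eq_of_mul_eq_mul_right Nat.card_pos (hj.trans (relIndex_mul_card' hT).symm)
  exact absurd (hN.dvd_of_dvd_relIndex hr hq ((hidx ▸ hqj).trans
    (Subgroup.relIndex_dvd_of_le_left E hNT)))
    ((Nat.Prime.coprime_iff_not_dvd hq).mp (hc.coprime_dvd_left hqj))

/-- If `χ` restricts irreducibly to `E`, the conjugates of a constituent `η` of `χ` are
`E`-conjugate. -/
theorem exists_mul_stab (hE : Nrm E H) (hK : Nrm K H) (hKE : K ≤ E) (hβ : Irr H β)
    (hβE : Irr E (res E β)) (hη : Irr K η) (hne : ip K β η ≠ 0) {x : G} (hx : x ∈ H) :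
    ∃ e ∈ E, ∃ t ∈ stab H η, x = e * t := by
  have h1 : ip K (res E β) η ≠ 0 := by rwa [← ip_res_left, res_res hKE, ip_res_left]
  have h2 : ip K (res E β) (cj x η) ≠ 0 := by
    rwa [← ip_res_left, res_res hKE, ip_res_left, ip_cj_eq_of_cls hK hx hβ.1]
  obtain ⟨y, hy, he⟩ := exists_cj_of_ip_ne_zero (hK.mono hE.le hKE) hβE hη
    (hη.cj_nrm hK hx) h1 h2
  refine ⟨x * y⁻¹ * y * (x * y⁻¹)⁻¹, hE.2 _ (H.mul_mem hx (H.inv_mem (hE.le hy))) y hy,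
    x * y⁻¹, mem_stab.mpr ⟨H.mul_mem hx (H.inv_mem (hE.le hy)), ?_⟩, by group⟩
  rw [← cj_cj, he, cj_cj, mul_inv_cancel, cj_one]

/-- The stabilizer of a constituent of a special character has `b`-power index. -/
theorem exists_index_stab (hN : Nrm N H) (hβ : Irr H β) (hη : Irr N η) (hne : ip N β η ≠ 0) :
    ∃ j, j * Nat.card (stab H η) = Nat.card H ∧ j ∣ dg β := by
  obtain ⟨ψ, hψ, -, -, hi, -⟩ := clifford_exists hN hβ hη hne
  obtain ⟨j, hj⟩ := Subgroup.card_dvd_of_le (stab_le (H := H) (θ := η))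
  refine ⟨j, by rw [hj, mul_comm], dg ψ, ?_⟩
  have h1 := ind_one (H := H) (K := stab H η) ψ
  rw [hi, ← hβ.1.cast_dg, ← hψ.1.cast_dg, hj] at h1
  have := card_ne_zero' (stab H η)
  push_cast at h1
  rw [mul_div_cancel_left₀ _ this] at h1
  exact_mod_cast h1

theorem Trv.ind {z : G} (hψ : ∀ g, ψ (g * z) = ψ g) (hz : ∀ h ∈ H, z * h = h * z) (g : G) :
    SubChar.ind K H ψ (g * z) = SubChar.ind K H ψ g := by
  rw [SubChar.ind, SubChar.ind]
  congr 1
  refine Finset.sum_congr rfl fun x _ => ?_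
  split_ifs with hx
  · rw [← hψ (x * g * x⁻¹)]
    congr 1
    simp only [mul_assoc]
    rw [hz _ (H.inv_mem hx)]
  · rfl

theorem Spec.split_of_not_invariant (h : PSol p n m G) (hE : Nrm E H) (hK : Nrm K H) (hKE : K ≤ E)
    (hch : Chief p n m K E) (hmax : ∀ D, Nrm D H → K ≤ D → D ≤ E → D = K ∨ D = E)
    (hβ : Spec m (p ^ n) H β) (hβE : Irr E (res E β)) (hη : Irr K η) (hne : ip K β η ≠ 0)
    (hT : stab H η ≠ H)
    (IH : ∀ β', Spec m (p ^ n) (stab H η) β' → dg β' < dg β → Split p n m (stab H η) β') :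
    Split p n m H β := by
  have hTH : stab H η ≤ H := stab_le
  have hKT : K ≤ stab H η := le_stab hK hη.1
  have hKE' := hK.mono hE.le hKE
  have hET := fun x hx => exists_mul_stab hE hK hKE hβ.irr hβE hη hne (x := x) hx
  have h1 : ip K (res E β) η ≠ 0 := by rwa [← ip_res_left, res_res hKE, ip_res_left]
  have hstab : stab E η ≠ E := by
    intro he
    refine hT (le_antisymm hTH fun x hx => ?_)
    obtain ⟨e, heE, t, ht, rfl⟩ := hET x hx
    rw [← he] at heE
    exact (stab H η).mul_mem (mem_stab.mpr ⟨hE.le (mem_stab.mp heE).1, (mem_stab.mp heE).2⟩) ht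
  rcases hch with hch | ⟨hab, hp⟩
  · obtain ⟨j, hj, hjd⟩ := exists_index_stab hKE' hβE hη h1
    rw [dg_res] at hjd
    exact absurd (eq_of_index_coprime hKE' (le_stab hKE' hη.1) stab_le hch
      (hβ.cop.coprime_dvd_left hjd) hj) hstab
  have hSK : stab E η = K := by
    have hKS : K ≤ stab E η := le_stab hKE' hη.1
    refine (hmax (stab E η) ⟨stab_le.trans hE.le, fun x hx d hd => ?_⟩ hKS stab_le).resolve_right
      hstab
    obtain ⟨e, he, t, ht, rfl⟩ := hET x hx
    have ht' := mem_stab.mp ht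
    have hd' := mem_stab.mp hd
    have h2 : t * d * t⁻¹ ∈ stab E η := mem_stab.mpr ⟨hE.2 t ht'.1 d hd'.1,
      (mem_stab.mp ((stab H η).mul_mem ((stab H η).mul_mem ht (mem_stab.mpr
        ⟨hE.le hd'.1, hd'.2⟩)) ((stab H η).inv_mem ht))).2⟩
    have h3 := (stab E η).mul_mem (hKS (hab e he _ (stab_le h2))) h2
    rw [show e * (t * d * t⁻¹) * e⁻¹ * (t * d * t⁻¹)⁻¹ * (t * d * t⁻¹) = e * t * d * (e * t)⁻¹ by
      group] at h3
    exact h3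
  obtain ⟨ψ, hψ, hψ1, -, -, hψ3⟩ := clifford_exists hKE' hβE hη h1
  rw [hSK] at hψ
  have h2 : ip K β η = 1 := by
    rw [← ip_res_left, ← res_res hKE, ip_res_left, ← hψ3, hψ.eq_of_ip_ne_zero hη hψ1, hη.2]
  obtain ⟨β₁, hβ₁, hβ₁n, -, hi, hβ₁e⟩ := clifford_exists hK hβ.irr hη hne
  have hr₁ : res K β₁ = η := by
    rw [res_of_invariant (hK.mono hTH hKT) hβ₁ hη hβ₁n fun x hx => (mem_stab.mp hx).2, hβ₁e, h2,
      one_smul]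
  have hdη : dg β₁ = dg η := by rw [← hr₁, dg_res]
  have hηS := hβ.constituent hK hη hne
  have hcop : (dg β₁).Coprime m := hdη ▸ hηS.cop
  have hab' : ExpFac m (p ^ n) G := h.ef.symm
  set μ := nd m (p ^ n) (stab H η) β₁ with hμ
  have hμl : Lin (stab H η) μ := hβ₁.1.nd_lin _ _
  have hμK : res K μ = tr K := by
    rw [hμ, ← nd_res hKT, hr₁]
    exact nd_eq_tr hab' hηS.cop fun g hg => hηS.dt_pow hg
  have hTE : stab H η ⊓ E = K := by
    rw [← hSK]
    ext x
    exact ⟨fun hx => ⟨hx.2, hx.1.2⟩, fun hx => ⟨⟨hE.le hx.1, hx.2⟩, hx.1⟩⟩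
  have htr : res K (tr E) = tr K := res_res hKE _
  obtain ⟨μ', hμ'I, -, hμ'T⟩ := exists_extension_supplement (ω := tr E) (α := μ) hE hTH hET
    (tr_lin E).irr (fun x hx => by rw [tr, cj_res (hE.mem_iff hx)]; rfl)
    (by rw [hTE, htr]; exact (tr_lin K).irr) hμl.irr (by
      rw [hTE, htr, ← ip_res_left, hμK, (tr_lin K).irr.2]
      exact one_ne_zero)
  have hμ' : Lin H μ' := hμ'I.1.lin (by
    rw [← hμl.one, ← hμ'T, res_of_mem (stab H η).one_mem])
  set β' := β₁ * μ⁻¹ with hβ'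
  have hβ'I : Irr (stab H η) β' := hβ₁.mul_lin hμl.inv'
  have hβ'K : res K β' = η := by
    rw [hβ', res_mul_nd_inv hab' hKT hcop fun g hg => ?_, hr₁]
    rw [← dt_res hg, hr₁]
    exact hηS.dt_pow hg
  have hβ'S : Spec m (p ^ n) (stab H η) β' := Spec.of_res hab' (hK.mono hTH hKT) hβ'I
    (hβ'K ▸ hηS) fun g hg => hβ₁.1.dt_mul_nd_inv hab' hcop hg
  have hβe : β = ind (stab H η) H β' * μ' := by
    rw [← ind_mul_res (fun g hg => hβ'I.supp hg) fun x hx g => hμ'I.1.cls hx g, hμ'T, hβ', mul_assoc,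
      mul_comm μ⁻¹, hμl.mul_inv, mul_comm, tr_mul_of_supp fun g hg => hβ₁.supp hg, hi]
  have hsupp {ψ : G → ℂ} {g : G} (hg : g ∉ H) : ind (stab H η) H ψ g * μ' g = 0 := by
    rw [hμ'I.supp hg, mul_zero]
  have hlt : Nat.card (stab H η) < Nat.card H := by
    by_contra hle
    exact hT (Subgroup.eq_of_le_of_card_ge hTH (not_lt.mp hle))
  have hμz {z : G} (hzH : z ∈ H) (hz : z ^ p ^ n = 1) (hzc : ∀ h ∈ H, z * h = h * z) :
      z ∈ stab H η ∧ ∀ g, μ' (g * z) = μ' g := by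
    have hzT : z ∈ stab H η := by
      refine mem_stab.mpr ⟨hzH, funext fun g => ?_⟩
      by_cases hg : g ∈ H
      · rw [SubChar.cj, hzc g hg, mul_inv_cancel_right]
      · rw [SubChar.cj, hη.supp fun h' => hg (hK.le h'), hη.supp fun h' => hg ?_]
        exact by simpa [mul_assoc] using H.mul_mem (H.mul_mem (H.inv_mem hzH) (hK.le h')) hzH
    refine ⟨hzT, fun g => ?_⟩
    by_cases hg : g ∈ H
    · have h3 : μ' z = 1 := by
        rw [← res_of_mem (f := μ') hzT, hμ'T]
        exact hμl.eq_one_of_pow (h.cop.symm.pow_right n)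
          (fun x hx => hβ₁.1.nd_pow hab' hcop hx) hzT hz
      rw [hμ'.mul g hg z hzH, h3, mul_one]
    · rw [hμ'I.supp hg, hμ'I.supp fun h' => hg ?_]
      simpa using H.mul_mem h' (H.inv_mem hzH)
  have hmul0 {ρ : G → ℂ} (hρ : Chr H ρ) (h0 : ρ ≠ 0) : ρ * μ' ≠ 0 := fun h' => by
    have := congrFun h' 1
    rw [Pi.mul_apply, hμ'.one, mul_one] at this
    exact hρ.apply_one_ne_zero h0 this
  by_cases hlin : β' 1 = 1
  · have htrI : Chr H (ind (stab H η) H (tr (stab H η))) := (tr_lin _).chr.ind hTH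
    have htrH : ip H (ind (stab H η) H (tr (stab H η))) (tr H) ≠ 0 := by
      rw [(tr_lin _).chr.frob hTH (tr_lin H).chr, ← ip_res_right, tr, tr, res_res hTH]
      exact ((tr_lin (stab H η)).irr.2.trans_ne one_ne_zero)
    obtain ⟨ρ, hρ, hρe⟩ := htrI.exists_add (tr_lin H).irr htrH
    refine ⟨tr H * μ', ρ * μ', (tr_lin H).chr.mul hμ'.chr, hρ.mul hμ'.chr, ?_, fun _ h0 => ?_, ?_, ?_⟩
    · rw [tr_mul_of_supp hμ'.supp]
      exact hμ'I.ne_zero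
    · refine hmul0 hρ (fun hρ0 => ?_) h0
      have h5 := congrFun hρe 1
      rw [hρ0, add_zero, ind_one, (tr_lin _).one, (tr_lin _).one, mul_one,
        div_eq_one_iff_eq (card_ne_zero' _)] at h5
      exact hlt.ne' (by exact_mod_cast h5)
    · intro g hg hgm
      rw [hβe, Pi.mul_apply, Pi.mul_apply, Pi.mul_apply, ← add_mul, ← Pi.add_apply, ← hρe]
      congr 1
      refine ind_congr_reg (m := m) (fun x hx hxm => ?_) (fun x hx => ?_) hgm
      · rw [hβ'S.eq_one_of_lin h hlin hx hxm, tr_of_mem hx]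
      · rw [hβ'I.supp hx, (tr_lin _).supp x hx]
    · intro z hzH hz hzc g
      obtain ⟨hzT, hμz⟩ := hμz hzH hz hzc
      have h4 : ρ = ind (stab H η) H (tr (stab H η)) - tr H := by rw [hρe, add_sub_cancel_left]
      simp only [h4, Pi.mul_apply, Pi.sub_apply, hμz, tr_mul_right hzH,
        Trv.ind (tr_mul_right hzT) hzc, and_self]
  · obtain ⟨ρ₁, ρ₂, h₁, h₂, h₁0, h₂0, hρ, hz⟩ := IH β' hβ'S (by
      have h5 := congrFun hβe 1
      rw [Pi.mul_apply, ind_one, hμ'.one, mul_one, ← hβ.irr.1.cast_dg, ← hβ'I.1.cast_dg,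
        div_mul_eq_mul_div, eq_div_iff (card_ne_zero' _)] at h5
      have h6 : dg β * Nat.card (stab H η) = Nat.card H * dg β' := by exact_mod_cast h5
      have h7 := hβ'I.dg_pos
      have h8 : 0 < Nat.card (stab H η) := Nat.card_pos
      nlinarith)
    refine ⟨ind _ H ρ₁ * μ', ind _ H ρ₂ * μ', (h₁.ind hTH).mul hμ'.chr, (h₂.ind hTH).mul hμ'.chr,
      ?_, fun _ => ?_, ?_, ?_⟩
    · exact hmul0 (h₁.ind hTH) fun h0 => h₁0 (h₁.ind_eq_zero h0)
    · exact hmul0 (h₂.ind hTH) fun h0 => h₂0 hlin (h₂.ind_eq_zero h0)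
    · intro g hg hgm
      rw [hβe, Pi.mul_apply, Pi.mul_apply, Pi.mul_apply, ← add_mul, ← Pi.add_apply, ← ind_add]
      congr 1
      refine ind_congr_reg (m := m) hρ (fun x hx => ?_) hgm
      rw [hβ'I.supp hx, Pi.add_apply, h₁.supp hx, h₂.supp hx, add_zero]
    · intro z hzH hz' hzc g
      obtain ⟨hzT, hμz⟩ := hμz hzH hz' hzc
      have h4 := hz z hzT hz' fun x hx => hzc x (hTH hx)
      simp only [Pi.mul_apply, hμz, Trv.ind (fun g => (h4 g).1) hzc,
        Trv.ind (fun g => (h4 g).2) hzc, and_self]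

end

section

variable {G : Type} [Group G] [Fintype G]
  {D E H J K M N L S T U X : Subgroup G} {f k θ χ ψ l β α ξ ζ ω η κ ρ : G → ℂ} {g : G}
  {a b p m n : ℕ}

theorem Chr.dual (hf : Chr H f) : Chr H fun g => f g⁻¹ := by
  obtain ⟨n, M, hM0, hM, -, hMf⟩ := hf.exists_matrix
  refine Chr.of_matrix (fun g => (M g⁻¹).transpose) (fun g hg h hh => ?_) (fun g hg => ?_)
    fun g hg => hf.supp fun h => hg (by simpa using H.inv_mem h)
  · rw [mul_inv_rev, hM _ (H.inv_mem hh) _ (H.inv_mem hg), Matrix.transpose_mul]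
  · rw [Matrix.trace_transpose, hMf]

/-- The square of a nonlinear character is reducible. -/
theorem Irr.apply_one_of_sq (hf : Irr H f) (h : Irr H (f * f)) : f 1 = 1 := by
  have hd := hf.1.dual
  have h1 : Irr H (f * fun g => f g⁻¹) := by
    refine ⟨hf.1.mul hd, ?_⟩
    rw [← h.2, ip, ip]
    congr 1
    refine Finset.sum_congr rfl fun g _ => ?_
    simp only [Pi.mul_apply, inv_inv]
    split_ifs
    · ring
    · rfl
  have h2 : ip H (f * fun g => f g⁻¹) (tr H) ≠ 0 := by
    rw [show ip H (f * fun g => f g⁻¹) (tr H) = ip H f f by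
      rw [ip, ip]
      congr 1
      refine Finset.sum_congr rfl fun g _ => ?_
      split_ifs with hg
      · rw [tr_of_mem (H.inv_mem hg), mul_one, Pi.mul_apply]
      · rfl, hf.2]
    exact one_ne_zero
  have h3 := congrFun (h1.eq_of_ip_ne_zero (tr_lin H).irr h2) 1
  rw [Pi.mul_apply, inv_one, (tr_lin H).one, ← hf.1.cast_dg] at h3
  rw [← hf.1.cast_dg]
  have : dg f * dg f = 1 := by exact_mod_cast h3
  rw [Nat.eq_one_of_mul_eq_one_right this, Nat.cast_one]

theorem Trv.of_add (hf : Chr H f) (hk : Chr H k) (hN : Nrm N H) (h : Trv N (f + k)) : Trv N f := by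
  have h1 : (f - avg N f) + (k - avg N k) = 0 := by
    have h2 := avg_of_trv h
    have h3 : avg N (f + k) = avg N f + avg N k := by
      ext g
      simp only [avg, Pi.add_apply, Finset.sum_add_distrib, mul_add]
    rw [h3] at h2
    rw [sub_add_sub_comm, h2, sub_self]
  have h4 : f - avg N f = 0 := by
    by_contra hne
    exact (hf.avg hN).2.add_ne_zero (hk.avg hN).2 hne h1
  rw [sub_eq_zero.mp h4]
  exact avg_trv N f

/-- The kernel of a linear character. -/
def Lin.ker (hl : Lin K l) : Subgroup G where
  carrier := {z | z ∈ K ∧ l z = 1}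
  one_mem' := ⟨K.one_mem, hl.one⟩
  mul_mem' {x y} hx hy := ⟨K.mul_mem hx.1 hy.1, by rw [hl.mul _ hx.1 _ hy.1, hx.2, hy.2, mul_one]⟩
  inv_mem' {x} hx := ⟨K.inv_mem hx.1, by rw [hl.inv_apply hx.1, hx.2, inv_one]⟩

theorem Irr.mul_apply_of_lin (hβ : Irr H β) (hK : Nrm K H) (hη : Lin K η)
    (hinv : ∀ x ∈ H, SubChar.cj x η = η) (hβK : res K β = β 1 • η) :
    ∀ z ∈ K, ∀ g, β (g * z) = β g * η z := by
  have hβz {z : G} (hz : z ∈ K) : β z = β 1 * η z := by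
    rw [← res_of_mem (f := β) hz, hβK]; rfl
  have hηx {x z : G} (hx : x ∈ H) : η (x * z * x⁻¹) = η z := congrFun (hinv x hx) z
  have hD : Nrm hη.ker H := ⟨fun z hz => hK.le hz.1, fun x hx z hz =>
    ⟨hK.2 x hx z hz.1, by rw [hηx hx, hz.2]⟩⟩
  have ht : Trv hη.ker β := hβ.1.trv_of_res hD fun z hz => by rw [hβz hz.1, hz.2, mul_one]
  intro z hz g
  by_cases hg : g ∈ H
  · have h1 := hβ.schur_average (hK.le hz) hg
    have hHc := card_ne_zero' H
    rw [Finset.sum_congr rfl fun (x : H) _ => show β (x * z * (x : G)⁻¹ * g) = β (g * z) by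
      have hx := hK.2 x x.2 z hz
      rw [← hβ.1.cls (H.inv_mem (hK.le hx)), inv_inv,
        show (x * z * (x : G)⁻¹)⁻¹ * (x * z * (x : G)⁻¹ * g) * (x * z * (x : G)⁻¹) =
          g * z * (z⁻¹ * (x * z * (x : G)⁻¹)) by group]
      refine ht _ ⟨K.mul_mem (K.inv_mem hz) hx, ?_⟩ _
      rw [hη.mul _ (K.inv_mem hz) _ hx, hηx x.2, ← hη.mul _ (K.inv_mem hz) _ hz, inv_mul_cancel,
        hη.one]] at h1
    simp only [Finset.sum_const, Finset.card_univ, Fintype.card_eq_nat_card, nsmul_eq_mul] at h1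
    rw [inv_mul_cancel_left₀ hHc, hβz hz] at h1
    rw [h1]
    have := hβ.apply_one_ne_zero
    field_simp
  · rw [hβ.supp hg, hβ.supp fun h => hg (by simpa using H.mul_mem h (H.inv_mem (hK.le hz))),
      zero_mul]

/-- A character of an abelian extension `E` of `K` which is reducible on `K` vanishes off `K`. -/
theorem Irr.eq_zero_of_chief (hE : Nrm E H) (hKE : K ≤ E)
    (hab : ∀ x ∈ E, ∀ y ∈ E, x * y * x⁻¹ * y⁻¹ ∈ K)
    (hK : Nrm K H) (hmax : ∀ D, Nrm D H → K ≤ D → D ≤ E → D = K ∨ D = E) (hβ : Irr H β)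
    (hβE : Irr E (res E β)) (hne : ip K β β ≠ 1) (hg : g ∈ E) (hgK : g ∉ K) : β g = 0 := by
  let D : Subgroup G :=
    { carrier := {x | x ∈ E ∧ ∀ ρ, Lin E ρ → Trv K ρ → res E β * ρ = res E β → ρ x = 1}
      one_mem' := ⟨E.one_mem, fun ρ hρ _ _ => hρ.one⟩
      mul_mem' := fun {x y} hx hy => ⟨E.mul_mem hx.1 hy.1, fun ρ hρ h1 h2 => by
        rw [hρ.mul _ hx.1 _ hy.1, hx.2 ρ hρ h1 h2, hy.2 ρ hρ h1 h2, mul_one]⟩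
      inv_mem' := fun {x} hx => ⟨E.inv_mem hx.1, fun ρ hρ h1 h2 => by
        rw [hρ.inv_apply hx.1, hx.2 ρ hρ h1 h2, inv_one]⟩ }
  have hDN : Nrm D H := by
    refine ⟨fun x hx => hE.le hx.1, fun x hx d hd => ⟨hE.2 x hx d hd.1, fun ρ hρ h1 h2 => ?_⟩⟩
    refine hd.2 (SubChar.cj x ρ) ⟨fun y hy => ?_, fun y hy z hz => ?_, ?_⟩ (fun z hz y => ?_) ?_
    · exact hρ.supp _ fun h => hy ((hE.mem_iff hx y).mpr h)
    · rw [SubChar.cj, SubChar.cj, SubChar.cj, ← hρ.mul _ (hE.2 x hx y hy) _ (hE.2 x hx z hz)]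
      congr 1
      group
    · rw [SubChar.cj, mul_one, mul_inv_cancel, hρ.one]
    · rw [SubChar.cj, SubChar.cj, show x * (y * z) * x⁻¹ = x * y * x⁻¹ * (x * z * x⁻¹) by group,
        h1 _ (hK.2 x hx z hz)]
    · have h3 : SubChar.cj x (res E β) = res E β := by
        rw [cj_res (hE.mem_iff hx), hβ.1.cj_eq hx]
      rw [← h3, ← cj_mul, h2]
  have hDK : D = K := by
    refine (hmax D hDN (fun z hz => ⟨hKE hz, fun ρ hρ h1 _ => ?_⟩) fun x hx => hx.1).resolve_right
      fun hDE => hne ?_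
    · rw [← one_mul z, h1 z hz, hρ.one]
    · rw [← ip_self_of_stab (hK.mono hE.le hKE) hab hβE fun ρ hρ h1 h2 => ?_]
      · rw [← ip_res_left β, ← ip_res_right _ β, ← ip_res_left (res E β),
          ← ip_res_right _ (res E β), res_res hKE]
      · refine hρ.ext' (tr_lin E) fun x hx => ?_
        rw [tr_of_mem hx]
        rw [← hDE] at hx
        exact hx.2 ρ hρ h1 h2
  by_contra h0
  refine hgK (hDK ▸ ⟨hg, fun ρ hρ h1 h2 => ?_⟩)
  have h3 := congrFun h2 g
  rw [Pi.mul_apply, res_of_mem hg] at h3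
  exact mul_left_cancel₀ h0 (h3.trans (mul_one _).symm)

theorem Lin.eq_one_of_commutator (hη : Lin K η) (hK : Nrm K H) (hinv : ∀ x ∈ H, SubChar.cj x η = η)
    (hab : a.Coprime m) (ha : ∀ k ∈ K, η k ^ a = 1) {x : G} (hg : g ∈ H) (hgm : g ^ m = 1)
    (hk : x * g * x⁻¹ * g⁻¹ ∈ K) : η (x * g * x⁻¹ * g⁻¹) = 1 := by
  set z := x * g * x⁻¹ * g⁻¹ with hz
  have h1 (j : ℕ) : ∃ y ∈ K, (z * g) ^ j = y * g ^ j ∧ η y = η z ^ j := by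
    induction j with
    | zero => exact ⟨1, K.one_mem, by simp, by simp [hη.one]⟩
    | succ j ih =>
      obtain ⟨y, hy, h2, h3⟩ := ih
      have h4 := H.pow_mem hg j
      have h5 := hK.2 _ h4 z hk
      refine ⟨y * (g ^ j * z * (g ^ j)⁻¹), K.mul_mem hy h5, ?_, ?_⟩
      · rw [pow_succ, h2, pow_succ]
        group
      · rw [hη.mul _ hy _ h5, h3, pow_succ]
        congr 1
        exact congrFun (hinv _ h4) z
  obtain ⟨y, hy, h2, h3⟩ := h1 m
  rw [show z * g = x * g * x⁻¹ by rw [hz, inv_mul_cancel_right], conj_pow, hgm, mul_one, mul_inv_cancel,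
    mul_one] at h2
  rw [← h2, hη.one] at h3
  exact eq_one_of_pow_of_coprime hab (ha z hk) h3.symm

theorem Spec.split_of_lin_constituent (h : PSol p n m G) (hodd : Odd p) (hE : Nrm E H)
    (hK : Nrm K H) (hKE : K < E)
    (hch : Chief p n m K E) (hmax : ∀ D, Nrm D H → K ≤ D → D ≤ E → D = K ∨ D = E)
    (hβ : Spec m (p ^ n) H β) (hβE : Irr E (res E β)) (hη : Lin K η) (hne : ip K β η ≠ 0)
    (hinv : ∀ x ∈ H, SubChar.cj x η = η) (h1 : β 1 ≠ 1) : Split p n m H β := by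
  have hKE' := hK.mono hE.le hKE.le
  have hβ0 := hβ.irr.apply_one_ne_zero
  have hβK : res K β = β 1 • η := by
    have h2 := res_of_invariant hK hβ.irr hη.irr hne hinv
    have h3 := congrFun h2 1
    rw [res_of_mem K.one_mem, Pi.smul_apply, hη.one, smul_eq_mul, mul_one] at h3
    rw [h2, ← h3]
  have hβz := hβ.irr.mul_apply_of_lin hK hη hinv hβK
  have hβk {z : G} (hz : z ∈ K) : β z = β 1 * η z := by rw [← hβz z hz, one_mul]
  rcases hch with hch | ⟨hab, -⟩
  · obtain ⟨j, hj⟩ := hβE.dg_dvd_index (l := η) hKE.le fun z hz g => by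
      by_cases hg : g ∈ E
      · rw [res_of_mem hg, res_of_mem (E.mul_mem hg (hKE.le hz)), hβz z hz]
      · rw [res_of_notMem hg, res_of_notMem fun h' => hg ?_, zero_mul]
        simpa using E.mul_mem h' (E.inv_mem (hKE.le hz))
    rw [dg_res, ← relIndex_mul_card' hKE.le] at hj
    have hj' := Nat.eq_of_mul_eq_mul_right Nat.card_pos hj
    refine absurd ?_ h1
    rw [← hβ.irr.1.cast_dg]
    by_contra hd
    obtain ⟨q, hq, hqd⟩ := Nat.exists_prime_and_dvd (fun h' : dg β = 1 => hd (by rw [h', Nat.cast_one]))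
    exact (Nat.Prime.coprime_iff_not_dvd hq).mp (hβ.cop.coprime_dvd_left hqd)
      (hKE'.dvd_of_dvd_relIndex hch hq (hqd.trans ⟨j, hj'.symm⟩))
  have hηS := hβ.constituent hK hη.irr hne
  have hηp {z : G} (hz : z ∈ K) : η z ^ p ^ n = 1 := by
    rw [← hη.dt_eq hz]
    exact hηS.dt_pow hz
  have hipK : ip K β β = β 1 * β 1 := by
    rw [← ip_res_left, ← ip_res_right, hβK, ip_smul_left, ip_smul_right, hη.irr.2, mul_one]
  have hvan {x : G} (hx : x ∈ E) (hxK : x ∉ K) : β x = 0 :=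
    hβ.irr.eq_zero_of_chief hE hKE.le hab hK hmax hβE (fun h' => h1 (by
      rw [hipK, ← hβ.irr.1.cast_dg] at h'
      have : dg β * dg β = 1 := by exact_mod_cast h'
      rw [← hβ.irr.1.cast_dg, Nat.eq_one_of_mul_eq_one_right this, Nat.cast_one])) hx hxK
  obtain ⟨σ, hσm, hσp⟩ := h.exists_galois hodd
  have hσ1 : σ (β 1) = β 1 := by rw [← hβ.irr.1.cast_dg, map_natCast]
  have hbI : Irr H (σ ∘ β) := hβ.irr.galois σ
  have hbE : Irr E (res E (σ ∘ β)) := by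
    rw [show res E (σ ∘ β) = σ ∘ res E β by
      ext g
      by_cases hg : g ∈ E
      · simp [res_of_mem hg]
      · simp [res_of_notMem hg]]
    exact hβE.galois σ
  have hsq : res E (β * β) = β 1 • res E (σ ∘ β) := by
    ext g
    by_cases hg : g ∈ E
    · rw [res_of_mem hg, Pi.smul_apply, res_of_mem hg, Pi.mul_apply, Function.comp_apply, smul_eq_mul]
      by_cases hgK : g ∈ K
      · rw [hβk hgK, map_mul, hσ1, hσp _ (hηp hgK)]
        ring
      · rw [hvan hg hgK, map_zero, mul_zero, mul_zero]
    · rw [res_of_notMem hg, Pi.smul_apply, res_of_notMem hg, smul_zero]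
  obtain ⟨ρ, hρ, hρE, hρe⟩ := gallagher_chr hE hbI hbE (hβ.irr.1.mul hβ.irr.1) fun ξ hξ hξ0 => by
    obtain ⟨ν, hν, hν0⟩ := hξ.exists_constituent hE.le
    have h2 := (hβ.irr.1.mul hβ.irr.1).over_trans hE.le hξ hν.1 hξ0 hν0
    rw [← ip_res_left, hsq, ip_smul_left] at h2
    rwa [hbE.eq_of_ip_ne_zero hν (right_ne_zero_of_mul h2)]
  have hρ1 : ρ 1 = β 1 := by
    have h2 := congrFun hρe 1
    rw [Pi.mul_apply, Pi.mul_apply, Function.comp_apply, hσ1] at h2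
    exact (mul_left_cancel₀ hβ0 h2).symm
  have hρ0 : ρ ≠ 0 := fun h' => hβ0 (by rw [← hρ1, h']; rfl)
  have hreg {g : G} (hg : g ∈ H) (hgm : g ^ m = 1) : β g = ρ g := by
    have h2 := congrFun hρe g
    rw [Pi.mul_apply, Pi.mul_apply, Function.comp_apply,
      hβ.irr.1.galois_apply_eq hg h.hm hgm hσm] at h2
    refine mul_left_cancel₀ (fun h0 => ?_) h2
    have h3 := hβ.irr.1.schur_average hE.le hβE hg (H.inv_mem hg)
    have h4 (x : E) : β (x * g * (x : G)⁻¹ * g⁻¹) =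
        β 1 * if (x : G) * g * (x : G)⁻¹ * g⁻¹ ∈ K then 1 else 0 := by
      split_ifs with hxK
      · rw [hβk hxK, hη.eq_one_of_commutator hK hinv (h.cop.pow_left n) (fun z hz => hηp hz) hg hgm hxK]
      · rw [hvan _ hxK, mul_zero]
        have := E.mul_mem x.2 (hE.2 g hg _ (E.inv_mem x.2))
        simpa [mul_assoc] using this
    rw [h0, zero_mul, zero_div, Finset.sum_congr rfl fun x _ => h4 x, ← Finset.mul_sum,
      Finset.sum_boole] at h3
    have h5 : (Finset.univ.filter fun x : E => (x : G) * g * (x : G)⁻¹ * g⁻¹ ∈ K).card = 0 := by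
      have h6 := (mul_eq_zero.mp ((mul_eq_zero.mp h3).resolve_left
        (inv_ne_zero (card_ne_zero' E)))).resolve_left hβ0
      exact_mod_cast h6
    rw [Finset.card_eq_zero, Finset.filter_eq_empty_iff] at h5
    exact h5 (Finset.mem_univ 1) (by simp [K.one_mem])
  have hzρ {z : G} (hzH : z ∈ H) (hz : z ^ p ^ n = 1) (hzc : ∀ x ∈ H, z * x = x * z) :
      ρ z = ρ 1 := by
    have hc (j : ℕ) : β (z ^ j) = β 1 * (β z / β 1) ^ j := by
      induction j with
      | zero => simp
      | succ j ih =>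
        have h2 := hβ.irr.apply_central hzH hzc (H.pow_mem hzH j)
        rw [← pow_succ', ih] at h2
        rw [eq_div_of_mul_eq hβ0 h2, pow_succ]
        field_simp
    have hcp : (β z / β 1) ^ p ^ n = 1 := by
      have h2 := hc (p ^ n)
      rw [hz] at h2
      exact (mul_left_cancel₀ hβ0 (by rw [mul_one]; exact h2)).symm
    have hσz := hσp _ hcp
    rw [map_div₀, hσ1] at hσz
    have hz0 : β z ≠ 0 := fun h0 => by
      rw [h0, zero_div, zero_pow h.ef.ha] at hcp
      exact zero_ne_one hcp
    have h2 := congrFun hρe z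
    rw [Pi.mul_apply, Pi.mul_apply, Function.comp_apply, (div_eq_iff hβ0).mp hσz] at h2
    rw [hρ1]
    field_simp at h2
    exact h2.symm
  have hred : ¬Irr H ρ := fun hI => h1 (hβ.irr.apply_one_of_sq (by
    rw [hρe]
    exact gallagher_aux hE hbI hbE ρ hI hρE))
  obtain ⟨ρ₁, ρ₂, h₁, h₂, he, h₁0, h₂0⟩ : ∃ ρ₁ ρ₂, Chr H ρ₁ ∧ Chr H ρ₂ ∧ ρ = ρ₁ + ρ₂ ∧
      ρ₁ ≠ 0 ∧ ρ₂ ≠ 0 := by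
    by_contra hcon
    push Not at hcon
    exact hred (hρ.irr_of_indecomposable hρ0 fun f₁ f₂ h₁ h₂ he => or_iff_not_imp_left.mpr
      (hcon f₁ f₂ h₁ h₂ he))
  refine ⟨ρ₁, ρ₂, h₁, h₂, h₁0, fun _ => h₂0, fun g hg hgm => ?_, fun z hzH hz hzc g => ?_⟩
  · rw [hreg hg hgm, he, Pi.add_apply]
  · have hZc {x : G} (hx : x ∈ Subgroup.zpowers z) : x ∈ H ∧ x ^ p ^ n = 1 ∧ ∀ y ∈ H, x * y = y * x := by
      obtain ⟨j, rfl⟩ := hx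
      refine ⟨H.zpow_mem hzH j, ?_, fun y hy => ?_⟩
      · simp only
        rw [← zpow_natCast, zpow_comm, zpow_natCast, hz, one_zpow]
      · exact (Commute.zpow_left (hzc y hy) j)
    have hZ : Nrm (Subgroup.zpowers z) H := ⟨fun x hx => (hZc hx).1, fun x hx y hy => by
      rwa [← (hZc hy).2.2 x hx, mul_inv_cancel_right]⟩
    have hT : Trv (Subgroup.zpowers z) ρ := hρ.trv_of_res hZ fun x hx =>
      hzρ (hZc hx).1 (hZc hx).2.1 (hZc hx).2.2
    have hzz := Subgroup.mem_zpowers z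
    exact ⟨Trv.of_add h₁ h₂ hZ (he ▸ hT) z hzz g,
      Trv.of_add h₂ h₁ hZ (by rw [add_comm]; exact he ▸ hT) z hzz g⟩

end

section

variable {G : Type} [Group G] [Fintype G]
  {D E H J K M N L S T U X : Subgroup G} {f k θ χ ψ l β α ξ ζ ω η κ ρ : G → ℂ} {g : G}
  {a b d p m n : ℕ}

theorem det_eq_dt {M : G → Matrix (Fin d) (Fin d) ℂ}
    (hM : ∀ g ∈ H, ∀ h ∈ H, M (g * h) = M g * M h) (hM1 : M 1 = 1)
    (hf : ∀ g, f g = (M g).trace) (hg : g ∈ H) : (M g).det = dt f g := by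
  have hpow (j : ℕ) : M (g ^ j) = M g ^ j := by
    induction j with
    | zero => rw [pow_zero, pow_zero, hM1]
    | succ j ih => rw [pow_succ, hM _ (H.pow_mem hg j) _ hg, ih, pow_succ]
  obtain ⟨s, -, hs, hs'⟩ := exists_eigenvalues (Matrix.toLin' (M g)) (N := orderOf g)
    (orderOf_pos g).ne' (by rw [← Matrix.toLin'_pow, ← hpow, pow_orderOf_eq_one, hM1, Matrix.toLin'_one]; rfl)
  rw [dt, eig_eq (s := s), ← hs, LinearMap.det_toLin']
  intro j
  rw [hf, hpow, ← hs', ← Matrix.toLin'_pow, Matrix.trace_toLin'_eq]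

theorem Spec.dg_eq_pow (h : PSol p n m G) (hη : Spec m (p ^ n) K η) : ∃ s, dg η = p ^ s := by
  obtain ⟨j, hj⟩ := hη.irr.dg_dvd_index (N := ⊥) (l := 1) bot_le fun z hz g => by
    rw [Subgroup.mem_bot.mp hz, mul_one, Pi.one_apply, mul_one]
  rw [Subgroup.card_bot, mul_one] at hj
  refine ⟨_, Nat.eq_prime_pow_of_unique_prime_dvd hη.irr.dg_pos.ne' fun {q} hq hqd => ?_⟩
  have : Fact q.Prime := ⟨hq⟩
  obtain ⟨x, hx⟩ := exists_prime_orderOf_dvd_card' (G := K) q (hj ▸ hqd.mul_right j)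
  have h1 : q ∣ p ^ n * m := by
    rw [← hx, orderOf_dvd_iff_pow_eq_one]
    exact Subtype.ext (h.ef.ex x)
  rcases (hq.dvd_mul).mp h1 with h2 | h2
  · exact (Nat.prime_dvd_prime_iff_eq hq h.hp).mp (hq.dvd_of_dvd_pow h2)
  · exact absurd (Nat.dvd_one.mp (hη.cop ▸ Nat.dvd_gcd hqd h2)) hq.one_lt.ne'

/-- An automorphism fixing an irreducible character is realised by an intertwiner. -/
theorem exists_intertwiner {M : G → Matrix (Fin d) (Fin d) ℂ}
    (hM : ∀ g ∈ K, ∀ h ∈ K, M (g * h) = M g * M h) (hM1 : M 1 = 1)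
    (hMη : ∀ g, η g = (M g).trace) (hη : Irr K η) {x : G} (hx : ∀ k ∈ K, x * k * x⁻¹ ∈ K)
    (hinv : cj x η = η) :
    ∃ A : Matrix (Fin d) (Fin d) ℂ, A.det = 1 ∧ ∀ k ∈ K, A * M k = M (x * k * x⁻¹) * A := by
  let c (k : G) : G := x * k * x⁻¹
  have hc (j k : G) : c (j * k) = c j * c k := by simp [c, mul_assoc]
  have hMc {j k : G} (hj : j ∈ K) (hk : k ∈ K) : M (c (j * k)) = M (c j) * M (c k) := by
    rw [hc, hM _ (hx j hj) _ (hx k hk)]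
  let T (B : Matrix (Fin d) (Fin d) ℂ) : Matrix (Fin d) (Fin d) ℂ :=
    ∑ k : K, M (c k) * B * M (k : G)⁻¹
  let T' (B : Matrix (Fin d) (Fin d) ℂ) : Matrix (Fin d) (Fin d) ℂ :=
    ∑ k : K, M k * B * M (c (k : G)⁻¹)
  have hT (B) {j : G} (hj : j ∈ K) : T B * M j = M (c j) * T B := by
    simp only [T, Finset.sum_mul, Finset.mul_sum]
    refine Fintype.sum_equiv (Equiv.mulLeft (⟨j, hj⟩ : K)⁻¹) _ _ fun k => ?_
    have h1 : M (k : G)⁻¹ * M j = M ((j⁻¹ * k : G)⁻¹) := by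
      rw [← hM _ (K.inv_mem k.2) _ hj]; simp
    have h2 : M (c j) * M (c (j⁻¹ * k)) = M (c k) := by
      rw [← hMc hj (K.mul_mem (K.inv_mem hj) k.2)]; simp
    simp only [Equiv.coe_mulLeft, Subgroup.coe_mul, Subgroup.coe_inv]
    rw [Matrix.mul_assoc, h1, ← Matrix.mul_assoc, ← Matrix.mul_assoc, h2]
  have hT' (B) {j : G} (hj : j ∈ K) : T' B * M (c j) = M j * T' B := by
    simp only [T', Finset.sum_mul, Finset.mul_sum]
    refine Fintype.sum_equiv (Equiv.mulLeft (⟨j, hj⟩ : K)⁻¹) _ _ fun k => ?_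
    have h1 : M (c (k : G)⁻¹) * M (c j) = M (c ((j⁻¹ * k : G)⁻¹)) := by
      rw [← hMc (K.inv_mem k.2) hj]; simp
    have h2 : M j * M (j⁻¹ * k) = M k := by
      rw [← hM _ hj _ (K.mul_mem (K.inv_mem hj) k.2)]; simp
    simp only [Equiv.coe_mulLeft, Subgroup.coe_mul, Subgroup.coe_inv]
    rw [Matrix.mul_assoc, h1, ← Matrix.mul_assoc, ← Matrix.mul_assoc, h2]
  have hne : ∃ B, T B ≠ 0 := by
    by_contra hcon
    push Not at hcon
    have h1 : ∑ i, ∑ j, (T (Matrix.single i j 1)) i j = (Nat.card K : ℂ) := by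
      have h2 (i j : Fin d) (k : K) : (M (c k) * (Matrix.single i j 1 : Matrix (Fin d) (Fin d) ℂ) * M (k : G)⁻¹) i j =
          M (c k) i i * M (k : G)⁻¹ j j := by
        rw [Matrix.mul_assoc, Matrix.mul_apply, Finset.sum_eq_single i]
        · simp
        · intro b _ hb
          rw [Matrix.single_mul_apply_of_ne _ _ _ _ _ hb, mul_zero]
        · simp
      simp only [T, Matrix.sum_apply, h2]
      have h3 : ∑ k : K, η k * η (k : G)⁻¹ = Nat.card K := by
        have h4 := hη.2
        rw [ip_eq] at h4
        rwa [inv_mul_eq_iff_eq_mul₀ (card_ne_zero' K), mul_one] at h4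
      rw [← h3, Finset.sum_congr rfl fun i _ => Finset.sum_comm, Finset.sum_comm]
      refine Finset.sum_congr rfl fun k _ => ?_
      rw [← Finset.sum_mul_sum, hMη (k : G)⁻¹]
      congr 1
      rw [← congrFun hinv k]
      exact (hMη _).symm
    simp only [hcon, Matrix.zero_apply, Finset.sum_const_zero] at h1
    exact card_ne_zero' K h1.symm
  obtain ⟨B, hB⟩ := hne
  obtain ⟨i, j, hij⟩ : ∃ i j, T B i j ≠ 0 := by
    by_contra hcon
    push Not at hcon
    exact hB (by ext i j; exact hcon i j)
  obtain ⟨e, he⟩ := schur (A := T' (Matrix.single j i 1) * T B) hM hM1 (by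
      have := hη.2
      rwa [show η = fun g => (M g).trace from funext hMη] at this) fun k hk => by
    rw [← Matrix.mul_assoc, ← hT' _ hk, Matrix.mul_assoc, Matrix.mul_assoc, hT _ hk]
  have he0 : e ≠ 0 := fun h0 => by
    have h1 : (T' (Matrix.single j i 1) * T B).trace = Nat.card K * T B i j := by
      simp only [T', Finset.sum_mul, Matrix.trace_sum]
      rw [Nat.card_eq_fintype_card, ← nsmul_eq_mul, ← Finset.card_univ, ← Finset.sum_const]
      refine Finset.sum_congr rfl fun k _ => ?_
      rw [Matrix.mul_assoc, Matrix.mul_assoc, Matrix.trace_mul_comm, Matrix.mul_assoc, Matrix.mul_assoc,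
        hT _ k.2, ← Matrix.mul_assoc (M (c (k : G)⁻¹)), ← hMc (K.inv_mem k.2) k.2]
      simp [c, hM1, Matrix.trace_single_mul]
    rw [he, h0, zero_smul, Matrix.trace_zero] at h1
    exact (mul_ne_zero (card_ne_zero' K) hij) h1.symm
  have hdet : (T B).det ≠ 0 := fun h0 => by
    have h1 := congrArg Matrix.det he
    rw [Matrix.det_mul, h0, mul_zero, Matrix.det_smul, Matrix.det_one, mul_one] at h1
    exact pow_ne_zero _ he0 h1.symm
  have hd : 0 < d := i.pos
  obtain ⟨z, hz⟩ := IsAlgClosed.exists_pow_nat_eq (T B).det⁻¹ hd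
  refine ⟨z • T B, ?_, fun k hk => ?_⟩
  · rw [Matrix.det_smul, Fintype.card_fin, hz, inv_mul_cancel₀ hdet]
  · rw [Matrix.smul_mul, hT _ hk, Matrix.mul_smul]

end

section

variable {G : Type} [Group G] [Fintype G]
  {D E H J K M N L S T U X : Subgroup G} {f k θ χ ψ l β α ξ ζ ω η κ ρ : G → ℂ} {g : G}
  {a b d p m n : ℕ}

/-- A central extension `Γ` of `H` by a `p`-group in which the character `η` of `K` lifts to a
normal subgroup `L` and extends to `w`. -/
structure Cover (p n m : ℕ) (H K : Subgroup G) (η : G → ℂ) {Γ : Type} [Group Γ] [Fintype Γ]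
    (π : Γ →* G) (r : ℕ) (L : Subgroup Γ) (w : Γ → ℂ) : Prop where
  sol : PSol p r m Γ
  map_top : (⊤ : Subgroup Γ).map π = H
  ker : ∀ z ∈ π.ker, z ^ p ^ r = 1 ∧ ∀ x, z * x = x * z
  nrm : Nrm L ⊤
  map : L.map π = K
  chr : Chr ⊤ w
  res : res L w = pb π L η
  le : n ≤ r
  central : ∀ z ∈ H, z ^ p ^ n = 1 → (∀ x ∈ H, z * x = x * z) →
    ∃ y, π y = z ∧ y ^ p ^ r = 1 ∧ ∀ x, y * x = x * y

theorem PSol.comap {Γ : Type} [Group Γ] (h : PSol p n m G) (π : Γ →* G) {r : ℕ} (hr : n ≤ r)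
    (hker : ∀ z ∈ π.ker, z ^ p ^ r = 1) (hex : ∀ z : Γ, z ^ (p ^ r * m) = 1) : PSol p r m Γ := by
  have hpn : p ^ n ∣ p ^ r := pow_dvd_pow p hr
  refine ⟨h.hp, fun h0 => h.hn (by omega), ⟨h.cop.pow_left r, pow_ne_zero _ h.hp.ne_zero, h.hm, hex⟩, ?_⟩
  refine .trans (b := π.ker) (.single ⟨⟨bot_le, fun x _ y hy => ?_⟩, Or.inl fun g hg => ?_⟩) ?_
  · rw [Subgroup.mem_bot.mp hy]; simp
  · exact hker g hg
  · have h1 := Relation.ReflTransGen.lift (fun X : Subgroup G => X.comap π)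
      (p := Step (G := Γ) (p ^ r) m) (fun X Y hXY => ?_) _ _ h.ser
    · simpa [Function.onFun, MonoidHom.comap_bot] using h1
    · have h2 : Nrm (X.comap π) (Y.comap π) := ⟨Subgroup.comap_mono hXY.1.le, fun x hx y hy => by
        rw [Subgroup.mem_comap] at hx hy ⊢
        simpa using hXY.1.2 _ hx _ hy⟩
      refine ⟨h2, hXY.2.imp (fun h3 g hg => ?_) fun h3 g hg => ?_⟩
      · rw [Subgroup.mem_comap, map_pow]
        obtain ⟨j, hj⟩ := hpn
        rw [hj, pow_mul]
        exact X.pow_mem (h3 _ hg) j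
      · rw [Subgroup.mem_comap, map_pow]
        exact h3 _ hg

theorem PSol.exists_cover (h : PSol p n m G) (hK : Nrm K H) (hη : Spec m (p ^ n) K η)
    (hinv : ∀ x ∈ H, cj x η = η) : ∃ (Γ : Type) (_ : Group Γ) (_ : Fintype Γ) (π : Γ →* G) (r : ℕ)
      (L : Subgroup Γ) (w : Γ → ℂ), Cover p n m H K η π r L w := by
  obtain ⟨d, M, hM0, hM, hM1, hMη⟩ := hη.irr.1.exists_matrix
  obtain ⟨s, hs⟩ := hη.dg_eq_pow h
  have hds : d = p ^ s := by
    rw [← hs]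
    have h1 := hη.irr.1.cast_dg
    rw [hMη, hM1, Matrix.trace_one, Fintype.card_fin] at h1
    exact_mod_cast h1.symm
  have hMi {k : G} (hk : k ∈ K) : M k * M k⁻¹ = 1 := by
    rw [← hM _ hk _ (K.inv_mem hk), mul_inv_cancel, hM1]
  have hMi' {k : G} (hk : k ∈ K) : M k⁻¹ * M k = 1 := by
    rw [← hM _ (K.inv_mem hk) _ hk, inv_mul_cancel, hM1]
  let W : Subgroup (G × (Matrix (Fin d) (Fin d) ℂ)ˣ) :=
    { carrier := {γ | γ.1 ∈ H ∧ (∀ k ∈ K, (γ.2 : Matrix (Fin d) (Fin d) ℂ) * M k =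
        M (γ.1 * k * γ.1⁻¹) * γ.2) ∧ (γ.2 : Matrix (Fin d) (Fin d) ℂ).det ^ p ^ n = 1}
      mul_mem' := by
        rintro ⟨x, A⟩ ⟨y, B⟩ ⟨hx, hA, hdA⟩ ⟨hy, hB, hdB⟩
        refine ⟨H.mul_mem hx hy, fun k hk => ?_, ?_⟩
        · simp only [Prod.mk_mul_mk, Units.val_mul] at *
          rw [Matrix.mul_assoc, hB k hk, ← Matrix.mul_assoc, hA _ (hK.2 y hy k hk), Matrix.mul_assoc]
          simp [mul_assoc]
        · simp only [Prod.mk_mul_mk, Units.val_mul] at *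
          rw [Matrix.det_mul, mul_pow, hdA, hdB, one_mul]
      one_mem' := ⟨H.one_mem, by simp, by simp⟩
      inv_mem' := by
        rintro ⟨x, A⟩ ⟨hx, hA, hdA⟩
        refine ⟨H.inv_mem hx, fun k hk => ?_, ?_⟩
        · simp only [Prod.inv_mk] at *
          have h1 := hA _ (hK.2 _ (H.inv_mem hx) k hk)
          rw [show x * (x⁻¹ * k * x⁻¹⁻¹) * x⁻¹ = k by group] at h1
          rw [Units.inv_mul_eq_iff_eq_mul, ← mul_assoc, h1, mul_assoc, Units.mul_inv, mul_one]
        · simp only [Prod.inv_mk] at *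
          have h1 : ((A⁻¹ : (Matrix (Fin d) (Fin d) ℂ)ˣ) : Matrix (Fin d) (Fin d) ℂ).det *
              (A : Matrix (Fin d) (Fin d) ℂ).det = 1 := by
            rw [← Matrix.det_mul, Units.inv_mul, Matrix.det_one]
          have h2 := congrArg (· ^ p ^ n) h1
          simp only [mul_pow, hdA, mul_one, one_pow] at h2
          exact h2 }
  let π : W →* G := (MonoidHom.fst _ _).comp W.subtype
  have hπ (γ : W) : π γ = γ.1.1 := rfl
  have hsc (γ : W) (hγ : γ ∈ π.ker) : ∃ e : ℂ, e ^ p ^ (s + n) = 1 ∧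
      (γ.1.2 : Matrix (Fin d) (Fin d) ℂ) = e • 1 := by
    have h1 : γ.1.1 = 1 := hγ
    obtain ⟨e, he⟩ := schur (A := (γ.1.2 : Matrix (Fin d) (Fin d) ℂ)) hM hM1 (by
        have := hη.irr.2
        rwa [show η = fun g => (M g).trace from funext hMη] at this) fun k hk => by
      rw [γ.2.2.1 k hk, h1]; simp
    refine ⟨e, ?_, he⟩
    have h2 := γ.2.2.2
    rw [he, Matrix.det_smul, Matrix.det_one, mul_one, Fintype.card_fin, ← pow_mul, hds, ← pow_add] at h2
    exact h2
  have hfin : Finite W := by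
    rw [π.finite_iff_finite_ker_range]
    refine ⟨?_, inferInstance⟩
    choose e he he' using hsc
    have : Finite {e : ℂ // e ^ p ^ (s + n) = 1} := by
      refine Set.Finite.subset (Polynomial.nthRootsFinset (p ^ (s + n)) (1 : ℂ)).finite_toSet fun e he => ?_
      rw [Finset.mem_coe, Polynomial.mem_nthRootsFinset (pow_pos h.hp.pos _)]
      exact he
    refine Finite.of_injective (β := {e : ℂ // e ^ p ^ (s + n) = 1})
      (fun z : π.ker => ⟨e z z.2, he z z.2⟩) fun y z hyz => ?_
    have h1 : e y.1 y.2 = e z.1 z.2 := congrArg Subtype.val hyz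
    refine Subtype.ext (Subtype.ext (Prod.ext ?_ (Units.ext ?_)))
    · have h2 : y.1.1.1 = 1 := y.2
      have h3 : z.1.1.1 = 1 := z.2
      rw [h2, h3]
    · rw [he' y.1 y.2, he' z.1 z.2, h1]
  have hker (z : W) (hz : z ∈ π.ker) : z ^ p ^ (n + (s + n)) = 1 ∧ ∀ x, z * x = x * z := by
    obtain ⟨e, he, he'⟩ := hsc z hz
    have h1 : z.1.1 = 1 := hz
    refine ⟨Subtype.ext (Prod.ext ?_ (Units.ext ?_)), fun x =>
      Subtype.ext (Prod.ext ?_ (Units.ext ?_))⟩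
    · simp [h1]
    · simp only [Subgroup.coe_pow, Prod.pow_snd, Units.val_pow_eq_pow_val, he']
      rw [smul_pow, one_pow, pow_add, pow_mul', he, one_pow, one_smul]
      rfl
    · simp [h1]
    · simp only [Subgroup.coe_mul, Prod.snd_mul, Units.val_mul, he']
      simp
  have hex (z : W) : z ^ (p ^ (n + (s + n)) * m) = 1 := by
    have h1 : z ^ (p ^ n * m) ∈ π.ker := by
      rw [MonoidHom.mem_ker, map_pow]
      exact h.ef.ex _
    obtain ⟨e, he, he'⟩ := hsc _ h1
    rw [pow_add, mul_right_comm, pow_mul]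
    refine Subtype.ext (Prod.ext ?_ (Units.ext ?_))
    · have h2 : (z ^ (p ^ n * m)).1.1 = 1 := h1
      rw [Subgroup.coe_pow, Prod.pow_fst, h2, one_pow]
      rfl
    · rw [Subgroup.coe_pow, Prod.pow_snd, Units.val_pow_eq_pow_val, he', smul_pow, one_pow, he, one_smul]
      rfl
  let L : Subgroup W :=
    { carrier := {γ | γ.1.1 ∈ K ∧ (γ.1.2 : Matrix (Fin d) (Fin d) ℂ) = M γ.1.1}
      mul_mem' := fun {x y} hx hy => ⟨K.mul_mem hx.1 hy.1, by
        simp only [Subgroup.coe_mul, Prod.snd_mul, Units.val_mul, Prod.fst_mul]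
        rw [hM _ hx.1 _ hy.1, hx.2, hy.2]⟩
      one_mem' := ⟨K.one_mem, hM1.symm⟩
      inv_mem' := fun {x} hx => ⟨K.inv_mem hx.1, by
        simp only [Subgroup.coe_inv, Prod.snd_inv, Prod.fst_inv]
        refine Units.inv_eq_of_mul_eq_one_right ?_
        rw [hx.2, hMi hx.1]⟩ }
  have : Fintype W := Fintype.ofFinite W
  have hKdet {k : G} (hk : k ∈ K) : (M k).det ^ p ^ n = 1 := by
    rw [det_eq_dt hM hM1 hMη hk, hη.dt_pow hk]
  refine ⟨W, inferInstance, inferInstance, π, n + (s + n), L,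
    fun γ => (γ.1.2 : Matrix (Fin d) (Fin d) ℂ).trace, h.comap π (by omega) (fun z hz => (hker z hz).1) hex,
    ?_, hker, ⟨le_top, fun x _ y hy => ?_⟩, ?_, ?_, ?_, by omega, fun z hz hzp hzc => ?_⟩
  · ext x
    simp only [Subgroup.mem_map, Subgroup.mem_top, true_and]
    refine ⟨?_, fun hx => ?_⟩
    · rintro ⟨γ, rfl⟩
      exact γ.2.1
    · obtain ⟨A, hA, hA'⟩ := exists_intertwiner hM hM1 hMη hη.irr (hK.2 x hx) (hinv x hx)
      refine ⟨⟨(x, ⟨A, A⁻¹, ?_, ?_⟩), hx, hA', ?_⟩, rfl⟩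
      · exact Matrix.mul_nonsing_inv A (by rw [hA]; exact isUnit_one)
      · exact Matrix.nonsing_inv_mul A (by rw [hA]; exact isUnit_one)
      · simp [hA]
  · refine ⟨hK.2 _ x.2.1 _ hy.1, ?_⟩
    simp only [Subgroup.coe_mul, Prod.snd_mul, Units.val_mul, Prod.fst_mul, Subgroup.coe_inv,
      Prod.snd_inv, Prod.fst_inv]
    rw [hy.2, x.2.2.1 _ hy.1, mul_assoc, Units.mul_inv, mul_one]
  · ext k
    refine ⟨?_, fun hk => ?_⟩
    · rintro ⟨γ, hγ, rfl⟩
      exact hγ.1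
    · refine ⟨⟨(k, ⟨M k, M k⁻¹, hMi hk, hMi' hk⟩), hK.le hk, fun j hj => ?_, hKdet hk⟩, ⟨hk, rfl⟩, rfl⟩
      simp only
      rw [← hM _ hk _ hj, ← hM _ (hK.2 k (hK.le hk) j hj) _ hk, inv_mul_cancel_right]
  · refine Chr.of_matrix (fun γ : W => (γ.1.2 : Matrix (Fin d) (Fin d) ℂ)) (fun g _ h _ => rfl)
      (fun g _ => rfl) fun g hg => absurd (Subgroup.mem_top g) hg
  · ext γ
    by_cases hγ : γ ∈ L
    · rw [res_of_mem hγ, pb_of_mem hγ, hMη, hγ.2, hπ]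
    · rw [res_of_notMem hγ, pb, res_of_notMem hγ]
  · refine ⟨⟨(z, 1), hz, fun k hk => ?_, by simp⟩, rfl, ?_, fun x => ?_⟩
    · simp only [Units.val_one, one_mul, mul_one]
      rw [hzc k (hK.le hk), mul_inv_cancel_right]
    · refine Subtype.ext (Prod.ext ?_ ?_)
      · simp [pow_add, pow_mul, hzp]
      · simp
    · refine Subtype.ext (Prod.ext ?_ ?_)
      · exact hzc _ x.2.1
      · simp

end

section

variable {G : Type} [Group G] [Fintype G]
  {D E H J K M N L S T U X : Subgroup G} {f k w θ χ ψ l β α ξ ζ ω η κ ρ : G → ℂ} {g : G}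
  {a b b' d p m n : ℕ}

theorem Spec.mono (h : Spec a b H f) (hb : b ∣ b') : Spec a b' H f :=
  ⟨h.irr, h.cop, fun J hJ θ hθ hne g hg => by
    obtain ⟨j, rfl⟩ := hb
    rw [pow_mul, h.det J hJ θ hθ hne g hg, one_pow]⟩

theorem Subn.sup (h : Subn J H) (hN : Nrm N H) : Subn (N ⊔ J) H := by
  induction h using Relation.ReflTransGen.head_induction_on with
  | refl => rw [sup_eq_right.mpr hN.le]; exact Relation.ReflTransGen.refl
  | @head J₁ J₂ h hJ ih =>
    have hle : J₂ ≤ H := Subn.le hJ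
    refine .head ⟨sup_le_sup_left h.le N, fun x hx v hv => ?_⟩ ih
    obtain ⟨s, hs, y, hy, rfl⟩ := mem_sup_of_nrm hN hle hx
    obtain ⟨t, ht, j, hj, rfl⟩ := mem_sup_of_nrm hN (h.le.trans hle) hv
    have hs' : s ∈ N ⊔ J₁ := Subgroup.mem_sup_left hs
    have h1 : s * y * (t * j) * (s * y)⁻¹ = s * ((y * t * y⁻¹) * (y * j * y⁻¹)) * s⁻¹ := by group
    rw [h1]
    exact (N ⊔ J₁).mul_mem ((N ⊔ J₁).mul_mem hs' ((N ⊔ J₁).mul_mem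
      (Subgroup.mem_sup_left (hN.2 y (hle hy) t ht)) (Subgroup.mem_sup_right (h.2 y hy j hj))))
      ((N ⊔ J₁).inv_mem hs')

theorem Trv.of_constituent (hf : Chr H f) (hfN : Trv N f) (hN : Nrm N X) (hX : X ≤ H) (hζ : Irr X ζ)
    (hne : ip X f ζ ≠ 0) : Trv N ζ := by
  obtain ⟨ν, hν, hν0⟩ := hζ.exists_constituent hN.le
  have h1 : ip N f ν ≠ 0 := by
    have h2 := (hf.res hX).over_trans hN.le hζ hν.1 (by rwa [ip_res_left]) hν0
    rwa [← ip_res_left, res_res hN.le, ip_res_left] at h2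
  rw [← ip_res_left, hfN.res_eq, ip_smul_left] at h1
  rw [← (tr_lin N).irr.eq_of_ip_ne_zero hν (right_ne_zero_of_mul h1)] at hν0
  exact hζ.trv_of_ip hN hν0

theorem Irr.res_supplement (hζ : Irr X ζ) (hN : Nrm N X) (hJ : J ≤ X)
    (hNJ : ∀ x ∈ X, ∃ k ∈ N, ∃ j ∈ J, x = k * j) (hζN : Trv N ζ) : Irr J (SubChar.res J ζ) := by
  refine ⟨hζ.1.res hJ, ?_⟩
  have h1 := sum_supplement hN.le hJ hNJ (fun x => ζ x * ζ x⁻¹) fun l hl x => by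
    rw [hζ.1.trv_conj hζN hN hl, mul_inv_rev, hζN _ (N.inv_mem hl)]
  have h2 : (Nat.card X : ℂ) * Nat.card (J ⊓ N : Subgroup G) = Nat.card J * Nat.card N := by
    exact_mod_cast card_supplement hN.le hJ hNJ
  have h3 := hζ.2
  rw [ip_eq] at h3
  rw [ip_res_left, ip_res_right, ip_eq]
  simp only [Subgroup.coe_inv] at h3 ⊢
  have hX := card_ne_zero' X
  have hJc := card_ne_zero' J
  have hNc := card_ne_zero' N
  have hD := card_ne_zero' (J ⊓ N)
  field_simp at h1 h3 ⊢
  rw [h3] at h1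
  have h4 : (Nat.card N : ℂ) * (∑ x : J, ζ x * ζ (x : G)⁻¹) = Nat.card N * Nat.card J := by
    linear_combination -h1 + h2
  exact mul_left_cancel₀ hNc h4

/-- If `w f` and the extension `w` are special, then so is the quotient `f`. -/
theorem Spec.of_mul (hab : ExpFac a b G) (hN : Nrm N H) (hw : Spec a b H w)
    (hwN : Irr N (res N w)) (hf : Irr H f) (hfN : Trv N f) (hβ : Spec a b H (w * f)) :
    Spec a b H f := by
  refine ⟨hf, hβ.cop.coprime_dvd_left ⟨dg w, by rw [dg_mul hw.irr.1 hf.1, mul_comm]⟩,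
    fun J hJ θ hθ hne g hg => ?_⟩
  have hX : N ⊔ J ≤ H := sup_le hN.le hJ.le
  have hNX : Nrm N (N ⊔ J) := hN.mono hX le_sup_left
  have hJX : J ≤ N ⊔ J := le_sup_right
  obtain ⟨ζ, hζ, hfζ, hζθ⟩ := exists_between hf.1 hX hJX hne
  have hζN : Trv N ζ := hfN.of_constituent hf.1 hNX hX hζ hfζ
  have hζJ := hζ.res_supplement hNX hJX (fun x hx => mem_sup_of_nrm hN hJ.le hx) hζN
  obtain rfl := hζJ.eq_of_ip_ne_zero hθ (by rwa [ip_res_left])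
  have hwX := Irr.res_of_le hw.irr.1 hwN le_sup_left hX
  have hwζ : Irr (N ⊔ J) (res (N ⊔ J) w * ζ) :=
    gallagher_aux hNX hwX (by rwa [res_res le_sup_left]) ζ hζ hζN
  have hne' : ip (N ⊔ J) (w * f) (res (N ⊔ J) w * ζ) ≠ 0 := by
    obtain ⟨f', hf', he⟩ := (hf.1.res hX).exists_add hζ (by rwa [ip_res_left])
    rw [← ip_res_left, res_mul, he, mul_add]
    exact ip_add_ne_zero hwζ.1 (hwX.1.mul hf') hwζ.1 (by rw [hwζ.2]; exact one_ne_zero)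
  have h1 := hβ.det _ (hJ.sup hN) _ hwζ hne' g (hJX hg)
  rw [hwX.1.dt_mul' hζ.1 (hJX hg), dt_res (hJX hg), dg_res, mul_pow, ← pow_mul, mul_comm (dg ζ),
    pow_mul, hw.dt_pow (hJ.le hg), one_pow, one_mul, ← pow_mul, mul_comm (dg w), pow_mul] at h1
  rw [dt_res hg]
  refine eq_one_of_pow_of_coprime hw.cop h1 ?_
  rw [← pow_mul, mul_comm b a]
  exact hζ.1.dt_ab hab (hJX hg)

theorem PSol.exists_lift_reg {Γ : Type} [Group Γ] [Fintype Γ] {π : Γ →* G} {r : ℕ}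
    (h : PSol p r m Γ) (y : Γ) (hy : π y ^ m = 1) : ∃ z, π z = π y ∧ z ^ m = 1 := by
  obtain ⟨t, ht1, ht2⟩ := Nat.chineseRemainder (h.cop.pow_left r).symm 1 0
  obtain ⟨j, rfl⟩ := (Nat.modEq_zero_iff_dvd).mp ht2
  exact ⟨y ^ (p ^ r * j), by rw [map_pow, pow_eq_of_modEq hy ht1, pow_one],
    by rw [← pow_mul, mul_right_comm, pow_mul, h.ef.ex, one_pow]⟩

theorem Spec.split_of_invariant (h : PSol p n m G) (hK : Nrm K H) (hβ : Spec m (p ^ n) H β)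
    (hβK : ¬Irr K (res K β)) (hη : Irr K η) (hne : ip K β η ≠ 0) (hinv : ∀ x ∈ H, SubChar.cj x η = η)
    (hη1 : η 1 ≠ 1)
    (IH : ∀ (Γ : Type) [Group Γ] [Fintype Γ] (r : ℕ), PSol p r m Γ → ∀ β' : Γ → ℂ,
      Spec m (p ^ r) ⊤ β' → dg β' < dg β → Split p r m ⊤ β') : Split p n m H β := by
  have hηs := hβ.constituent hK hη hne
  obtain ⟨Γ, _, _, π, r, L, w₀, C⟩ := h.exists_cover hK hηs hinv
  have hab : ExpFac m (p ^ r) Γ := C.sol.ef.symm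
  have hdvd : p ^ n ∣ p ^ r := pow_dvd_pow p C.le
  have hb : Spec m (p ^ r) ⊤ (SubChar.pb π ⊤ β) := by
    refine Spec.mono (Spec.pb ?_) hdvd
    rwa [C.map_top]
  have hηL : Spec m (p ^ r) L (SubChar.pb π L η) := by
    refine Spec.mono (Spec.pb ?_) hdvd
    rwa [C.map]
  have hw₀ : Irr ⊤ w₀ := C.chr.irr_of_res le_top (C.res ▸ hηL.irr)
  have hdw₀ : dg w₀ = dg η := by rw [← dg_res L, C.res, dg_pb]
  have hcw : (dg w₀).Coprime m := hdw₀ ▸ hηs.cop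
  set w := w₀ * (nd m (p ^ r) ⊤ w₀)⁻¹ with hwdef
  have hnd := (hw₀.1.nd_lin m (p ^ r)).inv'
  have hwL : res L w = SubChar.pb π L η := by
    rw [← C.res]
    exact res_mul_nd_inv hab le_top hcw fun g hg => by
      rw [← dt_res hg, C.res]
      exact hηL.dt_pow hg
  have hw : Spec m (p ^ r) ⊤ w := Spec.of_res hab C.nrm (hw₀.mul_lin hnd) (hwL ▸ hηL)
    fun g hg => hw₀.1.dt_mul_nd_inv hab hcw hg
  have hwLI : Irr L (res L w) := hwL ▸ hηL.irr
  have hdw : dg w = dg η := by rw [← hdw₀]; exact dg_mul_lin hnd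
  have hrb : res L (SubChar.pb π ⊤ β) = SubChar.pb π L β := by
    rw [res_pb le_top, SubChar.pb, SubChar.pb, C.map]
    ext x
    by_cases hx : x ∈ L
    · rw [res_of_mem hx, res_of_mem hx, Function.comp_apply, res_of_mem (C.map ▸ Subgroup.mem_map_of_mem π hx)]
      rfl
    · rw [res_of_notMem hx, res_of_notMem hx]
  obtain ⟨f, hf, hfL, hbf⟩ := gallagher C.nrm hw.irr hwLI hb.irr (by
    rw [← ip_res_left, hrb, hwL, ip_pb, C.map]
    exact hne)
  have hfs : Spec m (p ^ r) ⊤ f := hw.of_mul hab C.nrm hwLI hf hfL (hbf ▸ hb)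
  have hdβ : dg β = dg w * dg f := by rw [← dg_mul hw.irr.1 hf.1, ← hbf, dg_pb]
  have hw1 : dg w ≠ 1 := fun h0 => hη1 (by rw [← hη.1.cast_dg, ← hdw, h0, Nat.cast_one])
  have hf1 : dg f ≠ 1 := fun h0 => hβK (by
    have h1 : res L (SubChar.pb π ⊤ β) = res L w := by
      rw [hbf, res_mul, hfL.res_eq, ← hf.1.cast_dg, h0, Nat.cast_one, one_smul]
      ext x
      by_cases hx : x ∈ L
      · rw [Pi.mul_apply, tr_of_mem hx, mul_one]
      · rw [Pi.mul_apply, res_of_notMem hx, zero_mul]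
    refine ⟨hβ.irr.1.res hK.le, ?_⟩
    have h2 := hwLI.2
    rw [← h1, hrb, ip_pb, C.map] at h2
    rwa [ip_res_left, ip_res_right])
  have hwp := hw.irr.dg_pos
  have hfp := hf.dg_pos
  have hw1' : w 1 ≠ 1 := fun h0 => hw1 (by
    rw [← hw.irr.1.cast_dg] at h0
    exact_mod_cast h0)
  obtain ⟨w₁, w₂, hw₁, hw₂, hw₁0, hw₂0, hwe, hwz⟩ := IH Γ r C.sol w hw (by
    rw [hdβ]
    exact lt_mul_of_one_lt_right hwp (by omega))
  obtain ⟨f₁, f₂, hf₁, hf₂, hf₁0, -, hfe, hfz⟩ := IH Γ r C.sol f hfs (by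
    rw [hdβ]
    exact lt_mul_of_one_lt_left hfp (by omega))
  have hF := hf₁.add hf₂
  have hF0 : f₁ + f₂ ≠ 0 := hf₁.add_ne_zero hf₂ hf₁0
  have htriv {z : Γ} (hz : z ^ p ^ r = 1) (hzc : ∀ x, z * x = x * z) (g : Γ) :
      (w₁ * (f₁ + f₂)) (g * z) = (w₁ * (f₁ + f₂)) g ∧ (w₂ * (f₁ + f₂)) (g * z) = (w₂ * (f₁ + f₂)) g := by
    have h1 := hwz z (Subgroup.mem_top z) hz (fun x _ => hzc x) g
    have h2 := hfz z (Subgroup.mem_top z) hz (fun x _ => hzc x) g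
    simp only [Pi.mul_apply, Pi.add_apply, h1, h2, and_self]
  obtain ⟨ρ₁, hρ₁, he₁⟩ := (hw₁.mul hF).exists_pb (φ := π) (fun z hz g =>
    (htriv (C.ker z hz).1 (C.ker z hz).2 g).1) le_top
  obtain ⟨ρ₂, hρ₂, he₂⟩ := (hw₂.mul hF).exists_pb (φ := π) (fun z hz g =>
    (htriv (C.ker z hz).1 (C.ker z hz).2 g).2) le_top
  rw [C.map_top] at hρ₁ hρ₂
  have hval {ρ : G → ℂ} {y : Γ → ℂ} (he : y = SubChar.pb π ⊤ ρ) (x : Γ) : ρ (π x) = y x := by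
    rw [he, pb_of_mem (Subgroup.mem_top x)]
  have hne0 {ρ : G → ℂ} {v : Γ → ℂ} (hv : Chr ⊤ v) (hv0 : v ≠ 0) (he : v * (f₁ + f₂) = SubChar.pb π ⊤ ρ) :
      ρ ≠ 0 := fun h0 => by
    have h1 := congrFun he 1
    rw [pb_of_mem (Subgroup.mem_top 1), h0, Pi.mul_apply] at h1
    exact mul_ne_zero (hv.apply_one_ne_zero hv0) (hF.apply_one_ne_zero hF0) h1
  have hsurj {g : G} (hg : g ∈ H) : ∃ y, π y = g := by
    rw [← C.map_top] at hg
    obtain ⟨y, -, hy⟩ := hg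
    exact ⟨y, hy⟩
  refine ⟨ρ₁, ρ₂, hρ₁, hρ₂, hne0 hw₁ hw₁0 he₁, fun _ => hne0 hw₂ (hw₂0 hw1') he₂, fun g hg hgm => ?_,
    fun z hzH hz hzc g => ?_⟩
  · obtain ⟨y, rfl⟩ := hsurj hg
    obtain ⟨x, hx, hxm⟩ := C.sol.exists_lift_reg y hgm
    rw [← hx, hval (ρ := β) rfl x, hval he₁, hval he₂, hbf, Pi.mul_apply,
      hwe x (Subgroup.mem_top x) hxm, hfe x (Subgroup.mem_top x) hxm]
    simp only [Pi.mul_apply, Pi.add_apply]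
    ring
  · obtain ⟨y, rfl, hy, hyc⟩ := C.central z hzH hz hzc
    by_cases hg : g ∈ H
    · obtain ⟨x, rfl⟩ := hsurj hg
      rw [← map_mul, hval he₁, hval he₂, hval he₁, hval he₂]
      exact htriv hy hyc x
    · have hg' : g * π y ∉ H := fun h' => hg ((H.mul_mem_cancel_right hzH).mp h')
      rw [hρ₁.supp hg, hρ₁.supp hg', hρ₂.supp hg, hρ₂.supp hg']
      exact ⟨rfl, rfl⟩

end

section

variable {G : Type} [Group G] [Fintype G]
  {D E H J K M N L S T U X : Subgroup G} {f k w θ χ ψ l β α ξ ζ ω η κ ρ : G → ℂ} {g : G}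
  {a b b' d p m n : ℕ}

theorem PSol.split (hodd : Odd p) (d : ℕ) : ∀ (G : Type) [Group G] [Fintype G] (n : ℕ)
    (H : Subgroup G) (β : G → ℂ), PSol p n m G → Spec m (p ^ n) H β → dg β = d → Split p n m H β := by
  induction d using Nat.strong_induction_on with
  | _ d IH =>
  intro G _ _ n H β h hβ hd
  by_cases h1 : β 1 = 1
  · exact hβ.split_of_lin h h1
  obtain ⟨E, hEmin⟩ := Set.Finite.exists_minimal
    (s := {E : Subgroup G | Nrm E H ∧ Irr E (res E β)}) (Set.toFinite _)
    ⟨H, Nrm.refl H, by rw [res_of_supp fun g hg => hβ.irr.supp hg]; exact hβ.irr⟩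
  obtain ⟨hE, hβE⟩ := hEmin.1
  have hE0 : (⊥ : Subgroup G) < E := bot_lt_iff_ne_bot.mpr fun h0 => h1 (by
    subst h0
    have h2 := hβE.2
    rw [ip_res_left, ip_res_right, ip_eq] at h2
    have h3 : β 1 * β 1 = 1 := by
      have h3 : ((default : (⊥ : Subgroup G)) : G) = 1 := Subgroup.mem_bot.mp (default : (⊥ : Subgroup G)).2
      simpa [h3] using h2
    rw [← hβ.irr.1.cast_dg] at h3 ⊢
    have h4 : dg β * dg β = 1 := by exact_mod_cast h3
    rw [Nat.eq_one_of_mul_eq_one_left h4, Nat.cast_one])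
  obtain ⟨K, hKmax⟩ := Set.Finite.exists_maximal
    (s := {K : Subgroup G | Nrm K H ∧ K < E}) (Set.toFinite _) ⟨⊥, Nrm.bot H, hE0⟩
  obtain ⟨hK, hKE⟩ := hKmax.1
  have hmax : ∀ D, Nrm D H → K ≤ D → D ≤ E → D = K ∨ D = E := fun D hD hKD hDE => by
    rcases hDE.eq_or_lt with he | hlt
    · exact .inr he
    · exact .inl (le_antisymm (hKmax.2 ⟨hD, hlt⟩ hKD) hKD)
  have hch : Chief p n m K E := by
    obtain ⟨L, hL, hKL, hLE, hch⟩ := h.exists_chief hK hE hKE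
    rcases hmax L hL hKL.le hLE with rfl | rfl
    · exact absurd hKL (lt_irrefl _)
    · exact hch
  have hβK : ¬Irr K (res K β) := fun h' => hKE.not_ge (hEmin.2 ⟨hK, h'⟩ hKE.le)
  obtain ⟨η, hη, hne⟩ := hβ.irr.exists_constituent hK.le
  by_cases hT : stab H η = H
  · have hinv : ∀ x ∈ H, cj x η = η := fun x hx => (mem_stab.mp (hT.symm ▸ hx)).2
    by_cases hη1 : η 1 = 1
    · exact hβ.split_of_lin_constituent h hodd hE hK hKE hch hmax hβE (Chr.lin hη.1 hη1) hne hinv h1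
    · exact hβ.split_of_invariant h hK hβK hη hne hinv hη1 fun Γ _ _ r hΓ β' hβ' hlt =>
        IH _ (hd ▸ hlt) Γ r ⊤ β' hΓ hβ' rfl
  · exact hβ.split_of_not_invariant h hE hK hKE.le hch hmax hβE hη hne hT fun β' hβ' hlt =>
      IH _ (hd ▸ hlt) G n _ β' h hβ' rfl

theorem Spec.apply_one_of_lft (h : PSol p n m G) (hodd : Odd p) (hβ : Spec m (p ^ n) H β)
    (hl : Lft m H β) : β 1 = 1 := by
  by_contra h1
  obtain ⟨ρ₁, ρ₂, hρ₁, hρ₂, h₁, h₂, he, -⟩ := PSol.split hodd _ G n H β h hβ rfl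
  exact (hl ρ₁ ρ₂ hρ₁ hρ₂ he).elim h₁ (h₂ h1)

end

section

variable {G : Type} [Group G] [Fintype G]
  {B D E H J K M N L Q R S T U V X : Subgroup G} {f k w θ χ ψ l l' β α ξ ζ ω η κ ρ τ : G → ℂ} {g : G}
  {a b b' d p m n : ℕ}

theorem ind_galois (σ : ℂ →+* ℂ) (f : G → ℂ) : ind K H (σ ∘ f) = σ ∘ ind K H f := by
  ext g
  simp only [ind, Function.comp_apply, map_mul, map_inv₀, map_natCast, map_sum, apply_ite σ, map_zero]

theorem Chr.ind_self (hf : Chr H f) : SubChar.ind H H f = f := by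
  ext g
  have h1 : ∀ x, (if x ∈ H then f (x * g * x⁻¹) else 0) = if x ∈ H then f g else 0 := fun x => by
    split_ifs with hx
    · exact hf.cls hx g
    · rfl
  simp only [SubChar.ind, h1]
  rw [sum_ite_mem H, Finset.sum_const, Finset.card_univ, ← Nat.card_eq_fintype_card, nsmul_eq_mul,
    ← mul_assoc, inv_mul_cancel₀ (card_ne_zero' H), one_mul]

theorem Nrm.coprime_relIndex (hN : Nrm N E) {r : ℕ} (hr : ∀ g ∈ E, g ^ r ∈ N) (h : r.Coprime a) :
    (N.relIndex E).Coprime a := by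
  refine Nat.coprime_of_dvd fun q hq h1 h2 => ?_
  exact hq.one_lt.ne' (Nat.dvd_one.mp (h ▸ Nat.dvd_gcd (hN.dvd_of_dvd_relIndex hr hq h1) h2))

theorem Lin.ext_of_pow (hl : Lin L l) (hl' : Lin L l') (he : res S l = res S l')
    (hL : ∀ g ∈ L, g ^ m ∈ S) (ham : a.Coprime m) (ha : ∀ g ∈ L, l g ^ a = 1)
    (ha' : ∀ g ∈ L, l' g ^ a = 1) : l = l' := by
  refine hl.ext' hl' fun g hg => ?_
  have h0 : l' g ≠ 0 := hl'.ne_zero' hg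
  have h1 : (l g / l' g) ^ a = 1 := by rw [div_pow, ha g hg, ha' g hg, div_one]
  have h2 : (l g / l' g) ^ m = 1 := by
    have h3 := congrFun he (g ^ m)
    rw [res_of_mem (hL g hg), res_of_mem (hL g hg), hl.pow_apply hg, hl'.pow_apply hg] at h3
    rw [div_pow, h3, div_self (pow_ne_zero _ h0)]
  exact (div_eq_one_iff_eq h0).mp (eq_one_of_pow_of_coprime ham h1 h2)

theorem Lin.dg_eq (hl : Lin H l) : dg l = 1 := SubChar.dg_eq (by rw [hl.one, Nat.cast_one])

theorem Chr.nd_mul_lin_eq (hf : Chr H f) (hab : ExpFac a b G) (hc : (dg f).Coprime a)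
    (hd : ∀ g ∈ H, dt f g ^ b = 1) (hl : Lin H l) (hla : ∀ g ∈ H, l g ^ a = 1) :
    nd a b H (f * l) = l := by
  rw [hf.nd_mul_lin hab hc hl hla, nd_eq_tr hab hc hd, tr_mul_of_supp hl.supp]

theorem Lin.nd_eq (hl : Lin H l) (hab : ExpFac a b G) (hla : ∀ g ∈ H, l g ^ a = 1) :
    nd a b H l = l := by
  have h1 := (tr_lin H).irr.1.nd_mul_lin_eq hab (by rw [(tr_lin H).dg_eq]; exact Nat.coprime_one_left a)
    (fun g hg => by rw [(tr_lin H).dt_eq hg, tr_of_mem hg, one_pow]) hl hla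
  rwa [tr_mul_of_supp hl.supp] at h1

theorem Lin.exists_extension (hl : Lin S l) (hab : ExpFac a m G) (hS : Nrm S L)
    (hL : ∀ g ∈ L, g ^ m ∈ S) (hinv : ∀ x ∈ L, cj x l = l) (ha : ∀ g ∈ S, l g ^ a = 1) :
    ∃ k, Lin L k ∧ res S k = l ∧ ∀ g ∈ L, k g ^ a = 1 := by
  have hI := hl.irr.1.ind hS.le
  have hrI : res S (ind S L l) = (S.relIndex L : ℂ) • l := by
    ext g
    by_cases hg : g ∈ S
    · have h1 : ∀ x, (if x ∈ L then l (x * g * x⁻¹) else 0) = if x ∈ L then l g else 0 := fun x => by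
        split_ifs with hx
        · exact congrFun (hinv x hx) g
        · rfl
      have hS0 := card_ne_zero' S
      rw [res_of_mem hg, Pi.smul_apply, smul_eq_mul]
      simp only [SubChar.ind, h1]
      rw [sum_ite_mem L, Finset.sum_const, Finset.card_univ, ← Nat.card_eq_fintype_card,
        ← relIndex_mul_card' hS.le, nsmul_eq_mul, Nat.cast_mul]
      field_simp
    · rw [res_of_notMem hg, Pi.smul_apply, hl.supp g hg, smul_zero]
  have hj : (S.relIndex L).Coprime a := hS.coprime_relIndex hL hab.cop.symm
  have hdI : (dg (ind S L l)).Coprime a := by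
    rw [← dg_res S, hrI, dg_nsmul _ hl.irr.1, hl.dg_eq, mul_one]
    exact hj
  refine ⟨nd a m L (ind S L l), hI.nd_lin a m, ?_, fun g hg => hI.nd_pow hab hdI hg⟩
  rw [← nd_res hS.le, hrI, hl.irr.1.nd_nsmul hab _ (by rwa [hl.dg_eq, mul_one]), hl.nd_eq hab ha]

theorem exists_conj_le (hp : p.Prime) (hQ : IsPGroup p Q) (hQX : Q ≤ X)
    (hi : ¬p ∣ T.relIndex X) : ∃ x ∈ X, ∀ q ∈ Q, x⁻¹ * q * x ∈ T := by
  have : Fact p.Prime := ⟨hp⟩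
  have hQ' : IsPGroup p (Q.subgroupOf X) := hQ.comap_of_injective X.subtype X.subtype_injective
  obtain ⟨y, hy⟩ := hQ'.nonempty_fixed_point_of_prime_not_dvd_card (X ⧸ T.subgroupOf X) hi
  obtain ⟨x, rfl⟩ := QuotientGroup.mk_surjective y
  refine ⟨x, x.2, fun q hq => ?_⟩
  have h1 := hy ⟨⟨q, hQX hq⟩, hq⟩
  have h2 : (x⁻¹ * (⟨q, hQX hq⟩ * x) : X) ∈ T.subgroupOf X := QuotientGroup.eq.mp h1.symm
  rw [Subgroup.mem_subgroupOf] at h2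
  rw [mul_assoc]
  exact h2

theorem relIndex_inf_dvd (hM : Nrm M U) (hQ : Q ≤ U) : (Q ⊓ M).relIndex M ∣ Q.relIndex U := by
  have h1 := card_supplement (H := M ⊔ Q) le_sup_left le_sup_right
    fun x hx => mem_sup_of_nrm hM hQ hx
  have h2 : (Q ⊓ M).relIndex M = Q.relIndex (M ⊔ Q) := by
    have h3 := relIndex_mul_card' (inf_le_right : Q ⊓ M ≤ M)
    have h4 := relIndex_mul_card' (le_sup_right : Q ≤ M ⊔ Q)
    have h5 : 0 < Nat.card Q := Nat.card_pos
    have h6 : 0 < Nat.card (Q ⊓ M : Subgroup G) := Nat.card_pos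
    refine Nat.eq_of_mul_eq_mul_right (Nat.mul_pos h5 h6) ?_
    calc _ = (Q ⊓ M).relIndex M * Nat.card (Q ⊓ M : Subgroup G) * Nat.card Q := by ring
      _ = Nat.card (M ⊔ Q : Subgroup G) * Nat.card (Q ⊓ M : Subgroup G) := by rw [h3, h1, mul_comm]
      _ = _ := by rw [← h4]; ring
  rw [h2, ← Subgroup.relIndex_mul_relIndex Q (M ⊔ Q) U le_sup_right (sup_le hM.le hQ)]
  exact Dvd.intro _ rfl

end

section

variable {G : Type} [Group G] [Fintype G]
  {B D E H J K M N L Q R S T U V X : Subgroup G} {f k w θ χ ψ l l' β α ξ ζ ω η κ ρ τ : G → ℂ} {g : G}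
  {a b b' d p m n : ℕ} {σ : ℂ →+* ℂ}

theorem cj_galois (σ : ℂ →+* ℂ) (x : G) (f : G → ℂ) : cj x (σ ∘ f) = σ ∘ cj x f := rfl

theorem galois_injective (σ : ℂ →+* ℂ) : Function.Injective fun f : G → ℂ => σ ∘ f := fun f k h => by
  ext g
  exact σ.injective (congrFun h g)

theorem Lft.nd_eq_tr (h : PSol p n m G) (hσm : ∀ x, x ^ m = 1 → σ x = x)
    (hσp : ∀ x, x ^ p ^ n = 1 → σ x = x ^ 2) (hD : Nrm D U) (hα : Irr U α) (hασ : σ ∘ α = α)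
    (hd : (dg α).Coprime p) (hl : Lft m U α) (hτ : Irr D τ) (hne : ip D α τ ≠ 0) :
    nd (p ^ n) m D τ = tr D := by
  have hdn : (dg α).Coprime (p ^ n) := hd.pow_right n
  have hτd : (dg τ).Coprime (p ^ n) := hdn.coprime_dvd_left (dg_constituent_dvd hD hα hτ hne)
  have hμ := hτ.1.nd_lin (p ^ n) m
  by_contra hμ1
  have hσμ : σ ∘ nd (p ^ n) m D τ ≠ nd (p ^ n) m D τ := fun h0 => hμ1 (hμ.eq_tr fun g hg => by
    have h1 := congrFun h0 g
    rw [Function.comp_apply, hσp _ (hτ.1.nd_pow h.ef hτd hg), sq] at h1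
    exact mul_left_cancel₀ (hμ.ne_zero' hg) (by rw [h1, mul_one]))
  have hne' : ip D α (σ ∘ τ) ≠ 0 := by
    rw [← hασ, ip_galois]
    exact (map_ne_zero σ).mpr hne
  obtain ⟨u, hu, hτu⟩ := exists_cj_of_ip_ne_zero hD hα hτ (hτ.galois σ) hne hne'
  have huB : u ∉ stab U τ := fun h0 => hσμ (by
    rw [← hτ.1.nd_galois, hτu, (mem_stab.mp h0).2])
  have hstab : stab U (σ ∘ τ) = stab U τ := by
    ext x
    rw [mem_stab, mem_stab, cj_galois, (galois_injective σ).eq_iff]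
  have hnorm (x : G) : x ∈ stab U τ ↔ u * x * u⁻¹ ∈ stab U τ := by
    rw [← hstab, mem_stab, mem_stab, hτu, cj_cj]
    have h1 : u * x * u⁻¹ ∈ U ↔ x ∈ U := by
      rw [U.mul_mem_cancel_right (U.inv_mem hu), U.mul_mem_cancel_left hu]
    have h2 : SubChar.cj (u * x * u⁻¹) (σ ∘ τ) = σ ∘ τ ↔ SubChar.cj (u * x * u⁻¹) τ = τ := by
      rw [cj_galois, (galois_injective σ).eq_iff]
    rw [← hτu, h1, h2]
    refine and_congr_right fun _ => ⟨fun h3 => ?_, fun h3 => ?_⟩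
    · have h4 := congrArg (SubChar.cj u⁻¹) h3
      rw [hτu, cj_cj, cj_cj, mul_inv_cancel, cj_one] at h4
      exact h4
    · have h4 := congrArg (SubChar.cj u) h3
      rwa [cj_cj, inv_mul_cancel_right, ← hτu] at h4
  have hBU : stab U τ ≤ U := stab_le
  obtain ⟨κ, hκ, hκτ, hακ, hind, -⟩ := clifford_exists hD hα hτ hne
  have hσκ : σ ∘ κ = SubChar.cj u κ := by
    have hκu : Irr (stab U τ) (SubChar.cj u κ) := hκ.cj hnorm
    refine clifford_unique hD hα (hτ.galois σ) (hstab ▸ hκ.galois σ) (hstab ▸ hκu) ?_ ?_ ?_ ?_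
    · rw [ip_galois]
      exact (map_ne_zero σ).mpr hκτ
    · rw [hstab, ← hασ, ip_galois]
      exact (map_ne_zero σ).mpr hακ
    · rw [hτu, ip_cj (hD.mem_iff hu)]
      exact hκτ
    · rw [hstab, ← hα.1.cj_eq hu, ip_cj hnorm]
      exact hακ
  have hlκ : Lft m (stab U τ) κ := .of_ind hBU hκ.1 (hind ▸ hl)
  have hκd : (dg κ).Coprime (p ^ n) := hdn.coprime_dvd_left (hind ▸ dg_ind_dvd hBU hκ.1)
  obtain ⟨γ, hγ, hκγ⟩ := h.exists_spec_of_lft hκ hlκ hκd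
  have hγu : SubChar.cj u γ = γ := h.spec_ext (hγ.cj hnorm) hγ fun g hg hgm => by
    have hgu : (u * g * u⁻¹) ^ m = 1 := by rw [conj_pow, hgm, mul_one, mul_inv_cancel]
    have h1 : γ (u * g * u⁻¹) = κ (u * g * u⁻¹) := (hκγ _ ((hnorm g).mp hg) hgu).symm
    have h2 : σ (κ g) = κ (u * g * u⁻¹) := congrFun hσκ g
    rw [SubChar.cj, h1, ← h2, hκ.1.galois_apply_eq hg h.hm hgm hσm, hκγ g hg hgm]
  set C := U ⊓ Subgroup.normalizer (stab U τ : Set G) with hC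
  have hCU : C ≤ U := inf_le_left
  have hBC : Nrm (stab U τ) C :=
    ⟨le_inf hBU Subgroup.le_normalizer, fun x hx y hy => (Subgroup.mem_normalizer_iff.mp hx.2 y).mp hy⟩
  have huC : u ∈ stab C γ := ⟨⟨hu, Subgroup.mem_normalizer_iff.mpr hnorm⟩, hγu⟩
  have hγC := hγ.irr.1.ind hBC.le
  have hlγ : Lft m C (ind (stab U τ) C γ) := by
    refine .of_ind hCU hγC (hl.congr fun g hg hgm => ?_)
    rw [ind_trans hCU, ← hind]
    exact ind_congr_reg hκγ (fun g hg => by rw [hκ.supp hg, hγ.irr.supp hg]) hgm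
  have hirr := hlγ.irr hγC fun h0 => hγ.irr.ne_zero (hγ.irr.1.ind_eq_zero h0)
  have h1 := hirr.2
  rw [ip_ind_self hBC hγ.irr, div_eq_one_iff_eq (card_ne_zero' _)] at h1
  have h2 : Nat.card (stab C γ) = Nat.card (stab U τ) := by exact_mod_cast h1
  have h3 := Subgroup.eq_of_le_of_card_ge (le_stab hBC hγ.irr.1) h2.le
  exact huB (h3 ▸ huC)

/-- If a character of `p'`-degree times a linear `p`-character induces to a lift on `U L`, where
`L / S` is an abelian `p`-group, then `L ≤ U`. -/
theorem Lft.exists_constituent_of_abelian (h : PSol p n m G) (hσm : ∀ x, x ^ m = 1 → σ x = x)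
    (hσp : ∀ x, x ^ p ^ n = 1 → σ x = x ^ 2) (hS : Nrm S (L ⊔ U)) (hL : Nrm L (L ⊔ U)) (hSL : S ≤ L)
    (hSU : S ≤ U) (hcom : ∀ x ∈ L, ∀ y ∈ L, x * y * x⁻¹ * y⁻¹ ∈ S) (hpow : ∀ x ∈ L, x ^ p ^ n ∈ S)
    (hα : Irr U α) (hασ : σ ∘ α = α) (hd : (dg α).Coprime p) (hl : Lin U l)
    (hlp : ∀ g ∈ U, l g ^ p ^ n = 1) (hlft : Lft m (L ⊔ U) (ind U (L ⊔ U) (α * l)))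
    (hω : Spec (p ^ n) m S ω) (hne : ip S α ω ≠ 0) (hinv : ∀ x ∈ L ⊔ U, cj x ω = ω) :
    L ≤ U ∧ ∃ c, Spec (p ^ n) m L c ∧ ip L α c ≠ 0 ∧ ∀ x ∈ L ⊔ U, cj x c = c := by
  have hU : U ≤ L ⊔ U := le_sup_right
  have hdn : (dg α).Coprime (p ^ n) := hd.pow_right n
  have hdω : (dg ω).Coprime p := (Nat.coprime_pow_right_iff (Nat.pos_of_ne_zero h.hn) _ _).mp hω.cop
  have hSL' := hS.mono hL.le hSL
  obtain ⟨c, hc, hcω, hcd⟩ := exists_special_extension h.hp h.ef hSL' hcom hpow hω.irr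
    (fun x hx => hinv x (hL.le hx)) hdω fun g hg => hω.dt_pow hg
  have hdc : (dg c).Coprime (p ^ n) := by rw [← dg_res S, hcω]; exact hω.cop
  have hcs : Spec (p ^ n) m L c := .of_res h.ef hSL' hc (hcω ▸ hω) hcd
  have hext {D : Subgroup G} (hSD : S ≤ D) (hDL : D ≤ L) {c' : G → ℂ} (hc' : Irr D c')
      (he : res S c' = ω) (hd' : ∀ g ∈ D, dt c' g ^ m = 1) : c' = res D c := by
    have hcD : Irr D (res D c) := Irr.res_of_le hc.1 (hcω ▸ hω.irr) hSD hDL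
    refine extension_unique (hSL'.mono hDL hSD) hcD hc' ?_ ?_ (fun x hx => hpow x (hDL hx)) ?_
      h.ef.cop (fun g hg => ?_) hd'
    · rw [res_res hSD, hcω]; exact hω.irr
    · rw [res_res hSD, hcω, he]
    · rwa [dg_res]
    · rw [dt_res hg]; exact hcd g (hDL hg)
  have hcinv : ∀ x ∈ L ⊔ U, SubChar.cj x c = c := fun x hx => by
    have h1 := hext hSL le_rfl (hc.cj_nrm hL hx) (by
      rw [← cj_res (hS.mem_iff hx), hcω, hinv x hx]) fun g hg => by
        rw [dt_cj]
        exact hcd _ ((hL.mem_iff hx g).mp hg)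
    rwa [res_of_supp fun g hg => hc.supp hg] at h1
  have hDU : Nrm (U ⊓ L) U := hL.inf hU
  have hSD : S ≤ U ⊓ L := le_inf hSU hSL
  have hlα : Lft m U α := Lft.of_mul hl.irr.1 hl.irr.ne_zero (by
    rw [mul_comm]; exact hlft.of_ind hU (hα.mul_lin hl).1)
  obtain ⟨τ, hτ, hατ, hτω⟩ := exists_between hα.1 hDU.le hSD hne
  have hSD' := hSL'.mono inf_le_right hSD
  have hτd : (dg τ).Coprime (p ^ n) := hdn.coprime_dvd_left (dg_constituent_dvd hDU hα hτ hατ)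
  have hτS := hτ.res_of_abelian hSD' (fun x hx y hy => hcom x hx.2 y hy.2) (fun x hx => hpow x hx.2) hτd
  have hτω' : res S τ = ω := hτS.eq_of_ip_ne_zero hω.irr (by rwa [ip_res_left])
  have hτc : τ = res (U ⊓ L) c := hext hSD inf_le_right hτ hτω' fun g hg => by
    have h1 := hτ.1.dt_mul_nd_inv h.ef hτd hg
    rw [Lft.nd_eq_tr h hσm hσp hDU hα hασ hd hlα hτ hατ] at h1
    have h2 : τ * (tr (U ⊓ L))⁻¹ = τ := by
      ext x
      by_cases hx : x ∈ U ⊓ L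
      · rw [Pi.mul_apply, Pi.inv_apply, tr_of_mem hx, inv_one, mul_one]
      · rw [Pi.mul_apply, hτ.supp hx, zero_mul]
    rwa [h2] at h1
  obtain ⟨ξ, hξ, hξc, hξα⟩ := exists_extension_supplement hL hU (fun x hx => mem_sup_of_nrm hL hU hx)
    hc hcinv (hτc ▸ hτ) hα (hτc ▸ hατ)
  have hI := (tr_lin U).irr.1.ind hU
  obtain ⟨f, hf, hIf⟩ := hI.exists_add (tr_lin (L ⊔ U)).irr (by
    rw [(tr_lin U).irr.1.frob hU (tr_lin _).irr.1, ← ip_res_right]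
    have h1 : res U (tr (L ⊔ U)) = tr U := res_res hU _
    rw [h1, (tr_lin U).irr.2]
    exact one_ne_zero)
  have hsplit := hlft (ξ * tr (L ⊔ U)) (ξ * f) (hξ.1.mul (tr_lin _).irr.1) (hξ.1.mul hf)
    fun g hg hgm => by
      rw [← Pi.add_apply, ← mul_add, ← hIf, mul_comm ξ, ← ind_mul_res (fun g hg => (tr_lin U).supp g hg)
        fun x hx => hξ.1.cls hx, hξα]
      refine ind_congr_reg (fun g hg hgm => ?_) (fun g hg => ?_) hgm
      · rw [Pi.mul_apply, Pi.mul_apply, hl.eq_one_of_pow h.ef.cop hlp hg hgm, tr_of_mem hg, mul_comm]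
      · rw [Pi.mul_apply, Pi.mul_apply, hα.supp hg, zero_mul, mul_zero]
  have hf0 : f = 0 := by
    rcases hsplit with h0 | h0
    · have h1 := congrFun h0 1
      rw [Pi.mul_apply, tr_of_mem (L ⊔ U).one_mem, mul_one] at h1
      exact absurd h1 hξ.apply_one_ne_zero
    · by_contra hne'
      have h1 := congrFun h0 1
      exact mul_ne_zero hξ.apply_one_ne_zero (hf.apply_one_ne_zero hne') h1
  have hUX : U = L ⊔ U := by
    have h1 := congrFun hIf 1
    rw [hf0, add_zero, ind_one, tr_of_mem U.one_mem, tr_of_mem (L ⊔ U).one_mem, mul_one,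
      div_eq_one_iff_eq (card_ne_zero' _)] at h1
    have h2 : Nat.card (L ⊔ U : Subgroup G) = Nat.card U := by exact_mod_cast h1
    exact Subgroup.eq_of_le_of_card_ge hU h2.le
  refine ⟨sup_eq_right.mp hUX.symm, c, hcs, ?_, hcinv⟩
  rw [← hξα, hUX, res_of_supp fun g hg => hξ.supp hg]
  exact hξc

end

section

variable {G : Type} [Group G] [Fintype G]
  {B D E H J K M N L Q R S T U V X : Subgroup G} {f k w θ χ ψ l l' β α ξ ζ ω η κ ρ τ : G → ℂ} {g : G}
  {a b b' d p m n : ℕ} {σ : ℂ →+* ℂ}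

/-- A `σ`-invariant character `α` of `p'`-degree and a linear `p`-character `l` of `U`, such that
`α` restricts to a multiple of the special character `ω` of `S`, and `Q` is a Sylow `p`-subgroup
of `U`. -/
structure Node (p n m : ℕ) (σ : ℂ →+* ℂ) (S Q U : Subgroup G) (α l ω : G → ℂ) : Prop where
  irr : Irr U α
  galois : σ ∘ α = α
  cop : (dg α).Coprime p
  lin : Lin U l
  pow : ∀ g ∈ U, l g ^ p ^ n = 1
  pgroup : IsPGroup p Q
  le : Q ≤ U
  index : ¬p ∣ Q.relIndex U
  ge : S ≤ U
  spec : Spec (p ^ n) m S ω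
  ne : ip S α ω ≠ 0
  inv : ∀ x ∈ U, cj x ω = ω

theorem Lin.exists_extension_supplement (h : PSol p n m G) (hS : Nrm S (L ⊔ U))
    (hL : Nrm L (L ⊔ U)) (hSL : S ≤ L) (hSU : S ≤ U) (hpow : ∀ x ∈ L, x ^ m ∈ S) (hl : Lin U l)
    (hlp : ∀ g ∈ U, l g ^ p ^ n = 1) (hinv : ∀ x ∈ L ⊔ U, cj x (res S l) = res S l) :
    ∃ k, Lin (L ⊔ U) k ∧ res U k = l ∧ ∀ g ∈ L ⊔ U, k g ^ p ^ n = 1 := by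
  have hU : U ≤ L ⊔ U := le_sup_right
  have hlS := hl.res' hSU
  obtain ⟨k, hk, hkl, hkp⟩ := hlS.exists_extension h.ef (hS.mono hL.le hSL) hpow
    (fun x hx => hinv x (hL.le hx)) fun g hg => by rw [res_of_mem hg]; exact hlp g (hSU hg)
  have hkinv : ∀ x ∈ L ⊔ U, SubChar.cj x k = k := fun x hx => by
    refine Lin.ext_of_pow (Chr.lin (hk.irr.1.cj (hL.mem_iff hx)) ?_) hk ?_ hpow h.ef.cop ?_ hkp
    · rw [SubChar.cj, mul_one, mul_inv_cancel, hk.one]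
    · rw [← cj_res (hS.mem_iff hx), hkl, hinv x hx]
    · exact fun g hg => hkp _ ((hL.mem_iff hx g).mp hg)
  have hSD : S ≤ U ⊓ L := le_inf hSU hSL
  have hD : res (U ⊓ L) k = res (U ⊓ L) l := by
    refine Lin.ext_of_pow (hk.res' inf_le_right) (hl.res' inf_le_left) ?_ (fun g hg => hpow g hg.2)
      h.ef.cop (fun g hg => ?_) fun g hg => ?_
    · rw [res_res hSD, res_res hSD, hkl]
    · rw [res_of_mem hg]; exact hkp g hg.2
    · rw [res_of_mem hg]; exact hlp g hg.1
  obtain ⟨ξ, hξ, hξk, hξl⟩ := SubChar.exists_extension_supplement hL hU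
    (fun x hx => mem_sup_of_nrm hL hU hx) hk.irr hkinv (hk.res' inf_le_right).irr hl.irr (by
      rw [← ip_res_left, ← hD, (hk.res' inf_le_right).irr.2]
      exact one_ne_zero)
  have hξ1 : Lin (L ⊔ U) ξ := Chr.lin hξ.1 (by rw [← hl.one, ← hξl, res_of_mem U.one_mem])
  have hξL : res L ξ = k := (hξ1.res' hL.le).irr.eq_of_ip_ne_zero hk.irr (by rwa [ip_res_left])
  refine ⟨ξ, hξ1, hξl, fun x hx => ?_⟩
  obtain ⟨y, hy, u, hu, rfl⟩ := mem_sup_of_nrm hL hU hx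
  rw [hξ1.mul _ (hL.le hy) _ (hU hu), mul_pow, ← res_of_mem (f := ξ) hy, ← res_of_mem (f := ξ) hu,
    hξL, hξl, hkp y hy, hlp u hu, mul_one]

theorem Irr.exists_constituent_stab (hp : p.Prime) (hX : Irr X χ) (hL : Nrm L X)
    (hd : (dg χ).Coprime p) (hQ : IsPGroup p Q) (hQX : Q ≤ X) :
    ∃ ζ, Irr L ζ ∧ ip L χ ζ ≠ 0 ∧ Q ≤ stab X ζ := by
  obtain ⟨ζ, hζ, hne⟩ := hX.exists_constituent hL.le
  obtain ⟨j, hj, hjd⟩ := exists_index_stab hL hX hζ hne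
  have hjT : (stab X ζ).relIndex X = j := by
    rw [← relIndex_mul_card' (stab_le : stab X ζ ≤ X)] at hj
    exact (Nat.eq_of_mul_eq_mul_right Nat.card_pos hj).symm
  obtain ⟨x, hx, hxQ⟩ := exists_conj_le hp hQ hQX (T := stab X ζ) fun h0 => by
    have h1 := Nat.dvd_gcd ((hjT ▸ h0).trans hjd) dvd_rfl
    rw [hd] at h1
    exact hp.one_lt.ne' (Nat.dvd_one.mp h1)
  have hx' := X.inv_mem hx
  refine ⟨SubChar.cj x⁻¹ ζ, hζ.cj_nrm hL hx', ?_, fun q hq => mem_stab.mpr ⟨hQX hq, ?_⟩⟩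
  · rwa [ip_cj_eq_of_cls hL hx' hX.1]
  · have h1 := congrArg (SubChar.cj x⁻¹) (mem_stab.mp (hxQ q hq)).2
    rwa [cj_cj, mul_inv_cancel_right, ← cj_cj] at h1

theorem Node.exists_of_coprime (h : PSol p n m G) (hσm : ∀ x, x ^ m = 1 → σ x = x)
    (A : Node p n m σ S Q U α l ω) (hS : Nrm S (L ⊔ U)) (hL : Nrm L (L ⊔ U)) (hSL : S ≤ L)
    (hpow : ∀ x ∈ L, x ^ m ∈ S) (hlft : Lft m (L ⊔ U) (ind U (L ⊔ U) (α * l)))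
    (hinv : ∀ x ∈ L ⊔ U, cj x ω = ω) (hlinv : ∀ x ∈ L ⊔ U, cj x (res S l) = res S l) :
    ∃ R α' l' ζ, Node p n m σ L Q R α' l' ζ ∧ R ≤ L ⊔ U ∧ (∀ g ∈ Q, l' g = l g) ∧
      ind R (L ⊔ U) (α' * l') = ind U (L ⊔ U) (α * l) := by
  have hU : U ≤ L ⊔ U := le_sup_right
  obtain ⟨k, hk, hkl, hkp⟩ := A.lin.exists_extension_supplement h hS hL hSL A.ge hpow A.pow hlinv
  have hind : ind U (L ⊔ U) (α * l) = ind U (L ⊔ U) α * k := by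
    rw [← hkl]
    exact ind_mul_res (fun g hg => A.irr.supp hg) fun x hx => hk.irr.1.cls hx
  have haC := A.irr.1.ind hU
  have ha : Irr (L ⊔ U) (ind U (L ⊔ U) α) := by
    refine Lft.irr (m := m) ?_ haC fun h0 => A.irr.ne_zero (A.irr.1.ind_eq_zero h0)
    refine Lft.of_mul hk.irr.1 hk.irr.ne_zero ?_
    rwa [mul_comm, ← hind]
  have haσ : σ ∘ ind U (L ⊔ U) α = ind U (L ⊔ U) α := by rw [← ind_galois, A.galois]
  have hidx : (U.relIndex (L ⊔ U)).Coprime p := by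
    have h1 : U.relIndex (L ⊔ U) = (U ⊓ L).relIndex L := by
      have h2 := card_supplement hL.le hU fun x hx => mem_sup_of_nrm hL hU hx
      have h3 := relIndex_mul_card' hU
      have h4 := relIndex_mul_card' (inf_le_right : U ⊓ L ≤ L)
      refine Nat.eq_of_mul_eq_mul_right (Nat.mul_pos (Nat.card_pos (α := U))
        (Nat.card_pos (α := (U ⊓ L : Subgroup G)))) ?_
      rw [← mul_assoc, h3, h2, ← h4]
      ring
    rw [h1]
    refine Nat.Coprime.coprime_dvd_left ?_
      ((hS.mono hL.le hSL).coprime_relIndex hpow h.cop.symm)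
    rw [← Subgroup.relIndex_mul_relIndex S (U ⊓ L) L (le_inf A.ge hSL) inf_le_right]
    exact Dvd.intro_left _ rfl
  have hda : dg (ind U (L ⊔ U) α) = U.relIndex (L ⊔ U) * dg α := dg_eq (by
    rw [ind_one, ← relIndex_mul_card' hU, ← A.irr.1.cast_dg, Nat.cast_mul, Nat.cast_mul,
      mul_div_cancel_right₀ _ (card_ne_zero' U)])
  have had : (dg (ind U (L ⊔ U) α)).Coprime p := hda ▸ hidx.mul_left A.cop
  have haω : ip S (ind U (L ⊔ U) α) ω ≠ 0 := by
    refine ip_chain haC hU A.ge A.irr A.spec.irr ?_ A.ne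
    rw [ip_comm, ← A.irr.1.frob hU haC, ha.2]
    exact one_ne_zero
  obtain ⟨ζ, hζ, haζ, hQζ⟩ := ha.exists_constituent_stab h.hp hL had A.pgroup (A.le.trans hU)
  have hζd : (dg ζ).Coprime (p ^ n) :=
    (had.pow_right n).coprime_dvd_left (dg_constituent_dvd hL ha hζ haζ)
  have haS := res_of_invariant hS ha A.spec.irr haω hinv
  have hζs : Spec (p ^ n) m L ζ := by
    refine .of_coprime h.ef (hS.mono hL.le hSL) hζ (fun θ hθ hθ0 => ?_) hζd
      (h.cop.symm.pow_right n) hpow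
    have h1 := ip_chain haC hL.le hSL hζ hθ haζ hθ0
    rw [← ip_res_left, haS, ip_smul_left] at h1
    rw [← A.spec.irr.eq_of_ip_ne_zero hθ (right_ne_zero_of_mul h1)]
    exact A.spec
  obtain ⟨α', hα', hα'ζ, haα', hindα', -⟩ := clifford_exists hL ha hζ haζ
  have hR : stab (L ⊔ U) ζ ≤ L ⊔ U := stab_le
  have hα'σ : σ ∘ α' = α' := by
    refine clifford_unique hL ha hζ (hα'.galois σ) hα' ?_ ?_ hα'ζ haα'
    · rw [← h.spec_galois hζs hσm, ip_galois]
      exact (map_ne_zero σ).mpr hα'ζ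
    · rw [← haσ, ip_galois]
      exact (map_ne_zero σ).mpr haα'
  refine ⟨stab (L ⊔ U) ζ, α', res (stab (L ⊔ U) ζ) k, ζ, ⟨hα', hα'σ,
    had.coprime_dvd_left (hindα' ▸ dg_ind_dvd hR hα'.1), hk.res' hR,
    fun g hg => by rw [res_of_mem hg]; exact hkp g (hR hg), A.pgroup, hQζ, fun h0 => ?_,
    le_stab hL hζ.1, hζs, hα'ζ, fun x hx => (mem_stab.mp hx).2⟩, hR, fun g hg => ?_, ?_⟩
  · have h1 : p ∣ Q.relIndex (L ⊔ U) := h0.trans (by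
      rw [← Subgroup.relIndex_mul_relIndex Q _ _ hQζ hR]; exact Dvd.intro _ rfl)
    rw [← Subgroup.relIndex_mul_relIndex Q U _ A.le hU] at h1
    rcases h.hp.dvd_mul.mp h1 with h2 | h2
    · exact A.index h2
    · exact h.hp.one_lt.ne' (Nat.dvd_one.mp (hidx ▸ Nat.dvd_gcd h2 dvd_rfl))
  · rw [res_of_mem (hQζ hg), ← hkl, res_of_mem (A.le hg)]
  · rw [ind_mul_res (fun g hg => hα'.supp hg) fun x hx => hk.irr.1.cls hx, hindα', hind]

end

section

variable {G : Type} [Group G] [Fintype G]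
  {B D E H J K M N L Q R S T U V X : Subgroup G} {f k w θ χ ψ l l' β α ξ ζ ω η κ ρ τ : G → ℂ} {g : G}
  {a b b' d p m n : ℕ} {σ : ℂ →+* ℂ}

/-- The restriction of `χ` to `M` has an irreducible constituent induced from a pair on a subgroup
with Sylow `p`-subgroup `Q ⊓ M`, the `p`-part of which agrees with `l` on `Q ⊓ M`. -/
def HasPair (p n m : ℕ) (M Q : Subgroup G) (l χ : G → ℂ) : Prop :=
  ∃ V α' l', V ≤ M ∧ Q ⊓ M ≤ V ∧ ¬p ∣ (Q ⊓ M).relIndex V ∧ Spec (p ^ n) m V α' ∧ Lin V l' ∧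
    (∀ g ∈ V, l' g ^ p ^ n = 1) ∧ (∀ g ∈ Q ⊓ M, l' g = l g) ∧ Irr M (ind V M (α' * l')) ∧
    ip M χ (ind V M (α' * l')) ≠ 0

theorem Node.hasPair_of_stab (A : Node p n m σ S Q U α l ω) (hM : Nrm M H) (hS : Nrm S H)
    (hSM : S ≤ M) (hU : U ≤ stab H (ω * res S l)) (hχ : Irr H (ind U H (α * l)))
    (hT : HasPair p n m (stab H (ω * res S l) ⊓ M) Q l (ind U (stab H (ω * res S l)) (α * l))) :
    HasPair p n m M Q l (ind U H (α * l)) := by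
  have hαl := A.irr.mul_lin A.lin
  have hθ := A.spec.irr.mul_lin (A.lin.res' A.ge)
  set θ := ω * res S l with hθdef
  have hTH : stab H θ ≤ H := stab_le
  have hTM : stab M θ = stab H θ ⊓ M := by
    ext x
    rw [Subgroup.mem_inf, mem_stab, mem_stab]
    exact ⟨fun hx => ⟨⟨hM.le hx.1, hx.2⟩, hx.1⟩, fun hx => ⟨hx.2, hx.1.2⟩⟩
  have hQ : Q ⊓ (stab H θ ⊓ M) = Q ⊓ M := by
    rw [← inf_assoc, inf_eq_left.mpr (A.le.trans hU)]
  obtain ⟨V, α', l', hV, hQV, hi, hα', hl', hlp, hll, hirr, hne⟩ := hT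
  rw [hQ] at hQV hi hll
  have hχT := hαl.1.ind hU
  have hχTe : ind (stab H θ) H (ind U (stab H θ) (α * l)) = ind U H (α * l) := ind_trans hTH _
  have hχTi : Irr (stab H θ) (ind U (stab H θ) (α * l)) :=
    hχT.irr_of_indecomposable (fun h0 => hαl.ne_zero (hαl.1.ind_eq_zero h0)) fun f k hf hk he => by
      have h1 := hχ.indecomposable (hf.ind hTH) (hk.ind hTH) (by rw [← hχTe, he, ind_add])
      exact h1.imp hf.ind_eq_zero hk.ind_eq_zero
  have hST : Nrm S (stab H θ) := hS.mono hTH (le_stab hS hθ.1)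
  have hχθ : ip S (ind U (stab H θ) (α * l)) θ ≠ 0 := by
    refine ip_chain hχT hU A.ge hαl hθ ?_ ?_
    · rw [ip_comm, ← hαl.1.frob hU hχT, hχTi.2]
      exact one_ne_zero
    · obtain ⟨f, hf, he⟩ := (A.irr.1.res A.ge).exists_add A.spec.irr (by rw [ip_res_left]; exact A.ne)
      rw [← ip_res_left, res_mul, he, add_mul]
      exact ip_add_ne_zero hθ.1 (hf.mul (A.lin.res' A.ge).irr.1) hθ.1 (by rw [hθ.2]; exact one_ne_zero)
  have hres := res_of_invariant hST hχTi hθ hχθ fun x hx => (mem_stab.mp hx).2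
  have hSTM : S ≤ stab H θ ⊓ M := le_inf hST.le hSM
  have hψθ : ip S (ind V (stab H θ ⊓ M) (α' * l')) θ ≠ 0 := by
    obtain ⟨ν, hν, hν0⟩ := hirr.exists_constituent hSTM
    have h1 := ip_chain hχT inf_le_left hSTM hirr hν hne hν0
    rw [← ip_res_left, hres, ip_smul_left] at h1
    have h2 := hθ.eq_of_ip_ne_zero hν (right_ne_zero_of_mul h1)
    rw [← h2] at hν0
    exact hν0
  have hMi := clifford_ind_irr (hS.mono hM.le hSM) hθ (hTM.symm ▸ hirr) hψθ
  rw [hTM, ind_trans inf_le_right] at hMi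
  refine ⟨V, α', l', hV.trans inf_le_right, hQV, hi, hα', hl', hlp, hll, hMi, ?_⟩
  have hψM : ind V M (α' * l') = ind (stab H θ ⊓ M) M (ind V (stab H θ ⊓ M) (α' * l')) :=
    (ind_trans inf_le_right _).symm
  rw [ip_comm, ← ip_res_right, hψM, hirr.1.frob inf_le_right (hχ.1.res hM.le), ip_comm, ← ip_res_left,
    res_res inf_le_right, ip_res_left]
  refine ip_chain hχ.1 hTH inf_le_left hχTi hirr ?_ hne
  rw [ip_comm, ← hχT.frob hTH hχ.1, hχTe, hχ.2]
  exact one_ne_zero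

theorem Node.hasPair (h : PSol p n m G) (hσm : ∀ x, x ^ m = 1 → σ x = x)
    (hσp : ∀ x, x ^ p ^ n = 1 → σ x = x ^ 2) (d : ℕ) :
    ∀ (H M S Q U : Subgroup G) (α l ω : G → ℂ), Nat.card H + (Nat.card G - Nat.card S) = d → Nrm M H → Nrm S H → S ≤ M → U ≤ H →
    Node p n m σ S Q U α l ω → Lft m H (ind U H (α * l)) → HasPair p n m M Q l (ind U H (α * l)) := by
  induction d using Nat.strong_induction_on with
  | _ d IH =>
  intro H M S Q U α l ω hd hM hS hSM hU A hlft
  have hαl := A.irr.mul_lin A.lin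
  have hχ : Irr H (ind U H (α * l)) :=
    hlft.irr (hαl.1.ind hU) fun h0 => hαl.ne_zero (hαl.1.ind_eq_zero h0)
  have hlS := A.lin.res' A.ge
  have hlSp : ∀ g ∈ S, res S l g ^ p ^ n = 1 := fun g hg => by
    rw [res_of_mem hg]; exact A.pow g (A.ge hg)
  have hθ := A.spec.irr.mul_lin hlS
  have hSU := hS.mono hU A.ge
  by_cases hT : stab H (ω * res S l) = H
  swap
  · have hUT : U ≤ stab H (ω * res S l) := fun x hx => mem_stab.mpr ⟨hU hx, by
      rw [cj_mul, A.inv x hx, cj_res (hSU.mem_iff hx), A.lin.irr.1.cj_eq hx]⟩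
    have hTH : stab H (ω * res S l) ≤ H := stab_le
    refine A.hasPair_of_stab hM hS hSM hUT hχ (IH _ ?_ _ _ S Q U α l ω rfl (hM.inf hTH)
      (hS.mono hTH (le_stab hS hθ.1)) (le_inf (le_stab hS hθ.1) hSM) hUT A ?_)
    · have h1 := Subgroup.card_le_of_le hTH
      have h2 : Nat.card (stab H (ω * res S l)) ≠ Nat.card H := fun h0 =>
        hT (Subgroup.eq_of_le_of_card_ge hTH h0.ge)
      omega
    · exact .of_ind hTH (hαl.1.ind hUT) (by rwa [ind_trans hTH])
  have hinvθ : ∀ x ∈ H, cj x (ω * res S l) = ω * res S l := fun x hx => (mem_stab.mp (hT.symm ▸ hx)).2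
  have hnd : nd (p ^ n) m S (ω * res S l) = res S l :=
    A.spec.irr.1.nd_mul_lin_eq h.ef A.spec.cop (fun g hg => A.spec.dt_pow hg) hlS hlSp
  have hlinv : ∀ x ∈ H, cj x (res S l) = res S l := fun x hx => by
    rw [← hnd, ← nd_cj (hS.mem_iff hx), hinvθ x hx]
  have hωinv : ∀ x ∈ H, cj x ω = ω := fun x hx => by
    have h1 := hinvθ x hx
    rw [cj_mul, hlinv x hx] at h1
    ext g
    by_cases hg : g ∈ S
    · have h2 := congrFun h1 g
      rw [Pi.mul_apply, Pi.mul_apply] at h2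
      exact mul_right_cancel₀ (hlS.ne_zero' hg) h2
    · rw [A.spec.irr.supp hg, (A.spec.irr.cj_nrm hS hx).supp hg]
  have hχα {R : Subgroup G} {α' l' : G → ℂ} (hR : R ≤ H) (hα : Irr R (α' * l'))
      (he : ind R H (α' * l') = ind U H (α * l)) : ip R (ind U H (α * l)) (α' * l') ≠ 0 := by
    rw [ip_comm, ← hα.1.frob hR hχ.1, he, hχ.2]
    exact one_ne_zero
  rcases hSM.eq_or_lt with rfl | hlt
  · refine ⟨S, ω, res S l, le_rfl, inf_le_right, fun h0 => A.index (h0.trans (relIndex_inf_dvd hSU A.le)),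
      A.spec, hlS, hlSp, fun g hg => res_of_mem hg.2, ?_, ?_⟩
    · rwa [hθ.1.ind_self]
    · rw [hθ.1.ind_self]
      refine ip_chain hχ.1 hU A.ge hαl hθ (hχα hU hαl rfl) ?_
      obtain ⟨f, hf, he⟩ := (A.irr.1.res A.ge).exists_add A.spec.irr (by rw [ip_res_left]; exact A.ne)
      rw [← ip_res_left, res_mul, he, add_mul]
      exact ip_add_ne_zero hθ.1 (hf.mul hlS.irr.1) hθ.1 (by rw [hθ.2]; exact one_ne_zero)
  · obtain ⟨L, hL, hSL, hLM, hch⟩ := h.exists_chief hS hM hlt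
    have hX : L ⊔ U ≤ H := sup_le hL.le hU
    have hSX := hS.mono hX (hSL.le.trans le_sup_left)
    have hLX := hL.mono hX le_sup_left
    have hUX : U ≤ L ⊔ U := le_sup_right
    have hlftX : Lft m (L ⊔ U) (ind U (L ⊔ U) (α * l)) :=
      .of_ind hX (hαl.1.ind hUX) (by rwa [ind_trans hX])
    have hcard : Nat.card H + (Nat.card G - Nat.card L) < d := by
      have h1 : Nat.card S < Nat.card L := by
        refine lt_of_le_of_ne (Subgroup.card_le_of_le hSL.le) fun h0 => ?_
        exact hSL.ne (Subgroup.eq_of_le_of_card_ge hSL.le h0.ge)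
      have h2 := Subgroup.card_le_card_group L
      omega
    rcases hch with hpow | ⟨hcom, hpow⟩
    · obtain ⟨R, α', l', ζ, A', hR, hll, he⟩ := A.exists_of_coprime h hσm hSX hLX hSL.le hpow hlftX
        (fun x hx => hωinv x (hX hx)) fun x hx => hlinv x (hX hx)
      have he' : ind R H (α' * l') = ind U H (α * l) := by
        rw [← ind_trans hX, he, ind_trans hX]
      obtain ⟨V, α'', l'', h1, h2, h3, h4, h5, h6, h7, h8, h9⟩ := IH _ hcard H M L Q R α' l' ζ rfl hM hL
        hLM (hR.trans hX) A' (he' ▸ hlft)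
      exact ⟨V, α'', l'', h1, h2, h3, h4, h5, h6, fun g hg => (h7 g hg).trans (hll g hg.1), h8, he' ▸ h9⟩
    · obtain ⟨hLU, c, hc, hαc, hcinv⟩ := Lft.exists_constituent_of_abelian h hσm hσp hSX hLX hSL.le A.ge
        hcom hpow A.irr A.galois A.cop A.lin A.pow hlftX A.spec A.ne fun x hx => hωinv x (hX hx)
      exact IH _ hcard H M L Q U α l c rfl hM hL hLM hU
        { A with ge := hLU, spec := hc, ne := hαc, inv := fun x hx => hcinv x (hUX hx) } hlft

end

section

variable {G X : Type} [Group G] [Fintype G] [Group X] [Fintype X] {H J K M Q U V : Subgroup G}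
  {f θ χ α β l : G → ℂ} {a b p m n d : ℕ} {π : Set ℕ} {φ : X →* G}

theorem isCharacter_iff : IsCharacter G f ↔ Chr ⊤ f := by
  constructor
  · rintro ⟨V, hV⟩
    refine ⟨V, inferInstance, inferInstance, inferInstance, V.ρ.comp (⊤ : Subgroup G).subtype, ?_⟩
    ext g
    rw [hV, ext0, dif_pos (Subgroup.mem_top g)]
    rfl
  · rintro ⟨V, _, _, _, ρ, rfl⟩
    refine ⟨FDRep.of (ρ.comp Subgroup.topEquiv.symm.toMonoidHom), fun g => ?_⟩
    rw [ext0, dif_pos (Subgroup.mem_top g)]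
    rfl

theorem isIrrChar_iff : IsIrrChar G f ↔ Irr ⊤ f := by
  constructor
  · rintro ⟨hf, h0, h⟩
    refine (isCharacter_iff.mp hf).irr_of_indecomposable h0 fun f₁ f₂ h₁ h₂ he => ?_
    by_contra! hne
    exact h ⟨f₁, f₂, isCharacter_iff.mpr h₁, hne.1, isCharacter_iff.mpr h₂, hne.2, he⟩
  · intro hf
    refine ⟨isCharacter_iff.mpr hf.1, hf.ne_zero, ?_⟩
    rintro ⟨f₁, f₂, h₁, h₁', h₂, h₂', he⟩
    exact (hf.indecomposable (isCharacter_iff.mp h₁) (isCharacter_iff.mp h₂) he).elim h₁' h₂'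

theorem pb_top (φ : X →* G) (f : G → ℂ) : pb φ ⊤ f = f ∘ φ := res_of_supp fun _ h => absurd (Subgroup.mem_top _) h

theorem map_subtype_top (H : Subgroup G) : (⊤ : Subgroup H).map H.subtype = H := by
  rw [← MonoidHom.range_eq_map, Subgroup.range_subtype]

theorem pb_ext0 (H : Subgroup G) (ω : H → ℂ) : pb H.subtype ⊤ (ext0 H ω) = ω := by
  rw [pb_top]
  exact funext fun x => ext0_coe ω x

theorem IsCharacter.chr_ext0 {ω : H → ℂ} (h : IsCharacter H ω) : Chr H (ext0 H ω) := by
  obtain ⟨V, hV⟩ := h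
  exact ⟨V, inferInstance, inferInstance, inferInstance, V.ρ, congrArg (ext0 H) (funext hV)⟩

theorem IsIrrChar.irr_ext0 {ω : H → ℂ} (h : IsIrrChar H ω) : Irr H (ext0 H ω) := by
  refine ⟨IsCharacter.chr_ext0 h.1, ?_⟩
  have h1 := ip_pb H.subtype ⊤ (ext0 H ω) (ext0 H ω)
  rw [map_subtype_top, pb_ext0] at h1
  rw [← h1]
  exact (isIrrChar_iff.mp h).2

theorem Chr.isCharacter (hφ : (⊤ : Subgroup X).map φ = V) (h : Chr V f) : IsCharacter X (f ∘ φ) := by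
  subst hφ
  exact isCharacter_iff.mpr (pb_top φ f ▸ h.pb)

theorem Irr.isIrrChar (hφ : (⊤ : Subgroup X).map φ = V) (h : Irr V f) : IsIrrChar X (f ∘ φ) := by
  subst hφ
  exact isIrrChar_iff.mpr (pb_top φ f ▸ h.pb)

theorem resChar_eq_add {ω ξ : M → ℂ} (h : resChar M χ = ω + ξ) : res M χ = ext0 M ω + ext0 M ξ := by
  rw [← ext0_add, ← h]
  rfl

theorem IsConstituent.irr_ext0 {ω : M → ℂ} (h : IsConstituent ω (resChar M χ)) :
    Irr M (ext0 M ω) ∧ ip M χ (ext0 M ω) ≠ 0 := by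
  obtain ⟨hω, ξ, hξ, he⟩ := h
  have h1 := IsIrrChar.irr_ext0 hω
  refine ⟨h1, ?_⟩
  have hξ' : Chr M (ext0 M ξ) := by
    rcases hξ with rfl | hξ
    · rw [show ext0 M (0 : M → ℂ) = 0 from (ext0Hom M).map_zero]
      exact .zero M
    · exact IsCharacter.chr_ext0 hξ
  rw [← ip_res_left, resChar_eq_add he]
  exact ip_add_ne_zero h1.1 hξ' h1.1 (by rw [h1.2]; exact one_ne_zero)

theorem Irr.isConstituent (hχ : Chr M (res M χ)) (h : Irr M f) (hne : ip M χ f ≠ 0) :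
    IsConstituent (f ∘ M.subtype) (resChar M χ) := by
  obtain ⟨k, hk, he⟩ := hχ.exists_add h (by rwa [ip_res_left])
  refine ⟨h.isIrrChar (map_subtype_top M), k ∘ M.subtype, .inr (hk.isCharacter (map_subtype_top M)), ?_⟩
  ext x
  have h1 := congrFun he x
  rwa [res_of_mem x.2] at h1

theorem nrm_iff : Nrm K H ↔ K ≤ H ∧ (K.subgroupOf H).Normal := by
  constructor
  · exact fun h => ⟨h.le, ⟨fun y hy x => h.2 x x.2 y hy⟩⟩
  · exact fun h => ⟨h.1, fun x hx y hy => h.2.conj_mem ⟨y, h.1 hy⟩ hy ⟨x, hx⟩⟩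

theorem isSubnormalSubgroup_iff : IsSubnormalSubgroup J ↔ Subn J ⊤ := by
  constructor
  · rintro ⟨k, c, rfl, hl, hc⟩
    have key : ∀ i, Subn (c i) ⊤ := fun i => by
      induction i using Fin.reverseInduction with
      | last => rw [hl]; exact .refl
      | cast i ih => exact .head (nrm_iff.mpr (hc i)) ih
    exact key 0
  · intro h
    induction h using Relation.ReflTransGen.head_induction_on with
    | refl => exact ⟨0, fun _ => ⊤, rfl, rfl, fun i => i.elim0⟩
    | @head K L h _ ih =>
      obtain ⟨k, c, h0, hl, hc⟩ := ih
      refine ⟨k + 1, Fin.cons K c, rfl, hl, fun i => ?_⟩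
      induction i using Fin.cases with
      | zero =>
        have h1 := nrm_iff.mp h
        rw [← h0] at h1
        exact h1
      | succ i => exact hc i

theorem hasPiDetOrder_iff {ω : M → ℂ} (hω : IsCharacter M ω) :
    HasPiDetOrder π M ω ↔ IsPiNumber π (orderOf fun g : M => dt (ext0 M ω) g) := by
  have key (V : FDRep ℂ M) (hV : ∀ g, ω g = V.character g) :
      (fun g : M => LinearMap.det (V.ρ g)) = fun g : M => dt (ext0 M ω) g := by
    let e := Module.finBasis ℂ V
    have h1 : ∀ g, ω g = (LinearMap.toMatrix e e (V.ρ g)).trace := fun g => by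
      rw [hV, ← LinearMap.trace_eq_matrix_trace]
      rfl
    ext g
    rw [← LinearMap.det_toMatrix e]
    have h2 : dt (ext0 M ω) g = dt ω g := by
      rw [← pb_ext0 M ω, dt_pb (Subgroup.mem_top g), pb_ext0]
      rfl
    rw [h2]
    refine det_eq_dt (H := ⊤) (M := fun g => LinearMap.toMatrix e e (V.ρ g)) (fun x _ y _ => ?_) ?_ h1
      (Subgroup.mem_top g)
    · rw [map_mul, LinearMap.toMatrix_mul]
    · rw [map_one, LinearMap.toMatrix_one]
  constructor
  · rintro ⟨V, hV, h⟩
    rwa [key V hV] at h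
  · intro h
    obtain ⟨V, hV⟩ := hω
    exact ⟨V, hV, by rwa [key V hV]⟩

/-- `b` is the `π`-part of `a * b`. -/
def IsPart (π : Set ℕ) (a b : ℕ) : Prop := ∀ c, c ∣ a * b → (IsPiNumber π c ↔ c ∣ b)

theorem ext0_comp_subtype (hf : Chr M f) : ext0 M (f ∘ M.subtype) = f := by
  ext g
  by_cases hg : g ∈ M
  · rw [ext0, dif_pos hg]
    rfl
  · rw [ext0, dif_neg hg, hf.supp hg]

theorem IsPiSpecial.spec (he : ExpFac a b G) (hab : IsPart π a b) (h : IsPiSpecial π G f)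
    (hd : ∀ d, IsPiNumber π d → d.Coprime a) : Spec a b ⊤ f := by
  obtain ⟨hf, ⟨k, hk, hkπ⟩, hdet⟩ := h
  refine ⟨isIrrChar_iff.mp hf, ?_, fun J hJ θ hθ hne g hg => ?_⟩
  · have h1 := (isCharacter_iff.mp hf.1).cast_dg
    rw [hk] at h1
    rw [Nat.cast_injective h1]
    exact hd k hkπ
  · have h1 := hθ.isConstituent ((isCharacter_iff.mp hf.1).res le_top) hne
    have h2 := (hasPiDetOrder_iff h1.1.1).mp (hdet J (isSubnormalSubgroup_iff.mpr hJ) _ h1)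
    rw [ext0_comp_subtype hθ.1] at h2
    have h3 : (fun g : J => dt θ g) ^ (a * b) = 1 := by
      ext x
      exact hθ.1.dt_pow_eq_one x.2 (mul_ne_zero he.ha he.hb) (he.ex x)
    have h4 := orderOf_dvd_iff_pow_eq_one.mp ((hab _ (orderOf_dvd_of_pow_eq_one h3)).mp h2)
    exact congrFun h4 ⟨g, hg⟩

theorem Spec.isPiSpecial_top (hab : IsPart π a b) (h : Spec a b ⊤ f) (hd : IsPiNumber π (dg f)) :
    IsPiSpecial π G f := by
  refine ⟨isIrrChar_iff.mpr h.irr, ⟨dg f, h.irr.1.cast_dg.symm, hd⟩, fun J hJ ω hω => ?_⟩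
  rw [hasPiDetOrder_iff hω.1.1]
  have h1 := IsConstituent.irr_ext0 hω
  have h2 : (fun g : J => dt (ext0 J ω) g) ^ b = 1 := by
    ext x
    exact h.det J (isSubnormalSubgroup_iff.mp hJ) _ h1.1 h1.2 x x.2
  have h3 := orderOf_dvd_of_pow_eq_one h2
  exact (hab _ (h3.mul_left a)).mpr h3

theorem Spec.isPiSpecial (hab : IsPart π a b) (hφ : (⊤ : Subgroup X).map φ = V) (h : Spec a b V f)
    (hd : IsPiNumber π (dg f)) : IsPiSpecial π X (f ∘ φ) := by
  subst hφ
  have h1 := h.pb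
  rw [pb_top] at h1
  exact h1.isPiSpecial_top hab (by rwa [← pb_top, dg_pb])

theorem ExpFac.subgroup (h : ExpFac a b G) (H : Subgroup G) : ExpFac a b H :=
  ⟨h.cop, h.ha, h.hb, fun g => Subtype.ext (h.ex g)⟩

theorem IsPiSpecial.spec_ext0 (he : ExpFac a b G) (hab : IsPart π a b) {ω : U → ℂ}
    (h : IsPiSpecial π U ω) (hd : ∀ d, IsPiNumber π d → d.Coprime a) : Spec a b U (ext0 U ω) := by
  have h1 := IsPiSpecial.spec (he.subgroup U) hab h hd
  rw [← pb_ext0 U ω] at h1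
  have h2 := Spec.of_pb (by rw [map_subtype_top]; exact IsIrrChar.irr_ext0 h.1) h1
  rwa [map_subtype_top] at h2

theorem indChar_eq_ind (ω : U → ℂ) : indChar U ω = ind U ⊤ (ext0 U ω) := by
  ext g
  simp only [indChar, ind, ext0, Subgroup.mem_top, if_true]

theorem indChar_subgroupOf (hV : V ≤ M) (hf : ∀ g ∉ V, f g = 0) :
    indChar (V.subgroupOf M) (f ∘ (M.subtype.comp (V.subgroupOf M).subtype)) = ind V M f ∘ M.subtype := by
  ext g
  rw [indChar, Function.comp_apply, ind, Nat.card_congr (Subgroup.subgroupOfEquivOfLe hV).toEquiv,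
    sum_ite_mem M fun x => f (x * M.subtype g * x⁻¹)]
  congr 1
  refine Finset.sum_congr rfl fun x _ => ?_
  split_ifs with h
  · rfl
  · exact (hf _ h).symm

theorem map_subtype_comp (hV : V ≤ M) :
    (⊤ : Subgroup (V.subgroupOf M)).map (M.subtype.comp (V.subgroupOf M).subtype) = V := by
  rw [← Subgroup.map_map, map_subtype_top, Subgroup.map_subgroupOf_eq_of_le hV]

theorem isPart_singleton (hp : p.Prime) (hpm : p.Coprime m) : IsPart {p} m (p ^ n) := fun _ hc =>
  ⟨fun h => dvd_of_isPiNumber_singleton hp hpm h (by rwa [mul_comm]), fun h q hq hqc =>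
    (Nat.prime_dvd_prime_iff_eq hq hp).mp (hq.dvd_of_dvd_pow (hqc.trans h))⟩

theorem isPart_compl (hp : p.Prime) (hpm : p.Coprime m) : IsPart {p}ᶜ (p ^ n) m := fun _ hc =>
  ⟨fun h => dvd_of_isPiNumber_compl hp h hc, fun h _ _ hqc hqp =>
    hp.coprime_iff_not_dvd.mp hpm (Set.mem_singleton_iff.mp hqp ▸ hqc.trans h)⟩

theorem coprime_of_isPiNumber_singleton (hp : p.Prime) (hpm : p.Coprime m) (h : IsPiNumber {p} d) :
    d.Coprime m :=
  Nat.coprime_of_dvd fun q hq h1 h2 => hp.coprime_iff_not_dvd.mp hpm (Set.mem_singleton_iff.mp (h q hq h1) ▸ h2)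

theorem isPiNumber_compl_iff (hp : p.Prime) : IsPiNumber {p}ᶜ d ↔ d.Coprime p := by
  rw [Nat.coprime_comm, hp.coprime_iff_not_dvd]
  exact ⟨fun h hd => h p hp hd rfl, fun h _ _ hqd hqp => h (Set.mem_singleton_iff.mp hqp ▸ hqd)⟩

theorem Lin.spec (hl : Lin U l) (hb : ∀ g ∈ U, l g ^ b = 1) : Spec a b U l := by
  refine ⟨hl.irr, by rw [hl.dg_eq]; exact Nat.coprime_one_left a, fun J hJ θ hθ hne g hg => ?_⟩
  have h1 := hl.res' hJ.le
  rw [← ip_res_left] at hne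
  rw [← h1.irr.eq_of_ip_ne_zero hθ hne, h1.dt_eq hg, res_of_mem hg]
  exact hb g (hJ.le hg)

theorem lft_of_isLiftOfPi (hp : p.Prime) (he : ExpFac (p ^ n) m G) {φ : G → ℂ} (hφ : IsIBrChar p G φ)
    (h : IsLiftOfPi {p}ᶜ G χ φ) : Lft m ⊤ χ := by
  intro χ₁ χ₂ h₁ h₂ hs
  by_contra! hne
  refine hφ.2 ⟨_, _, ⟨χ₁, isCharacter_iff.mpr h₁, hne.1, rfl⟩, ⟨χ₂, isCharacter_iff.mpr h₂, hne.2, rfl⟩, ?_⟩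
  rw [← h.2]
  ext g
  rw [Pi.add_apply]
  by_cases hg : IsPiElt {p}ᶜ g
  · simp only [piRestrict, if_pos hg]
    refine hs g (Subgroup.mem_top g) (orderOf_dvd_iff_pow_eq_one.mp ?_)
    exact dvd_of_isPiNumber_compl hp hg (orderOf_dvd_of_pow_eq_one (he.ex g))
  · simp only [piRestrict, if_neg hg, add_zero]

end

end SubChar

open SubChar

/-- **Theorem (Statement 5).** Let `p` be an odd prime, `G` a finite `p`-solvable group,
`φ ∈ IBr(G)` and `M ⊴ G`.  If `χ ∈ Irr(G)` is a lift of `φ` with vertex pair `(Q, δ)`,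
then some irreducible constituent of `χ_M` has vertex pair `(Q ⊓ M, δ_{Q ⊓ M})`. -/
theorem constituent_with_vertex_pair_inter
    (p : ℕ) (hp : p.Prime) (hodd : Odd p)
    (G : Type) [Group G] [Fintype G] (hG : IsPSolvable p G)
    (φ : G → ℂ) (hφ : IsIBrChar p G φ)
    (M : Subgroup G) (hM : M.Normal)
    (χ : G → ℂ) (hlift : IsLiftOfPi ({p}ᶜ) G χ φ)
    (Q : Subgroup G) (δ : ↥Q → ℂ) (hvp : IsVertexPair p χ Q δ) :
    ∃ ψ : ↥M → ℂ, IsConstituent ψ (resChar M χ) ∧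
      IsVertexPair p ψ ((Q ⊓ M).subgroupOf M)
        (fun x : ↥((Q ⊓ M).subgroupOf M) =>
          δ ⟨((x : ↥M) : G), (Subgroup.mem_subgroupOf.mp x.2).1⟩) := by
  obtain ⟨n, m, h⟩ := SubChar.IsPSolvable.pSol hp hG
  obtain ⟨σ, hσm, hσp⟩ := h.exists_galois hodd
  have hpm := h.cop
  obtain ⟨hQ, -, U, hQU, α, β, hα, hβ, hαβ, hind, hidx, hδ⟩ := hvp
  have hα' := SubChar.IsPiSpecial.spec_ext0 h.ef (isPart_compl hp hpm) hα fun d hd =>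
    ((isPiNumber_compl_iff hp).mp hd).pow_right n
  have hβ' := SubChar.IsPiSpecial.spec_ext0 h.ef.symm (isPart_singleton (n := n) hp hpm) hβ fun d hd =>
    coprime_of_isPiNumber_singleton hp hpm hd
  have hχ : ind U ⊤ (ext0 U α * ext0 U β) = χ := by
    rw [← hind, indChar_eq_ind]
    congr 1
    ext g
    by_cases hg : g ∈ U <;> simp [ext0, hg]
  have hlft : Lft m ⊤ (ind U ⊤ (ext0 U α * ext0 U β)) := hχ ▸ lft_of_isLiftOfPi hp h.ef hφ hlift
  have hβ1 : ext0 U β 1 = 1 := hβ'.apply_one_of_lft h hodd <|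
    .of_mul hα'.irr.1 hα'.irr.ne_zero (.of_ind le_top (hα'.irr.1.mul hβ'.irr.1) hlft)
  have hl : Lin U (ext0 U β) := hβ'.irr.1.lin hβ1
  have hlp : ∀ g ∈ U, ext0 U β g ^ p ^ n = 1 := fun g hg => by
    rw [← hl.dt_eq hg]
    exact hβ'.dt_pow hg
  have h1 := tr_lin (⊥ : Subgroup G)
  have hne : ip ⊥ (ext0 U α) (tr ⊥) ≠ 0 := by
    rw [ip, Finset.sum_eq_single 1 (fun g _ hg => if_neg fun h0 => hg (Subgroup.mem_bot.mp h0))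
      fun h0 => absurd (Finset.mem_univ _) h0, if_pos (⊥ : Subgroup G).one_mem, inv_one, h1.one, mul_one]
    exact mul_ne_zero (inv_ne_zero (card_ne_zero' ⊥)) hα'.irr.apply_one_ne_zero
  have hMn : Nrm M ⊤ := ⟨le_top, fun x _ y hy => hM.conj_mem y hy x⟩
  have A : Node p n m σ ⊥ Q U (ext0 U α) (ext0 U β) (tr ⊥) :=
    { irr := hα'.irr
      galois := h.spec_galois hα' hσm
      cop := (Nat.coprime_pow_right_iff (Nat.pos_of_ne_zero h.hn) _ _).mp hα'.cop
      lin := hl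
      pow := hlp
      pgroup := hQ
      le := hQU
      index := hidx
      ge := bot_le
      spec := h1.irr.spec_bot (by rw [h1.dg_eq]; exact Nat.coprime_one_left _)
      ne := hne
      inv := fun x _ => cj_res ((Nrm.bot ⊤).mem_iff (Subgroup.mem_top x)) 1 }
  obtain ⟨V, α', l', hV, hQV, hi, hα₁, hl₁, hlp₁, hll, hirr, hne₁⟩ := A.hasPair h hσm hσp _ ⊤ M ⊥ Q U _ _ _ rfl
    hMn (.bot ⊤) bot_le le_top hlft
  rw [hχ] at hne₁
  have hQM : Q ⊓ M ≤ M := inf_le_right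
  have hχc : Chr M (res M χ) := (isCharacter_iff.mp hlift.1.1).res le_top
  have hδl : (fun x : ↥((Q ⊓ M).subgroupOf M) => δ ⟨((x : ↥M) : G), (Subgroup.mem_subgroupOf.mp x.2).1⟩) =
      res (Q ⊓ M) (ext0 U β) ∘ (M.subtype.comp ((Q ⊓ M).subgroupOf M).subtype) := by
    ext x
    have hx := Subgroup.mem_subgroupOf.mp x.2
    rw [hδ, Function.comp_apply]
    exact ((res_of_mem hx).trans (dif_pos (hQU hx.1))).symm
  refine ⟨_, hirr.isConstituent hχc hne₁, (hQ.to_le inf_le_left).comap_subtype, ?_, V.subgroupOf M,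
    Subgroup.comap_mono hQV, α' ∘ (M.subtype.comp (V.subgroupOf M).subtype),
    l' ∘ (M.subtype.comp (V.subgroupOf M).subtype), ?_, ?_, ?_, ?_, ?_, ?_⟩
  · rw [hδl]
    exact (hl.res' (inf_le_left.trans hQU)).irr.isIrrChar (map_subtype_comp hQM)
  · exact hα₁.isPiSpecial (isPart_compl hp hpm) (map_subtype_comp hV) <| (isPiNumber_compl_iff hp).mpr <|
      (Nat.coprime_pow_right_iff (Nat.pos_of_ne_zero h.hn) _ _).mp hα₁.cop
  · refine (hl₁.spec hlp₁).isPiSpecial (isPart_singleton (n := n) hp hpm) (map_subtype_comp hV) ?_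
    rw [hl₁.dg_eq]
    exact fun q hq hq1 => absurd (Nat.dvd_one.mp hq1) hq.ne_one
  · exact (hα₁.irr.mul_lin hl₁).isIrrChar (map_subtype_comp hV)
  · exact indChar_subgroupOf hV fun g hg => (hα₁.irr.mul_lin hl₁).supp hg
  · rwa [← Subgroup.relIndex, Subgroup.relIndex_subgroupOf hV]
  · intro x
    have hx := Subgroup.mem_subgroupOf.mp x.2
    exact (congrFun hδl x).trans ((res_of_mem hx).trans (hll _ hx).symm)
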